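/- Fix p ∈ (0,1), q ≥ 1 with φ^0_{p,q} ≠ φ^1_{p,q}, and even integers M, N ≥ 0; write Slit = Slit(M,N). Let (ξ_k)_{k≥1} be any sequence of boundary conditions on Λ_k ∩ Slit which are wired on ∂H and free on ∂H⁻. Then the weak limit of the FK measures φ^{ξ_k}_{Λ_k ∩ Slit, p, q} as k → ∞ exists and does not depend on the choice of the sequence (ξ_k). -/

import Mathlib

open MeasureTheory ProbabilityTheory Filter
open scoped ENNReal

noncomputable section

namespace FK

/-- Ambient vertex set: points of the plane with integer coordinates. -/
abbrev V : Type := ℤ × ℤ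

variable (Adj : V → V → Prop)

/-- The edge set of the graph with adjacency relation `Adj`, as unordered pairs. -/
def EdgeSet : Set (Sym2 V) := {e | ∃ u v : V, Adj u v ∧ e = s(u, v)}

/-- Edges of the graph. -/
abbrev Edge := {e : Sym2 V // e ∈ EdgeSet Adj}

/-- A percolation configuration: each edge is open (`true`) or closed (`false`). -/
abbrev Config := Edge Adj → Bool

/-- A vertex is an endpoint of an edge. -/
def Inc (v : V) (e : Edge Adj) : Prop := v ∈ (e : Sym2 V)

/-- The vertex set of a finite set of edges. -/
def vertexSet (D : Finset (Edge Adj)) : Set V := {v | ∃ e ∈ D, Inc Adj v e}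

open Classical in
/-- The degree of a vertex in a finite set of edges. -/
def degree (D : Finset (Edge Adj)) (v : V) : ℕ :=
  (D.filter fun e => Inc Adj v e).card

/-- Boundary of a finite domain: its vertices of degree less than `maxDeg`
(the degree of the full lattice). -/
def bdry (maxDeg : ℕ) (D : Finset (Edge Adj)) : Set V :=
  {v | v ∈ vertexSet Adj D ∧ degree Adj D v < maxDeg}

/-- `u` and `v` are connected by a path of `ω`-open edges, all belonging to `S`. -/
def ConnectedIn (ω : Config Adj) (S : Set (Edge Adj)) (u v : V) : Prop :=
  Relation.ReflTransGen
    (fun a b => ∃ e : Edge Adj, e ∈ S ∧ ω e = true ∧ Inc Adj a e ∧ Inc Adj b e) u v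

/-- `u` lies in an infinite cluster of `ω` restricted to the edges of `S`. -/
def InfCluster (ω : Config Adj) (S : Set (Edge Adj)) (u : V) : Prop :=
  {v | ConnectedIn Adj ω S u v}.Infinite

/-- The set of edges whose endpoints all belong to the region `S`. -/
def edgesInRegion (S : Set V) : Set (Edge Adj) := {e | ∀ v ∈ (e : Sym2 V), v ∈ S}

/-- The boundary condition induced on `D` by the configuration outside of `D`:
two boundary vertices are wired iff they are connected outside of `D`,
or both belong to infinite clusters of the configuration outside of `D`. -/
def inducedBC (maxDeg : ℕ) (D : Finset (Edge Adj)) (ω : Config Adj) :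
    Setoid (bdry Adj maxDeg D) :=
  Relation.EqvGen.setoid fun u v =>
    ConnectedIn Adj ω {e | e ∉ D} u.1 v.1 ∨
      (InfCluster Adj ω {e | e ∉ D} u.1 ∧ InfCluster Adj ω {e | e ∉ D} v.1)

/-- Extension of a local configuration on `D` by closed edges. -/
def extendBy (D : Finset (Edge Adj)) (η : {e // e ∈ D} → Bool) : Config Adj :=
  fun e => if h : e ∈ D then η ⟨e, h⟩ else false

open Classical in
/-- Number of open edges of a local configuration. -/
def openCount (D : Finset (Edge Adj)) (η : {e // e ∈ D} → Bool) : ℕ :=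
  (Finset.univ.filter fun e : {e // e ∈ D} => η e = true).card

/-- The number of clusters of the configuration `ω` in the domain `D`, where boundary
vertices wired together by `ξ` are identified. -/
def clusterCount (maxDeg : ℕ) (D : Finset (Edge Adj)) (ξ : Setoid (bdry Adj maxDeg D))
    (ω : Config Adj) : ℕ :=
  Nat.card (Quot fun u v : vertexSet Adj D =>
    (∃ e ∈ D, ω e = true ∧ Inc Adj u.1 e ∧ Inc Adj v.1 e) ∨
      ∃ hu : u.1 ∈ bdry Adj maxDeg D, ∃ hv : v.1 ∈ bdry Adj maxDeg D,
        ξ.r ⟨u.1, hu⟩ ⟨v.1, hv⟩)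

/-- The FK-percolation weight of a local configuration `η` on the domain `D` with
boundary condition `ξ`. -/
def fkWeight (p q : ℝ) (maxDeg : ℕ) (D : Finset (Edge Adj)) (ξ : Setoid (bdry Adj maxDeg D))
    (η : {e // e ∈ D} → Bool) : ℝ :=
  (p / (1 - p)) ^ openCount Adj D η * q ^ clusterCount Adj maxDeg D ξ (extendBy Adj D η)

/-- The finite-volume FK-percolation measure on the domain `D` with edge-intensity `p`,
cluster-weight `q` and boundary condition `ξ`. -/
def fkFin (p q : ℝ) (maxDeg : ℕ) (D : Finset (Edge Adj)) (ξ : Setoid (bdry Adj maxDeg D)) :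
    Measure ({e // e ∈ D} → Bool) :=
  (∑ η : {e // e ∈ D} → Bool, ENNReal.ofReal (fkWeight Adj p q maxDeg D ξ η))⁻¹ •
    ∑ η : {e // e ∈ D} → Bool,
      ENNReal.ofReal (fkWeight Adj p q maxDeg D ξ η) • Measure.dirac η

/-- Restriction of a configuration to the edges of `D`. -/
def restrictD (D : Finset (Edge Adj)) (ω : Config Adj) : {e // e ∈ D} → Bool := fun e => ω e.1

/-- The event `B` depends only on the edges outside of `D`. -/
def DependsOutside (D : Finset (Edge Adj)) (B : Set (Config Adj)) : Prop :=
  ∀ ω ω' : Config Adj, (∀ e : Edge Adj, e ∉ D → ω e = ω' e) → (ω ∈ B ↔ ω' ∈ B)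

/-- `φ` is a Gibbs measure for FK-percolation with parameters `(p, q)`:
for every finite domain `D` and boundary condition `ξ`, conditionally on the event that
the configuration outside `D` induces the boundary condition `ξ` and on any event
measurable with respect to the edges outside of `D`, the restriction of `φ` to `D`
is the finite-volume FK-percolation measure with boundary condition `ξ`. -/
def IsGibbs (maxDeg : ℕ) (p q : ℝ) (φ : Measure (Config Adj)) : Prop :=
  IsProbabilityMeasure φ ∧
    ∀ (D : Finset (Edge Adj)) (ξ : Setoid (bdry Adj maxDeg D)) (B : Set (Config Adj)),
      MeasurableSet B → DependsOutside Adj D B →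
      φ ({ω | inducedBC Adj maxDeg D ω = ξ} ∩ B) ≠ 0 →
      (φ[|{ω | inducedBC Adj maxDeg D ω = ξ} ∩ B]).map (restrictD Adj D) =
        fkFin Adj p q maxDeg D ξ

/-- The cylinder event prescribing the configuration on the edges of `D`. -/
def cylinder (D : Finset (Edge Adj)) (η : {e // e ∈ D} → Bool) : Set (Config Adj) :=
  {ω | ∀ e : {e // e ∈ D}, ω e.1 = η e}

/-- Weak convergence of measures on configurations: convergence of the probabilities of
all cylinder events. -/
def WeakLim (μs : ℕ → Measure (Config Adj)) (μ : Measure (Config Adj)) : Prop :=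
  ∀ (D : Finset (Edge Adj)) (η : {e // e ∈ D} → Bool),
    Tendsto (fun k => μs k (cylinder Adj D η)) atTop (nhds (μ (cylinder Adj D η)))

/-- A sequence of finite domains increasing to the full lattice. -/
def IsExhaustion (Dseq : ℕ → Finset (Edge Adj)) : Prop :=
  Monotone Dseq ∧ ∀ e : Edge Adj, ∃ k, e ∈ Dseq k

/-- `φ` is the free infinite-volume FK measure: the weak limit of finite-volume measures
with free boundary conditions along any exhaustion. -/
def IsFreeLimit (maxDeg : ℕ) (p q : ℝ) (φ : Measure (Config Adj)) : Prop :=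
  IsProbabilityMeasure φ ∧
    ∀ Dseq : ℕ → Finset (Edge Adj), IsExhaustion Adj Dseq →
      WeakLim Adj
        (fun k => (fkFin Adj p q maxDeg (Dseq k) ⊥).map (extendBy Adj (Dseq k))) φ

/-- `φ` is the wired infinite-volume FK measure: the weak limit of finite-volume measures
with wired boundary conditions along any exhaustion. -/
def IsWiredLimit (maxDeg : ℕ) (p q : ℝ) (φ : Measure (Config Adj)) : Prop :=
  IsProbabilityMeasure φ ∧
    ∀ Dseq : ℕ → Finset (Edge Adj), IsExhaustion Adj Dseq →
      WeakLim Adj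
        (fun k => (fkFin Adj p q maxDeg (Dseq k) ⊤).map (extendBy Adj (Dseq k))) φ

/-- Tail triviality: every event depending on no finite set of edges has probability 0 or 1. -/
def TailTrivial (φ : Measure (Config Adj)) : Prop :=
  ∀ B : Set (Config Adj), MeasurableSet B →
    (∀ D : Finset (Edge Adj), DependsOutside Adj D B) → φ B = 0 ∨ φ B = 1


open Classical in
/-- The finite set of edges of the graph with both endpoints in the finite vertex set `W`. -/
def finEdgesIn (W : Finset V) : Finset (Edge Adj) :=
  (((W ×ˢ W).filter fun p => Adj p.1 p.2).image fun p => s(p.1, p.2)).subtype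
    (· ∈ EdgeSet Adj)

/-- Adjacency of the square lattice `L`: vertices with even coordinate sum at
euclidean distance `√2`. -/
def AdjL (u v : V) : Prop :=
  Even (u.1 + u.2) ∧ Even (v.1 + v.2) ∧ (u.1 - v.1) ^ 2 = 1 ∧ (u.2 - v.2) ^ 2 = 1

end FK

namespace FK

/-! ### Additional structure on the square lattice: translations, duality, half-planes,
boxes and slit domains. -/

/-- Translation vectors of the square lattice `L`. -/
def IsLatticeVec (t : V) : Prop := Even (t.1 + t.2)

/-- Translation of the plane by `t`. -/
def shiftV (t : V) (v : V) : V := (v.1 + t.1, v.2 + t.2)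

lemma adjL_shift {t : V} (ht : IsLatticeVec t) {u v : V} (h : AdjL u v) :
    AdjL (shiftV t u) (shiftV t v) := by
  obtain ⟨hu, hv, h1, h2⟩ := h
  refine ⟨?_, ?_, ?_, ?_⟩
  · have e : (u.1 + t.1) + (u.2 + t.2) = (u.1 + u.2) + (t.1 + t.2) := by ring
    exact e ▸ hu.add ht
  · have e : (v.1 + t.1) + (v.2 + t.2) = (v.1 + v.2) + (t.1 + t.2) := by ring
    exact e ▸ hv.add ht
  · have e : (u.1 + t.1) - (v.1 + t.1) = u.1 - v.1 := by ring
    exact e ▸ h1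
  · have e : (u.2 + t.2) - (v.2 + t.2) = u.2 - v.2 := by ring
    exact e ▸ h2

lemma edgeSet_shift {t : V} (ht : IsLatticeVec t) {e : Sym2 V} (he : e ∈ EdgeSet AdjL) :
    Sym2.map (shiftV t) e ∈ EdgeSet AdjL := by
  obtain ⟨u, v, huv, rfl⟩ := he
  exact ⟨shiftV t u, shiftV t v, adjL_shift ht huv, by rw [Sym2.map_pair_eq]⟩

/-- Translation of an edge of the square lattice by a lattice vector. -/
def shiftEdge (t : V) (ht : IsLatticeVec t) (e : Edge AdjL) : Edge AdjL :=
  ⟨Sym2.map (shiftV t) e.1, edgeSet_shift ht e.2⟩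

/-- The shift of a configuration by a lattice vector. -/
def Shift (t : V) (ht : IsLatticeVec t) (ω : Config AdjL) : Config AdjL :=
  fun e => ω (shiftEdge t ht e)

/-- Dual vertices: points with odd coordinate sum, i.e. vertices of `L* = L + (1,0)`. -/
def IsDualV (w : V) : Prop := Odd (w.1 + w.2)

/-- The primal edge crossed by the dual edge joining the dual vertices `w` and `w'`. -/
def crossSym (w w' : V) : Sym2 V := s(((w.1, w'.2) : V), ((w'.1, w.2) : V))

/-- One step of a dual-open path: `w` and `w'` are adjacent dual vertices and the primal
edge crossing the dual edge between them belongs to `S` and is closed in `ω`. -/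
def DualStep (ω : Config AdjL) (S : Set (Edge AdjL)) (w w' : V) : Prop :=
  IsDualV w ∧ IsDualV w' ∧ (w.1 - w'.1) ^ 2 = 1 ∧ (w.2 - w'.2) ^ 2 = 1 ∧
    ∃ h : crossSym w w' ∈ EdgeSet AdjL,
      (⟨crossSym w w', h⟩ : Edge AdjL) ∈ S ∧ ω ⟨crossSym w w', h⟩ = false

/-- Connectivity by a dual-open path whose crossed primal edges all lie in `S`. -/
def DualConnectedIn (ω : Config AdjL) (S : Set (Edge AdjL)) (w w' : V) : Prop :=
  Relation.ReflTransGen (DualStep ω S) w w'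

/-- The dual vertex `w` lies in an infinite dual cluster. -/
def DualInfCluster (ω : Config AdjL) (S : Set (Edge AdjL)) (w : V) : Prop :=
  {w' | DualConnectedIn ω S w w'}.Infinite

/-- The upper half-plane `H = ℝ × [0, ∞)`. -/
def HP : Set V := {v | 0 ≤ v.2}

/-- The edges of the square lattice contained in the upper half-plane. -/
def HPedges : Set (Edge AdjL) := edgesInRegion AdjL HP

/-- The vertex set of the rectangle `[x1,x2] × [y1,y2]`. -/
def rectV (x1 x2 y1 y2 : ℤ) : Finset V := Finset.Icc x1 x2 ×ˢ Finset.Icc y1 y2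

/-- The edges of the box `Λ_n = [-n,n]²`. -/
def boxE (n : ℤ) : Finset (Edge AdjL) := finEdgesIn AdjL (rectV (-n) n (-n) n)

open Classical in
/-- The configuration in which precisely the edges of the upper half-plane are open. -/
def tau10 : Config AdjL := fun e => if e ∈ HPedges then true else false

/-- The self-dual (= critical) point `p_c(q) = √q / (1 + √q)`. -/
def pc (q : ℝ) : ℝ := Real.sqrt q / (1 + Real.sqrt q)

/-- The domain `[-N,N] × [0,N]`. -/
def hpDomain (N : ℤ) : Finset (Edge AdjL) := finEdgesIn AdjL (rectV (-N) N 0 N)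

/-- `φ` is the infinite-volume FK measure on the upper half-plane with Dobrushin boundary
conditions at parameters `(p,q)`: the weak limit, as `N → ∞`, of the finite-volume FK
measures on `[-N,N] × [0,N]` with the boundary conditions induced by `tau10`. -/
def IsHPDobrushin (p q : ℝ) (φ : Measure (Config AdjL)) : Prop :=
  IsProbabilityMeasure φ ∧
    WeakLim AdjL (fun N =>
      (fkFin AdjL p q 4 (hpDomain N) (inducedBC AdjL 4 (hpDomain N) tau10)).map
        (extendBy AdjL (hpDomain N))) φ

/-- The free and wired infinite-volume measures (at parameters `(p,q)`) differ. -/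
def FreeNeqWired (p q : ℝ) : Prop :=
  ∃ φ0 φ1 : Measure (Config AdjL),
    IsFreeLimit AdjL 4 p q φ0 ∧ IsWiredLimit AdjL 4 p q φ1 ∧ φ0 ≠ φ1

/-! #### The slit domain `Slit(M,N)` -/

/-- Points of the axis that are split in the slit domain `Slit(M,N)`. -/
def SplitPt (M N : ℤ) (v : V) : Prop := v.2 = 0 ∧ (v.1 < -M ∨ N < v.1)

open Classical in
/-- The copy (upper = `true` / lower = `false`) of the endpoint `u` to which the edge `e`
is attached in the slit domain. -/
def endSide (M N : ℤ) (u : V) (e : Edge AdjL) : Bool :=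
  if SplitPt M N u ∧ e ∉ HPedges then false else true

/-- Admissible slit vertices: pairs (vertex, side), the side being `true` except that split
points carry two copies. -/
def SlitVOK (M N : ℤ) (a : V × Bool) : Prop := a.2 = true ∨ SplitPt M N a.1

open Classical in
/-- The degree of a slit vertex in the finite edge set `D`. -/
def slitDeg (M N : ℤ) (D : Finset (Edge AdjL)) (a : V × Bool) : ℕ :=
  (D.filter fun e => Inc AdjL a.1 e ∧ a.2 = endSide M N a.1 e).card

/-- A slit vertex belongs to the finite slit graph spanned by `D`. -/
def SlitPresent (M N : ℤ) (D : Finset (Edge AdjL)) (a : V × Bool) : Prop :=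
  SlitVOK M N a ∧ 0 < slitDeg M N D a

/-- Boundary of the finite slit graph spanned by `D`: its vertices of degree `< 4`. -/
def slitBdry (M N : ℤ) (D : Finset (Edge AdjL)) : Set (V × Bool) :=
  {a | SlitPresent M N D a ∧ slitDeg M N D a < 4}

/-- Number of clusters of `ω` in the finite slit graph spanned by `D`, with boundary
vertices wired together according to `ξ`. -/
def slitClusterCount (M N : ℤ) (D : Finset (Edge AdjL)) (ξ : Setoid (V × Bool))
    (ω : Config AdjL) : ℕ :=
  Nat.card (Quot fun a b : {a : V × Bool // SlitPresent M N D a} =>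
    (∃ e ∈ D, ω e = true ∧ Inc AdjL a.1.1 e ∧ Inc AdjL b.1.1 e ∧
        a.1.2 = endSide M N a.1.1 e ∧ b.1.2 = endSide M N b.1.1 e) ∨
      (a.1 ∈ slitBdry M N D ∧ b.1 ∈ slitBdry M N D ∧ ξ.r a.1 b.1))

/-- FK weight of a local configuration on the finite slit graph. -/
def slitWeight (p q : ℝ) (M N : ℤ) (D : Finset (Edge AdjL)) (ξ : Setoid (V × Bool))
    (η : {e // e ∈ D} → Bool) : ℝ :=
  (p / (1 - p)) ^ openCount AdjL D η *
    q ^ slitClusterCount M N D ξ (extendBy AdjL D η)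

/-- Finite-volume FK measure on the slit graph spanned by `D`, with boundary
condition `ξ`. -/
def slitFin (p q : ℝ) (M N : ℤ) (D : Finset (Edge AdjL)) (ξ : Setoid (V × Bool)) :
    Measure ({e // e ∈ D} → Bool) :=
  (∑ η : {e // e ∈ D} → Bool, ENNReal.ofReal (slitWeight p q M N D ξ η))⁻¹ •
    ∑ η : {e // e ∈ D} → Bool,
      ENNReal.ofReal (slitWeight p q M N D ξ η) • Measure.dirac η

/-- The boundary condition on the slit graph which is wired on `∂Slit⁺` (the upper copies
of the split points) and free everywhere else. -/
def slitPlusBC (M N : ℤ) : Setoid (V × Bool) :=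
  Relation.EqvGen.setoid fun a b =>
    (SplitPt M N a.1 ∧ a.2 = true) ∧ (SplitPt M N b.1 ∧ b.2 = true)

/-- `φ` is the FK measure `φ^{1/0}_{Slit(M,N),p,q}` on `Slit(M,N)`, with wired boundary
conditions on `∂Slit⁺` and free boundary conditions on `∂Slit⁻`: the weak limit of the
finite-volume slit measures on `Λ_R ∩ Slit` as `R → ∞`. -/
def IsSlitMeasure (p q : ℝ) (M N : ℤ) (φ : Measure (Config AdjL)) : Prop :=
  IsProbabilityMeasure φ ∧
    WeakLim AdjL (fun R =>
      (slitFin p q M N (boxE R) (slitPlusBC M N)).map (extendBy AdjL (boxE R))) φ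

/-- The event that `z` is connected to `∂Slit⁺` by an open path contained in the upper
half-plane `H`. -/
def slitPlusConn (M N : ℤ) (z : V) : Set (Config AdjL) :=
  {ω | ∃ a : ℤ, (a < -M ∨ N < a) ∧ ConnectedIn AdjL ω HPedges z (a, 0)}

open Classical in
/-- The number of `c`-good points `(a, 0)`, `a ∈ [x1, x2]`, for the slit measure `φ`:
points of the primal lattice for which the probability of being connected to `∂Slit⁺`
inside `H` is at least `c`. -/
def goodCount (M N : ℤ) (φ : Measure (Config AdjL)) (c : ℝ) (x1 x2 : ℤ) : ℕ :=
  ((Finset.Icc x1 x2).filter fun a =>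
    Even a ∧ ENNReal.ofReal c ≤ φ (slitPlusConn M N (a, 0))).card

end FK

namespace FK

/-- A boundary condition on the finite slit graph spanned by `D` which is wired on
`∂Slit⁺` (= `∂H`), free on `∂Slit⁻` (= `∂H⁻`), and arbitrary on the rest of the boundary
of the graph (but wires only boundary vertices). -/
def SlitBCWiredFree (M N : ℤ) (D : Finset (Edge AdjL)) (ξ : Setoid (V × Bool)) : Prop :=
  (∀ a b : V × Bool, SlitPresent M N D a → SlitPresent M N D b →
      SplitPt M N a.1 → a.2 = true → SplitPt M N b.1 → b.2 = true → ξ.r a b) ∧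
  (∀ a b : V × Bool, SplitPt M N a.1 → a.2 = false → ξ.r a b → a = b) ∧
  (∀ a b : V × Bool, a ∉ slitBdry M N D → ξ.r a b → a = b)

end FK

set_option linter.unusedSectionVars false

namespace FKS
open FK Finset
local notation "ℤ²" => ℤ × ℤ

open scoped Classical
variable {E : Type*} [DecidableEq E]

/-- `W` is an FK weight on the subsets of `D`: opening an edge `e` multiplies the weight by `x`
if the ends of `e` are already connected (`c e S`) and by `x / q` otherwise. -/
structure IsFK (D : Finset E) (x q : ℝ) (c : E → Finset E → Prop) (W : Finset E → ℝ) : Prop where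
  pos : ∀ S ⊆ D, 0 < W S
  step : ∀ S ⊆ D, ∀ e ∈ D, e ∉ S → W (insert e S) = W S * (if c e S then x else x / q)

/-- Expectation of `f` with respect to the probability measure proportional to `W`. -/
def ex (D : Finset E) (W : Finset E → ℝ) (f : Finset E → ℝ) : ℝ :=
  (∑ S ∈ D.powerset, W S * f S) / ∑ S ∈ D.powerset, W S

/-- Indicator of an event. -/
def ind (A : Finset E → Prop) (S : Finset E) : ℝ := if A S then 1 else 0

/-- Probability of the event `A`. -/
def pr (D : Finset E) (W : Finset E → ℝ) (A : Finset E → Prop) : ℝ := ex D W (ind A)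

/-- Monotonicity of the connection predicates. -/
def CLe (D : Finset E) (c c' : E → Finset E → Prop) : Prop :=
  ∀ S T e, S ⊆ T → T ⊆ D → e ∈ D → e ∉ T → c e S → c' e T
variable {D D' : Finset E} {x x' q : ℝ} {c c' : E → Finset E → Prop} {W W' : Finset E → ℝ}

lemma ind_nonneg (A : Finset E → Prop) (S : Finset E) : 0 ≤ ind A S := by
  unfold ind; split_ifs <;> norm_num

lemma ind_le_one (A : Finset E → Prop) (S : Finset E) : ind A S ≤ 1 := by
  unfold ind; split_ifs <;> norm_num

namespace IsFK

lemma tot_pos (h : IsFK D x q c W) : 0 < ∑ S ∈ D.powerset, W S :=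
  sum_pos (fun S hS => h.pos S (mem_powerset.1 hS)) ⟨∅, by simp⟩

lemma lattice_aux (h : IsFK D x q c W) (h' : IsFK D x' q c' W') (hx : 0 < x) (hxx : x ≤ x')
    (hq : 1 ≤ q) (hc : CLe D c c') {I T : Finset E} (hIT : I ⊆ T) (hT : T ⊆ D) (U : Finset E)
    (hU : U ⊆ D) (hUT : Disjoint U T) :
    W (I ∪ U) * W' T ≤ W I * W' (T ∪ U) := by
  induction U using Finset.induction_on with
  | empty => simp
  | insert e U he ih =>
    have hU' : U ⊆ D := (subset_insert _ _).trans hU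
    have heD : e ∈ D := hU (mem_insert_self _ _)
    have hd := disjoint_insert_left.1 hUT
    have ih := ih hU' hd.2
    have hTU : T ∪ U ⊆ D := union_subset hT hU'
    have hIU : I ∪ U ⊆ T ∪ U := union_subset_union_left hIT
    have heTU : e ∉ T ∪ U := by simp [hd.1, he]
    have e1 : I ∪ insert e U = insert e (I ∪ U) := by
      ext; simp only [mem_union, mem_insert]; tauto
    have e2 : T ∪ insert e U = insert e (T ∪ U) := by
      ext; simp only [mem_union, mem_insert]; tauto
    rw [e1, e2, h.step _ (hIU.trans hTU) e heD (fun hh => heTU (hIU hh)),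
      h'.step _ hTU e heD heTU]
    have hfac : (if c e (I ∪ U) then x else x / q) ≤ if c' e (T ∪ U) then x' else x' / q := by
      have hq0 : 0 < q := by linarith
      have hx' : 0 < x' := by linarith
      have a1 : x / q ≤ x := div_le_self hx.le hq
      have a2 : x / q ≤ x' / q := by gcongr
      by_cases h1 : c e (I ∪ U)
      · have h2 := hc _ _ e hIU hTU heD heTU h1
        simp [h1, h2, hxx]
      · by_cases h2 : c' e (T ∪ U)
        · simp [h1, h2]; linarith
        · simp [h1, h2, a2]
    have p1 := h.pos _ (hIT.trans hT)
    have p2 := h'.pos _ hTU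
    have p3 := h.pos _ (hIU.trans hTU)
    have p4 := h'.pos _ hT
    have hf0 : 0 ≤ (if c e (I ∪ U) then x else x / q) := by
      have hq0 : 0 < q := by linarith
      split_ifs <;> positivity
    calc _ = (W (I ∪ U) * W' T) * (if c e (I ∪ U) then x else x / q) := by ring
      _ ≤ (W I * W' (T ∪ U)) * (if c' e (T ∪ U) then x' else x' / q) := by gcongr
      _ = _ := by ring

lemma lattice (h : IsFK D x q c W) (h' : IsFK D x' q c' W') (hx : 0 < x) (hxx : x ≤ x')
    (hq : 1 ≤ q) (hc : CLe D c c') {S T : Finset E} (hS : S ⊆ D) (hT : T ⊆ D) :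
    W S * W' T ≤ W (S ∩ T) * W' (S ∪ T) := by
  have := lattice_aux h h' hx hxx hq hc (I := S ∩ T) inter_subset_right hT (S \ T)
    (sdiff_subset.trans hS) sdiff_disjoint
  have e1 : S ∩ T ∪ S \ T = S := by ext; simp; tauto
  have e2 : T ∪ S \ T = S ∪ T := by ext; simp; tauto
  rwa [e1, e2] at this

open scoped FinsetFamily in
/-- The Holley/FKG inequality in product form. -/
lemma holley_sum (h : IsFK D x q c W) (h' : IsFK D x' q c' W') (hx : 0 < x) (hxx : x ≤ x')
    (hq : 1 ≤ q) (hc : CLe D c c') {f g : Finset E → ℝ} (hf0 : ∀ S, 0 ≤ f S)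
    (hg0 : ∀ S, 0 ≤ g S) (hf : ∀ S T, S ⊆ T → T ⊆ D → f S ≤ f T)
    (hg : ∀ S T, S ⊆ T → T ⊆ D → g S ≤ g T) :
    (∑ S ∈ D.powerset, W S * f S) * (∑ S ∈ D.powerset, W' S * g S) ≤
      (∑ S ∈ D.powerset, W S) * ∑ S ∈ D.powerset, W' S * (f S * g S) := by
  set P : Finset E → ℝ := fun S => if S ⊆ D then W S else 0 with hP
  set P' : Finset E → ℝ := fun S => if S ⊆ D then W' S else 0 with hP'
  have hP0 : ∀ S, 0 ≤ P S := fun S => by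
    simp only [hP]; split_ifs with hh; exacts [(h.pos S hh).le, le_rfl]
  have hP0' : ∀ S, 0 ≤ P' S := fun S => by
    simp only [hP']; split_ifs with hh; exacts [(h'.pos S hh).le, le_rfl]
  have cP : ∀ f : Finset E → ℝ, ∑ S ∈ D.powerset, W S * f S = ∑ S ∈ D.powerset, P S * f S :=
    fun f => sum_congr rfl fun S hS => by simp [hP, mem_powerset.1 hS]
  have cP' : ∀ f : Finset E → ℝ, ∑ S ∈ D.powerset, W' S * f S = ∑ S ∈ D.powerset, P' S * f S :=
    fun f => sum_congr rfl fun S hS => by simp [hP', mem_powerset.1 hS]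
  have c1 : ∑ S ∈ D.powerset, W S = ∑ S ∈ D.powerset, P S := by
    simpa using cP (fun _ => 1)
  have key := Finset.four_functions_theorem (𝒜 := D.powerset) (ℬ := D.powerset) D
    (f₁ := fun S => P S * f S) (f₂ := fun S => P' S * g S)
    (f₃ := P) (f₄ := fun S => P' S * (f S * g S))
    (fun S => mul_nonneg (hP0 S) (hf0 S)) (fun S => mul_nonneg (hP0' S) (hg0 S)) hP0
    (fun S => mul_nonneg (hP0' S) (mul_nonneg (hf0 S) (hg0 S)))
    (by
      intro S hS T hT
      have hST := union_subset hS hT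
      have hl := lattice h h' hx hxx hq hc hS hT
      have e1 : P S = W S := by simp [hP, hS]
      have e2 : P' T = W' T := by simp [hP', hT]
      have e3 : P (S ∩ T) = W (S ∩ T) := by simp [hP, inter_subset_left.trans hS]
      have e4 : P' (S ∪ T) = W' (S ∪ T) := by simp only [hP', if_pos hST]
      simp only [e1, e2, e3, e4]
      have p3 := h.pos _ (inter_subset_left.trans hS : S ∩ T ⊆ D)
      have p4 := h'.pos _ hST
      calc _ = (W S * W' T) * (f S * g T) := by ring
        _ ≤ (W (S ∩ T) * W' (S ∪ T)) * (f (S ∪ T) * g (S ∪ T)) := by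
          have b1 := hf S (S ∪ T) subset_union_left hST
          have b2 := hg T (S ∪ T) subset_union_right hST
          have := hf0 S; have := hg0 T; have := hf0 (S ∪ T)
          gcongr
        _ = _ := by ring)
    (Subset.refl _) (Subset.refl _)
  rw [cP, cP', c1, cP']
  refine key.trans ?_
  have s1 : D.powerset ⊼ D.powerset ⊆ D.powerset := by
    intro S hS
    obtain ⟨A, hA, B, hB, rfl⟩ := mem_infs.1 hS
    exact mem_powerset.2 (inter_subset_left.trans (mem_powerset.1 hA))
  have s2 : D.powerset ⊻ D.powerset ⊆ D.powerset := by
    intro S hS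
    obtain ⟨A, hA, B, hB, rfl⟩ := mem_sups.1 hS
    exact mem_powerset.2
      (union_subset (mem_powerset.1 hA) (mem_powerset.1 hB))
  exact mul_le_mul
    (sum_le_sum_of_subset_of_nonneg s1 fun S _ _ => hP0 S)
    (sum_le_sum_of_subset_of_nonneg s2 fun S _ _ =>
      mul_nonneg (hP0' S) (mul_nonneg (hf0 S) (hg0 S)))
    (sum_nonneg fun S _ => mul_nonneg (hP0' S) (mul_nonneg (hf0 S) (hg0 S)))
    (sum_nonneg fun S _ => hP0 S)

lemma ex_add (f g : Finset E → ℝ) : ex D W (fun S => f S + g S) = ex D W f + ex D W g := by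
  unfold ex; rw [← add_div, ← sum_add_distrib]; simp only [mul_add]

lemma ex_sub (f g : Finset E → ℝ) : ex D W (fun S => f S - g S) = ex D W f - ex D W g := by
  unfold ex; rw [← sub_div, ← sum_sub_distrib]; simp only [mul_sub]

lemma ex_sum {ι : Type*} (s : Finset ι) (f : ι → Finset E → ℝ) :
    ex D W (fun S => ∑ i ∈ s, f i S) = ∑ i ∈ s, ex D W (f i) := by
  unfold ex
  rw [← sum_div, sum_comm]
  simp only [mul_sum]

lemma ex_const_mul (a : ℝ) (f : Finset E → ℝ) :
    ex D W (fun S => a * f S) = a * ex D W f := by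
  unfold ex
  rw [← mul_div_assoc, mul_sum]
  congr 1
  exact sum_congr rfl fun S _ => by ring

lemma ex_const (h : IsFK D x q c W) (a : ℝ) : ex D W (fun _ => a) = a := by
  unfold ex
  rw [← sum_mul, mul_div_assoc, mul_comm, div_mul_cancel₀]
  exact h.tot_pos.ne'

lemma ex_mono (h : IsFK D x q c W) {f g : Finset E → ℝ} (hfg : ∀ S ⊆ D, f S ≤ g S) :
    ex D W f ≤ ex D W g := by
  unfold ex
  refine div_le_div_of_nonneg_right (sum_le_sum fun S hS => ?_) h.tot_pos.le
  have hS := mem_powerset.1 hS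
  exact mul_le_mul_of_nonneg_left (hfg S hS) (h.pos S hS).le

lemma ex_congr {f g : Finset E → ℝ} (hfg : ∀ S ⊆ D, f S = g S) : ex D W f = ex D W g := by
  unfold ex
  congr 1
  exact sum_congr rfl fun S hS => by rw [hfg S (mem_powerset.1 hS)]

/-- Stochastic domination. -/
lemma ex_le (h : IsFK D x q c W) (h' : IsFK D x' q c' W') (hx : 0 < x) (hxx : x ≤ x')
    (hq : 1 ≤ q) (hc : CLe D c c') {f : Finset E → ℝ} (hf0 : ∀ S, 0 ≤ f S)
    (hf : ∀ S T, S ⊆ T → T ⊆ D → f S ≤ f T) : ex D W f ≤ ex D W' f := by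
  have := holley_sum h h' hx hxx hq hc (g := fun _ => 1) hf0 (by simp) hf (by simp)
  simp only [mul_one] at this
  unfold ex
  rw [div_le_div_iff₀ h.tot_pos h'.tot_pos]
  linarith

/-- Positive association. -/
lemma fkg (h : IsFK D x q c W) (hx : 0 < x) (hq : 1 ≤ q) (hc : CLe D c c)
    {f g : Finset E → ℝ} (hf0 : ∀ S, 0 ≤ f S)
    (hg0 : ∀ S, 0 ≤ g S) (hf : ∀ S T, S ⊆ T → T ⊆ D → f S ≤ f T)
    (hg : ∀ S T, S ⊆ T → T ⊆ D → g S ≤ g T) :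
    ex D W f * ex D W g ≤ ex D W (fun S => f S * g S) := by
  have := holley_sum h h hx le_rfl hq hc hf0 hg0 hf hg
  have hp := h.tot_pos
  unfold ex
  rw [div_mul_div_comm, div_le_div_iff₀ (by positivity) hp]
  nlinarith

end IsFK

/-- An event is increasing on the subsets of `D`. -/
def Incr (D : Finset E) (A : Finset E → Prop) : Prop := ∀ S T, S ⊆ T → T ⊆ D → A S → A T

lemma Incr.ind_le {A : Finset E → Prop} (hA : Incr D A) (S T : Finset E) (hST : S ⊆ T)
    (hT : T ⊆ D) : ind A S ≤ ind A T := by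
  unfold ind
  by_cases h : A S
  · simp [h, hA S T hST hT h]
  · simp [h]; split_ifs <;> norm_num

namespace IsFK

lemma pr_nonneg (h : IsFK D x q c W) (A : Finset E → Prop) : 0 ≤ pr D W A := by
  have := h.ex_mono (f := fun _ => 0) (g := ind A) fun S _ => ind_nonneg A S
  rwa [h.ex_const] at this

lemma pr_le_one (h : IsFK D x q c W) (A : Finset E → Prop) : pr D W A ≤ 1 := by
  have := h.ex_mono (f := ind A) (g := fun _ => 1) fun S _ => ind_le_one A S
  rwa [h.ex_const] at this

lemma pr_mono (h : IsFK D x q c W) {A B : Finset E → Prop} (hAB : ∀ S ⊆ D, A S → B S) :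
    pr D W A ≤ pr D W B :=
  h.ex_mono fun S hS => by
    unfold ind
    by_cases h : A S
    · simp [h, hAB S hS h]
    · simp [h]; split_ifs <;> norm_num

lemma pr_congr {A B : Finset E → Prop} (hAB : ∀ S ⊆ D, A S ↔ B S) : pr D W A = pr D W B :=
  ex_congr fun S hS => by unfold ind; simp [hAB S hS]

lemma pr_of_forall (h : IsFK D x q c W) {A : Finset E → Prop} (hA : ∀ S ⊆ D, A S) :
    pr D W A = 1 := by
  have : pr D W A = ex D W (fun _ => 1) := ex_congr fun S hS => by simp [ind, hA S hS]
  rw [this, h.ex_const]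

lemma pr_not (h : IsFK D x q c W) (A : Finset E → Prop) :
    pr D W (fun S => ¬ A S) = 1 - pr D W A := by
  have : pr D W (fun S => ¬ A S) = ex D W (fun S => 1 - ind A S) :=
    ex_congr fun S _ => by unfold ind; by_cases h : A S <;> simp [h]
  rw [this, ex_sub (fun _ => 1), h.ex_const]; rfl

lemma pr_or_le (h : IsFK D x q c W) (A B : Finset E → Prop) :
    pr D W (fun S => A S ∨ B S) ≤ pr D W A + pr D W B := by
  unfold pr; rw [← ex_add]
  refine h.ex_mono fun S _ => ?_
  unfold ind; by_cases h1 : A S <;> by_cases h2 : B S <;> simp [h1, h2]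

lemma pr_and_ge (h : IsFK D x q c W) (A B : Finset E → Prop) :
    pr D W A + pr D W B - 1 ≤ pr D W (fun S => A S ∧ B S) := by
  have := h.pr_or_le (fun S => ¬ A S) (fun S => ¬ B S)
  rw [h.pr_not, h.pr_not] at this
  have h2 : pr D W (fun S => ¬ A S ∨ ¬ B S) = pr D W (fun S => ¬ (A S ∧ B S)) :=
    pr_congr fun S _ => by tauto
  rw [h2, h.pr_not] at this
  linarith

lemma pr_exists_le (h : IsFK D x q c W) {ι : Type*} (s : Finset ι) (A : ι → Finset E → Prop) :
    pr D W (fun S => ∃ i ∈ s, A i S) ≤ ∑ i ∈ s, pr D W (A i) := by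
  unfold pr; rw [← ex_sum]
  refine h.ex_mono fun S _ => ?_
  unfold ind
  split_ifs with hh
  · obtain ⟨i, hi, hA⟩ := hh
    have := single_le_sum (f := fun i => if A i S then (1:ℝ) else 0)
      (fun j _ => by split_ifs <;> norm_num) hi
    simpa [hA] using this
  · exact sum_nonneg fun j _ => by split_ifs <;> norm_num

lemma pr_le (h : IsFK D x q c W) (h' : IsFK D x' q c' W') (hx : 0 < x) (hxx : x ≤ x')
    (hq : 1 ≤ q) (hc : CLe D c c') {A : Finset E → Prop} (hA : Incr D A) :
    pr D W A ≤ pr D W' A :=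
  h.ex_le h' hx hxx hq hc (ind_nonneg A) hA.ind_le

lemma pr_fkg (h : IsFK D x q c W) (hx : 0 < x) (hq : 1 ≤ q) (hc : CLe D c c)
    {A B : Finset E → Prop} (hA : Incr D A) (hB : Incr D B) :
    pr D W A * pr D W B ≤ pr D W (fun S => A S ∧ B S) := by
  have := h.fkg hx hq hc (ind_nonneg A) (ind_nonneg B) hA.ind_le hB.ind_le
  refine this.trans (le_of_eq (ex_congr fun S _ => ?_))
  unfold ind; by_cases h1 : A S <;> by_cases h2 : B S <;> simp [h1, h2]

/-- Two FK weights with the same connection predicate are proportional. -/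
lemma unique (h : IsFK D x q c W) (h' : IsFK D x q c W') (S : Finset E) (hS : S ⊆ D) :
    W' S * W ∅ = W S * W' ∅ := by
  induction S using Finset.induction_on with
  | empty => ring
  | insert e S he ih =>
    have hS' := (subset_insert _ _).trans hS
    have heD : e ∈ D := hS (mem_insert_self _ _)
    rw [h.step S hS' e heD he, h'.step S hS' e heD he]
    linear_combination (if c e S then x else x / q) * ih hS'

lemma congr_c (h : IsFK D x q c W) (hc : ∀ S ⊆ D, ∀ e ∈ D, e ∉ S → (c e S ↔ c' e S)) :
    IsFK D x q c' W :=
  ⟨h.pos, fun S hS e he heS => by rw [h.step S hS e he heS]; simp only [hc S hS e he heS]⟩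

lemma pr_unique (h : IsFK D x q c W) (h' : IsFK D x q c W') (A : Finset E → Prop) :
    pr D W A = pr D W' A := by
  have h0 := h.pos ∅ (by simp)
  have h0' := h'.pos ∅ (by simp)
  have key : ∀ S ⊆ D, W' S = W S * (W' ∅ / W ∅) := fun S hS => by
    rw [← mul_div_assoc, eq_div_iff h0.ne', h.unique h' S hS]
  have e1 : ∑ S ∈ D.powerset, W' S * ind A S = (∑ S ∈ D.powerset, W S * ind A S) * (W' ∅ / W ∅) := by
    rw [sum_mul]
    exact sum_congr rfl fun S hS => by rw [key S (mem_powerset.1 hS)]; ring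
  have e2 : ∑ S ∈ D.powerset, W' S = (∑ S ∈ D.powerset, W S) * (W' ∅ / W ∅) := by
    rw [sum_mul]
    exact sum_congr rfl fun S hS => by rw [key S (mem_powerset.1 hS)]
  unfold pr ex
  rw [e1, e2, mul_div_mul_right _ _ (div_pos h0' h0).ne']

end IsFK

lemma sum_powerset_split (hD : D' ⊆ D) (f : Finset E → ℝ) :
    ∑ S ∈ D.powerset, f S = ∑ T ∈ (D \ D').powerset, ∑ S ∈ D'.powerset, f (S ∪ T) := by
  rw [← sum_product']
  symm
  refine sum_bij' (fun a _ => a.2 ∪ a.1) (fun S _ => (S \ D', S ∩ D')) ?_ ?_ ?_ ?_ ?_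
  · intro a ha
    simp only [mem_product, mem_powerset] at ha ⊢
    exact union_subset (ha.2.trans hD) (ha.1.trans sdiff_subset)
  · intro S hS
    simp only [mem_product, mem_powerset] at hS ⊢
    exact ⟨sdiff_subset_sdiff hS le_rfl, inter_subset_right⟩
  · rintro ⟨T, S⟩ ha
    simp only [mem_product, mem_powerset] at ha
    obtain ⟨hT, hS⟩ := ha
    ext e
    · have := @hT e; have := @hS e
      simp only [Finset.mem_sdiff, mem_union] at *; tauto
    · have := @hT e; have := @hS e
      simp only [Finset.mem_sdiff, mem_union, mem_inter] at *; tauto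
  · intro S hS
    ext e; simp only [Finset.mem_sdiff, mem_union, mem_inter]; tauto
  · intro a _; rfl

lemma IsFK.restrict (h : IsFK D x q c W) (hD : D' ⊆ D) {T : Finset E} (hT : T ⊆ D \ D') :
    IsFK D' x q (fun e S => c e (S ∪ T)) (fun S => W (S ∪ T)) := by
  have hTD : T ⊆ D := hT.trans sdiff_subset
  refine ⟨fun S hS => h.pos _ (union_subset (hS.trans hD) hTD), fun S hS e he heS => ?_⟩
  have heT : e ∉ T := fun hh => (Finset.mem_sdiff.1 (hT hh)).2 he
  rw [insert_union]
  exact h.step _ (union_subset (hS.trans hD) hTD) e (hD he) (by simp [heS, heT])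

lemma sdiff_union_of_sub {S T : Finset E} (hS : S ⊆ D') (hT : T ⊆ D \ D') : (S ∪ T) \ D' = T := by
  ext e
  have := @hT e; have := @hS e
  simp only [Finset.mem_sdiff, mem_union] at *; tauto

/-- Comparison of expectations over `D` given the configuration off `D'`. -/
lemma IsFK.sum_split_le (h : IsFK D x q c W) (hD : D' ⊆ D) {f g : Finset E → ℝ}
    (hfg : ∀ T ⊆ D \ D', ∑ S ∈ D'.powerset, W (S ∪ T) * f (S ∪ T) ≤
      ∑ S ∈ D'.powerset, W (S ∪ T) * g (S ∪ T)) : ex D W f ≤ ex D W g := by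
  unfold ex
  refine div_le_div_of_nonneg_right ?_ h.tot_pos.le
  rw [sum_powerset_split hD, sum_powerset_split hD]
  exact sum_le_sum fun T hT => hfg T (mem_powerset.1 hT)

/-- Domain Markov upper bound. -/
lemma IsFK.md_upper (h : IsFK D x q c W) (hD : D' ⊆ D) (h' : IsFK D' x' q c' W') (hx : 0 < x)
    (hxx : x ≤ x') (hq : 1 ≤ q) {A A' B : Finset E → Prop} (hA' : Incr D' A')
    (hA : ∀ T ⊆ D \ D', B T → ∀ S ⊆ D', A (S ∪ T) → A' S)
    (hc : ∀ T ⊆ D \ D', B T → CLe D' (fun e S => c e (S ∪ T)) c') :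
    pr D W (fun S => A S ∧ B (S \ D')) ≤ pr D' W' A' * pr D W (fun S => B (S \ D')) := by
  have : pr D' W' A' * pr D W (fun S => B (S \ D')) =
    ex D W (fun S => pr D' W' A' * ind (fun S => B (S \ D')) S) := (ex_const_mul _ _).symm
  rw [this]
  refine h.sum_split_le hD fun T hT => ?_
  by_cases hB : B T
  · have hr := h.restrict hD hT
    have key := (hr.pr_mono (hA T hT hB)).trans (hr.pr_le h' hx hxx hq (hc T hT hB) hA')
    unfold pr at key
    nth_rewrite 1 [ex] at key
    rw [div_le_iff₀ hr.tot_pos, mul_sum] at key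
    refine le_trans (le_of_eq ?_) (key.trans (le_of_eq ?_))
    · refine sum_congr rfl fun S hS => ?_
      have := sdiff_union_of_sub (mem_powerset.1 hS) hT
      simp [ind, this, hB]
    · refine sum_congr rfl fun S hS => ?_
      have := sdiff_union_of_sub (mem_powerset.1 hS) hT
      simp [ind, this, hB, pr, mul_comm]
  · refine sum_le_sum fun S hS => ?_
    have := sdiff_union_of_sub (mem_powerset.1 hS) hT
    simp [ind, this, hB]

/-- Domain Markov lower bound. -/
lemma IsFK.md_lower (h : IsFK D x q c W) (hD : D' ⊆ D) (h' : IsFK D' x' q c' W') (hx : 0 < x')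
    (hxx : x' ≤ x) (hq : 1 ≤ q) {A A' B : Finset E → Prop} (hA' : Incr D' A')
    (hA : ∀ T ⊆ D \ D', B T → ∀ S ⊆ D', A' S → A (S ∪ T))
    (hc : ∀ T ⊆ D \ D', B T → CLe D' c' (fun e S => c e (S ∪ T))) :
    pr D' W' A' * pr D W (fun S => B (S \ D')) ≤ pr D W (fun S => A S ∧ B (S \ D')) := by
  have : pr D' W' A' * pr D W (fun S => B (S \ D')) =
    ex D W (fun S => pr D' W' A' * ind (fun S => B (S \ D')) S) := (ex_const_mul _ _).symm
  rw [this]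
  refine h.sum_split_le hD fun T hT => ?_
  by_cases hB : B T
  · have hr := h.restrict hD hT
    have key := (h'.pr_le hr hx hxx hq (hc T hT hB) hA').trans (hr.pr_mono (hA T hT hB))
    unfold pr at key
    nth_rewrite 2 [ex] at key
    rw [le_div_iff₀ hr.tot_pos, mul_sum] at key
    refine le_trans (le_of_eq ?_) (key.trans (le_of_eq ?_))
    · refine sum_congr rfl fun S hS => ?_
      have := sdiff_union_of_sub (mem_powerset.1 hS) hT
      simp [ind, this, hB, pr, mul_comm]
    · refine sum_congr rfl fun S hS => ?_
      have := sdiff_union_of_sub (mem_powerset.1 hS) hT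
      simp [ind, this, hB]
  · refine sum_le_sum fun S hS => ?_
    have := sdiff_union_of_sub (mem_powerset.1 hS) hT
    simp [ind, this, hB]

/-- Exploration: summing over the configurations according to the explored region `K S` and the
configuration inside. -/
lemma sum_explore_nonpos (K : Finset E → Finset E)
    (hK : ∀ S S', S ∩ K S = S' ∩ K S → K S' = K S) (N : Finset E → Prop)
    (hN : ∀ S S', S ∩ K S = S' ∩ K S → N S → N S') (F : Finset E → ℝ)
    (hF : ∀ S ⊆ D, N S → ∑ S' ∈ (D \ K S).powerset, F ((S ∩ K S) ∪ S') ≤ 0) :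
    ∑ S ∈ D.powerset with N S, F S ≤ 0 := by
  rw [← sum_fiberwise_of_maps_to (t := (D.powerset.filter N).image fun S => (K S, S ∩ K S))
    (g := fun S => (K S, S ∩ K S)) (fun S hS => mem_image_of_mem _ hS)]
  refine sum_nonpos fun a ha => ?_
  obtain ⟨S0, hS0, rfl⟩ := mem_image.1 ha
  rw [mem_filter, mem_powerset] at hS0
  refine le_trans (le_of_eq ?_) (hF S0 hS0.1 hS0.2)
  symm
  have hin : ∀ S' ⊆ D \ K S0, (S0 ∩ K S0 ∪ S') ∩ K S0 = S0 ∩ K S0 := fun S' hS' => by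
    ext e
    have := @hS' e
    simp only [Finset.mem_sdiff, mem_union, mem_inter] at *; tauto
  refine sum_bij' (fun S' _ => (S0 ∩ K S0) ∪ S') (fun S _ => S \ K S0) ?_ ?_ ?_ ?_ ?_
  · intro S' hS'
    rw [mem_powerset] at hS'
    have h1 := hin S' hS'
    have hk := hK S0 _ h1.symm
    simp only [mem_filter, mem_powerset, Prod.mk.injEq]
    refine ⟨⟨union_subset (inter_subset_left.trans hS0.1)
      (hS'.trans sdiff_subset), hN _ _ h1.symm hS0.2⟩, hk, ?_⟩
    rw [hk, h1]
  · intro S hS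
    simp only [mem_filter, mem_powerset, Prod.mk.injEq] at hS ⊢
    exact sdiff_subset_sdiff hS.1.1 le_rfl
  · intro S' hS'
    ext e
    have : e ∈ S' → _ := fun h => mem_powerset.1 hS' h
    simp only [Finset.mem_sdiff, mem_union, mem_inter] at *; tauto
  · intro S hS
    simp only [mem_filter, mem_powerset, Prod.mk.injEq] at hS
    obtain ⟨-, h2, h3⟩ := hS
    rw [← h3, h2]
    ext e; simp only [Finset.mem_sdiff, mem_union, mem_inter]; tauto
  · intro _ _; rfl

/-- If, given the explored region and the configuration inside, `A` has probability at most `β`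
under a comparison weight, then `A ∩ N` has probability at most `β` times that of `N`. -/
lemma IsFK.explore_upper (h : IsFK D x q c W) (hx : 0 < x) (hq : 1 ≤ q) (K : Finset E → Finset E)
    (hK : ∀ S S', S ∩ K S = S' ∩ K S → K S' = K S) (N A : Finset E → Prop)
    (hN : ∀ S S', S ∩ K S = S' ∩ K S → N S → N S') (β : ℝ)
    (hF : ∀ S ⊆ D, N S → ∃ (c' : E → Finset E → Prop) (W' : Finset E → ℝ) (A' : Finset E → Prop),
      IsFK (D \ K S) x q c' W' ∧ Incr (D \ K S) A' ∧ pr (D \ K S) W' A' ≤ β ∧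
      (∀ S' ⊆ D \ K S, A (S' ∪ (S ∩ K S)) → A' S') ∧
      CLe (D \ K S) (fun e S' => c e (S' ∪ (S ∩ K S))) c') :
    pr D W (fun S => A S ∧ N S) ≤ β * pr D W N := by
  have hb : β * pr D W N = ex D W (fun S => β * ind N S) := (ex_const_mul _ _).symm
  rw [hb]
  unfold pr ex
  refine div_le_div_of_nonneg_right ?_ h.tot_pos.le
  rw [← sub_nonpos, ← sum_sub_distrib]
  have := sum_explore_nonpos (D := D) K hK N hN
    (fun S => W S * ind (fun S => A S ∧ N S) S - W S * (β * ind N S)) ?_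
  · refine le_trans (le_of_eq ?_) this
    rw [sum_filter]
    refine sum_congr rfl fun S _ => ?_
    by_cases hh : N S <;> simp [hh, ind]
  · intro S hS hNS
    obtain ⟨c', W', A', h', hA', hβ, hAA, hc⟩ := hF S hS hNS
    have hsub : S ∩ K S ⊆ D \ (D \ K S) := by
      intro e he
      have := @hS e
      simp only [Finset.mem_sdiff, mem_inter] at *; tauto
    have hr := h.restrict (sdiff_subset : D \ K S ⊆ D) hsub
    have key := ((hr.pr_mono hAA).trans (hr.pr_le h' hx le_rfl hq hc hA')).trans hβ
    unfold pr at key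
    rw [ex, div_le_iff₀ hr.tot_pos, mul_sum] at key
    rw [sum_sub_distrib, sub_nonpos]
    have hNN : ∀ S' ∈ (D \ K S).powerset, N (S ∩ K S ∪ S') := fun S' hS' => by
      refine hN S _ ?_ hNS
      ext e
      have : e ∈ S' → _ := fun h => mem_powerset.1 hS' h
      simp only [Finset.mem_sdiff, mem_union, mem_inter] at *; tauto
    refine le_trans (le_of_eq ?_) (key.trans (le_of_eq ?_))
    · refine sum_congr rfl fun S' hS' => ?_
      have := hNN S' hS'
      have hcm := union_comm (S ∩ K S) S'
      rw [hcm] at this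
      simp [ind, this, hcm]
    · refine sum_congr rfl fun S' hS' => ?_
      have := hNN S' hS'
      have hcm := union_comm (S ∩ K S) S'
      rw [hcm] at this
      simp [ind, this, hcm, mul_comm]

lemma IsFK.le_open (h : IsFK D x q c W) (hx : 0 < x) (hq : 1 ≤ q) {T : Finset E} (U : Finset E)
    (hU : U ⊆ D) (hT : T ⊆ D) (hUT : Disjoint U T) :
    W T ≤ (max 1 (q / x)) ^ U.card * W (U ∪ T) := by
  induction U using Finset.induction_on with
  | empty => simp
  | insert e U he ih =>
    have hU' : U ⊆ D := (subset_insert _ _).trans hU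
    have hd := disjoint_insert_left.1 hUT
    have ih := ih hU' hd.2
    rw [insert_union, h.step _ (union_subset hU' hT) e
      (hU (mem_insert_self _ _)) (by simp [he, hd.1]), card_insert_of_notMem he]
    refine ih.trans ?_
    have hp := h.pos _ (union_subset hU' hT)
    have hq0 : 0 < q := by linarith
    have h1 : 1 ≤ max 1 (q / x) * (if c e (U ∪ T) then x else x / q) := by
      have : 1 ≤ (q / x) * (if c e (U ∪ T) then x else x / q) := by
        split_ifs
        · rw [div_mul_cancel₀ _ hx.ne']; exact hq
        · rw [div_mul_div_comm, mul_comm, div_self (by positivity)]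
      refine this.trans (mul_le_mul_of_nonneg_right (le_max_right _ _) ?_)
      split_ifs <;> positivity
    have hm : 0 < (max 1 (q / x)) ^ U.card := by positivity
    calc _ = max 1 (q / x) ^ U.card * W (U ∪ T) * 1 := by ring
      _ ≤ max 1 (q / x) ^ U.card * W (U ∪ T) *
          (max 1 (q / x) * (if c e (U ∪ T) then x else x / q)) := by gcongr
      _ = _ := by rw [pow_succ]; ring

lemma IsFK.le_closed (h : IsFK D x q c W) (hx : 0 < x) (hq : 1 ≤ q) {T : Finset E} (U : Finset E)
    (hU : U ⊆ D) (hT : T ⊆ D) (hUT : Disjoint U T) :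
    W (U ∪ T) ≤ (max 1 x) ^ U.card * W T := by
  induction U using Finset.induction_on with
  | empty => simp
  | insert e U he ih =>
    have hU' : U ⊆ D := (subset_insert _ _).trans hU
    have hd := disjoint_insert_left.1 hUT
    have ih := ih hU' hd.2
    rw [insert_union, h.step _ (union_subset hU' hT) e
      (hU (mem_insert_self _ _)) (by simp [he, hd.1]), card_insert_of_notMem he]
    have hp := h.pos _ (union_subset hU' hT)
    have hpT := h.pos _ hT
    have hq0 : 0 < q := by linarith
    have h1 : (if c e (U ∪ T) then x else x / q) ≤ max 1 x := by
      have : x / q ≤ x := div_le_self hx.le hq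
      split_ifs
      · exact le_max_right _ _
      · exact this.trans (le_max_right _ _)
    calc _ ≤ (max 1 x ^ U.card * W T) * max 1 x := by gcongr
      _ = _ := by rw [pow_succ]; ring

/-- Finite energy: opening a finite set of edges. -/
lemma IsFK.finite_energy_open (h : IsFK D x q c W) (hx : 0 < x) (hq : 1 ≤ q) {b : Finset E}
    (hb : b ⊆ D) (A : Finset E → Prop) :
    pr D W (fun S => A (S \ b)) ≤
      (2 * max 1 (q / x)) ^ b.card * pr D W (fun S => A (S \ b) ∧ b ⊆ S) := by
  rw [pr, pr, ← ex_const_mul]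
  refine h.sum_split_le hb fun T hT => ?_
  have hTD : T ⊆ D := hT.trans sdiff_subset
  by_cases hA : A T
  · have e2 : (2 * max 1 (q / x)) ^ b.card * W (b ∪ T) ≤ ∑ S ∈ b.powerset, W (S ∪ T) *
      ((2 * max 1 (q / x)) ^ b.card * ind (fun S => A (S \ b) ∧ b ⊆ S) (S ∪ T)) := by
      refine le_trans (le_of_eq ?_) (single_le_sum (f := fun S => W (S ∪ T) *
        ((2 * max 1 (q / x)) ^ b.card * ind (fun S => A (S \ b) ∧ b ⊆ S) (S ∪ T)))
        (fun S hS => ?_) (mem_powerset.2 (Subset.refl b)))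
      · have := sdiff_union_of_sub (Subset.refl b) hT
        simp [ind, this, hA, mul_comm]
      · have := h.pos (S ∪ T) (union_subset ((mem_powerset.1 hS).trans hb) hTD)
        have h2 := ind_nonneg (fun S => A (S \ b) ∧ b ⊆ S) (S ∪ T)
        positivity
    refine le_trans ?_ e2
    have hpos := h.pos (b ∪ T) (union_subset hb hTD)
    have : ∀ S ∈ b.powerset, W (S ∪ T) * ind (fun S => A (S \ b)) (S ∪ T) ≤
        (max 1 (q / x)) ^ b.card * W (b ∪ T) := by
      intro S hS
      rw [mem_powerset] at hS
      have hp := h.pos (S ∪ T) (union_subset (hS.trans hb) hTD)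
      have h1 := h.le_open hx hq (T := S ∪ T) (b \ S) (sdiff_subset.trans hb)
        (union_subset (hS.trans hb) hTD) (by
          rw [disjoint_left]; intro e he he2
          have := @hT e
          simp only [Finset.mem_sdiff, mem_union] at *; tauto)
      have e1 : b \ S ∪ (S ∪ T) = b ∪ T := by
        ext e; have := @hS e
        simp only [Finset.mem_sdiff, mem_union]; tauto
      rw [e1] at h1
      have h3 : (max 1 (q / x)) ^ (b \ S).card ≤ (max 1 (q / x)) ^ b.card :=
        pow_le_pow_right₀ (le_max_left _ _) (card_le_card sdiff_subset)
      calc _ ≤ W (S ∪ T) * 1 := by gcongr; exact ind_le_one _ _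
        _ ≤ (max 1 (q / x)) ^ (b \ S).card * W (b ∪ T) := by rw [mul_one]; exact h1
        _ ≤ _ := by gcongr
    refine (sum_le_card_nsmul _ _ _ this).trans (le_of_eq ?_)
    rw [card_powerset, nsmul_eq_mul, mul_pow]
    push_cast; ring
  · have : ∀ S ∈ b.powerset, (S ∪ T) \ b = T := fun S hS =>
      sdiff_union_of_sub (mem_powerset.1 hS) hT
    refine sum_le_sum fun S hS => ?_
    simp [ind, this S hS, hA]

/-- Finite energy: closing a finite set of edges. -/
lemma IsFK.finite_energy_closed (h : IsFK D x q c W) (hx : 0 < x) (hq : 1 ≤ q) {b : Finset E}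
    (hb : b ⊆ D) (A : Finset E → Prop) :
    pr D W (fun S => A (S \ b)) ≤
      (2 * max 1 x) ^ b.card * pr D W (fun S => A (S \ b) ∧ Disjoint S b) := by
  rw [pr, pr, ← ex_const_mul]
  refine h.sum_split_le hb fun T hT => ?_
  have hTD : T ⊆ D := hT.trans sdiff_subset
  by_cases hA : A T
  · have e2 : (2 * max 1 x) ^ b.card * W T ≤ ∑ S ∈ b.powerset, W (S ∪ T) *
      ((2 * max 1 x) ^ b.card * ind (fun S => A (S \ b) ∧ Disjoint S b) (S ∪ T)) := by
      refine le_trans (le_of_eq ?_) (single_le_sum (f := fun S => W (S ∪ T) *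
        ((2 * max 1 x) ^ b.card * ind (fun S => A (S \ b) ∧ Disjoint S b) (S ∪ T)))
        (fun S hS => ?_) (mem_powerset.2 (empty_subset b)))
      · have := sdiff_union_of_sub (empty_subset b) hT
        have hd : Disjoint (∅ ∪ T) b := by
          rw [empty_union]
          exact disjoint_left.2 fun e he => (Finset.mem_sdiff.1 (hT he)).2
        rw [ind, if_pos ⟨by rw [this]; exact hA, hd⟩, empty_union]; ring
      · have := h.pos (S ∪ T) (union_subset ((mem_powerset.1 hS).trans hb) hTD)
        have h2 := ind_nonneg (fun S => A (S \ b) ∧ Disjoint S b) (S ∪ T)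
        positivity
    refine le_trans ?_ e2
    have hpos := h.pos T hTD
    have : ∀ S ∈ b.powerset, W (S ∪ T) * ind (fun S => A (S \ b)) (S ∪ T) ≤
        (max 1 x) ^ b.card * W T := by
      intro S hS
      rw [mem_powerset] at hS
      have hp := h.pos (S ∪ T) (union_subset (hS.trans hb) hTD)
      have h1 := h.le_closed hx hq (T := T) S (hS.trans hb) hTD (by
          rw [disjoint_left]; intro e he he2
          have := @hT e; have := @hS e
          simp only [Finset.mem_sdiff] at *; tauto)
      have h3 : (max 1 x) ^ S.card ≤ (max 1 x) ^ b.card :=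
        pow_le_pow_right₀ (le_max_left _ _) (card_le_card hS)
      calc _ ≤ W (S ∪ T) * 1 := by gcongr; exact ind_le_one _ _
        _ ≤ (max 1 x) ^ S.card * W T := by rw [mul_one]; exact h1
        _ ≤ _ := by gcongr
    refine (sum_le_card_nsmul _ _ _ this).trans (le_of_eq ?_)
    rw [card_powerset, nsmul_eq_mul, mul_pow]
    push_cast; ring
  · have : ∀ S ∈ b.powerset, (S ∪ T) \ b = T := fun S hS =>
      sdiff_union_of_sub (mem_powerset.1 hS) hT
    refine sum_le_sum fun S hS => ?_
    simp [ind, this S hS, hA]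

/-- `a` and `b` are opposite corners of the unit cell `z`. -/
def Lnk (z a b : ℤ²) : Prop :=
  (a.1 = z.1 ∧ b.1 = z.1 + 1 ∨ b.1 = z.1 ∧ a.1 = z.1 + 1) ∧
  (a.2 = z.2 ∧ b.2 = z.2 + 1 ∨ b.2 = z.2 ∧ a.2 = z.2 + 1)

/-- Connection by diagonals of the cells of `O`. -/
def Conn (O : Set ℤ²) (a b : ℤ²) : Prop :=
  Relation.ReflTransGen (fun a b => ∃ z ∈ O, Lnk z a b) a b

/-- Parity of a lattice point. -/
def par (a : ℤ²) : ℤ := (a.1 + a.2) % 2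

/-- The left corner of parity `π` of the cell `z`. -/
def pu (π : ℤ) (z : ℤ²) : ℤ² := if par z = π then z else (z.1, z.2 + 1)

/-- The right corner of parity `π` of the cell `z`. -/
def pv (π : ℤ) (z : ℤ²) : ℤ² := if par z = π then (z.1 + 1, z.2 + 1) else (z.1 + 1, z.2)

/-- The corners of parity `π` of the cell `z` are connected in `O`. -/
def cn (π : ℤ) (z : ℤ²) (O : Set ℤ²) : Prop := Conn O (pu π z) (pv π z)

lemma Lnk.symm {z a b : ℤ²} (h : Lnk z a b) : Lnk z b a := by
  unfold Lnk at *; tauto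

lemma Lnk.par_eq {z a b : ℤ²} (h : Lnk z a b) : par a = par b := by
  unfold Lnk par at *; omega

lemma lnk_pu_pv (π : ℤ) (z : ℤ²) : Lnk z (pu π z) (pv π z) := by
  unfold Lnk pu pv; split_ifs <;> simp

lemma Lnk.eq_or {z a b : ℤ²} {π : ℤ} (h : Lnk z a b) (ha : par a = π) :
    a = pu π z ∧ b = pv π z ∨ a = pv π z ∧ b = pu π z := by
  obtain ⟨a1, a2⟩ := a; obtain ⟨b1, b2⟩ := b; obtain ⟨z1, z2⟩ := z
  simp only [Lnk, pu, pv, par] at *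
  by_cases hz : (z1 + z2) % 2 = π <;> simp only [hz, if_true, if_false, Prod.mk.injEq] <;> omega

lemma par_pu {π : ℤ} (hπ : π = 0 ∨ π = 1) (z : ℤ²) : par (pu π z) = π := by
  unfold pu; split_ifs with h
  · exact h
  · unfold par at *; simp only; omega

lemma par_pv {π : ℤ} (hπ : π = 0 ∨ π = 1) (z : ℤ²) : par (pv π z) = π :=
  (lnk_pu_pv π z).par_eq.symm.trans (par_pu hπ z)

lemma par_zero_or_one (a : ℤ²) : par a = 0 ∨ par a = 1 := by unfold par; omega

namespace Conn

lemma refl (O : Set ℤ²) (a : ℤ²) : Conn O a a := Relation.ReflTransGen.refl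

lemma trans {O : Set ℤ²} {a b c : ℤ²} (h : Conn O a b) (h' : Conn O b c) : Conn O a c :=
  Relation.ReflTransGen.trans h h'

lemma symm {O : Set ℤ²} {a b : ℤ²} (h : Conn O a b) : Conn O b a := by
  induction h with
  | refl => exact refl _ _
  | tail _ h ih =>
    obtain ⟨z, hz, hl⟩ := h
    exact (Relation.ReflTransGen.single ⟨z, hz, hl.symm⟩ : Conn O _ _).trans ih

lemma of_lnk {O : Set ℤ²} {z a b : ℤ²} (hz : z ∈ O) (h : Lnk z a b) : Conn O a b :=
  Relation.ReflTransGen.single ⟨z, hz, h⟩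

lemma mono {O O' : Set ℤ²} (h : O ⊆ O') {a b : ℤ²} (hc : Conn O a b) : Conn O' a b := by
  induction hc with
  | refl => exact refl _ _
  | tail _ hs ih => obtain ⟨z, hz, hl⟩ := hs; exact ih.trans (of_lnk (h hz) hl)

lemma par_eq {O : Set ℤ²} {a b : ℤ²} (h : Conn O a b) : par a = par b := by
  induction h with
  | refl => rfl
  | tail _ h ih => obtain ⟨z, -, hl⟩ := h; exact ih.trans hl.par_eq

/-- Transport of connections along a map of points. -/
lemma map {O O' : Set ℤ²} {a b : ℤ²} (r : ℤ² → ℤ²)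
    (hr : ∀ z ∈ O, ∀ a b, Lnk z a b → par a = par b → Conn O' (r a) (r b)) (h : Conn O a b) :
    Conn O' (r a) (r b) := by
  induction h with
  | refl => exact refl _ _
  | tail _ h ih => obtain ⟨z, hz, hl⟩ := h; exact ih.trans (hr z hz _ _ hl hl.par_eq)

/-- The effect of opening one cell. -/
lemma insert_iff {O : Set ℤ²} {e a b : ℤ²} {π : ℤ} (ha : par a = π) :
    Conn (insert e O) a b ↔ Conn O a b ∨ (Conn O a (pu π e) ∧ Conn O (pv π e) b) ∨
      (Conn O a (pv π e) ∧ Conn O (pu π e) b) := by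
  constructor
  · intro h
    induction h with
    | refl => exact Or.inl (refl _ _)
    | @tail b c hab h ih =>
      obtain ⟨z, hz, hl⟩ := h
      rcases hz with rfl | hz
      · have hb : par b = π := (par_eq hab).symm.trans ha
        rcases hl.eq_or hb with ⟨rfl, rfl⟩ | ⟨rfl, rfl⟩
        · rcases ih with h | ⟨h, -⟩ | ⟨h, -⟩
          · exact Or.inr (Or.inl ⟨h, refl _ _⟩)
          · exact Or.inr (Or.inl ⟨h, refl _ _⟩)
          · exact Or.inl h
        · rcases ih with h | ⟨h, -⟩ | ⟨h, -⟩
          · exact Or.inr (Or.inr ⟨h, refl _ _⟩)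
          · exact Or.inl h
          · exact Or.inr (Or.inr ⟨h, refl _ _⟩)
      · have hs := of_lnk hz hl
        rcases ih with h | ⟨h, h'⟩ | ⟨h, h'⟩
        · exact Or.inl (h.trans hs)
        · exact Or.inr (Or.inl ⟨h, h'.trans hs⟩)
        · exact Or.inr (Or.inr ⟨h, h'.trans hs⟩)
  · have hsub : O ⊆ insert e O := Set.subset_insert _ _
    have he : Conn (insert e O) (pu π e) (pv π e) := of_lnk (Set.mem_insert _ _) (lnk_pu_pv π e)
    rintro (h | ⟨h, h'⟩ | ⟨h, h'⟩)
    · exact h.mono hsub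
    · exact ((h.mono hsub).trans he).trans (h'.mono hsub)
    · exact ((h.mono hsub).trans he.symm).trans (h'.mono hsub)

end Conn

/-- Merging two classes of an equivalence relation lowers the number of classes by one. -/
lemma card_quotient_merge {α : Type*} [Finite α] (R R' : Setoid α) (u v : α)
    (h : ∀ a b, R'.r a b ↔ R.r a b ∨ (R.r a u ∧ R.r v b) ∨ (R.r a v ∧ R.r u b)) :
    Nat.card (Quotient R) = Nat.card (Quotient R') + if R.r u v then 0 else 1 := by
  split_ifs with huv
  · have : R = R' := by
      ext a b
      refine ((h a b).trans ⟨?_, Or.inl⟩).symm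
      rintro (h | ⟨h, h'⟩ | ⟨h, h'⟩)
      · exact h
      · exact R.trans' h (R.trans' huv h')
      · exact R.trans' h (R.trans' (R.symm' huv) h')
    rw [this, add_zero]
  · have hvu : ¬ R.r v u := fun hh => huv (R.symm' hh)
    let f : Quotient R' → {y : Quotient R // y ≠ ⟦v⟧} := fun y =>
      Quotient.lift (s := R') (fun a => if ha : R.r a v then
        (⟨⟦u⟧, fun hh => huv (Quotient.exact hh)⟩ : {y : Quotient R // y ≠ ⟦v⟧})
        else ⟨⟦a⟧, fun hh => ha (Quotient.exact hh)⟩) (by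
          intro a b hab
          have hab := (h a b).1 hab
          rcases hab with hh | ⟨h1, h2⟩ | ⟨h1, h2⟩
          · by_cases ha : R.r a v
            · have hb : R.r b v := R.trans' (R.symm' hh) ha
              simp only [ha, hb, dif_pos]
            · have hb : ¬ R.r b v := fun hb => ha (R.trans' hh hb)
              simp only [ha, hb, dif_neg, not_false_eq_true]
              exact Subtype.ext (Quotient.sound hh)
          · have ha : ¬ R.r a v := fun ha => huv (R.trans' (R.symm' h1) ha)
            have hb : R.r b v := R.symm' h2
            simp only [ha, hb, dif_pos, dif_neg, not_false_eq_true]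
            exact Subtype.ext (Quotient.sound h1)
          · have hb : ¬ R.r b v := fun hb => huv (R.trans' h2 hb)
            simp only [h1, hb, dif_pos, dif_neg, not_false_eq_true]
            exact Subtype.ext (Quotient.sound h2)) y
    have hf : Function.Bijective f := by
      constructor
      · intro y y'
        induction y using Quotient.inductionOn with | _ a
        induction y' using Quotient.inductionOn with | _ b
        intro hfe
        apply Quotient.sound
        refine (h a b).2 ?_
        by_cases ha : R.r a v <;> by_cases hb : R.r b v
        · exact Or.inl (R.trans' ha (R.symm' hb))
        · simp only [f, Quotient.lift_mk, ha, hb, dif_pos, dif_neg, not_false_eq_true,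
            Subtype.mk.injEq] at hfe
          exact Or.inr (Or.inr ⟨ha, Quotient.exact hfe⟩)
        · simp only [f, Quotient.lift_mk, ha, hb, dif_pos, dif_neg, not_false_eq_true,
            Subtype.mk.injEq] at hfe
          exact Or.inr (Or.inl ⟨Quotient.exact hfe, R.symm' hb⟩)
        · simp only [f, Quotient.lift_mk, ha, hb, dif_neg, not_false_eq_true,
            Subtype.mk.injEq] at hfe
          exact Or.inl (Quotient.exact hfe)
      · rintro ⟨y, hy⟩
        induction y using Quotient.inductionOn with | _ a
        have ha : ¬ R.r a v := fun hh => hy (Quotient.sound hh)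
        exact ⟨Quotient.mk R' a, by simp only [f, Quotient.lift_mk, ha, dif_neg, not_false_eq_true]⟩
    have : Finite (Quotient R) := Quotient.finite _
    have e1 : Nat.card (Quotient R') = Nat.card {y : Quotient R // y ≠ ⟦v⟧} :=
      Nat.card_congr (Equiv.ofBijective f hf)
    have := Fintype.ofFinite (Quotient R)
    rw [e1, Nat.card_eq_fintype_card, Nat.card_eq_fintype_card, Fintype.card_subtype_compl,
      Fintype.card_subtype_eq]
    have : 0 < Fintype.card (Quotient R) := Fintype.card_pos_iff.2 ⟨⟦v⟧⟩
    omega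

/-- Corners of parity `π` of the cells of `D`. -/
def pts (π : ℤ) (D : Finset ℤ²) : Finset ℤ² := D.image (pu π) ∪ D.image (pv π)

/-- The partition of the corners of `D` into clusters of `O`. -/
def clSetoid (π : ℤ) (D : Finset ℤ²) (O : Set ℤ²) : Setoid {a // a ∈ pts π D} where
  r a b := Conn O a.1 b.1
  iseqv := ⟨fun _ => Conn.refl _ _, fun h => h.symm, fun h h' => h.trans h'⟩

/-- The configuration in `D` extended by `ζ` outside. -/
def cfg (D : Finset ℤ²) (ζ : Set ℤ²) (S : Finset ℤ²) : Set ℤ² :=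
  ↑S ∪ (ζ \ ↑D)

/-- The FK weight on cells with clusters of parity `π`. -/
def Wt (π : ℤ) (D : Finset ℤ²) (ζ : Set ℤ²) (x q : ℝ) (S : Finset ℤ²) : ℝ :=
  x ^ S.card * q ^ Nat.card (Quotient (clSetoid π D (cfg D ζ S)))

/-- FK probability of the event `A` in `D`, the configuration outside of `D` being `ζ`. -/
def PP (π : ℤ) (D : Finset ℤ²) (ζ : Set ℤ²) (x q : ℝ) (A : Set ℤ² → Prop) : ℝ :=
  pr D (Wt π D ζ x q) (fun S => A (cfg D ζ S))

lemma cfg_insert (D : Finset ℤ²) (ζ : Set ℤ²) (e : ℤ²) (S : Finset ℤ²) :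
    cfg D ζ (insert e S) = insert e (cfg D ζ S) := by
  unfold cfg; rw [coe_insert, Set.insert_union]

lemma cfg_mono {D : Finset ℤ²} {ζ ζ' : Set ℤ²} {S S' : Finset ℤ²} (hS : S ⊆ S')
    (hζ : ζ ⊆ ζ') : cfg D ζ S ⊆ cfg D ζ' S' :=
  Set.union_subset_union (coe_subset.2 hS) (Set.sdiff_subset_sdiff_left hζ)

lemma mem_cfg {D : Finset ℤ²} {ζ : Set ℤ²} {S : Finset ℤ²} {z : ℤ²} :
    z ∈ cfg D ζ S ↔ z ∈ S ∨ (z ∈ ζ ∧ z ∉ D) := by simp [cfg]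

lemma Wt_isFK {π : ℤ} (hπ : π = 0 ∨ π = 1) (D : Finset ℤ²) (ζ : Set ℤ²) {x q : ℝ}
    (hx : 0 < x) (hq : 1 ≤ q) :
    IsFK D x q (fun e S => cn π e (cfg D ζ S)) (Wt π D ζ x q) := by
  have hq0 : 0 < q := by linarith
  refine ⟨fun S _ => by unfold Wt; positivity, fun S hS e he heS => ?_⟩
  have hu : pu π e ∈ pts π D := mem_union_left _ (mem_image_of_mem _ he)
  have hv : pv π e ∈ pts π D := mem_union_right _ (mem_image_of_mem _ he)
  have hpar : ∀ a ∈ pts π D, par a = π := by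
    intro a ha
    rcases mem_union.1 ha with h | h
    · obtain ⟨z, -, rfl⟩ := mem_image.1 h; exact par_pu hπ z
    · obtain ⟨z, -, rfl⟩ := mem_image.1 h; exact par_pv hπ z
  have hm := card_quotient_merge (clSetoid π D (cfg D ζ S)) (clSetoid π D (cfg D ζ (insert e S)))
    ⟨_, hu⟩ ⟨_, hv⟩ (fun a b => by
      show Conn (cfg D ζ (insert e S)) a.1 b.1 ↔ _
      rw [cfg_insert, Conn.insert_iff (hpar _ a.2)]; rfl)
  unfold Wt
  rw [card_insert_of_notMem heS, hm]
  have : (clSetoid π D (cfg D ζ S)).r ⟨_, hu⟩ ⟨_, hv⟩ ↔ cn π e (cfg D ζ S) := Iff.rfl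
  simp only [this]
  split_ifs with h
  · rw [pow_succ, add_zero]; ring
  · rw [pow_succ, pow_succ]; field_simp

/-- `O` agrees with `ζ` off `D`. -/
def Agr (D : Finset ℤ²) (ζ O : Set ℤ²) : Prop := ∀ z, z ∉ D → (z ∈ O ↔ z ∈ ζ)

/-- The configuration equal to `O` in `D` and to `ζ` outside. -/
def glue (D : Finset ℤ²) (ζ O : Set ℤ²) : Set ℤ² := (O ∩ ↑D) ∪ (ζ \ ↑D)

/-- The event `B` does not depend on the cells of `D`. -/
def OffD (D : Finset ℤ²) (B : Set ℤ² → Prop) : Prop :=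
  ∀ O O', Agr D O O' → B O → B O'

lemma OffD.cfg_sdiff {D D' : Finset ℤ²} {ζ : Set ℤ²} {B : Set ℤ² → Prop} (hB : OffD D' B)
    {S : Finset ℤ²} : B (cfg D ζ S) ↔ B (cfg D ζ (S \ D')) := by
  constructor <;> refine hB _ _ (fun z hz => ?_) <;>
    · rw [mem_cfg, mem_cfg, Finset.mem_sdiff]; tauto

lemma OffD.cfg_union {D D' S T : Finset ℤ²} {ζ : Set ℤ²} {B : Set ℤ² → Prop} (hB : OffD D' B)
    (hS : S ⊆ D') (h : B (cfg D ζ T)) : B (cfg D ζ (S ∪ T)) := by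
  refine hB _ _ (fun z hz => ?_) h
  rw [mem_cfg, mem_cfg, mem_union]; have := @hS z; tauto

lemma mem_glue {D : Finset ℤ²} {ζ O : Set ℤ²} {z : ℤ²} :
    z ∈ glue D ζ O ↔ (z ∈ O ∧ z ∈ D) ∨ (z ∈ ζ ∧ z ∉ D) := by simp [glue]

lemma agr_cfg {D S : Finset ℤ²} (hS : S ⊆ D) (ζ : Set ℤ²) : Agr D ζ (cfg D ζ S) := by
  intro z hz
  rw [mem_cfg]
  have := @hS z
  tauto

lemma glue_cfg {D D' S T : Finset ℤ²} (hS : S ⊆ D') (hT : T ⊆ D \ D') (ζ ζ' : Set ℤ²)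
    (hD : D' ⊆ D) : glue D' ζ' (cfg D ζ (S ∪ T)) = cfg D' ζ' S := by
  ext z
  rw [mem_glue, mem_cfg, mem_cfg, mem_union]
  have := @hS z; have := @hT z; have := @hD z
  simp only [Finset.mem_sdiff] at *
  tauto
variable {π : ℤ} {D D' : Finset ℤ²} {ζ ζ' : Set ℤ²} {x x' q : ℝ}
  {A A' B : Set ℤ² → Prop}

lemma incr_cfg (D : Finset ℤ²) (ζ : Set ℤ²) (hA : Monotone A) :
    Incr D (fun S => A (cfg D ζ S)) :=
  fun _ _ hST _ h => hA (cfg_mono hST le_rfl) h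

lemma cle_cfg (π : ℤ) (D : Finset ℤ²) (h : ∀ z, z ∉ D → z ∈ ζ → z ∈ ζ') :
    CLe D (fun e S => cn π e (cfg D ζ S)) (fun e S => cn π e (cfg D ζ' S)) :=
  fun _ _ _ hST _ _ _ hc => hc.mono (fun z hz => by
    rw [mem_cfg] at *; have := @hST z; have := h z; tauto)

section
variable (hπ : π = 0 ∨ π = 1) (hx : 0 < x) (hq : 1 ≤ q)
include hπ hx hq

lemma pp_nonneg (A) : 0 ≤ PP π D ζ x q A := (Wt_isFK hπ D ζ hx hq).pr_nonneg _

lemma pp_le_one (A) : PP π D ζ x q A ≤ 1 := (Wt_isFK hπ D ζ hx hq).pr_le_one _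

lemma pp_mono (h : ∀ O, Agr D ζ O → A O → B O) : PP π D ζ x q A ≤ PP π D ζ x q B :=
  (Wt_isFK hπ D ζ hx hq).pr_mono fun _ hS => h _ (agr_cfg hS ζ)

lemma pp_one (h : ∀ O, Agr D ζ O → A O) : PP π D ζ x q A = 1 :=
  (Wt_isFK hπ D ζ hx hq).pr_of_forall fun _ hS => h _ (agr_cfg hS ζ)

lemma pp_not (A) : PP π D ζ x q (fun O => ¬ A O) = 1 - PP π D ζ x q A :=
  (Wt_isFK hπ D ζ hx hq).pr_not _

lemma pp_or_le (A B) : PP π D ζ x q (fun O => A O ∨ B O) ≤ PP π D ζ x q A + PP π D ζ x q B :=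
  (Wt_isFK hπ D ζ hx hq).pr_or_le _ _

lemma pp_and_ge (A B) :
    PP π D ζ x q A + PP π D ζ x q B - 1 ≤ PP π D ζ x q (fun O => A O ∧ B O) :=
  (Wt_isFK hπ D ζ hx hq).pr_and_ge _ _

lemma pp_exists_le {ι : Type*} (s : Finset ι) (A : ι → Set ℤ² → Prop) :
    PP π D ζ x q (fun O => ∃ i ∈ s, A i O) ≤ ∑ i ∈ s, PP π D ζ x q (A i) :=
  (Wt_isFK hπ D ζ hx hq).pr_exists_le s fun i S => A i (cfg D ζ S)

lemma pp_fkg (hA : Monotone A) (hB : Monotone B) :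
    PP π D ζ x q A * PP π D ζ x q B ≤ PP π D ζ x q (fun O => A O ∧ B O) :=
  (Wt_isFK hπ D ζ hx hq).pr_fkg hx hq (cle_cfg π D fun _ _ h => h) (incr_cfg D ζ hA)
    (incr_cfg D ζ hB)

lemma pp_dom (hxx : x ≤ x') (h : ∀ z, z ∉ D → z ∈ ζ → z ∈ ζ') (hA : Monotone A) :
    PP π D ζ x q A ≤ PP π D ζ' x' q A := by
  have h1 := (Wt_isFK hπ D ζ hx hq).pr_le (Wt_isFK hπ D ζ' (hx.trans_le hxx) hq) hx hxx hq
    (cle_cfg π D h) (incr_cfg D ζ hA)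
  refine h1.trans ((Wt_isFK hπ D ζ' (hx.trans_le hxx) hq).pr_mono fun S hS hAS => hA ?_ hAS)
  intro z hz
  rw [mem_cfg] at *
  have := h z; tauto

lemma pp_md_upper (hD : D' ⊆ D) (hxx : x ≤ x') (hA' : Monotone A') (hB : OffD D' B)
    (H : ∀ O, Agr D ζ O → B O → (A O → A' (glue D' ζ' O)) ∧
      ∀ e ∈ D', e ∉ O → cn π e O → cn π e (glue D' ζ' O)) :
    PP π D ζ x q (fun O => A O ∧ B O) ≤ PP π D' ζ' x' q A' * PP π D ζ x q B := by
  have h1 := Wt_isFK hπ D ζ hx hq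
  have h2 := Wt_isFK hπ D' ζ' (hx.trans_le hxx) hq
  have hsub : ∀ T ⊆ D \ D', ∀ S ⊆ D', S ∪ T ⊆ D := fun T hT S hS =>
    union_subset (hS.trans hD) (hT.trans sdiff_subset)
  have key := h1.md_upper hD h2 hx hxx hq (A := fun S => A (cfg D ζ S))
    (A' := fun S => A' (cfg D' ζ' S)) (B := fun T => B (cfg D ζ T)) (incr_cfg D' ζ' hA')
    (fun T hT hBT S hS hA => by
      have := (H _ (agr_cfg (hsub T hT S hS) ζ) (hB.cfg_union hS hBT)).1 hA
      rwa [glue_cfg hS hT _ _ hD] at this)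
    (fun T hT hBT S S' e hSS hS' he heS hc => by
      have hS := hSS.trans hS'
      have heO : e ∉ cfg D ζ (S ∪ T) := by
        rw [mem_cfg, mem_union]; have := @hT e; have := @hSS e; have := @hD e
        simp only [Finset.mem_sdiff] at *; tauto
      have := (H _ (agr_cfg (hsub T hT S hS) ζ) (hB.cfg_union hS hBT)).2 e he heO hc
      rw [glue_cfg hS hT _ _ hD] at this
      exact this.mono (cfg_mono hSS le_rfl))
  have e2 : PP π D ζ x q B = pr D (Wt π D ζ x q) (fun S => B (cfg D ζ (S \ D'))) :=
    IsFK.pr_congr fun _ _ => hB.cfg_sdiff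
  have e3 : PP π D ζ x q (fun O => A O ∧ B O) =
      pr D (Wt π D ζ x q) (fun S => A (cfg D ζ S) ∧ B (cfg D ζ (S \ D'))) :=
    IsFK.pr_congr fun S hS => by beta_reduce; rw [hB.cfg_sdiff]
  rw [e2, e3]; exact key

lemma pp_md_lower (hD : D' ⊆ D) (hxx : x ≤ x') (hA' : Monotone A') (hB : OffD D' B)
    (H : ∀ O, Agr D ζ O → B O → (A' (glue D' ζ' O) → A O) ∧
      ∀ e ∈ D', e ∉ O → cn π e (glue D' ζ' O) → cn π e O) :
    PP π D' ζ' x q A' * PP π D ζ x' q B ≤ PP π D ζ x' q (fun O => A O ∧ B O) := by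
  have h1 := Wt_isFK hπ D ζ (hx.trans_le hxx) hq
  have h2 := Wt_isFK hπ D' ζ' hx hq
  have hsub : ∀ T ⊆ D \ D', ∀ S ⊆ D', S ∪ T ⊆ D := fun T hT S hS =>
    union_subset (hS.trans hD) (hT.trans sdiff_subset)
  have key := h1.md_lower hD h2 hx hxx hq (A := fun S => A (cfg D ζ S))
    (A' := fun S => A' (cfg D' ζ' S)) (B := fun T => B (cfg D ζ T)) (incr_cfg D' ζ' hA')
    (fun T hT hBT S hS hA => by
      refine (H _ (agr_cfg (hsub T hT S hS) ζ) (hB.cfg_union hS hBT)).1 ?_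
      rwa [glue_cfg hS hT _ _ hD])
    (fun T hT hBT S S' e hSS hS' he heS hc => by
      have heO : e ∉ cfg D ζ (S' ∪ T) := by
        rw [mem_cfg, mem_union]; have := @hT e; have := @hD e
        simp only [Finset.mem_sdiff] at *; tauto
      refine (H _ (agr_cfg (hsub T hT S' hS') ζ) (hB.cfg_union hS' hBT)).2 e he heO ?_
      rw [glue_cfg hS' hT _ _ hD]
      exact hc.mono (cfg_mono hSS le_rfl))
  have e2 : PP π D ζ x' q B = pr D (Wt π D ζ x' q) (fun S => B (cfg D ζ (S \ D'))) :=
    IsFK.pr_congr fun _ _ => hB.cfg_sdiff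
  have e3 : PP π D ζ x' q (fun O => A O ∧ B O) =
      pr D (Wt π D ζ x' q) (fun S => A (cfg D ζ S) ∧ B (cfg D ζ (S \ D'))) :=
    IsFK.pr_congr fun S hS => by beta_reduce; rw [hB.cfg_sdiff]
  rw [e2, e3]; exact key

/-- Shrinking the domain while opening everything outside increases the measure. -/
lemma pp_shrink (hD : D' ⊆ D) (hxx : x ≤ x') (hA : Monotone A)
    (h : ∀ z, z ∉ D' → (z ∈ D ∨ z ∈ ζ) → z ∈ ζ') :
    PP π D ζ x q A ≤ PP π D' ζ' x' q A := by
  have := pp_md_upper (π := π) (D := D) (D' := D') (ζ := ζ) (ζ' := ζ') (A := A) (A' := A)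
    (B := fun _ => True) hπ hx hq hD hxx hA (fun _ _ _ _ => trivial) (fun O hO _ => by
      have hsub : O ⊆ glue D' ζ' O := by
        intro z hz; rw [mem_glue]; have := hO z; have := h z; tauto
      exact ⟨fun hAO => hA hsub hAO, fun e _ _ hc => hc.mono hsub⟩)
  rw [pp_one (π := π) (D := D) (ζ := ζ) (A := fun _ => True) hπ hx hq (fun _ _ => trivial),
    mul_one] at this
  simpa using this

/-- Enlarging the domain, starting from a smaller configuration outside. -/
lemma pp_enlarge (hD : D ⊆ D') (hxx : x ≤ x') (hA : Monotone A)
    (h : ∀ z, z ∉ D → z ∈ ζ → z ∈ ζ' ∧ z ∉ D') :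
    PP π D ζ x q A ≤ PP π D' ζ' x' q A := by
  have := pp_md_lower (π := π) (D := D') (D' := D) (ζ := ζ') (ζ' := ζ) (A := A) (A' := A)
    (B := fun _ => True) hπ hx hq hD hxx hA (fun _ _ _ _ => trivial) (fun O hO _ => by
      have hsub : glue D ζ O ⊆ O := by
        intro z hz; rw [mem_glue] at hz; have := hO z; have := h z; tauto
      exact ⟨fun hAO => hA hsub hAO, fun e _ _ hc => hc.mono hsub⟩)
  rw [pp_one (π := π) (D := D') (ζ := ζ') (A := fun _ => True) hπ (hx.trans_le hxx) hq
    (fun _ _ => trivial), mul_one] at this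
  simpa using this

lemma pp_open_cells {b : Finset ℤ²} (hb : b ⊆ D) (hA : OffD b A) :
    PP π D ζ x q A ≤ (2 * max 1 (q / x)) ^ b.card *
      PP π D ζ x q (fun O => A O ∧ ∀ z ∈ b, z ∈ O) := by
  have key := (Wt_isFK hπ D ζ hx hq).finite_energy_open hx hq hb (fun S => A (cfg D ζ S))
  refine le_trans (le_of_eq (IsFK.pr_congr fun _ _ => hA.cfg_sdiff)) (key.trans (le_of_eq ?_))
  congr 1
  refine IsFK.pr_congr fun S hS => ?_
  beta_reduce
  rw [hA.cfg_sdiff (S := S)]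
  refine and_congr_right fun _ => ⟨fun h z hz => mem_cfg.2 (Or.inl (h hz)), fun h z hz => ?_⟩
  have := mem_cfg.1 (h z hz); have := @hb z; tauto

lemma pp_close_cells {b : Finset ℤ²} (hb : b ⊆ D) (hA : OffD b A) :
    PP π D ζ x q A ≤ (2 * max 1 x) ^ b.card *
      PP π D ζ x q (fun O => A O ∧ ∀ z ∈ b, z ∉ O) := by
  have key := (Wt_isFK hπ D ζ hx hq).finite_energy_closed hx hq hb (fun S => A (cfg D ζ S))
  refine le_trans (le_of_eq (IsFK.pr_congr fun _ _ => hA.cfg_sdiff)) (key.trans (le_of_eq ?_))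
  congr 1
  refine IsFK.pr_congr fun S hS => ?_
  beta_reduce
  rw [hA.cfg_sdiff (S := S), disjoint_right]
  refine and_congr_right fun _ => forall_congr' fun z => forall_congr' fun hz => ?_
  rw [mem_cfg]; have := @hb z; tauto

end

lemma pp_congr (h : ∀ O, Agr D ζ O → (A O ↔ B O)) : PP π D ζ x q A = PP π D ζ x q B :=
  IsFK.pr_congr fun _ hS => h _ (agr_cfg hS ζ)

lemma pp_congr_env (h : Agr D ζ ζ') : PP π D ζ x q A = PP π D ζ' x q A := by
  have : ∀ S, cfg D ζ S = cfg D ζ' S := fun S => by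
    ext z; rw [mem_cfg, mem_cfg]; have := h z; tauto
  have hW : Wt π D ζ x q = Wt π D ζ' x q := by funext S; unfold Wt; rw [this]
  unfold PP; rw [hW]; simp only [this]

section
variable {E E' : Type*} [DecidableEq E] [DecidableEq E'] {D : Finset E} {x q : ℝ} {c : E → Finset E → Prop} {W : Finset E → ℝ}

lemma IsFK.dual (h : IsFK D x q c W) (hx : 0 < x) (hq : 1 ≤ q) :
    IsFK D (q / x) q (fun e S => ¬ c e (D \ insert e S)) (fun S => W (D \ S)) := by
  refine ⟨fun S _ => h.pos _ sdiff_subset, fun S hS e he heS => ?_⟩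
  have e1 : D \ S = insert e (D \ insert e S) := by
    ext z; simp only [Finset.mem_sdiff, mem_insert]
    by_cases hz : z = e
    · subst hz; tauto
    · tauto
  have := h.step (D \ insert e S) sdiff_subset e he (by simp)
  rw [e1, this]
  have hq0 : 0 < q := by linarith
  by_cases hc : c e (D \ insert e S)
  · simp only [hc, not_true_eq_false, if_true, if_false]; field_simp
  · simp only [hc, not_false_eq_true, if_true, if_false]; field_simp

lemma pr_dual (D : Finset E) (W : Finset E → ℝ) (A : Finset E → Prop) :
    pr D (fun S => W (D \ S)) (fun S => A (D \ S)) = pr D W A := by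
  have key : ∀ f : Finset E → ℝ, ∑ S ∈ D.powerset, f (D \ S) = ∑ S ∈ D.powerset, f S := by
    intro f
    refine sum_nbij' (fun S => D \ S) (fun S => D \ S) ?_ ?_ ?_ ?_ (fun _ _ => rfl)
    · intro S _; exact mem_powerset.2 sdiff_subset
    · intro S _; exact mem_powerset.2 sdiff_subset
    · intro S hS; exact Finset.sdiff_sdiff_eq_self (mem_powerset.1 hS)
    · intro S hS; exact Finset.sdiff_sdiff_eq_self (mem_powerset.1 hS)
  unfold pr ex ind
  rw [key W, ← key (fun S => W S * if A S then 1 else 0)]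

lemma IsFK.comap {D : Finset E} {D' : Finset E'} {c : E' → Finset E' → Prop}
    {W : Finset E' → ℝ} (h : IsFK D' x q c W) (f : E ↪ E') (hD : D.map f = D') :
    IsFK D x q (fun e S => c (f e) (S.map f)) (fun S => W (S.map f)) := by
  subst hD
  refine ⟨fun S hS => h.pos _ (map_subset_map.2 hS), fun S hS e he heS => ?_⟩
  rw [map_insert]
  exact h.step _ (map_subset_map.2 hS) _ (mem_map_of_mem _ he)
    (fun hh => heS ((Finset.mem_map' f).1 hh))

lemma pr_comap {D : Finset E} {D' : Finset E'} (f : E ↪ E') (hD : D.map f = D')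
    (W : Finset E' → ℝ) (A : Finset E' → Prop) :
    pr D (fun S => W (S.map f)) (fun S => A (S.map f)) = pr D' W A := by
  subst hD
  have key : ∀ g : Finset E' → ℝ,
      ∑ S ∈ D.powerset, g (S.map f) = ∑ S ∈ (D.map f).powerset, g S := by
    intro g
    refine sum_bij (fun S _ => S.map f) ?_ ?_ ?_ (fun _ _ => rfl)
    · intro S hS; exact mem_powerset.2 (map_subset_map.2 (mem_powerset.1 hS))
    · intro S _ S' _ h; exact Finset.map_injective f h
    · intro T hT
      obtain ⟨u, hu, rfl⟩ := subset_map_iff.1 (mem_powerset.1 hT)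
      exact ⟨u, mem_powerset.2 hu, rfl⟩
  unfold pr ex ind
  rw [key W, ← key (fun S => W S * if A S then 1 else 0)]

end

/-- A symmetry of the plane acting on cells and lattice points. -/
structure PSym where
  cell : ℤ² ≃ ℤ²
  pt : ℤ² ≃ ℤ²
  sh : ℤ
  lnk : ∀ z a b, Lnk (cell z) (pt a) (pt b) ↔ Lnk z a b
  par_pt : ∀ a, par (pt a) = (par a + sh) % 2

namespace PSym

lemma conn_image (σ : PSym) {O : Set ℤ²} {a b : ℤ²} :
    Conn (σ.cell '' O) (σ.pt a) (σ.pt b) ↔ Conn O a b := by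
  constructor
  · intro h
    have := h.map (O' := O) σ.pt.symm (by
      rintro _ ⟨z, hz, rfl⟩ a b hl -
      refine Conn.of_lnk hz ((σ.lnk _ _ _).1 ?_)
      simpa using hl)
    simpa using this
  · intro h
    exact h.map σ.pt fun z hz a b hl _ => Conn.of_lnk ⟨z, hz, rfl⟩ ((σ.lnk _ _ _).2 hl)

lemma cn_image (σ : PSym) {π : ℤ} (hπ : π = 0 ∨ π = 1) {O : Set ℤ²} {z : ℤ²} :
    cn ((π + σ.sh) % 2) (σ.cell z) (σ.cell '' O) ↔ cn π z O := by
  have h1 := (σ.lnk z _ _).2 (lnk_pu_pv π z)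
  have h2 : par (σ.pt (pu π z)) = (π + σ.sh) % 2 := by rw [σ.par_pt, par_pu hπ]
  unfold cn
  rw [← σ.conn_image (O := O)]
  rcases h1.eq_or h2 with ⟨h, h'⟩ | ⟨h, h'⟩
  · rw [h, h']
  · rw [h, h']; exact ⟨Conn.symm, Conn.symm⟩

lemma pp (σ : PSym) {π π' : ℤ} (hπ : π = 0 ∨ π = 1) (hπ' : π' = (π + σ.sh) % 2)
    {D D' : Finset ℤ²} {ζ ζ' : Set ℤ²} {x q : ℝ} (hx : 0 < x) (hq : 1 ≤ q)
    (hD : ∀ z, σ.cell z ∈ D' ↔ z ∈ D) (hζ : ∀ z, z ∉ D → (σ.cell z ∈ ζ' ↔ z ∈ ζ))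
    (A : Set ℤ² → Prop) :
    PP π' D' ζ' x q A = PP π D ζ x q (fun O => A (σ.cell '' O)) := by
  have hDm : D.map σ.cell.toEmbedding = D' := by
    ext z
    rw [Finset.mem_map]
    constructor
    · rintro ⟨y, hy, rfl⟩; exact (hD y).2 hy
    · intro hz
      exact ⟨σ.cell.symm z, (hD _).1 (by simpa using hz), by simp⟩
  have hcfg : ∀ S, S ⊆ D → cfg D' ζ' (S.map σ.cell.toEmbedding) = σ.cell '' cfg D ζ S := by
    intro S hS
    ext z
    obtain ⟨y, rfl⟩ := σ.cell.surjective z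
    rw [mem_cfg, hD, σ.cell.injective.mem_set_image, mem_cfg,
      ← Equiv.coe_toEmbedding, Finset.mem_map', Equiv.coe_toEmbedding]
    have := hζ y; tauto
  have hπ2 : π' = 0 ∨ π' = 1 := by omega
  have h1 := (Wt_isFK hπ2 D' ζ' hx hq).comap σ.cell.toEmbedding hDm
  have h2 := (Wt_isFK hπ D ζ hx hq)
  have h3 := h1.congr_c (c' := fun e S => cn π e (cfg D ζ S)) (fun S hS e _ _ => by
    rw [hcfg S hS, hπ', Equiv.coe_toEmbedding, σ.cn_image hπ])
  unfold PP
  rw [← pr_comap σ.cell.toEmbedding hDm, h3.pr_unique h2]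
  refine IsFK.pr_congr fun S hS => ?_
  rw [hcfg S hS]

/-- Translation by `t`. -/
def shift (t : ℤ²) : PSym where
  cell := Equiv.addRight t
  pt := Equiv.addRight t
  sh := par t
  lnk z a b := by simp [Lnk]; omega
  par_pt a := by simp [par]; omega

/-- The reflection `(x, y) ↦ (c - x, y)`. -/
def reflX (c : ℤ) : PSym where
  cell := ⟨fun z => (c - 1 - z.1, z.2), fun z => (c - 1 - z.1, z.2), fun z => by simp,
    fun z => by simp⟩
  pt := ⟨fun z => (c - z.1, z.2), fun z => (c - z.1, z.2), fun z => by simp, fun z => by simp⟩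
  sh := c % 2
  lnk z a b := by simp only [Lnk, Equiv.coe_fn_mk]; omega
  par_pt a := by simp only [par, Equiv.coe_fn_mk]; omega

/-- The reflection `(x, y) ↦ (x, c - y)`. -/
def reflY (c : ℤ) : PSym where
  cell := ⟨fun z => (z.1, c - 1 - z.2), fun z => (z.1, c - 1 - z.2), fun z => by simp,
    fun z => by simp⟩
  pt := ⟨fun z => (z.1, c - z.2), fun z => (z.1, c - z.2), fun z => by simp, fun z => by simp⟩
  sh := c % 2
  lnk z a b := by simp only [Lnk, Equiv.coe_fn_mk]; omega
  par_pt a := by simp only [par, Equiv.coe_fn_mk]; omega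

/-- The reflection exchanging the coordinates. -/
def swap : PSym where
  cell := Equiv.prodComm ℤ ℤ
  pt := Equiv.prodComm ℤ ℤ
  sh := 0
  lnk z a b := by simp only [Lnk, Equiv.prodComm_apply, Prod.fst_swap, Prod.snd_swap]; tauto
  par_pt a := by simp only [par, Equiv.prodComm_apply, Prod.fst_swap, Prod.snd_swap]; omega

@[simp] lemma shift_cell (t z : ℤ²) : (shift t).cell z = z + t := rfl
@[simp] lemma shift_pt (t z : ℤ²) : (shift t).pt z = z + t := rfl
@[simp] lemma reflX_cell (c : ℤ) (z : ℤ²) : (reflX c).cell z = (c - 1 - z.1, z.2) := rfl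
@[simp] lemma reflX_pt (c : ℤ) (z : ℤ²) : (reflX c).pt z = (c - z.1, z.2) := rfl
@[simp] lemma reflY_cell (c : ℤ) (z : ℤ²) : (reflY c).cell z = (z.1, c - 1 - z.2) := rfl
@[simp] lemma reflY_pt (c : ℤ) (z : ℤ²) : (reflY c).pt z = (z.1, c - z.2) := rfl
@[simp] lemma swap_cell (z : ℤ²) : swap.cell z = (z.2, z.1) := rfl
@[simp] lemma swap_pt (z : ℤ²) : swap.pt z = (z.2, z.1) := rfl

end PSym
/-- Points of the same parity in a rectangle are connected by its cells. -/
lemma conn_row {O : Set ℤ²} {y a b : ℤ} (h : ∀ x, a ≤ x → x < b → (x, y) ∈ O)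
    {u v : ℤ²} (hu1 : a ≤ u.1) (hu : u.1 ≤ b) (hu2 : u.2 = y ∨ u.2 = y + 1)
    (hv1 : a ≤ v.1) (hv : v.1 ≤ b)
    (hv2 : v.2 = y ∨ v.2 = y + 1) (hpar : par u = par v) : Conn O u v := by
  have key : ∀ n : ℕ, ∀ u v : ℤ², a ≤ u.1 → v.1 ≤ b → (u.2 = y ∨ u.2 = y + 1) →
      (v.2 = y ∨ v.2 = y + 1) → par u = par v → v.1 = u.1 + n → Conn O u v := by
    intro n
    induction n with
    | zero =>
      intro u v _ _ hu2 hv2 hp hn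
      have : u = v := by
        unfold par at hp
        apply Prod.ext <;> omega
      rw [this]; exact Conn.refl _ _
    | succ n ih =>
      intro u v h1 h2 hu2 hv2 hp hn
      push_cast at hn
      let w : ℤ² := (v.1 - 1, 2 * y + 1 - v.2)
      have hl : Lnk (v.1 - 1, y) w v := by
        refine ⟨Or.inl ⟨rfl, (sub_add_cancel _ _).symm⟩, ?_⟩
        show 2 * y + 1 - v.2 = y ∧ v.2 = y + 1 ∨ v.2 = y ∧ 2 * y + 1 - v.2 = y + 1
        omega
      refine (ih u w h1 ?_ hu2 ?_ ?_ ?_).trans (Conn.of_lnk (h _ ?_ ?_) hl)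
      · simp only [w]; omega
      · simp only [w]; omega
      · rw [hp, hl.par_eq]
      · simp only [w]; omega
      · omega
      · omega
  rcases le_total u.1 v.1 with h' | h'
  · exact key (v.1 - u.1).toNat u v hu1 hv hu2 hv2 hpar (by omega)
  · exact (key (u.1 - v.1).toNat v u hv1 hu hv2 hu2 hpar.symm (by omega)).symm

lemma conn_rect {O : Set ℤ²} {a b c d : ℤ} (hab : a < b)
    (h : ∀ x y, a ≤ x → x < b → c ≤ y → y < d → (x, y) ∈ O)
    {u v : ℤ²} (hu1 : a ≤ u.1) (hu2 : u.1 ≤ b) (hu3 : c ≤ u.2) (hu4 : u.2 ≤ d)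
    (hv1 : a ≤ v.1) (hv2 : v.1 ≤ b) (hv3 : c ≤ v.2) (hv4 : v.2 ≤ d)
    (hcd : c < d) (hpar : par u = par v) : Conn O u v := by
  have key : ∀ n : ℕ, ∀ u v : ℤ², a ≤ u.1 → u.1 ≤ b → c ≤ u.2 → a ≤ v.1 → v.1 ≤ b →
      v.2 ≤ d → par u = par v → v.2 = u.2 + n + 1 → Conn O u v := by
    intro n
    induction n with
    | zero =>
      intro u v h1 h2 h3 h4 h5 h6 hp hn
      exact conn_row (y := u.2) (fun x hx hx' => h x _ hx hx' (by omega) (by push_cast at hn; omega))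
        h1 h2 (Or.inl rfl) h4 h5 (Or.inr (by push_cast at hn; omega)) hp
    | succ n ih =>
      intro u v h1 h2 h3 h4 h5 h6 hp hn
      push_cast at hn
      obtain ⟨w, hw1, hw2, hw3, hw4⟩ : ∃ w : ℤ², a ≤ w.1 ∧ w.1 ≤ b ∧ w.2 = v.2 - 1 ∧
          par w = par v := by
        by_cases hpa : par (a, v.2 - 1) = par v
        · exact ⟨_, le_rfl, hab.le, rfl, hpa⟩
        · refine ⟨(a + 1, v.2 - 1), by simp, hab, rfl, ?_⟩
          unfold par at *; simp only at *; omega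
      refine (ih u w h1 h2 h3 hw1 hw2 (by omega) (hp.trans hw4.symm) (by omega)).trans ?_
      exact conn_row (y := w.2) (fun x hx hx' => h x _ hx hx' (by omega) (by omega))
        hw1 hw2 (Or.inl rfl) h4 h5 (Or.inr (by omega)) hw4
  rcases lt_trichotomy u.2 v.2 with h' | h' | h'
  · exact key (v.2 - u.2 - 1).toNat u v hu1 hu2 hu3 hv1 hv2 hv4 hpar (by omega)
  · by_cases hd : u.2 = d
    · exact conn_row (y := u.2 - 1) (fun x hx hx' => h x _ hx hx' (by omega) (by omega))
        hu1 hu2 (Or.inr (by omega)) hv1 hv2 (Or.inr (by omega)) hpar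
    · exact conn_row (y := u.2) (fun x hx hx' => h x _ hx hx' (by omega) (by omega))
        hu1 hu2 (Or.inl (by omega)) hv1 hv2 (Or.inl (by omega)) hpar
  · exact (key (u.2 - v.2 - 1).toNat v u hv1 hv2 hv3 hu1 hu2 hu4 hpar.symm (by omega)).symm

/-- The boundary of a set of cells, seen as diagonals, modulo two. -/
def bd (c : ℤ² → ZMod 2) (y : ℤ²) : ZMod 2 :=
  c (y.1 - 1, y.2 - 1) + c (y.1, y.2 - 1) + c (y.1 - 1, y.2) + c (y.1, y.2)

/-- The indicator of a cell. -/
def one (z : ℤ²) (y : ℤ²) : ZMod 2 := if y = z then 1 else 0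

lemma zmod_two_cases (a : ZMod 2) : a = 0 ∨ a = 1 := by revert a; decide

lemma bd_add (c c' : ℤ² → ZMod 2) (y : ℤ²) :
    bd (fun z => c z + c' z) y = bd c y + bd c' y := by unfold bd; ring

lemma bd_one {π : ℤ} (z y : ℤ²) (hy : par y = π) :
    bd (one z) y = one (pu π z) y + one (pv π z) y := by
  obtain ⟨z1, z2⟩ := z; obtain ⟨y1, y2⟩ := y
  simp only [bd, one, pu, pv, par, Prod.mk.injEq] at *
  by_cases h1 : y1 = z1
  · by_cases h2 : y2 = z2
    · subst h1; subst h2; simp [hy]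
    · by_cases h3 : y2 = z2 + 1
      · subst h1; subst h3
        have : ¬ ((y1 + z2) % 2 = π) := by omega
        simp [this]
      · have : ¬ (y2 - 1 = z2) := by omega
        split_ifs <;> simp_all
  · by_cases h1' : y1 = z1 + 1
    · subst h1'
      by_cases h2 : y2 = z2
      · subst h2
        have : ¬ ((z1 + y2) % 2 = π) := by omega
        simp [this]
      · by_cases h3 : y2 = z2 + 1
        · subst h3
          have : (z1 + z2) % 2 = π := by omega
          simp [this]
        · have : ¬ (y2 - 1 = z2) := by omega
          split_ifs <;> simp_all
    · have : ¬ (y1 - 1 = z1) := by omega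
      split_ifs <;> simp_all

lemma exists_primitive (f : ℤ → ZMod 2) : ∃ G : ℤ → ZMod 2, G 0 = 0 ∧ ∀ n, G n + G (n + 1) = f n := by
  refine ⟨fun n => ∑ i ∈ Ico 0 n, f i + ∑ i ∈ Ico n 0, f i, by simp, fun n => ?_⟩
  rcases le_or_gt 0 n with h | h
  · have e : Ico 0 (n + 1) = insert n (Ico 0 n) := by
      ext i; simp only [mem_Ico, mem_insert]; omega
    beta_reduce
    rw [e, sum_insert (by simp), Ico_eq_empty (a := n) (b := 0) (by omega),
      Ico_eq_empty (a := n + 1) (b := 0) (by omega)]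
    generalize ∑ i ∈ Ico 0 n, f i = s
    generalize f n = t
    simp only [sum_empty]
    revert s t; decide
  · have e : Ico n 0 = insert n (Ico (n + 1) 0) := by
      ext i; simp only [mem_Ico, mem_insert]; omega
    beta_reduce
    rw [e, sum_insert (by simp), Ico_eq_empty (a := 0) (b := n) (by omega),
      Ico_eq_empty (a := 0) (b := n + 1) (by omega)]
    generalize ∑ i ∈ Ico (n + 1) 0, f i = s
    generalize f n = t
    simp only [sum_empty]
    revert s t; decide

/-- Cycles of odd diagonals are coboundaries of functions on even points. -/
lemma poincare {c : ℤ² → ZMod 2} (hc : ∀ y, par y = 1 → bd c y = 0) :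
    ∃ s : ℤ² → ZMod 2, ∀ z a b, Lnk z a b → par a = 0 → s a + s b = c z := by
  obtain ⟨H, -, hH⟩ := exists_primitive (fun a => c (a, a))
  choose G hG0 hG using fun a : ℤ => exists_primitive (fun b => c (a - b - 1, a + b))
  have key : ∀ a b : ℤ, G a b + G (a + 1) b = c (a, a) + c (a - b, a + b) := by
    have step : ∀ a b : ℤ, c (a - b - 1, a + b) + c (a - b, a + b) +
        c (a - b - 1, a + b + 1) + c (a - b, a + b + 1) = 0 := by
      intro a b
      have := hc (a - b, a + b + 1) (by unfold par; simp only; omega)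
      simpa [bd] using this
    intro a b
    have hs := step a
    induction b using Int.induction_on with
    | zero =>
      simp only [hG0, sub_zero, add_zero]
      generalize c (a, a) = t
      revert t; decide
    | succ i ih =>
      have h1 := hG a i; have h2 := hG (a + 1) i; have h3 := hs i
      rw [show a + 1 - (i : ℤ) - 1 = a - i by ring, show a + 1 + (i : ℤ) = a + i + 1 by ring] at h2
      rw [show a - ((i : ℤ) + 1) = a - i - 1 by ring, show a + ((i : ℤ) + 1) = a + i + 1 by ring]
      have h : ∀ z : ZMod 2, z + z = 0 := by decide
      linear_combination ih + h1 + h2 + h3 - h (c (a - i - 1, a + i + 1)) - h (G a i) -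
        h (G (a + 1) i)
    | pred i ih =>
      set j : ℤ := -(i : ℤ) - 1 with hj
      have hji : -(i : ℤ) = j + 1 := by omega
      have h1 := hG a j; have h2 := hG (a + 1) j; have h3 := hs j
      rw [show a + 1 - j - 1 = a - j by ring, show a + 1 + j = a + j + 1 by ring] at h2
      rw [hji, show a - (j + 1) = a - j - 1 by ring, show a + (j + 1) = a + j + 1 by ring] at ih
      have h : ∀ z : ZMod 2, z + z = 0 := by decide
      linear_combination ih + h1 + h2 + h3 - h (c (a - j, a + j)) - h (G a (j + 1)) -
        h (G (a + 1) (j + 1))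
  refine ⟨fun p => H ((p.1 + p.2) / 2) + G ((p.1 + p.2) / 2) ((p.2 - p.1) / 2), ?_⟩
  have main : ∀ z : ℤ², (fun p : ℤ² => H ((p.1 + p.2) / 2) +
      G ((p.1 + p.2) / 2) ((p.2 - p.1) / 2)) (pu 0 z) +
      (fun p : ℤ² => H ((p.1 + p.2) / 2) + G ((p.1 + p.2) / 2) ((p.2 - p.1) / 2)) (pv 0 z) =
        c z := by
    rintro ⟨z1, z2⟩
    have h : ∀ z : ZMod 2, z + z = 0 := by decide
    by_cases hz : (z1 + z2) % 2 = 0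
    · obtain ⟨a, b, rfl, rfl⟩ : ∃ a b : ℤ, z1 = a - b ∧ z2 = a + b :=
        ⟨(z1 + z2) / 2, (z2 - z1) / 2, by omega, by omega⟩
      have e1 : (a - b + (a + b)) / 2 = a := by omega
      have e2 : (a + b - (a - b)) / 2 = b := by omega
      have e3 : (a - b + 1 + (a + b + 1)) / 2 = a + 1 := by omega
      have e4 : (a + b + 1 - (a - b + 1)) / 2 = b := by omega
      simp only [pu, pv, par, hz, if_true, e1, e2, e3, e4]
      linear_combination hH a + key a b + h (c (a, a))
    · obtain ⟨a, b, rfl, rfl⟩ : ∃ a b : ℤ, z1 = a - b - 1 ∧ z2 = a + b :=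
        ⟨(z1 + z2 + 1) / 2, (z2 - z1 - 1) / 2, by omega, by omega⟩
      have e1 : (a - b - 1 + (a + b + 1)) / 2 = a := by omega
      have e2 : (a + b + 1 - (a - b - 1)) / 2 = b + 1 := by omega
      have e3 : (a - b - 1 + 1 + (a + b)) / 2 = a := by omega
      have e4 : (a + b - (a - b - 1 + 1)) / 2 = b := by omega
      simp only [pu, pv, par, hz, if_false, e1, e2, e3, e4]
      linear_combination hG a b + h (H a)
  intro z a b hl ha
  rcases hl.eq_or ha with ⟨rfl, rfl⟩ | ⟨rfl, rfl⟩
  · exact main z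
  · rw [add_comm]; exact main z

/-- A path yields a chain bounding its endpoints. -/
lemma Conn.exists_chain {P : Set ℤ²} {w w' : ℤ²} {π : ℤ} (hw : par w = π)
    (h : Conn P w w') : ∃ c : ℤ² → ZMod 2, (∀ z, c z ≠ 0 → z ∈ P) ∧
      ∀ y, par y = π → bd c y = one w y + one w' y := by
  induction h with
  | refl =>
    refine ⟨fun _ => 0, fun _ h => absurd rfl h, fun y _ => ?_⟩
    have h : ∀ z : ZMod 2, z + z = 0 := by decide
    rw [h]; simp [bd]
  | @tail a b hab hs ih =>
    obtain ⟨c, hc1, hc2⟩ := ih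
    obtain ⟨z, hz, hl⟩ := hs
    have h : ∀ z : ZMod 2, z + z = 0 := by decide
    have ha : par a = π := (Conn.par_eq hab).symm.trans hw
    refine ⟨fun y => c y + one z y, fun y hy => ?_, fun y hy => ?_⟩
    · by_cases hyz : y = z
      · exact hyz ▸ hz
      · refine hc1 y fun h0 => hy ?_
        simp [h0, one, hyz]
    · rw [bd_add, hc2 y hy, bd_one z y hy]
      rcases hl.eq_or ha with ⟨rfl, rfl⟩ | ⟨rfl, rfl⟩
      · linear_combination h (one (pu π z) y)
      · linear_combination h (one (pv π z) y)

lemma const_of_conn {s : ℤ² → ZMod 2} {c : ℤ² → ZMod 2} {O : Set ℤ²} {π : ℤ}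
    (hs : ∀ z a b, Lnk z a b → par a = π → s a + s b = c z) (hO : ∀ z ∈ O, c z = 0)
    {a b : ℤ²} (ha : par a = π) (h : Conn O a b) : s a = s b := by
  induction h with
  | refl => rfl
  | @tail b d hab hst ih =>
    obtain ⟨z, hz, hl⟩ := hst
    have := hs z b d hl ((Conn.par_eq hab).symm.trans ha)
    rw [hO z hz] at this
    rw [ih]; revert this; generalize s b = t, s d = r; revert t r; decide

/-- A primal and a dual connection between the corners of a cell cannot coexist. -/
lemma not_conn_and_dual {O : Set ℤ²} {e : ℤ²} (he : e ∉ O) (h0 : cn 0 e O)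
    (h1 : cn 1 e (insert e O)ᶜ) : False := by
  obtain ⟨c, hc1, hc2⟩ := h1.exists_chain (par_pu (Or.inr rfl) e)
  have h : ∀ z : ZMod 2, z + z = 0 := by decide
  obtain ⟨s, hs⟩ := poincare (c := fun y => c y + one e y) (fun y hy => by
    rw [bd_add, hc2 y hy, bd_one e y hy, h])
  have hce : c e = 0 := by
    by_contra hne; exact hc1 e hne (Set.mem_insert _ _)
  have := const_of_conn (O := O) hs (fun z hz => by
    have h1 : c z = 0 := by
      by_contra hne; exact hc1 z hne (Set.mem_insert_of_mem _ hz)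
    have h2 : z ≠ e := fun hh => he (hh ▸ hz)
    simp [h1, one, h2]) (par_pu (Or.inl rfl) e) h0
  have h3 := hs e _ _ (lnk_pu_pv 0 e) (par_pu (Or.inl rfl) e)
  rw [this, h] at h3
  simp [hce, one] at h3

lemma sum_bd_eq_zero {π : ℤ} (F : Finset ℤ²) (g : ℤ² → ZMod 2)
    (hg : ∀ z ∈ F, g (pu π z) = g (pv π z)) (Y : Finset ℤ²) (hY : ∀ y ∈ Y, par y = π)
    (hFY : ∀ z ∈ F, pu π z ∈ Y ∧ pv π z ∈ Y) :
    ∑ y ∈ Y, g y * bd (fun z => if z ∈ F then 1 else 0) y = 0 := by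
  induction F using Finset.induction_on with
  | empty => simp [bd]
  | insert z F hz ih =>
    have e : (fun y => if y ∈ insert z F then (1 : ZMod 2) else 0) =
        fun y => one z y + if y ∈ F then 1 else 0 := by
      funext y
      by_cases hy : y = z
      · subst hy; simp [one, hz]
      · simp [one, hy]
    have ih := ih (fun y hy => hg y (mem_insert_of_mem hy))
      (fun y hy => hFY y (mem_insert_of_mem hy))
    rw [e]
    simp only [bd_add, mul_add, sum_add_distrib]
    rw [ih, add_zero]
    have h1 := hFY z (mem_insert_self _ _)
    rw [sum_congr rfl (fun y hy => by rw [bd_one z y (hY y hy)])]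
    simp only [mul_add, sum_add_distrib, one, mul_ite, mul_one, mul_zero,
      sum_ite_eq', h1, if_true]
    rw [hg z (mem_insert_self _ _)]
    exact CharTwo.add_self_eq_zero _

/-- If the dual cluster of a dual end of `e` is finite and does not contain the other end, then
the primal ends of `e` are connected around it. -/
lemma conn_of_finite_dual {O : Set ℤ²} {e f f' : ℤ²} (hl : Lnk e f f')
    (hf : par f = 1) (hfin : {w | Conn (insert e O)ᶜ f w}.Finite)
    (hn : ¬ Conn (insert e O)ᶜ f f') : cn 0 e O := by
  by_contra hcon
  set K := {w | Conn (insert e O)ᶜ f w} with hK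
  have h : ∀ z : ZMod 2, z + z = 0 := by decide
  have hf'K : f' ∉ K := hn
  have hfK : f ∈ K := Conn.refl _ _
  let k : ℤ² → ZMod 2 := fun w => if w ∈ K then 1 else 0
  let c : ℤ² → ZMod 2 := fun z => k (pu 1 z) + k (pv 1 z)
  have hce : c e = 1 := by
    rcases hl.eq_or hf with ⟨h1, h2⟩ | ⟨h1, h2⟩
    · simp only [c, k, ← h1, ← h2, hfK, hf'K, if_true, if_false]; rfl
    · simp only [c, k, ← h1, ← h2, hfK, hf'K, if_true, if_false]; rfl
  have hcO : ∀ z, c z ≠ 0 → z = e ∨ z ∈ O := by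
    intro z hz
    by_contra hne
    have hzc : z ∈ (insert e O)ᶜ := by simpa [not_or] using hne
    have hiff : pu 1 z ∈ K ↔ pv 1 z ∈ K :=
      ⟨fun hh => Conn.trans hh (Conn.of_lnk hzc (lnk_pu_pv 1 z)),
        fun hh => Conn.trans hh (Conn.of_lnk hzc (lnk_pu_pv 1 z).symm)⟩
    apply hz
    simp only [c, k, hiff]; exact h _
  have hbdc : ∀ y, par y = 0 → bd c y = 0 := by
    rintro ⟨y1, y2⟩ hy
    have hkpar : ∀ z : ℤ², c z = if par z = 1 then k z + k (z.1 + 1, z.2 + 1)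
        else k (z.1, z.2 + 1) + k (z.1 + 1, z.2) := by
      intro z; simp only [c, pu, pv]; split_ifs <;> rfl
    unfold par at hy; simp only at hy
    have p1 : par (y1 - 1, y2 - 1) ≠ 1 := by unfold par; simp only; omega
    have p2 : par (y1, y2 - 1) = 1 := by unfold par; simp only; omega
    have p3 : par (y1 - 1, y2) = 1 := by unfold par; simp only; omega
    have p4 : par (y1, y2) ≠ 1 := by unfold par; simp only; omega
    simp only [bd, hkpar, p1, p2, p3, p4, if_true, if_false, sub_add_cancel]
    linear_combination h (k (y1 - 1, y2)) + h (k (y1, y2 - 1)) + h (k (y1 + 1, y2)) +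
      h (k (y1, y2 + 1))
  have hsupp : {z | c z ≠ 0 ∧ z ≠ e}.Finite := by
    refine Set.Finite.subset ((hfin.image (fun w : ℤ² => w)).union
      ((hfin.image (fun w : ℤ² => (w.1 - 1, w.2 - 1))).union
      ((hfin.image (fun w : ℤ² => (w.1, w.2 - 1))).union
      (hfin.image (fun w : ℤ² => (w.1 - 1, w.2)))))) ?_
    rintro z ⟨hz, -⟩
    have : pu 1 z ∈ K ∨ pv 1 z ∈ K := by
      by_contra hh
      push Not at hh
      apply hz; simp only [c, k, hh.1, hh.2, if_false, add_zero]
    simp only [Set.mem_union, Set.mem_image]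
    simp only [pu, pv] at this
    rcases this with hh | hh <;> split_ifs at hh
    · exact Or.inl ⟨_, hh, rfl⟩
    · exact Or.inr (Or.inr (Or.inl ⟨_, hh, by simp⟩))
    · exact Or.inr (Or.inl ⟨_, hh, by simp⟩)
    · exact Or.inr (Or.inr (Or.inr ⟨_, hh, by simp⟩))
  let F := hsupp.toFinset
  have hcF : ∀ z, c z = one e z + if z ∈ F then 1 else 0 := by
    intro z
    have hz : z ∈ F ↔ c z ≠ 0 ∧ z ≠ e := by simp [F]
    by_cases h1 : z = e
    · subst h1; simp [hz, hce, one]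
    · rcases zmod_two_cases (c z) with h2 | h2 <;> simp [hz, h1, h2, one]
  have hbdF : ∀ y, par y = 0 → bd (fun z => if z ∈ F then (1 : ZMod 2) else 0) y =
      one (pu 0 e) y + one (pv 0 e) y := by
    intro y hy
    have h1 := hbdc y hy
    rw [show c = fun z => one e z + if z ∈ F then 1 else 0 from funext hcF, bd_add,
      bd_one e y hy] at h1
    revert h1
    generalize one (pu 0 e) y + one (pv 0 e) y = a, bd _ y = b
    revert a b; decide
  have hFO : ∀ z ∈ F, z ∈ O := by
    intro z hz
    have hz : c z ≠ 0 ∧ z ≠ e := by simpa [F] using hz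
    exact (hcO z hz.1).resolve_left hz.2
  let Y : Finset ℤ² := pts 0 F ∪ {pu 0 e, pv 0 e}
  have hsum := sum_bd_eq_zero (π := 0) F
    (fun y => if Conn O (pu 0 e) y then 1 else 0) (fun z hz => by
      have hzO := hFO z hz
      have : Conn O (pu 0 e) (pu 0 z) ↔ Conn O (pu 0 e) (pv 0 z) :=
        ⟨fun hh => hh.trans (Conn.of_lnk hzO (lnk_pu_pv 0 z)),
          fun hh => hh.trans (Conn.of_lnk hzO (lnk_pu_pv 0 z).symm)⟩
      simp only [this]) Y (fun y hy => by
      simp only [Y, pts, mem_union, mem_image, mem_insert,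
        mem_singleton] at hy
      rcases hy with (⟨z, -, rfl⟩ | ⟨z, -, rfl⟩) | rfl | rfl
      · exact par_pu (Or.inl rfl) z
      · exact par_pv (Or.inl rfl) z
      · exact par_pu (Or.inl rfl) e
      · exact par_pv (Or.inl rfl) e) (fun z hz => by
      simp only [Y, pts, mem_union, mem_image]
      exact ⟨Or.inl (Or.inl ⟨z, hz, rfl⟩), Or.inl (Or.inr ⟨z, hz, rfl⟩)⟩)
  have hYpar : ∀ y ∈ Y, par y = 0 := by
    intro y hy
    simp only [Y, pts, mem_union, mem_image, mem_insert,
        mem_singleton] at hy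
    rcases hy with (⟨z, -, rfl⟩ | ⟨z, -, rfl⟩) | rfl | rfl
    · exact par_pu (Or.inl rfl) z
    · exact par_pv (Or.inl rfl) z
    · exact par_pu (Or.inl rfl) e
    · exact par_pv (Or.inl rfl) e
  rw [sum_congr rfl (fun y hy => by rw [hbdF y (hYpar y hy)])] at hsum
  have m1 : pu 0 e ∈ Y := by simp [Y]
  have m2 : pv 0 e ∈ Y := by simp [Y]
  have hcn : ¬ Conn O (pu 0 e) (pv 0 e) := hcon
  simp only [mul_add, sum_add_distrib, one, mul_ite, mul_one, mul_zero,
      sum_ite_eq', m1, m2, if_true, hcn, if_false, Conn.refl, add_zero] at hsum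
  exact absurd hsum (by decide)

/-- Outside of a finite set, the odd points touching the closed cells off `D` are mutually
dual connected off `D`. -/
def Far (D : Finset ℤ²) (ζ : Set ℤ²) : Prop :=
  ∃ B : Set ℤ², B.Finite ∧ ∀ a b z z' : ℤ², par a = 1 → par b = 1 → a ∉ B → b ∉ B →
    z ∉ ζ → z ∉ D → z' ∉ ζ → z' ∉ D → (a = pu 1 z ∨ a = pv 1 z) → (b = pu 1 z' ∨ b = pv 1 z') →
    Conn (ζ ∪ ↑D)ᶜ a b

lemma Far.exists_mem {D : Finset ℤ²} {O : Set ℤ²} {B : Set ℤ²}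
    (hB : B.Finite) {f : ℤ²} (hf : par f = 1) (hinf : ¬ {w | Conn Oᶜ f w}.Finite) :
    ∃ a z, Conn Oᶜ f a ∧ par a = 1 ∧ a ∉ B ∧ z ∉ O ∧ z ∉ D ∧ (a = pu 1 z ∨ a = pv 1 z) := by
  obtain ⟨a, ha, ha'⟩ := (Set.not_finite.1 hinf |>.sdiff
    ((hB.union (pts 1 D).finite_toSet).union (Set.finite_singleton f))).nonempty
  simp only [Set.mem_union, mem_coe, Set.mem_singleton_iff, not_or] at ha'
  have ha : Conn Oᶜ f a := ha
  have hpa : par a = 1 := ha.par_eq.symm.trans hf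
  obtain hfa | ⟨b, -, z, hz, hl⟩ := Relation.ReflTransGen.cases_tail ha
  · exact absurd hfa.symm (by tauto)
  · have hor : a = pu 1 z ∨ a = pv 1 z := by
      rcases hl.symm.eq_or hpa with ⟨h, -⟩ | ⟨h, -⟩ <;> tauto
    refine ⟨a, z, ha, hpa, ha'.1.1, hz, fun hzD => ha'.1.2 ?_, hor⟩
    unfold pts
    rcases hor with h | h
    · exact mem_union_left _ (h ▸ mem_image_of_mem _ hzD)
    · exact mem_union_right _ (h ▸ mem_image_of_mem _ hzD)

lemma cn_dual_iff {D : Finset ℤ²} {ζ O : Set ℤ²} (hfar : Far D ζ) (hO : Agr D ζ O)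
    {e : ℤ²} (he : e ∈ D) (heO : e ∉ O) : cn 1 e (insert e O)ᶜ ↔ ¬ cn 0 e O := by
  refine ⟨fun h1 h0 => not_conn_and_dual heO h0 h1, fun h0 => ?_⟩
  by_contra h1
  obtain ⟨B, hB, hBc⟩ := hfar
  have hu := par_pu (Or.inr rfl : (1 : ℤ) = 0 ∨ (1 : ℤ) = 1) e
  have hv := par_pv (Or.inr rfl : (1 : ℤ) = 0 ∨ (1 : ℤ) = 1) e
  have hi1 : ¬ {w | Conn (insert e O)ᶜ (pu 1 e) w}.Finite := fun hfin =>
    h0 (conn_of_finite_dual (lnk_pu_pv 1 e) hu hfin h1)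
  have hi2 : ¬ {w | Conn (insert e O)ᶜ (pv 1 e) w}.Finite := fun hfin =>
    h0 (conn_of_finite_dual (lnk_pu_pv 1 e).symm hv hfin fun h => h1 h.symm)
  obtain ⟨a, z, ha1, ha2, ha3, ha4, ha5, ha6⟩ := Far.exists_mem (D := D) hB hu hi1
  obtain ⟨b, z', hb1, hb2, hb3, hb4, hb5, hb6⟩ := Far.exists_mem (D := D) hB hv hi2
  have hζ : ∀ z, z ∉ insert e O → z ∉ D → z ∉ ζ := fun z hz hzD hzζ =>
    hz (Set.mem_insert_of_mem _ ((hO z hzD).2 hzζ))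
  have hab := hBc a b z z' ha2 hb2 ha3 hb3 (hζ z ha4 ha5) ha5 (hζ z' hb4 hb5) hb5 ha6 hb6
  have hsub : (ζ ∪ ↑D)ᶜ ⊆ (insert e O)ᶜ := by
    intro z hz hz'
    simp only [Set.mem_compl_iff, Set.mem_union, mem_coe, not_or] at hz
    rcases hz' with rfl | hz'
    · exact hz.2 he
    · exact hz.1 ((hO z hz.2).1 hz')
  exact h1 ((ha1.trans (hab.mono hsub)).trans hb1.symm)

lemma pp_dual {D : Finset ℤ²} {ζ : Set ℤ²} {x q : ℝ} (hx : 0 < x) (hq : 1 ≤ q)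
    (hfar : Far D ζ) (A : Set ℤ² → Prop) :
    PP 1 D ζᶜ (q / x) q A = PP 0 D ζ x q (fun O => A Oᶜ) := by
  have hq0 : 0 < q := by linarith
  have hcfg : ∀ S ⊆ D, cfg D ζᶜ S = (cfg D ζ (D \ S))ᶜ := by
    intro S hS
    ext z
    have := @hS z
    simp only [mem_cfg, Set.mem_compl_iff, Finset.mem_sdiff]
    tauto
  have h1 := (Wt_isFK (Or.inl rfl) D ζ hx hq).dual hx hq
  have h2 := (Wt_isFK (Or.inr rfl) D ζᶜ (div_pos hq0 hx) hq)
  have h3 := h1.congr_c (c' := fun e S => cn 1 e (cfg D ζᶜ S)) (fun S hS e he heS => by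
    have heO : e ∉ cfg D ζ (D \ insert e S) := by
      rw [mem_cfg, Finset.mem_sdiff, mem_insert]; tauto
    rw [← cn_dual_iff hfar (agr_cfg sdiff_subset ζ) he heO, hcfg S hS, ← cfg_insert]
    have : D \ S = insert e (D \ insert e S) := by
      ext z; simp only [Finset.mem_sdiff, mem_insert]
      by_cases hz : z = e
      · subst hz; tauto
      · tauto
    rw [this])
  unfold PP
  rw [← pr_dual D (Wt 0 D ζ x q), h2.pr_unique h3]
  refine IsFK.pr_congr fun S hS => ?_
  rw [hcfg S hS]

/-- The combinatorial core of the Burton-Keane argument. -/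
lemma card_le_of_branches {ι P : Type*} (R : ι → P → P → Prop) (V : ι → Set P)
    (hR : ∀ i, Equivalence (R i))
    (h1 : ∀ i j, i ≠ j → ∀ u ∈ V j, ∀ v ∈ V j, R i u v)
    (h2 : ∀ i j, i ≠ j → ∀ y w, R j y w → R i y w ∨ ∃ v ∈ V i, R j y v ∧ R i y v)
    (n : ℕ) : ∀ (I : Finset ι) (Y : Finset P) (y : ι → Fin 3 → P), I.card = n →
      (∀ i ∈ I, ∀ a, y i a ∈ Y) → (∀ i ∈ I, ∀ a, ∃ v ∈ V i, R i (y i a) v) →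
      (∀ i ∈ I, ∀ a b, a ≠ b → ¬ R i (y i a) (y i b)) → n ≤ Y.card := by
  induction n with
  | zero => intros; exact Nat.zero_le _
  | succ n ih =>
    intro I Y y hI hyY hyV hyR
    have hne : (I ×ˢ (univ : Finset (Fin 3))).Nonempty := by
      obtain ⟨i, hi⟩ := card_pos.1 (show 0 < I.card by omega)
      exact ⟨(i, 0), by simp [hi]⟩
    obtain ⟨⟨i, a⟩, hia, hmin⟩ := exists_min_image _
      (fun t : ι × Fin 3 => (Y.filter (R t.1 (y t.1 t.2))).card) hne
    have hi : i ∈ I := (mem_product.1 hia).1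
    have hfar : ∀ j ∈ I, j ≠ i → ∀ u ∈ V j, ¬ R i (y i a) u := by
      intro j hj hji u hu hiu
      have hone : ∃ b₁ b₂ : Fin 3, b₁ ≠ b₂ ∧ (∀ v ∈ V i, ¬ R j (y j b₁) v) ∧
          ∀ v ∈ V i, ¬ R j (y j b₂) v := by
        by_contra hcon
        push Not at hcon
        have hb : ∀ b₁ b₂ : Fin 3, b₁ ≠ b₂ → (∃ v ∈ V i, R j (y j b₁) v) →
            (∃ v ∈ V i, R j (y j b₂) v) → False := by
          rintro b₁ b₂ hb ⟨v, hv, hv'⟩ ⟨w, hw, hw'⟩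
          exact hyR j hj b₁ b₂ hb ((hR j).trans hv' ((hR j).trans (h1 j i hji v hv w hw)
            ((hR j).symm hw')))
        have c01 := hcon 0 1 (by decide)
        have c02 := hcon 0 2 (by decide)
        have c12 := hcon 1 2 (by decide)
        have b01 := hb 0 1 (by decide)
        have b02 := hb 0 2 (by decide)
        have b12 := hb 1 2 (by decide)
        by_cases k0 : ∃ v ∈ V i, R j (y j 0) v
        · by_cases k1 : ∃ v ∈ V i, R j (y j 1) v
          · exact b01 k0 k1
          · push Not at k1
            exact b02 k0 (c12 k1)
        · push Not at k0
          exact b12 (c01 k0) (c02 k0)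
      obtain ⟨b₁, b₂, hb, hb₁, hb₂⟩ := hone
      have hsub : ∀ b : Fin 3, (∀ v ∈ V i, ¬ R j (y j b) v) → ∀ p, R j (y j b) p →
          R i (y i a) p := by
        intro b hb p hp
        have aux : ∀ p, R j (y j b) p → R i (y j b) p := by
          intro p hp
          rcases h2 i j hji.symm _ _ hp with h | ⟨v, hv, h, -⟩
          · exact h
          · exact absurd h (hb v hv)
        obtain ⟨v', hv', hv''⟩ := hyV j hj b
        have : R i (y i a) (y j b) := (hR i).trans hiu ((hR i).trans (h1 i j hji.symm u hu v' hv')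
          ((hR i).symm (aux v' hv'')))
        exact (hR i).trans this (aux p hp)
      have hlt : (Y.filter (R j (y j b₁))).card < (Y.filter (R i (y i a))).card := by
        apply card_lt_card
        refine ssubset_iff_of_subset ?_ |>.2 ⟨y j b₂, ?_, ?_⟩
        · intro p hp
          rw [mem_filter] at *
          exact ⟨hp.1, hsub b₁ hb₁ p hp.2⟩
        · rw [mem_filter]
          exact ⟨hyY j hj _, hsub b₂ hb₂ _ ((hR j).refl _)⟩
        · rw [mem_filter]
          exact fun hh => hyR j hj _ _ hb hh.2
      exact absurd (hmin (j, b₁) (by simp [hj])) (not_le.2 hlt)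
    have hrep : ∀ j b, ∃ y', j ∈ I → j ≠ i →
        y' ∈ Y ∧ ¬ R i (y i a) y' ∧ R j (y j b) y' := by
      intro j b
      by_cases hj : j ∈ I ∧ j ≠ i
      swap
      · exact ⟨y j b, fun h h' => absurd ⟨h, h'⟩ hj⟩
      obtain ⟨hj, hji⟩ := hj
      by_cases hin : R i (y i a) (y j b)
      · obtain ⟨v', hv', hv''⟩ := hyV j hj b
        rcases h2 i j hji.symm _ _ hv'' with h | ⟨v, hv, hjv, -⟩
        · exact absurd ((hR i).trans hin h) (hfar j hj hji v' hv')
        · have : ∃ b' : Fin 3, b' ≠ a ∧ ∀ u ∈ V j, ¬ R i (y i b') u := by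
            obtain ⟨b₁, b₂, k1, k2, k3⟩ : ∃ b₁ b₂ : Fin 3, b₁ ≠ a ∧ b₂ ≠ a ∧ b₁ ≠ b₂ :=
              (by decide : ∀ a : Fin 3, ∃ b₁ b₂ : Fin 3, b₁ ≠ a ∧ b₂ ≠ a ∧ b₁ ≠ b₂) a
            by_contra hcon
            push Not at hcon
            obtain ⟨u, hu, hu'⟩ := hcon b₁ k1
            obtain ⟨w, hw, hw'⟩ := hcon b₂ k2
            exact hyR i hi _ _ k3 ((hR i).trans hu' ((hR i).trans (h1 i j hji.symm u hu w hw)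
              ((hR i).symm hw')))
          obtain ⟨b', hb'a, hb'⟩ := this
          refine ⟨y i b', fun _ _ => ⟨hyY i hi _, hyR i hi _ _ hb'a.symm, ?_⟩⟩
          obtain ⟨w, hw, hw'⟩ := hyV i hi b'
          rcases h2 j i hji _ _ hw' with h | ⟨u, hu, hu', -⟩
          · exact (hR j).trans hjv ((hR j).trans (h1 j i hji v hv w hw) ((hR j).symm h))
          · exact absurd hu' (hb' u hu)
      · exact ⟨y j b, fun _ _ => ⟨hyY j hj b, hin, (hR j).refl _⟩⟩
    choose y' hy' using hrep
    have hcard := ih (I.erase i) (Y.filter fun p => ¬ R i (y i a) p) y'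
      (by rw [card_erase_of_mem hi, hI]; rfl)
      (fun j hj b => by
        rw [mem_erase] at hj
        rw [mem_filter]; exact ⟨(hy' j b hj.2 hj.1).1, (hy' j b hj.2 hj.1).2.1⟩)
      (fun j hj b => by
        rw [mem_erase] at hj
        obtain ⟨v, hv, hv'⟩ := hyV j hj.2 b
        exact ⟨v, hv, (hR j).trans ((hR j).symm (hy' j b hj.2 hj.1).2.2) hv'⟩)
      (fun j hj b c hbc hR' => by
        rw [mem_erase] at hj
        exact hyR j hj.2 b c hbc ((hR j).trans (hy' j b hj.2 hj.1).2.2 ((hR j).trans hR'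
          ((hR j).symm (hy' j c hj.2 hj.1).2.2))))
    refine hcard.trans_lt (card_lt_card ?_)
    refine ssubset_iff_of_subset (filter_subset _ _) |>.2 ⟨y i a, hyY i hi a, ?_⟩
    rw [mem_filter]
    exact fun hh => hh.2 ((hR i).refl _)

/-- A path either avoids the cells of `b` or reaches a corner of `b`. -/
lemma Conn.avoid_or {O : Set ℤ²} {π : ℤ} (b : Set ℤ²) {y w : ℤ²} (hy : par y = π)
    (h : Conn O y w) : Conn (O \ b) y w ∨
      ∃ z ∈ b, ∃ v, (v = pu π z ∨ v = pv π z) ∧ Conn (O \ b) y v := by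
  induction h with
  | refl => exact Or.inl (Conn.refl _ _)
  | @tail u w hu hs ih =>
    rcases ih with ih | ih
    · obtain ⟨z, hz, hl⟩ := hs
      by_cases hzb : z ∈ b
      · refine Or.inr ⟨z, hzb, u, ?_, ih⟩
        rcases hl.eq_or ((Conn.par_eq hu).symm.trans hy) with ⟨h, -⟩ | ⟨h, -⟩ <;> tauto
      · exact Or.inl (ih.trans (Conn.of_lnk ⟨hz, hzb⟩ hl))
    · exact Or.inr ih

/-- The corners of parity `π` of the cells of `b`. -/
def corn (π : ℤ) (b : Set ℤ²) : Set ℤ² := {v | ∃ z ∈ b, v = pu π z ∨ v = pv π z}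

/-- `b` is a trifurcation of `O` with respect to the marks `Y`. -/
def Trif (π : ℤ) (O b Y : Set ℤ²) : Prop :=
  b ⊆ O ∧ ∃ y : Fin 3 → ℤ², (∀ a, y a ∈ Y ∧ ∃ v ∈ corn π b, Conn (O \ b) (y a) v) ∧
    ∀ a a', a ≠ a' → ¬ Conn (O \ b) (y a) (y a')

lemma card_trif_le {ι : Type*} {π : ℤ} {O : Set ℤ²} (b : ι → Set ℤ²)
    (hπ : π = 0 ∨ π = 1)
    (hdisj : ∀ i j, i ≠ j → Disjoint (b i) (b j))
    (hconn : ∀ i, ∀ u ∈ corn π (b i), ∀ v ∈ corn π (b i), Conn (b i) u v)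
    (Y : Finset ℤ²) (I : Finset ι) (hI : ∀ i ∈ I, Trif π O (b i) ↑Y) :
    I.card ≤ Y.card := by
  have hcpar : ∀ i, ∀ v ∈ corn π (b i), par v = π := by
    rintro i v ⟨z, -, rfl | rfl⟩
    · exact par_pu hπ z
    · exact par_pv hπ z
  have hy : ∀ i : {i // i ∈ I}, ∃ y : Fin 3 → {v : ℤ² // par v = π},
      (∀ a, (y a).1 ∈ Y ∧ ∃ v ∈ corn π (b i), Conn (O \ b i) (y a).1 v) ∧
      ∀ a a', a ≠ a' → ¬ Conn (O \ b i) (y a).1 (y a').1 := by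
    intro i
    obtain ⟨y, h1, h2⟩ := (hI i i.2).2
    refine ⟨fun a => ⟨y a, ?_⟩, h1, h2⟩
    obtain ⟨v, hv, hc⟩ := (h1 a).2
    exact (Conn.par_eq hc).trans (hcpar i v hv) 
  choose y hy1 hy2 using hy
  have key := card_le_of_branches (ι := {i // i ∈ I}) (P := {v : ℤ² // par v = π})
    (R := fun i u v => Conn (O \ b i) u.1 v.1)
    (V := fun i => {u | u.1 ∈ corn π (b i)})
    (fun i => ⟨fun _ => Conn.refl _ _, Conn.symm, Conn.trans⟩)
    (fun i j hij u hu v hv => Conn.mono (O' := O \ b i) (fun z hz =>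
      ⟨(hI j j.2).1 hz, fun hz' => Set.disjoint_left.1
        (hdisj i j (fun h => hij (Subtype.ext h))) hz' hz⟩) (hconn j u hu v hv))
    (fun i j hij y w h => by
      rcases h.avoid_or (b i) y.2 with h | ⟨z, hz, v, hv, h⟩
      · exact Or.inl (Conn.mono (O' := O \ b i) (fun z hz => ⟨hz.1.1, hz.2⟩) h)
      · have hvc : v ∈ corn π (b i) := ⟨z, hz, hv⟩
        exact Or.inr ⟨⟨v, hcpar i v hvc⟩, hvc,
          Conn.mono (O' := O \ b j) (fun z hz => hz.1) h,
          Conn.mono (O' := O \ b i) (fun z hz => ⟨hz.1.1, hz.2⟩) h⟩)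
    I.attach.card I.attach (Y.subtype (fun v => par v = π)) (fun i => y i) rfl
    (fun i _ a => by
      rw [mem_subtype]
      exact (hy1 i a).1)
    (fun i _ a => by
      obtain ⟨v, hv, hc⟩ := (hy1 i a).2
      exact ⟨⟨v, hcpar i v hv⟩, hv, hc⟩) (fun i _ a b hab => hy2 i a b hab)
  rw [card_attach] at key
  refine key.trans ?_
  rw [card_subtype]
  exact card_filter_le _ _

/-- The union of the clusters of the points of `s`. -/
def clus (s O : Set ℤ²) : Set ℤ² := {v | ∃ u ∈ s, Conn O u v}

/-- The cells of `D` with a corner of parity `π` in the clusters of `s`. -/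
def touch (π : ℤ) (s : Set ℤ²) (D : Finset ℤ²) (O : Set ℤ²) : Finset ℤ² :=
  D.filter fun z => pu π z ∈ clus s O ∨ pv π z ∈ clus s O

lemma touch_sub (s : Set ℤ²) (O : Set ℤ²) : touch π s D O ⊆ D := filter_subset _ _

lemma clus_sub_of_touch {s O O' : Set ℤ²} (hs : ∀ u ∈ s, par u = π)
    (hO : ∀ z, z ∉ D → z ∈ O → z ∈ O')
    (h : ∀ z ∈ touch π s D O, z ∈ touch π s D O' → z ∈ O → z ∈ O') : clus s O ⊆ clus s O' := by
  rintro v ⟨u, hu, hc⟩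
  refine ⟨u, hu, ?_⟩
  induction hc with
  | refl => exact Conn.refl _ _
  | @tail w v hw hst ih =>
    obtain ⟨z, hz, hl⟩ := hst
    refine ih.trans (Conn.of_lnk (z := z) ?_ hl)
    by_cases hzD : z ∈ D
    · have hp : par w = π := (Conn.par_eq hw).symm.trans (hs u hu)
      refine h z (mem_filter.2 ⟨hzD, ?_⟩) (mem_filter.2 ⟨hzD, ?_⟩) hz <;>
        rcases hl.eq_or hp with ⟨rfl, -⟩ | ⟨rfl, -⟩
      exacts [Or.inl ⟨u, hu, hw⟩, Or.inr ⟨u, hu, hw⟩, Or.inl ⟨u, hu, ih⟩, Or.inr ⟨u, hu, ih⟩]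
    · exact hO z hzD hz

lemma clus_eq_of_touch {s O O' : Set ℤ²} (hs : ∀ u ∈ s, par u = π)
    (hO : ∀ z, z ∉ D → (z ∈ O ↔ z ∈ O')) (h : ∀ z ∈ touch π s D O, z ∈ O ↔ z ∈ O') :
    clus s O' = clus s O :=
  Set.Subset.antisymm (clus_sub_of_touch hs (fun z hz => (hO z hz).2) fun z _ hz => (h z hz).2)
    (clus_sub_of_touch hs (fun z hz => (hO z hz).1) fun z hz _ => (h z hz).1)

lemma pp_sum_le (hπ : π = 0 ∨ π = 1) (hx : 0 < x) (hq : 1 ≤ q) {ι : Type*} (s : Finset ι)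
    (A : ι → Set ℤ² → Prop) (n : ℕ) (h : ∀ O, Agr D ζ O → (s.filter (A · O)).card ≤ n) :
    ∑ i ∈ s, PP π D ζ x q (A i) ≤ n := by
  have h1 := Wt_isFK hπ D ζ hx hq
  unfold PP pr
  rw [← IsFK.ex_sum]
  refine (h1.ex_mono (g := fun _ => (n : ℝ)) fun S hS => ?_).trans (le_of_eq (h1.ex_const _))
  have := h _ (agr_cfg hS ζ)
  simp only [ind]
  rw [sum_ite]
  simpa using this

/-- Exploration of the clusters of `s` by cells of `Y`. -/
lemma pp_explore_on (Y : Set ℤ²) (hπ : π = 0 ∨ π = 1) (hx : 0 < x) (hq : 1 ≤ q) {s : Set ℤ²}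
    (hs : ∀ u ∈ s, par u = π) (N : Set ℤ² → Prop) (β : ℝ)
    (H : ∀ O, Agr D ζ O → N (clus s (O ∩ Y)) → ∃ (ζ' : Set ℤ²) (A' : Set ℤ² → Prop),
      Monotone A' ∧ PP π (D \ touch π s (D.filter (· ∈ Y)) (O ∩ Y)) ζ' x q A' ≤ β ∧
      ∀ O', Agr D ζ O' → clus s (O' ∩ Y) = clus s (O ∩ Y) →
        (A O' → A' (glue (D \ touch π s (D.filter (· ∈ Y)) (O ∩ Y)) ζ' O')) ∧
        ∀ e ∈ D \ touch π s (D.filter (· ∈ Y)) (O ∩ Y), e ∉ O' → cn π e O' →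
          cn π e (glue (D \ touch π s (D.filter (· ∈ Y)) (O ∩ Y)) ζ' O')) :
    PP π D ζ x q (fun O => A O ∧ N (clus s (O ∩ Y))) ≤ β * PP π D ζ x q (fun O => N (clus s (O ∩ Y))) := by
  set K : Finset ℤ² → Finset ℤ² := fun S => touch π s (D.filter (· ∈ Y)) (cfg D ζ (S ∩ D) ∩ Y) with hKdef
  have hKD : ∀ S, K S ⊆ D := fun S => (touch_sub _ _).trans (filter_subset _ _)
  have hcl : ∀ S S' : Finset ℤ², S ∩ K S = S' ∩ K S →
      clus s (cfg D ζ (S' ∩ D) ∩ Y) = clus s (cfg D ζ (S ∩ D) ∩ Y) := by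
    intro S S' h
    refine clus_eq_of_touch (D := D.filter (· ∈ Y)) hs (fun z hz => ?_) (fun z hz => ?_)
    · rw [mem_filter] at hz
      simp only [mem_cfg, mem_inter, Set.mem_inter_iff]; tauto
    · have := Finset.ext_iff.1 h z
      have hzD := (mem_filter.1 (touch_sub _ _ hz)).1
      rw [mem_inter, mem_inter] at this
      simp only [mem_cfg, mem_inter, Set.mem_inter_iff]; tauto
  have hK : ∀ S S' : Finset ℤ², S ∩ K S = S' ∩ K S → K S' = K S := by
    intro S S' h
    simp only [hKdef, touch, hcl S S' h]
  have h1 := Wt_isFK hπ D ζ hx hq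
  have hDS : ∀ S ⊆ D, S ∩ D = S := fun S hS => inter_eq_left.2 hS
  have key := h1.explore_upper hx hq K hK (fun S => N (clus s (cfg D ζ (S ∩ D) ∩ Y)))
    (fun S => A (cfg D ζ S)) (fun S S' h hN => by rw [hcl S S' h]; exact hN) β
    (fun S hS hN => by
      obtain ⟨ζ', A', hA', hβ, hH⟩ := H (cfg D ζ (S ∩ D)) (by
        rw [hDS S hS]; exact agr_cfg hS ζ) hN
      have hgl : ∀ S' ⊆ D \ K S, glue (D \ K S) ζ' (cfg D ζ (S' ∪ S ∩ K S)) =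
          cfg (D \ K S) ζ' S' := fun S' hS' => glue_cfg hS' (by
            intro z hz
            have := hS (mem_inter.1 hz).1
            have := (mem_inter.1 hz).2
            simp only [Finset.mem_sdiff]; tauto) _ _ sdiff_subset
      have hsubD : ∀ S' ⊆ D \ K S, S' ∪ S ∩ K S ⊆ D := fun S' hS' =>
        union_subset (hS'.trans sdiff_subset) (inter_subset_left.trans hS)
      have hclS : ∀ S' ⊆ D \ K S, clus s (cfg D ζ (S' ∪ S ∩ K S) ∩ Y) =
          clus s (cfg D ζ (S ∩ D) ∩ Y) := by
        intro S' hS'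
        have := hcl S (S' ∪ S ∩ K S) (by
          ext z
          have := @hS' z
          simp only [mem_inter, mem_union, Finset.mem_sdiff] at *
          tauto)
        rwa [hDS _ (hsubD S' hS')] at this
      refine ⟨fun e S' => cn π e (cfg (D \ K S) ζ' S'), Wt π (D \ K S) ζ' x q,
        fun S' => A' (cfg (D \ K S) ζ' S'), Wt_isFK hπ _ _ hx hq, incr_cfg _ _ hA', hβ, ?_, ?_⟩
      · intro S' hS' hA
        have := (hH _ (agr_cfg (hsubD S' hS') ζ) (hclS S' hS')).1 hA
        rwa [hgl S' hS'] at this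
      · intro S₁ S₂ e h12 h2 he heS hc
        have h1' := h12.trans h2
        have heO : e ∉ cfg D ζ (S₁ ∪ S ∩ K S) := by
          rw [mem_cfg, mem_union, mem_inter]
          have := @h12 e
          simp only [Finset.mem_sdiff] at he
          tauto
        have := (hH _ (agr_cfg (hsubD S₁ h1') ζ) (hclS S₁ h1')).2 e he heO hc
        rw [hgl S₁ h1'] at this
        exact Conn.mono (cfg_mono h12 le_rfl) this)
  have e1 : PP π D ζ x q (fun O => A O ∧ N (clus s (O ∩ Y))) = pr D (Wt π D ζ x q)
      (fun S => A (cfg D ζ S) ∧ N (clus s (cfg D ζ (S ∩ D) ∩ Y))) :=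
    IsFK.pr_congr fun S hS => by rw [hDS S hS]
  have e2 : PP π D ζ x q (fun O => N (clus s (O ∩ Y))) = pr D (Wt π D ζ x q)
      (fun S => N (clus s (cfg D ζ (S ∩ D) ∩ Y))) :=
    IsFK.pr_congr fun S hS => by rw [hDS S hS]
  rw [e1, e2]; exact key
lemma pp_explore (hπ : π = 0 ∨ π = 1) (hx : 0 < x) (hq : 1 ≤ q) {s : Set ℤ²}
    (hs : ∀ u ∈ s, par u = π) (N : Set ℤ² → Prop) (β : ℝ)
    (H : ∀ O, Agr D ζ O → N (clus s O) → ∃ (ζ' : Set ℤ²) (A' : Set ℤ² → Prop),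
      Monotone A' ∧ PP π (D \ touch π s D O) ζ' x q A' ≤ β ∧
      ∀ O', Agr D ζ O' → clus s O' = clus s O →
        (A O' → A' (glue (D \ touch π s D O) ζ' O')) ∧
        ∀ e ∈ D \ touch π s D O, e ∉ O' → cn π e O' →
          cn π e (glue (D \ touch π s D O) ζ' O')) :
    PP π D ζ x q (fun O => A O ∧ N (clus s O)) ≤ β * PP π D ζ x q (fun O => N (clus s O)) := by
  have := pp_explore_on (A := A) Set.univ hπ hx hq hs N β (D := D) (ζ := ζ)
  simp only [Set.inter_univ, Set.mem_univ, filter_true] at this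
  exact this H

/-- The event `A` depends on the cells of `X` only. -/
def Loc (X : Finset ℤ²) (A : Set ℤ² → Prop) : Prop :=
  ∀ O O' : Set ℤ², (∀ z ∈ X, z ∈ O ↔ z ∈ O') → A O → A O'

lemma conn_off_clus {s O O' : Set ℤ²} {u v : ℤ²} (hu : u ∉ clus s O)
    (h : ∀ z ∈ O, ∀ a b, Lnk z a b → par a = par u → a ∉ clus s O → b ∉ clus s O → z ∈ O')
    (hc : Conn O u v) : Conn O' u v := by
  have : v ∉ clus s O ∧ Conn O' u v := by
    induction hc with
    | refl => exact ⟨hu, Conn.refl _ _⟩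
    | @tail w v hw hst ih =>
      obtain ⟨z, hz, hl⟩ := hst
      have hv : v ∉ clus s O := fun ⟨t, ht, htv⟩ =>
        ih.1 ⟨t, ht, htv.trans (Conn.of_lnk hz hl.symm)⟩
      exact ⟨hv, ih.2.trans (Conn.of_lnk (h z hz w v hl (Conn.par_eq hw).symm ih.1 hv) hl)⟩
  exact this.2

/-- The effect of the boundary conditions on local increasing events. -/
lemma wired_sub_free_le (hπ : π = 0 ∨ π = 1) (hx : 0 < x) (hq : 1 ≤ q) (hA : Monotone A)
    {X : Finset ℤ²} (hX : X ⊆ D) (hAX : Loc X A) :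
    PP π D Set.univ x q A ≤ PP π D ∅ x q A + PP π D Set.univ x q
      (fun O => ∃ v ∈ corn π X, v ∈ clus (corn π (↑D)ᶜ) O) := by
  set s := corn π ((↑D : Set ℤ²)ᶜ) with hs
  have hspar : ∀ u ∈ s, par u = π := by
    rintro u ⟨z, -, rfl | rfl⟩
    · exact par_pu hπ z
    · exact par_pv hπ z
  have h1 : PP π D Set.univ x q (fun O => A O ∧ ∀ v ∈ corn π X, v ∉ clus s O) ≤
      PP π D ∅ x q A * PP π D Set.univ x q (fun O => ∀ v ∈ corn π X, v ∉ clus s O) := by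
    refine pp_explore hπ hx hq hspar (fun C => ∀ v ∈ corn π X, v ∉ C) _ fun O hO hN =>
      ⟨∅, A, hA, pp_enlarge hπ hx hq sdiff_subset le_rfl hA (by simp), ?_⟩
    intro O' hO' hcl
    have hXK : ∀ z ∈ X, z ∉ touch π s D O := by
      intro z hz hzt
      rcases (mem_filter.1 hzt).2 with h | h
      · exact hN _ ⟨z, hz, Or.inl rfl⟩ h
      · exact hN _ ⟨z, hz, Or.inr rfl⟩ h
    refine ⟨hAX _ _ fun z hz => ?_, fun e he heO hc => ?_⟩
    · rw [mem_glue, Finset.mem_sdiff]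
      have := hXK z hz; have := hX hz; simp; tauto
    · have heK : pu π e ∉ clus s O' := by
        intro h
        rw [hcl] at h
        exact (Finset.mem_sdiff.1 he).2 (mem_filter.2 ⟨(Finset.mem_sdiff.1 he).1, Or.inl h⟩)
      refine conn_off_clus heK (fun z hz a b hl hp ha hb => ?_) hc
      rw [par_pu hπ] at hp
      have hl' := hl.eq_or hp
      have hzD : z ∈ D := by
        by_contra hzD
        refine ha ⟨a, ⟨z, hzD, ?_⟩, Conn.refl _ _⟩
        tauto
      refine mem_glue.2 (Or.inl ⟨hz, Finset.mem_sdiff.2 ⟨hzD, fun hzt => ?_⟩⟩)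
      have := (mem_filter.1 hzt).2
      rw [← hcl] at this
      rcases hl' with ⟨rfl, rfl⟩ | ⟨rfl, rfl⟩ <;> tauto
  have h2 : PP π D Set.univ x q (fun O => ∀ v ∈ corn π X, v ∉ clus s O) ≤ 1 :=
    pp_le_one hπ hx hq _
  have h3 := pp_nonneg (D := D) (ζ := ∅) hπ hx hq A
  have h4 : PP π D Set.univ x q A ≤
      PP π D Set.univ x q (fun O => A O ∧ ∀ v ∈ corn π X, v ∉ clus s O) +
      PP π D Set.univ x q (fun O => ∃ v ∈ corn π X, v ∈ clus s O) := by
    refine le_trans (pp_mono hπ hx hq fun O _ hA => ?_) (pp_or_le hπ hx hq _ _)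
    by_cases h : ∃ v ∈ corn π X, v ∈ clus s O
    · exact Or.inr h
    · push Not at h; exact Or.inl ⟨hA, h⟩
  nlinarith

/-- Domination of the effect of boundary conditions on events by that on edges. -/
lemma sub_le_sum_edges (hπ : π = 0 ∨ π = 1) (hx : 0 < x) (hq : 1 ≤ q)
    {X : Finset ℤ²} (hX : X ⊆ D) (hAX : Loc X A) (hζ : ζ ⊆ ζ') :
    PP π D ζ' x q A ≤ PP π D ζ x q A +
      ∑ e ∈ X, (PP π D ζ' x q (fun O => e ∈ O) - PP π D ζ x q (fun O => e ∈ O)) := by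
  have h1 := Wt_isFK hπ D ζ hx hq
  have h2 := Wt_isFK hπ D ζ' hx hq
  have hmem : ∀ ξ : Set ℤ², ∀ e ∈ X, ∀ S, e ∈ cfg D ξ S ↔ e ∈ S := by
    intro ξ e he S
    have := hX he
    rw [mem_cfg]; tauto
  set f : Finset ℤ² → ℝ := fun S => ∑ e ∈ X, ind (fun S => e ∈ S) S +
    (1 - ind (fun S => A (cfg D ζ S)) S) with hf
  have hf0 : ∀ S, 0 ≤ f S := by
    intro S
    have := ind_le_one (fun S => A (cfg D ζ S)) S
    have := sum_nonneg fun e (_ : e ∈ X) => ind_nonneg (fun S => e ∈ S) S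
    simp only [hf]; linarith
  have hmono : ∀ S T, S ⊆ T → T ⊆ D → f S ≤ f T := by
    intro S T hST _
    have hle : ∀ e ∈ X, ind (fun S => e ∈ S) S ≤ ind (fun S => e ∈ S) T := by
      intro e _
      simp only [ind]
      by_cases h : e ∈ S
      · simp [h, hST h]
      · simp only [h, if_false]; split_ifs <;> norm_num
    by_cases hX' : ∀ e ∈ X, (e ∈ S ↔ e ∈ T)
    · have : A (cfg D ζ S) ↔ A (cfg D ζ T) :=
        ⟨hAX _ _ fun z hz => by rw [hmem ζ z hz, hmem ζ z hz, hX' z hz],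
          hAX _ _ fun z hz => by rw [hmem ζ z hz, hmem ζ z hz, hX' z hz]⟩
      simp only [hf, ind, this]
      simp only [ind] at hle
      have := sum_le_sum hle
      linarith
    · push Not at hX'
      obtain ⟨e, he, hne⟩ := hX'
      have heS : e ∉ S ∧ e ∈ T := by
        have := @hST e; tauto
      have h3 := ind_le_one (fun S => A (cfg D ζ S)) T
      have h4 := ind_nonneg (fun S => A (cfg D ζ S)) S
      have h5 : ∑ e ∈ X, ind (fun S => e ∈ S) S + 1 ≤ ∑ e ∈ X, ind (fun S => e ∈ S) T := by
        rw [← add_sum_erase X _ he, ← add_sum_erase X (fun e => ind (fun S => e ∈ S) T) he]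
        have := sum_le_sum fun a (ha : a ∈ X.erase e) => hle a (mem_of_mem_erase ha)
        have e1 : ind (fun S => e ∈ S) S = 0 := by simp [ind, heS.1]
        have e2 : ind (fun S => e ∈ S) T = 1 := by simp [ind, heS.2]
        rw [e1, e2]; linarith
      simp only [hf]; linarith
  have key := h1.ex_le h2 hx le_rfl hq (cle_cfg π D fun z _ hz => hζ hz) hf0 hmono
  have hA' : PP π D ζ' x q A = pr D (Wt π D ζ' x q) (fun S => A (cfg D ζ S)) :=
    IsFK.pr_congr fun S _ =>
      ⟨hAX _ _ fun z hz => by rw [hmem ζ z hz, hmem ζ' z hz],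
        hAX _ _ fun z hz => by rw [hmem ζ z hz, hmem ζ' z hz]⟩
  have he : ∀ ξ : Set ℤ², ∀ e ∈ X, PP π D ξ x q (fun O => e ∈ O) =
      ex D (Wt π D ξ x q) (ind fun S => e ∈ S) := fun ξ e he =>
    IsFK.pr_congr fun S _ => hmem ξ e he S
  have hex : ∀ {c} {ξ : Set ℤ²}, IsFK D x q c (Wt π D ξ x q) →
      ex D (Wt π D ξ x q) f = ∑ e ∈ X, PP π D ξ x q (fun O => e ∈ O) +
        (1 - pr D (Wt π D ξ x q) (fun S => A (cfg D ζ S))) := by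
    intro c ξ h
    rw [hf, IsFK.ex_add, IsFK.ex_sum, IsFK.ex_sub, h.ex_const, sum_congr rfl (he ξ)]
    rfl
  rw [hex h1, hex h2, ← hA'] at key
  rw [sum_sub_distrib]
  have : PP π D ζ x q A = pr D (Wt π D ζ x q) (fun S => A (cfg D ζ S)) := rfl
  linarith

lemma exp_mean_le {E : Type*} [DecidableEq E] {D : Finset E} {c : E → Finset E → Prop}
    {W : Finset E → ℝ} (h : IsFK D x q c W) (l : ℝ) (f : Finset E → ℝ) :
    Real.exp (l * ex D W f) ≤ ex D W (fun S => Real.exp (l * f S)) := by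
  set m := ex D W f with hm
  have h1 : ex D W (fun S => Real.exp (l * m) * (1 - l * m) + Real.exp (l * m) * l * f S) ≤
      ex D W (fun S => Real.exp (l * f S)) := by
    refine h.ex_mono fun S _ => ?_
    have := Real.add_one_le_exp (l * f S - l * m)
    have e : Real.exp (l * f S) = Real.exp (l * m) * Real.exp (l * f S - l * m) := by
      rw [← Real.exp_add]; congr 1; ring
    rw [e]
    nlinarith [Real.exp_pos (l * m)]
  rw [IsFK.ex_add, h.ex_const, IsFK.ex_const_mul, ← hm] at h1
  nlinarith

/-- The total weight. -/
def Zt (π : ℤ) (D : Finset ℤ²) (ζ : Set ℤ²) (x q : ℝ) : ℝ :=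
  ∑ S ∈ D.powerset, Wt π D ζ x q S

/-- The mean number of open cells. -/
def Mn (π : ℤ) (D : Finset ℤ²) (ζ : Set ℤ²) (x q : ℝ) : ℝ :=
  ∑ e ∈ D, PP π D ζ x q (fun O => e ∈ O)

lemma mn_eq : Mn π D ζ x q = ex D (Wt π D ζ x q) (fun S => (S.card : ℝ)) := by
  unfold Mn PP pr
  rw [← IsFK.ex_sum]
  refine IsFK.ex_congr fun S hS => ?_
  simp only [ind]
  rw [sum_congr rfl (g := fun e => if e ∈ S then (1 : ℝ) else 0) fun e he => by
    have : e ∈ cfg D ζ S ↔ e ∈ S := by rw [mem_cfg]; tauto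
    simp only [this]]
  rw [sum_boole, filter_mem_eq_inter, inter_eq_right.2 hS]

lemma ex_exp_card (hπ : π = 0 ∨ π = 1) (hx : 0 < x) (hx' : 0 < x') (hq : 1 ≤ q) :
    ex D (Wt π D ζ x q) (fun S => Real.exp (Real.log (x' / x) * S.card)) =
      Zt π D ζ x' q / Zt π D ζ x q := by
  have hW : ∀ S, Wt π D ζ x q S * Real.exp (Real.log (x' / x) * S.card) = Wt π D ζ x' q S := by
    intro S
    have : Real.exp (Real.log (x' / x) * S.card) = (x' / x) ^ S.card := by
      rw [mul_comm, Real.exp_nat_mul, Real.exp_log (by positivity)]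
    rw [this]; unfold Wt
    rw [div_pow]; field_simp
  unfold ex Zt
  simp only [hW]

lemma zt_pos (hπ : π = 0 ∨ π = 1) (hx : 0 < x) (hq : 1 ≤ q) : 0 < Zt π D ζ x q :=
  (Wt_isFK hπ D ζ hx hq).tot_pos

lemma card_classes_le {O O' : Set ℤ²} (h : O ⊆ O') :
    Nat.card (Quotient (clSetoid π D O')) ≤ Nat.card (Quotient (clSetoid π D O)) := by
  refine Nat.card_le_card_of_surjective
    (Quotient.map' id fun a b (hab : Conn O a.1 b.1) => (hab.mono h : Conn O' a.1 b.1)) ?_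
  rintro ⟨a⟩
  exact ⟨Quotient.mk _ a, rfl⟩

/-- The corners of `D` which are also corners of cells outside `D`. -/
def bpts (π : ℤ) (D : Finset ℤ²) : Finset ℤ² :=
  (pts π D).filter fun v => v ∈ corn π ((↑D : Set ℤ²)ᶜ)

lemma mem_pts {v : ℤ²} : v ∈ pts π D ↔ ∃ z ∈ D, v = pu π z ∨ v = pv π z := by
  simp only [pts, mem_union, mem_image]
  constructor
  · rintro (⟨z, hz, h⟩ | ⟨z, hz, h⟩)
    · exact ⟨z, hz, Or.inl h.symm⟩
    · exact ⟨z, hz, Or.inr h.symm⟩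
  · rintro ⟨z, hz, h | h⟩
    · exact Or.inl ⟨z, hz, h.symm⟩
    · exact Or.inr ⟨z, hz, h.symm⟩

lemma par_of_mem_pts (hπ : π = 0 ∨ π = 1) {v : ℤ²} (h : v ∈ pts π D) : par v = π := by
  obtain ⟨z, -, rfl | rfl⟩ := mem_pts.1 h
  · exact par_pu hπ z
  · exact par_pv hπ z

lemma card_classes_ge (hπ : π = 0 ∨ π = 1) {S : Finset ℤ²} (hS : S ⊆ D) :
    Nat.card (Quotient (clSetoid π D (cfg D ∅ S))) ≤
      Nat.card (Quotient (clSetoid π D (cfg D Set.univ S))) + (bpts π D).card := by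
  set O := cfg D ∅ S
  set O' := cfg D Set.univ S
  have hsub : ∀ z, z ∈ O' → z ∈ D → z ∈ O := by
    intro z hz hzD
    rw [mem_cfg] at *; tauto
  have hOS : ∀ z ∈ O, z ∈ D := by
    intro z hz
    rw [mem_cfg] at hz
    rcases hz with h | h
    · exact hS h
    · exact h.1.elim
  have key : ∀ a b : {a // a ∈ pts π D}, Conn O' a.1 b.1 →
      (∀ v ∈ bpts π D, ¬ Conn O a.1 v) → Conn O a.1 b.1 := by
    intro a b hab hno
    have hp := par_of_mem_pts hπ a.2
    rcases hab.avoid_or ((↑D : Set ℤ²)ᶜ) hp with h | ⟨z, hz, v, hv, h⟩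
    · exact h.mono fun z hz => hsub z hz.1 (by simpa using hz.2)
    · have hav : Conn O a.1 v := h.mono fun z hz => hsub z hz.1 (by simpa using hz.2)
      refine absurd hav (hno v (mem_filter.2 ⟨?_, z, hz, hv⟩))
      rcases Relation.ReflTransGen.cases_tail hav with h | ⟨w, hw, z', hz', hl⟩
      · rw [h]; exact a.2
      · refine mem_pts.2 ⟨z', hOS z' hz', ?_⟩
        rcases hl.eq_or ((Conn.par_eq hw).symm.trans hp) with h | h <;> tauto
  have hex : ∀ c : Quotient (clSetoid π D O), ∃ t : Quotient (clSetoid π D O') ⊕ {v // v ∈ bpts π D},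
      ∀ a : {a // a ∈ pts π D}, Quotient.mk _ a = c →
        (∀ C, t = Sum.inl C → C = Quotient.mk _ a ∧ ∀ v ∈ bpts π D, ¬ Conn O a.1 v) ∧
        ∀ v, t = Sum.inr v → Conn O a.1 v.1 := by
    intro c
    obtain ⟨a, rfl⟩ := Quotient.exists_rep c
    by_cases h : ∃ v ∈ bpts π D, Conn O a.1 v
    · obtain ⟨v, hv, hav⟩ := h
      refine ⟨Sum.inr ⟨v, hv⟩, fun b hb => ⟨fun C hC => (by simp at hC), fun w hw => ?_⟩⟩
      have hba : Conn O b.1 a.1 := Quotient.exact hb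
      have : w = ⟨v, hv⟩ := by simpa using hw.symm
      rw [this]; exact hba.trans hav
    · push Not at h
      refine ⟨Sum.inl (Quotient.mk _ a), fun b hb => ⟨fun C hC => ⟨?_, fun v hv hbv => ?_⟩,
        fun w hw => (by simp at hw)⟩⟩
      · have hba : Conn O b.1 a.1 := Quotient.exact hb
        have : C = Quotient.mk _ a := by simpa using hC.symm
        rw [this]
        refine Quotient.sound ?_
        exact hba.symm.mono (cfg_mono le_rfl (Set.empty_subset _))
      · have hba : Conn O b.1 a.1 := Quotient.exact hb
        exact h v hv (hba.symm.trans hbv)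
  choose f hf using hex
  have hinj : Function.Injective f := by
    intro c c' hcc
    obtain ⟨a, rfl⟩ := Quotient.exists_rep c
    obtain ⟨b, rfl⟩ := Quotient.exists_rep c'
    refine Quotient.sound ?_
    rcases h : f (Quotient.mk _ a) with C | v
    · obtain ⟨h1, h2⟩ := (hf _ a rfl).1 C h
      obtain ⟨h3, -⟩ := (hf _ b rfl).1 C (hcc ▸ h)
      exact key a b (Quotient.exact (h1.symm.trans h3)) h2
    · exact ((hf _ a rfl).2 v h).trans ((hf _ b rfl).2 v (hcc ▸ h)).symm
  have := Nat.card_le_card_of_injective f hinj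
  rwa [Nat.card_sum, Nat.card_eq_fintype_card (α := {v // v ∈ bpts π D}),
    Fintype.card_coe] at this

lemma zt_le_zt (hπ : π = 0 ∨ π = 1) (hx : 0 < x) (hq : 1 ≤ q) :
    Zt π D Set.univ x q ≤ Zt π D ∅ x q := by
  refine sum_le_sum fun S _ => ?_
  unfold Wt
  refine mul_le_mul_of_nonneg_left (pow_le_pow_right₀ hq ?_) (by positivity)
  exact card_classes_le (cfg_mono le_rfl (Set.empty_subset _))

lemma zt_le_mul_zt (hπ : π = 0 ∨ π = 1) (hx : 0 < x) (hq : 1 ≤ q) :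
    Zt π D ∅ x q ≤ q ^ (bpts π D).card * Zt π D Set.univ x q := by
  unfold Zt
  rw [mul_sum]
  refine sum_le_sum fun S hS => ?_
  have h := card_classes_ge hπ (mem_powerset.1 hS)
  unfold Wt
  calc x ^ S.card * q ^ Nat.card (Quotient (clSetoid π D (cfg D ∅ S)))
      ≤ x ^ S.card * q ^ (Nat.card (Quotient (clSetoid π D (cfg D Set.univ S))) +
        (bpts π D).card) := mul_le_mul_of_nonneg_left (pow_le_pow_right₀ hq h) (by positivity)
    _ = _ := by rw [pow_add]; ring

/-- The mean number of open cells with wired boundary conditions is, up to a boundary term, at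
most that with free boundary conditions at a larger parameter. -/
lemma mn_wired_le (hπ : π = 0 ∨ π = 1) (hx : 0 < x) (hxx : x < x') (hq : 1 ≤ q) :
    Mn π D Set.univ x q ≤ Mn π D ∅ x' q +
      (bpts π D).card * Real.log q / Real.log (x' / x) := by
  have hx' := hx.trans hxx
  have hl : 0 < Real.log (x' / x) := Real.log_pos ((one_lt_div hx).2 hxx)
  have h1 := exp_mean_le (Wt_isFK hπ D Set.univ hx hq) (Real.log (x' / x)) (fun S => (S.card : ℝ))
  rw [← mn_eq, ex_exp_card hπ hx hx' hq] at h1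
  have h2 := exp_mean_le (Wt_isFK hπ D ∅ hx' hq) (Real.log (x / x')) (fun S => (S.card : ℝ))
  rw [← mn_eq, ex_exp_card hπ hx' hx hq] at h2
  have hlog : Real.log (x / x') = - Real.log (x' / x) := by
    rw [← Real.log_inv, inv_div]
  rw [hlog, neg_mul, Real.exp_neg] at h2
  have z1 := zt_pos (D := D) (ζ := Set.univ) hπ hx hq
  have z2 := zt_pos (D := D) (ζ := Set.univ) hπ hx' hq
  have z3 := zt_pos (D := D) (ζ := ∅) hπ hx hq
  have z4 := zt_pos (D := D) (ζ := ∅) hπ hx' hq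
  have z5 := zt_le_zt (D := D) hπ hx' hq
  have z6 := zt_le_mul_zt (D := D) hπ hx hq
  have hq' : 0 < q := by linarith
  have h3 : Zt π D ∅ x' q / Zt π D ∅ x q ≤
      Real.exp (Real.log (x' / x) * Mn π D ∅ x' q) := by
    have := inv_anti₀ (by positivity) h2
    rwa [inv_inv, inv_div] at this
  have h4 : Zt π D Set.univ x' q / Zt π D Set.univ x q ≤
      q ^ (bpts π D).card * (Zt π D ∅ x' q / Zt π D ∅ x q) := by
    rw [div_le_iff₀ z1]
    calc Zt π D Set.univ x' q ≤ Zt π D ∅ x' q := z5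
      _ = (Zt π D ∅ x' q / Zt π D ∅ x q) * Zt π D ∅ x q := by field_simp
      _ ≤ (Zt π D ∅ x' q / Zt π D ∅ x q) * (q ^ (bpts π D).card * Zt π D Set.univ x q) :=
        mul_le_mul_of_nonneg_left z6 (by positivity)
      _ = _ := by ring
  have h5 : Real.exp (Real.log (x' / x) * Mn π D Set.univ x q) ≤
      Real.exp ((bpts π D).card * Real.log q + Real.log (x' / x) * Mn π D ∅ x' q) := by
    rw [Real.exp_add, Real.exp_nat_mul, Real.exp_log hq']
    exact h1.trans (h4.trans (mul_le_mul_of_nonneg_left h3 (by positivity)))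
  have h6 := Real.exp_le_exp.1 h5
  have : Mn π D ∅ x' q + (bpts π D).card * Real.log q / Real.log (x' / x) =
      ((bpts π D).card * Real.log q + Real.log (x' / x) * Mn π D ∅ x' q) / Real.log (x' / x) := by
    field_simp; ring
  rw [this, le_div_iff₀ hl]; linarith

/-- The square box of cells around the cell `e`. -/
def cb (e : ℤ²) (n : ℕ) : Finset ℤ² :=
  Ico (e.1 - n) (e.1 + n + 1) ×ˢ Ico (e.2 - n) (e.2 + n + 1)

lemma mem_cb {e z : ℤ²} {n : ℕ} : z ∈ cb e n ↔
    e.1 - n ≤ z.1 ∧ z.1 ≤ e.1 + n ∧ e.2 - n ≤ z.2 ∧ z.2 ≤ e.2 + n := by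
  simp only [cb, mem_product, mem_Ico]; omega

lemma card_cb (e : ℤ²) (n : ℕ) : (cb e n).card = (2 * n + 1) ^ 2 := by
  simp only [cb, card_product, Int.card_Ico]
  have h1 : (e.1 + n + 1 - (e.1 - n)).toNat = 2 * n + 1 := by omega
  have h2 : (e.2 + n + 1 - (e.2 - n)).toNat = 2 * n + 1 := by omega
  rw [h1, h2, sq]

@[simp] lemma PSym.shift_sh (t : ℤ²) : (PSym.shift t).sh = par t := rfl
@[simp] lemma PSym.reflX_sh (c : ℤ) : (PSym.reflX c).sh = c % 2 := rfl
@[simp] lemma PSym.reflY_sh (c : ℤ) : (PSym.reflY c).sh = c % 2 := rfl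
@[simp] lemma PSym.swap_sh : PSym.swap.sh = 0 := rfl

lemma PSym.mem_image (σ : PSym) {z z' : ℤ²} (h : z' = σ.cell z) (O : Set ℤ²) :
    z' ∈ σ.cell '' O ↔ z ∈ O := by rw [h, σ.cell.injective.mem_set_image]

lemma pp_cb_cell (hπ : π = 0 ∨ π = 1) (hx : 0 < x) (hq : 1 ≤ q) (e : ℤ²) (n : ℕ)
    (hζ : ∀ z z', z ∈ ζ ↔ z' ∈ ζ) :
    PP π (cb e n) ζ x q (fun O => e ∈ O) = PP 0 (cb 0 n) ζ x q (fun O => (0 : ℤ²) ∈ O) := by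
  have hsh : ∀ {ρ : ℤ}, (ρ = 0 ∨ ρ = 1) → π = (ρ + par e) % 2 →
      PP π (cb e n) ζ x q (fun O => e ∈ O) = PP ρ (cb 0 n) ζ x q (fun O => (0 : ℤ²) ∈ O) := by
    intro ρ hρ h
    rw [PSym.pp (PSym.shift e) (π := ρ) hρ h hx hq (D := cb 0 n) (ζ := ζ) ?_ ?_]
    · exact pp_congr fun O _ => PSym.mem_image _ (by simp) O
    · intro z
      simp only [mem_cb, PSym.shift_cell, Prod.fst_add, Prod.snd_add]; simp; omega
    · exact fun z _ => hζ _ _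
  have hp := par_zero_or_one e
  by_cases h : π = (0 + par e) % 2
  · exact hsh (Or.inl rfl) h
  · rw [hsh (ρ := 1) (Or.inr rfl) (by omega), PSym.pp (PSym.reflX 1) (π := 0) (Or.inl rfl)
      (by simp) hx hq (D := cb 0 n) (ζ := ζ) ?_ ?_]
    · exact pp_congr fun O _ => PSym.mem_image _ (by simp; rfl) O
    · intro z
      simp only [mem_cb, PSym.reflX_cell]; simp; omega
    · exact fun z _ => hζ _ _

/-- The probability that a cell is open, with wired or free boundary conditions at distance `n`. -/
def ew (ζ : Set ℤ²) (x q : ℝ) (n : ℕ) : ℝ := PP 0 (cb 0 n) ζ x q (fun O => (0 : ℤ²) ∈ O)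

lemma mono_mem (e : ℤ²) : Monotone fun O : Set ℤ² => e ∈ O := fun _ _ h he => h he

lemma pp_cell_le (hπ : π = 0 ∨ π = 1) (hx : 0 < x) (hq : 1 ≤ q) {e : ℤ²} {n : ℕ}
    (h : cb e n ⊆ D) : PP π D Set.univ x q (fun O => e ∈ O) ≤ ew Set.univ x q n := by
  unfold ew
  rw [← pp_cb_cell hπ hx hq e n (by simp)]
  exact pp_shrink hπ hx hq h le_rfl (mono_mem e) (by simp)

lemma le_pp_cell (hπ : π = 0 ∨ π = 1) (hx : 0 < x) (hq : 1 ≤ q) {e : ℤ²} {n : ℕ}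
    (h : D ⊆ cb e n) : ew Set.univ x q n ≤ PP π D Set.univ x q (fun O => e ∈ O) := by
  unfold ew
  rw [← pp_cb_cell hπ hx hq e n (by simp)]
  exact pp_shrink hπ hx hq h le_rfl (mono_mem e) (by simp)

lemma pp_cell_free_le (hπ : π = 0 ∨ π = 1) (hx : 0 < x) (hq : 1 ≤ q) {e : ℤ²} {n : ℕ}
    (h : D ⊆ cb e n) : PP π D ∅ x q (fun O => e ∈ O) ≤ ew ∅ x q n := by
  unfold ew
  rw [← pp_cb_cell hπ hx hq e n (by simp)]
  exact pp_enlarge hπ hx hq h le_rfl (mono_mem e) (by simp)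

lemma le_pp_cell_free (hπ : π = 0 ∨ π = 1) (hx : 0 < x) (hq : 1 ≤ q) {e : ℤ²} {n : ℕ}
    (h : cb e n ⊆ D) : ew ∅ x q n ≤ PP π D ∅ x q (fun O => e ∈ O) := by
  unfold ew
  rw [← pp_cb_cell hπ hx hq e n (by simp)]
  exact pp_enlarge hπ hx hq h le_rfl (mono_mem e) (by simp)

/-- The limiting edge densities. -/
def dw (x q : ℝ) : ℝ := ⨅ n, ew Set.univ x q n
def df (x q : ℝ) : ℝ := ⨆ n, ew ∅ x q n

lemma ew_nonneg (hx : 0 < x) (hq : 1 ≤ q) (n : ℕ) : 0 ≤ ew ζ x q n :=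
  pp_nonneg (Or.inl rfl) hx hq _

lemma ew_le_one (hx : 0 < x) (hq : 1 ≤ q) (n : ℕ) : ew ζ x q n ≤ 1 :=
  pp_le_one (Or.inl rfl) hx hq _

lemma dw_le (hx : 0 < x) (hq : 1 ≤ q) (n : ℕ) : dw x q ≤ ew Set.univ x q n :=
  ciInf_le ⟨0, by rintro _ ⟨n, rfl⟩; exact ew_nonneg hx hq n⟩ n

lemma le_df (hx : 0 < x) (hq : 1 ≤ q) (n : ℕ) : ew ∅ x q n ≤ df x q :=
  le_ciSup (f := fun n => ew ∅ x q n) ⟨1, by rintro _ ⟨n, rfl⟩; exact ew_le_one hx hq n⟩ n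

lemma cb_sub {e e' : ℤ²} {m n : ℕ} (h1 : |e.1 - e'.1| + m ≤ n) (h2 : |e.2 - e'.2| + m ≤ n) :
    cb e m ⊆ cb e' n := by
  intro z hz
  rw [mem_cb] at *
  rw [← Int.natCast_natAbs] at h1 h2; omega

lemma near_of_corner {v z : ℤ²} (h : v = pu π z ∨ v = pv π z) :
    (v.1 = z.1 ∨ v.1 = z.1 + 1) ∧ (v.2 = z.2 ∨ v.2 = z.2 + 1) := by
  rcases h with rfl | rfl
  · unfold pu; split_ifs <;> simp
  · unfold pv; split_ifs <;> simp

lemma card_bpts_cb (n : ℕ) : (bpts π (cb 0 n)).card ≤ 8 * (n + 1) := by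
  have hsub : bpts π (cb 0 n) ⊆
      ((({(-n : ℤ), (n : ℤ) + 1} : Finset ℤ) ×ˢ Icc (-n : ℤ) (n + 1)) ∪
        (Icc (-n : ℤ) (n + 1) ×ˢ ({(-n : ℤ), (n : ℤ) + 1} : Finset ℤ))) := by
    intro v hv
    obtain ⟨h1, z', hz', h2⟩ := mem_filter.1 hv
    obtain ⟨z, hz, h1⟩ := mem_pts.1 h1
    have hz'' : ¬ z' ∈ cb 0 n := hz'
    rw [mem_cb] at hz hz''
    simp only [Prod.fst_zero, Prod.snd_zero] at hz hz''
    have a1 := near_of_corner h1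
    have a2 := near_of_corner h2
    simp only [mem_union, mem_product, mem_Icc, mem_insert,
      mem_singleton]
    omega
  refine (card_le_card hsub).trans ((card_union_le _ _).trans ?_)
  rw [card_product, card_product, Int.card_Icc]
  have h2 : ({(-n : ℤ), (n : ℤ) + 1} : Finset ℤ).card ≤ 2 := card_le_two
  have h3 : ((n : ℤ) + 1 + 1 - -n).toNat = 2 * n + 2 := by omega
  rw [h3]
  nlinarith

lemma dw_le_df (hx : 0 < x) (hxx : x < x') (hq : 1 ≤ q) : dw x q ≤ df x' q := by
  have hx' := hx.trans hxx
  set C := Real.log q / Real.log (x' / x) with hC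
  have hCn : 0 ≤ C := div_nonneg (Real.log_nonneg hq)
    (Real.log_nonneg ((one_le_div hx).2 hxx.le))
  have key : ∀ n : ℕ, (2 * n + 1) ^ 2 * dw x q ≤ (2 * n + 1) ^ 2 * df x' q + 8 * (n + 1) * C := by
    intro n
    have h1 := mn_wired_le (π := 0) (D := cb 0 n) (Or.inl rfl) hx hxx hq
    have hsub : ∀ e ∈ cb 0 n, cb 0 n ⊆ cb e (2 * n) := by
      intro e he
      rw [mem_cb] at he
      simp only [Prod.fst_zero, Prod.snd_zero] at he
      refine cb_sub ?_ ?_ <;>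
      · push_cast
        simp only [Prod.fst_zero, Prod.snd_zero]
        rw [← Int.natCast_natAbs]
        omega
    have h2 : ((cb 0 n).card : ℝ) * dw x q ≤ Mn 0 (cb 0 n) Set.univ x q := by
      rw [← nsmul_eq_mul]
      exact card_nsmul_le_sum _ _ _ fun e he =>
        (dw_le hx hq (2 * n)).trans (le_pp_cell (Or.inl rfl) hx hq (hsub e he))
    have h3 : Mn 0 (cb 0 n) ∅ x' q ≤ ((cb 0 n).card : ℝ) * df x' q := by
      rw [← nsmul_eq_mul]
      exact sum_le_card_nsmul _ _ _ fun e he =>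
        (pp_cell_free_le (Or.inl rfl) hx' hq (hsub e he)).trans (le_df hx' hq (2 * n))
    have h4 : ((bpts 0 (cb 0 n)).card : ℝ) ≤ 8 * (n + 1) := by
      exact_mod_cast card_bpts_cb (π := 0) n
    rw [card_cb] at h2 h3
    push_cast at h2 h3
    rw [mul_div_assoc] at h1
    have := mul_le_mul_of_nonneg_right h4 hCn
    linarith
  by_contra hlt
  push Not at hlt
  set δ := dw x q - df x' q with hδ
  have hδ0 : 0 < δ := by linarith
  obtain ⟨n, hn⟩ := exists_nat_gt (8 * C / δ)
  rw [div_lt_iff₀ hδ0] at hn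
  have h1 := key n
  have hn0 : (0 : ℝ) ≤ n := Nat.cast_nonneg n
  nlinarith [mul_nonneg hn0 hδ0.le, mul_pos (by positivity : (0:ℝ) < n + 1) (sub_pos.2 hn)]

lemma df_nonneg (hx : 0 < x) (hq : 1 ≤ q) : 0 ≤ df x q :=
  (ew_nonneg hx hq 0).trans (le_df hx hq 0)

lemma df_le_one (hx : 0 < x) (hq : 1 ≤ q) : df x q ≤ 1 := ciSup_le fun n => ew_le_one hx hq n

/-- Between two parameters the wired and free densities are somewhere close. -/
lemma exists_dw_sub_df_lt (hx : 0 < x) (hxx : x < x') (hq : 1 ≤ q) {ε : ℝ} (hε : 0 < ε) :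
    ∃ y, x ≤ y ∧ y ≤ x' ∧ dw y q < df y q + ε := by
  obtain ⟨n, hn⟩ := exists_nat_gt (1 / ε)
  have hn0 : (0 : ℝ) < n := lt_trans (by positivity) hn
  rw [div_lt_iff₀ hε] at hn
  set y : ℕ → ℝ := fun i => x + i * ((x' - x) / n) with hy
  have hd : 0 < (x' - x) / n := div_pos (by linarith) hn0
  have hy0 : ∀ i, x ≤ y i := fun i => by
    have : (0 : ℝ) ≤ i := Nat.cast_nonneg i
    simp only [hy]; nlinarith
  by_contra hcon
  push Not at hcon
  have h1 : ∀ i ∈ range n, ε ≤ df (y (i + 1)) q - df (y i) q := by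
    intro i hi
    have hin : (i : ℝ) ≤ n := by exact_mod_cast (mem_range.1 hi).le
    have h2 := hcon (y i) (hy0 i) (by
      have e1 : (n : ℝ) * ((x' - x) / n) = x' - x := by field_simp
      have e2 := mul_le_mul_of_nonneg_right hin hd.le
      simp only [hy]; linarith)
    have h3 : dw (y i) q ≤ df (y (i + 1)) q := dw_le_df (hx.trans_le (hy0 i)) (by
      simp only [hy]; push_cast; linarith) hq
    linarith
  have h2 := sum_le_sum h1
  rw [sum_range_sub (fun i => df (y i) q)] at h2
  simp only [sum_const, card_range, nsmul_eq_mul] at h2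
  have h3 := df_le_one (hx.trans_le (hy0 n)) hq
  have h4 := df_nonneg (hx.trans_le (hy0 0)) hq
  linarith

/-- Free boundary conditions at a larger parameter dominate wired ones, for local events. -/
lemma wired_le_free_add (hπ : π = 0 ∨ π = 1) (hx : 0 < x) (hxx : x < x') (hq : 1 ≤ q)
    (hA : Monotone A) {X : Finset ℤ²} (hAX : Loc X A) {ε : ℝ} (hε : 0 < ε) :
    ∃ n₀ : ℕ, ∀ D, cb 0 n₀ ⊆ D → PP π D Set.univ x q A ≤ PP π D ∅ x' q A + ε := by
  set δ := ε / (3 * (X.card + 1)) with hδ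
  have hδ0 : 0 < δ := by positivity
  obtain ⟨y, hy1, hy2, hy3⟩ := exists_dw_sub_df_lt hx hxx hq hδ0
  have hy0 := hx.trans_le hy1
  obtain ⟨n₁, h1⟩ := exists_lt_of_ciInf_lt (lt_add_of_pos_right (dw y q) hδ0)
  obtain ⟨n₂, h2⟩ := exists_lt_of_lt_ciSup (sub_lt_self (df y q) hδ0)
  obtain ⟨k, hk⟩ : ∃ k : ℕ, ∀ e ∈ X, e.1.natAbs ≤ k ∧ e.2.natAbs ≤ k :=
    ⟨X.sup fun e => max e.1.natAbs e.2.natAbs, fun e he => by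
      have := le_sup (f := fun e : ℤ² => max e.1.natAbs e.2.natAbs) he
      exact ⟨(le_max_left _ _).trans this, (le_max_right _ _).trans this⟩⟩
  refine ⟨k + n₁ + n₂, fun D hD => ?_⟩
  have hsub : ∀ e ∈ X, ∀ n, n ≤ n₁ + n₂ → cb e n ⊆ D := by
    intro e he n hn
    have := hk e he
    refine subset_trans (cb_sub ?_ ?_) hD <;>
    · push_cast
      simp only [Prod.fst_zero, Prod.snd_zero]
      rw [← Int.natCast_natAbs]
      omega
  have hXD : X ⊆ D := fun e he => hsub e he 0 (by omega) (mem_cb.2 (by simp))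
  have h3 := sub_le_sum_edges hπ hy0 hq hXD hAX (Set.empty_subset Set.univ)
  have h4 : ∑ e ∈ X, (PP π D Set.univ y q (fun O => e ∈ O) - PP π D ∅ y q (fun O => e ∈ O)) ≤
      X.card • (3 * δ) := sum_le_card_nsmul _ _ _ fun e he => by
    have a1 := pp_cell_le hπ hy0 hq (hsub e he n₁ (by omega))
    have a2 := le_pp_cell_free hπ hy0 hq (hsub e he n₂ (by omega))
    linarith
  have h5 := pp_dom (D := D) (ζ := Set.univ) (ζ' := Set.univ) hπ hx hq hy1 (by simp) hA
  have h6 := pp_dom (D := D) (ζ := ∅) (ζ' := ∅) hπ hy0 hq hy2 (by simp) hA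
  have h7 : X.card • (3 * δ) ≤ ε := by
    rw [nsmul_eq_mul, hδ]
    have : (X.card : ℝ) * (3 * (ε / (3 * (X.card + 1)))) = ε * (X.card / (X.card + 1)) := by
      field_simp
    rw [this]
    exact mul_le_of_le_one_right hε.le (div_le_one_of_le₀ (by linarith) (by positivity))
  linarith


lemma pp_or_add_and (π : ℤ) (D : Finset ℤ²) (ζ : Set ℤ²) (x q : ℝ)
    (A B : Set ℤ² → Prop) :
    PP π D ζ x q (fun O => A O ∨ B O) + PP π D ζ x q (fun O => A O ∧ B O) =
      PP π D ζ x q A + PP π D ζ x q B := by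
  unfold PP pr ex
  rw [← add_div, ← add_div, ← sum_add_distrib, ← sum_add_distrib]
  congr 1
  refine sum_congr rfl fun S _ => ?_
  simp only [ind]
  by_cases h1 : A (cfg D ζ S) <;> by_cases h2 : B (cfg D ζ S) <;> simp [h1, h2]

/-- The square root trick for two increasing events of equal probability. -/
lemma pp_sq_trick (hπ : π = 0 ∨ π = 1) (hx : 0 < x) (hq : 1 ≤ q) (hA : Monotone A)
    (hB : Monotone B) (hAB : PP π D ζ x q B = PP π D ζ x q A) {ε : ℝ} (hε : 0 ≤ ε)
    (h : 1 - ε ^ 2 ≤ PP π D ζ x q (fun O => A O ∨ B O)) : 1 - ε ≤ PP π D ζ x q A := by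
  have h1 := pp_or_add_and π D ζ x q A B
  have h2 := pp_fkg (D := D) (ζ := ζ) hπ hx hq hA hB
  have h3 := pp_le_one (D := D) (ζ := ζ) hπ hx hq A
  rw [hAB] at h1 h2
  by_contra hlt
  push Not at hlt
  nlinarith

/-- Chebyshev's inequality for a family of events. -/
lemma pp_second_moment (hπ : π = 0 ∨ π = 1) (hx : 0 < x) (hq : 1 ≤ q) {ι : Type*} (J : Finset ι)
    (F : ι → Set ℤ² → Prop) {θ τ : ℝ} (hθ : 0 < θ) (hτ : 0 ≤ τ) (hJ : 1 ≤ J.card * θ)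
    (h1 : ∀ j ∈ J, θ ≤ PP π D ζ x q (F j))
    (h2 : ∀ i ∈ J, ∀ j ∈ J, i ≠ j → PP π D ζ x q (fun O => F i O ∧ F j O) ≤ τ) :
    PP π D ζ x q (fun O => ∀ j ∈ J, ¬ F j O) ≤ τ / θ ^ 2 - 1 + 1 / (J.card * θ) := by
  have hk := Wt_isFK hπ D ζ hx hq
  set t := J.card * θ with ht
  have ht0 : 0 < t := by linarith
  have key : PP π D ζ x q (fun O => ∀ j ∈ J, ¬ F j O) ≤
      1 - 2 / t * ∑ j ∈ J, PP π D ζ x q (F j) +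
        (t ^ 2)⁻¹ * ∑ i ∈ J, ∑ j ∈ J, PP π D ζ x q (fun O => F i O ∧ F j O) := by
    unfold PP pr
    have hc := hk.ex_const 1
    have e1 : ∀ i ∈ J, ∑ j ∈ J, ex D (Wt π D ζ x q)
        (ind fun S => F i (cfg D ζ S) ∧ F j (cfg D ζ S)) = ex D (Wt π D ζ x q)
        (fun S => ∑ j ∈ J, ind (fun S => F i (cfg D ζ S) ∧ F j (cfg D ζ S)) S) :=
      fun i _ => (IsFK.ex_sum _ _).symm
    rw [sum_congr rfl e1, ← IsFK.ex_sum, ← IsFK.ex_sum, ← hc, ← IsFK.ex_const_mul,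
      ← IsFK.ex_const_mul, ← IsFK.ex_sub, ← IsFK.ex_add]
    refine hk.ex_mono fun S hS => ?_
    have e2 : ∑ i ∈ J, ∑ j ∈ J, ind (fun S => F i (cfg D ζ S) ∧ F j (cfg D ζ S)) S =
        (∑ i ∈ J, ind (fun S => F i (cfg D ζ S)) S) ^ 2 := by
      rw [sq, sum_mul_sum]
      refine sum_congr rfl fun i _ => sum_congr rfl fun j _ => ?_
      simp only [ind]
      by_cases a : F i (cfg D ζ S) <;> by_cases b : F j (cfg D ζ S) <;> simp [a, b]
    rw [e2]
    set X := ∑ i ∈ J, ind (fun S => F i (cfg D ζ S)) S with hX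
    have e3 : 1 - 2 / t * X + (t ^ 2)⁻¹ * X ^ 2 = (1 - X / t) ^ 2 := by ring
    rw [e3]
    simp only [ind]
    split_ifs with hn
    · have : X = 0 := sum_eq_zero fun i hi => by simp [ind, hn i hi]
      simp [this]
    · positivity
  set a := ∑ j ∈ J, PP π D ζ x q (F j) with ha
  have hta : t ≤ a := by
    rw [ht, ha, ← nsmul_eq_mul]
    exact card_nsmul_le_sum _ _ _ h1
  have hpairs : ∑ i ∈ J, ∑ j ∈ J, PP π D ζ x q (fun O => F i O ∧ F j O) ≤
      a + J.card ^ 2 * τ := by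
    have e : ∀ i ∈ J, ∑ j ∈ J, PP π D ζ x q (fun O => F i O ∧ F j O) ≤
        PP π D ζ x q (F i) + J.card * τ := by
      intro i hi
      rw [← add_sum_erase _ _ hi]
      refine add_le_add (pp_mono hπ hx hq fun O _ h => h.1) ?_
      refine (sum_le_card_nsmul (J.erase i) _ τ fun j hj =>
        h2 i hi j (mem_of_mem_erase hj) (ne_of_mem_erase hj).symm).trans ?_
      rw [nsmul_eq_mul]
      have : ((J.erase i).card : ℝ) ≤ J.card := by exact_mod_cast card_erase_le
      gcongr
    refine (sum_le_sum e).trans (le_of_eq ?_)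
    rw [sum_add_distrib, sum_const, nsmul_eq_mul]
    ring
  have hJ0 : (J.card : ℝ) ≠ 0 := by
    intro h; rw [ht, h] at ht0; simp at ht0
  have e5 : (J.card : ℝ) ^ 2 * τ / t ^ 2 = τ / θ ^ 2 := by
    rw [ht]; field_simp
  have e6 : 1 - 2 / t * a + (t ^ 2)⁻¹ * (a + J.card ^ 2 * τ) =
      1 - (2 / t - (t ^ 2)⁻¹) * a + τ / θ ^ 2 := by rw [← e5]; ring
  have e7 : (2 / t - (t ^ 2)⁻¹) * t = 2 - 1 / t := by field_simp
  have e8 : 0 ≤ 2 / t - (t ^ 2)⁻¹ := by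
    rw [sub_nonneg, ← one_div, div_le_div_iff₀ (by positivity) ht0]
    nlinarith
  calc _ ≤ _ := key
    _ ≤ 1 - 2 / t * a + (t ^ 2)⁻¹ * (a + J.card ^ 2 * τ) := by gcongr
    _ = 1 - (2 / t - (t ^ 2)⁻¹) * a + τ / θ ^ 2 := e6
    _ ≤ 1 - (2 / t - (t ^ 2)⁻¹) * t + τ / θ ^ 2 := by gcongr
    _ = _ := by rw [e7]; ring

/-- A path leaving the region where all incident cells lie in `B` reaches `F` inside `B`. -/
lemma Conn.exit {O B : Set ℤ²} {F : ℤ² → Prop}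
    (hB : ∀ b, ¬ F b → ∀ z c, Lnk z b c → z ∈ B) {u w : ℤ²} (h : Conn O u w) :
    Conn (O ∩ B) u w ∨ ∃ w', F w' ∧ Conn (O ∩ B) u w' := by
  induction h with
  | refl => exact Or.inl (Conn.refl _ _)
  | @tail b c _ hs ih =>
    obtain ⟨z, hz, hl⟩ := hs
    rcases ih with ih | ih
    · by_cases hF : F b
      · exact Or.inr ⟨b, hF, ih⟩
      · exact Or.inl (ih.trans (Conn.of_lnk ⟨hz, hB _ hF _ _ hl⟩ hl))
    · exact Or.inr ih

lemma Conn.last_cell {O : Set ℤ²} {u v : ℤ²} (h : Conn O u v) (hne : u ≠ v) :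
    ∃ z ∈ O, ∃ a, Lnk z a v := by
  rcases Relation.ReflTransGen.cases_tail h with h | ⟨c, -, z, hz, hl⟩
  · exact absurd h.symm hne
  · exact ⟨z, hz, c, hl⟩

/-- The cells of the square of half-side `n` centred at `v`. -/
def bx (v : ℤ²) (n : ℤ) : Finset ℤ² :=
  Ico (v.1 - n) (v.1 + n) ×ˢ Ico (v.2 - n) (v.2 + n)

/-- The points at sup-distance at least `n` from `v`. -/
def far (v : ℤ²) (n : ℤ) (w : ℤ²) : Prop :=
  w.1 ≤ v.1 - n ∨ v.1 + n ≤ w.1 ∨ w.2 ≤ v.2 - n ∨ v.2 + n ≤ w.2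

/-- A point of `U` is connected to a point of `F` by cells of `B`. -/
def GArm (π : ℤ) (B : Set ℤ²) (U F : ℤ² → Prop) (O : Set ℤ²) : Prop :=
  ∃ u, U u ∧ par u = π ∧ ∃ w, F w ∧ Conn (O ∩ B) u w

lemma mem_bx {v z : ℤ²} {n : ℤ} : z ∈ bx v n ↔
    v.1 - n ≤ z.1 ∧ z.1 < v.1 + n ∧ v.2 - n ≤ z.2 ∧ z.2 < v.2 + n := by
  simp only [bx, mem_product, mem_Ico]; omega

lemma lnk_mem_bx {v b c z : ℤ²} {n : ℤ} (h : ¬ far v n b) (hl : Lnk z b c) : z ∈ bx v n := by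
  unfold far Lnk at *; rw [mem_bx]; omega

lemma garm_mono (π : ℤ) (B : Set ℤ²) (U F : ℤ² → Prop) : Monotone (GArm π B U F) := by
  rintro O O' h ⟨u, hu, hp, w, hw, hc⟩
  exact ⟨u, hu, hp, w, hw, hc.mono (Set.inter_subset_inter_left _ h)⟩

lemma GArm.sub {B B' : Set ℤ²} {U U' F F' : ℤ² → Prop} {O : Set ℤ²}
    (h : GArm π B U F O) (hB : B ⊆ B') (hU : ∀ u, U u → U' u) (hF : ∀ u, F u → F' u) :
    GArm π B' U' F' O := by
  obtain ⟨u, hu, hp, w, hw, hc⟩ := h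
  exact ⟨u, hU u hu, hp, w, hF w hw, hc.mono (Set.inter_subset_inter_right _ hB)⟩

lemma garm_or {B : Set ℤ²} {U U' F : ℤ² → Prop} {O : Set ℤ²} :
    GArm π B (fun u => U u ∨ U' u) F O ↔ GArm π B U F O ∨ GArm π B U' F O := by
  unfold GArm
  constructor
  · rintro ⟨u, hu | hu, h⟩
    · exact Or.inl ⟨u, hu, h⟩
    · exact Or.inr ⟨u, hu, h⟩
  · rintro (⟨u, hu, h⟩ | ⟨u, hu, h⟩)
    · exact ⟨u, Or.inl hu, h⟩
    · exact ⟨u, Or.inr hu, h⟩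

lemma GArm.exit {B B' : Set ℤ²} {U F F' : ℤ² → Prop} {O : Set ℤ²}
    (h : GArm π B U F O) (hF : ∀ u, F u → F' u)
    (hB : ∀ b, ¬ F' b → ∀ z c, Lnk z b c → z ∈ B') : GArm π (B ∩ B') U F' O := by
  obtain ⟨u, hu, hp, w, hw, hc⟩ := h
  refine ⟨u, hu, hp, ?_⟩
  rw [← Set.inter_assoc]
  rcases hc.exit hB with h | h
  · exact ⟨w, hF w hw, h⟩
  · exact h

lemma garm_loc {B : Finset ℤ²} {U F : ℤ² → Prop} : Loc B (GArm π B U F) := by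
  rintro O O' h ⟨u, hu, hp, w, hw, hc⟩
  refine ⟨u, hu, hp, w, hw, hc.mono ?_⟩
  intro z hz
  exact ⟨(h z hz.2).1 hz.1, hz.2⟩

lemma garm_image (σ : PSym) {B B' : Set ℤ²} {U U' F F' : ℤ² → Prop}
    {O : Set ℤ²} (hπ : π = 0 ∨ π = 1) {π' : ℤ} (hπ' : π' = (π + σ.sh) % 2)
    (hB : ∀ z, σ.cell z ∈ B' ↔ z ∈ B) (hU : ∀ u, U' (σ.pt u) ↔ U u)
    (hF : ∀ u, F' (σ.pt u) ↔ F u) :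
    GArm π' B' U' F' (σ.cell '' O) ↔ GArm π B U F O := by
  have e : σ.cell '' O ∩ B' = σ.cell '' (O ∩ B) := by
    ext z
    constructor
    · rintro ⟨⟨z, hz, rfl⟩, h2⟩
      exact ⟨z, ⟨hz, (hB z).1 h2⟩, rfl⟩
    · rintro ⟨z, ⟨hz, hz'⟩, rfl⟩
      exact ⟨⟨z, hz, rfl⟩, (hB z).2 hz'⟩
  unfold GArm
  rw [e, ← σ.pt.exists_congr_right]
  refine exists_congr fun u => ?_
  rw [hU u, ← σ.pt.exists_congr_right]
  refine and_congr_right fun _ => and_congr ?_ (exists_congr fun w => ?_)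
  · rw [σ.par_pt, hπ']
    have := par_zero_or_one u
    omega
  · rw [hF w, σ.conn_image]

lemma pp_garm_image (σ : PSym) (hπ : π = 0 ∨ π = 1) {π' : ℤ} (hπ' : π' = (π + σ.sh) % 2)
    (hx : 0 < x) (hq : 1 ≤ q) (hD : ∀ z, σ.cell z ∈ D' ↔ z ∈ D)
    (hζ : ∀ z, z ∉ D → (σ.cell z ∈ ζ' ↔ z ∈ ζ)) {B B' : Set ℤ²} {U U' F F' : ℤ² → Prop}
    (hB : ∀ z, σ.cell z ∈ B' ↔ z ∈ B) (hU : ∀ u, U' (σ.pt u) ↔ U u)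
    (hF : ∀ u, F' (σ.pt u) ↔ F u) :
    PP π' D' ζ' x q (GArm π' B' U' F') = PP π D ζ x q (GArm π B U F) := by
  rw [σ.pp hπ hπ' hx hq hD hζ]
  exact pp_congr fun O _ => garm_image σ hπ hπ' hB hU hF

/-- Events in disjoint boxes are negatively controlled by wired boxes. -/
lemma pp_two_boxes (hπ : π = 0 ∨ π = 1) (hx : 0 < x) (hq : 1 ≤ q) {b b' : Finset ℤ²}
    (hb : b ⊆ D) (hb' : b' ⊆ D) (hd : Disjoint b b') (h1 : ∀ z, z ∉ b → (z ∈ D ∨ z ∈ ζ) → z ∈ ζ')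
    (h2 : ∀ z, z ∉ b' → (z ∈ D ∨ z ∈ ζ) → z ∈ ζ')
    {A A' : Set ℤ² → Prop} (hA : Monotone A) (hA' : Monotone A') (hl : Loc b' A') :
    PP π D ζ x q (fun O => A O ∧ A' O) ≤ PP π b ζ' x q A * PP π b' ζ' x q A' := by
  have e1 := pp_md_upper (π := π) (D := D) (D' := b) (ζ := ζ) (ζ' := ζ') (A := A)
    (A' := A) (B := A') hπ hx hq hb le_rfl hA
    (fun O O' h => hl O O' fun z hz => (h z (disjoint_right.1 hd hz)).symm)
    (fun O hO _ => by
      have hsub : O ⊆ glue b ζ' O := by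
        intro z hz
        rw [mem_glue]
        have := hO z; have := h1 z; tauto
      exact ⟨fun h => hA hsub h, fun e _ _ hc => hc.mono hsub⟩)
  refine e1.trans (mul_le_mul_of_nonneg_left ?_ (pp_nonneg hπ hx hq _))
  exact pp_shrink hπ hx hq hb' le_rfl hA' h2

/-- The wired probability that the origin is connected to distance `n`. -/
def theta (n : ℤ) (x q : ℝ) : ℝ :=
  PP 0 (bx (0, 0) n) Set.univ x q
    (GArm 0 (bx (0, 0) n : Finset ℤ²) (fun u => u = (0, 0)) (far (0, 0) n))

lemma pp_reach_eq (hx : 0 < x) (hq : 1 ≤ q) {v : ℤ²} (hv : par v = π) (n : ℤ) :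
    PP π (bx v n) Set.univ x q
      (GArm π (bx v n : Finset ℤ²) (fun u => u = v) (far v n)) = theta n x q := by
  unfold theta
  refine pp_garm_image (PSym.shift v) (Or.inl rfl) ?_ hx hq ?_ ?_ ?_ ?_ ?_
  · rw [PSym.shift_sh]; unfold par at *; omega
  · intro z; rw [PSym.shift_cell, mem_bx, mem_bx]; simp only [Prod.fst_add, Prod.snd_add]; omega
  · simp
  · intro z
    rw [PSym.shift_cell, mem_coe, mem_coe, mem_bx, mem_bx]
    simp only [Prod.fst_add, Prod.snd_add]; omega
  · intro u
    obtain ⟨a, b⟩ := u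
    obtain ⟨c, d⟩ := v
    rw [PSym.shift_pt]; simp only [Prod.mk_add_mk, Prod.mk.injEq]; omega
  · intro u
    rw [PSym.shift_pt]; unfold far; simp only [Prod.fst_add, Prod.snd_add]; omega

lemma exists_sub_bx (D : Finset ℤ²) (v : ℤ²) (m : ℕ) : ∃ N : ℕ, m ≤ N ∧ D ⊆ bx v N := by
  refine ⟨m + ∑ z ∈ D, ((z.1 - v.1).natAbs + (z.2 - v.2).natAbs + 1), by omega, fun z hz => ?_⟩
  have := single_le_sum (f := fun z : ℤ² =>
    (z.1 - v.1).natAbs + (z.2 - v.2).natAbs + 1) (fun _ _ => Nat.zero_le _) hz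
  rw [mem_bx]; omega

/-- Every wired domain connects a point to the boundary of a box with probability at least
the limit of `theta`. -/
lemma le_pp_reach (hπ : π = 0 ∨ π = 1) (hx : 0 < x) (hq : 1 ≤ q) {θ : ℝ}
    (hθ : ∀ n : ℕ, θ ≤ theta n x q) (D : Finset ℤ²) {v : ℤ²} (hv : par v = π) (n : ℤ) :
    θ ≤ PP π D Set.univ x q
      (GArm π (bx (0, 0) n : Finset ℤ²) (fun u => u = v) (far (0, 0) n)) := by
  obtain ⟨N, hN, hsub⟩ := exists_sub_bx D v (n.natAbs + v.1.natAbs + v.2.natAbs)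
  calc θ ≤ theta N x q := hθ N
    _ = _ := (pp_reach_eq hx hq hv N).symm
    _ ≤ PP π (bx v N) Set.univ x q
      (GArm π (bx (0, 0) n : Finset ℤ²) (fun u => u = v) (far (0, 0) n)) := by
        refine pp_mono hπ hx hq fun O _ h => ?_
        refine (h.exit (F' := far (0, 0) n) (B' := (bx (0, 0) n : Finset ℤ²)) ?_ ?_).sub
          Set.inter_subset_right (fun _ h => h) (fun _ h => h)
        · intro u hu
          unfold far at *; simp only; omega
        · exact fun b hb z c hl => lnk_mem_bx hb hl
    _ ≤ _ := pp_shrink hπ hx hq hsub le_rfl (garm_mono _ _ _ _) (by simp)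

/-- The boundary points of a centred square. -/
def rim (m : ℤ) (u : ℤ²) : Prop :=
  far (0, 0) m u ∧ -m ≤ u.1 ∧ u.1 ≤ m ∧ -m ≤ u.2 ∧ u.2 ≤ m

/-- The cells of a centred annulus. -/
def ann (m n : ℤ) : Set ℤ² := {z | z ∈ bx (0, 0) n ∧ z ∉ bx (0, 0) m}

lemma mem_ann {m n : ℤ} {z : ℤ²} : z ∈ ann m n ↔ z ∈ bx (0, 0) n ∧ z ∉ bx (0, 0) m := Iff.rfl

lemma garm_rim {m n : ℤ} (hmn : m < n) {U : ℤ² → Prop} {O : Set ℤ²}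
    (hU : ∀ u, U u → ¬ far (0, 0) m u)
    (h : GArm π (bx (0, 0) n : Finset ℤ²) U (far (0, 0) n) O) :
    GArm π (ann m n) (rim m) (far (0, 0) n) O := by
  obtain ⟨v, hv, hp, w, hw, hc⟩ := h
  have hwp : par w = π := hc.par_eq.symm.trans hp
  have hOb : (O ∩ ↑(bx (0, 0) n)) \ ↑(bx (0, 0) m) ⊆ O ∩ ann m n :=
    fun z hz => ⟨hz.1.1, hz.1.2, hz.2⟩
  rcases hc.symm.avoid_or (↑(bx (0, 0) m) : Set ℤ²) hwp with h | ⟨z, hz, v', hv', h⟩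
  · exfalso
    have hne : w ≠ v := by
      rintro rfl
      have := hU _ hv
      unfold far at *; omega
    obtain ⟨z, hz, a, hl⟩ := h.last_cell hne
    exact hz.2 (lnk_mem_bx (hU v hv) hl.symm)
  · have hcl := near_of_corner hv'
    rw [mem_coe, mem_bx] at hz
    simp only at hz
    have hne : w ≠ v' := by
      rintro rfl
      unfold far at *; simp only at *; omega
    refine ⟨v', ⟨?_, ?_⟩, h.par_eq.symm.trans hwp, w, hw, (h.mono hOb).symm⟩
    · obtain ⟨z', hz', a, hl⟩ := h.last_cell hne
      by_contra hf
      exact hz'.2 (lnk_mem_bx hf hl.symm)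
    · omega

lemma exists_scale {f : ℕ → ℝ} {ε₀ ε : ℝ} (hε₀ : 0 < ε₀) (hf : ∀ n, ε₀ ≤ f n) (hε : 0 < ε) :
    ∃ (θ : ℝ) (l M : ℕ), 0 < θ ∧ (∀ n, θ ≤ f n) ∧ f l ^ 2 / θ ^ 2 - 1 < ε / 2 ∧ 1 ≤ M * θ ∧
      1 / (M * θ) ≤ ε / 2 := by
  have hbdd : BddBelow (Set.range f) := ⟨ε₀, by rintro _ ⟨n, rfl⟩; exact hf n⟩
  set θ := ⨅ n, f n
  have hθ0 : 0 < θ := hε₀.trans_le (le_ciInf hf)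
  have hθn : ∀ n, θ ≤ f n := ciInf_le hbdd
  have hcont : Tendsto (fun t : ℝ => t ^ 2 / θ ^ 2 - 1) (nhds θ) (nhds (θ ^ 2 / θ ^ 2 - 1)) :=
    Continuous.tendsto (by fun_prop) θ
  rw [div_self (by positivity), sub_self] at hcont
  obtain ⟨δ, hδ, h⟩ := Metric.eventually_nhds_iff.1 (hcont.eventually (gt_mem_nhds (half_pos hε)))
  obtain ⟨l, hl⟩ := exists_lt_of_ciInf_lt (lt_add_of_pos_right θ hδ)
  obtain ⟨M, hM⟩ := exists_nat_gt (max (1 / θ) (2 / (ε * θ)))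
  have hM1 : 1 ≤ M * θ := (div_le_iff₀ hθ0).1 ((le_max_left _ _).trans hM.le)
  refine ⟨θ, l, M, hθ0, hθn, h ?_, hM1, ?_⟩
  · rw [Real.dist_eq, abs_lt]
    constructor <;> linarith [hθn l]
  · have := (le_max_right _ _).trans hM.le
    rw [div_le_iff₀ (by positivity)] at this
    rw [div_le_iff₀ (by linarith)]
    linarith

lemma mul_succ_le_or (l : ℕ) {i j : ℕ} (h : i ≠ j) :
    (l : ℤ) * i + l ≤ l * j ∨ (l : ℤ) * j + l ≤ l * i := by
  rcases lt_or_gt_of_ne h with h | h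
  · exact Or.inl (by exact_mod_cast Nat.mul_le_mul_left l h)
  · exact Or.inr (by exact_mod_cast Nat.mul_le_mul_left l h)

/-- In the percolating phase, large boxes are connected to distance `n` with large probability. -/
lemma le_pp_garm_rim (hπ : π = 0 ∨ π = 1) (hx : 0 < x) (hq : 1 ≤ q) {ε₀ ε : ℝ} (hε₀ : 0 < ε₀)
    (hθ : ∀ n : ℕ, ε₀ ≤ theta n x q) (hε : 0 < ε) :
    ∃ m₀ : ℤ, 0 < m₀ ∧ ∀ m n : ℤ, m₀ ≤ m → m < n → ∀ D,
      1 - ε ≤ PP π D Set.univ x q (GArm π (ann m n) (rim m) (far (0, 0) n)) := by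
  obtain ⟨θ, l, M, hθ0, hθn, hl, hM1, hM2⟩ := exists_scale hε₀ hθ hε
  set v : ℕ → ℤ² := fun j => (2 * (l * j) + π, 0) with hv
  have hvp : ∀ j, par (v j) = π := by intro j; simp only [hv, par]; omega
  have hvM : ∀ j < M, (l : ℤ) * j ≤ l * M := fun j hj => by
    have : (j : ℤ) ≤ M := by exact_mod_cast hj.le
    exact mul_le_mul_of_nonneg_left this (by positivity)
  have hv0 : ∀ j : ℕ, 0 ≤ (l : ℤ) * j := fun j => by positivity
  refine ⟨2 * (l * M) + 2 + l, by positivity, fun m n hm hmn D => ?_⟩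
  set F : ℕ → Set ℤ² → Prop := fun j =>
    GArm π (bx (0, 0) n : Finset ℤ²) (fun u => u = v j) (far (0, 0) n) with hF
  set E : ℕ → Set ℤ² → Prop := fun j =>
    GArm π (bx (v j) l : Finset ℤ²) (fun u => u = v j) (far (v j) l) with hE
  set D' := D ∪ (range M).biUnion fun j => bx (v j) l with hD'
  have hbD : ∀ j ∈ range M, bx (v j) l ⊆ D' := fun j hj =>
    (subset_biUnion_of_mem (fun j => bx (v j) l) hj).trans subset_union_right
  have hFE : ∀ j ∈ range M, ∀ O, F j O → E j O := by
    intro j hj O h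
    have h1 := hvM j (mem_range.1 hj)
    have h2 := hv0 j
    refine (h.exit (F' := far (v j) l) (B' := (bx (v j) l : Finset ℤ²)) ?_
      (fun b hb z c hl => lnk_mem_bx hb hl)).sub
      Set.inter_subset_right (fun _ h => h) (fun _ h => h)
    intro u hu
    simp only [hv, far] at *
    omega
  have hcheb := pp_second_moment (D := D') (ζ := Set.univ) hπ hx hq (range M) F hθ0
    (sq_nonneg (theta l x q)) (by simpa using hM1)
    (fun j _ => le_pp_reach hπ hx hq hθn D' (hvp j) n) (fun i hi j hj hij => by
      refine (pp_mono (B := fun O => E i O ∧ E j O) hπ hx hq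
        fun O _ h => ⟨hFE i hi O h.1, hFE j hj O h.2⟩).trans ?_
      have := pp_two_boxes (π := π) (D := D') (ζ := Set.univ) (ζ' := Set.univ) hπ hx hq (hbD i hi)
        (hbD j hj) ?_ (by simp) (by simp) (garm_mono π (bx (v i) l : Finset ℤ²) (fun u => u = v i) (far (v i) l))
        (garm_mono π (bx (v j) l : Finset ℤ²) (fun u => u = v j) (far (v j) l)) garm_loc
      · rw [pp_reach_eq hx hq (hvp i), pp_reach_eq hx hq (hvp j), ← sq] at this
        exact this
      · rw [disjoint_left]
        intro z hz1 hz2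
        rw [mem_bx] at hz1 hz2
        simp only [hv] at hz1 hz2
        rcases mul_succ_le_or l hij with h | h <;> omega)
  rw [card_range] at hcheb
  have h3 : 1 - ε ≤ PP π D' Set.univ x q (fun O => ¬ ∀ j ∈ range M, ¬ F j O) := by
    rw [pp_not hπ hx hq (fun O => ∀ j ∈ range M, ¬ F j O)]; linarith
  refine h3.trans ((pp_mono hπ hx hq fun O _ h => ?_).trans
    (pp_shrink hπ hx hq subset_union_left le_rfl (garm_mono _ _ _ _) (by simp)))
  push Not at h
  obtain ⟨j, hj, h⟩ := h
  have h1 := hvM j (mem_range.1 hj)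
  have h2 := hv0 j
  refine garm_rim hmn ?_ h
  rintro u rfl
  simp only [hv, far]
  omega

/-- Symmetries preserving the centred squares. -/
def PSym.Central (σ : PSym) : Prop :=
  σ.sh = 0 ∧ (∀ k z, σ.cell z ∈ bx (0, 0) k ↔ z ∈ bx (0, 0) k) ∧
    ∀ k w, far (0, 0) k (σ.pt w) ↔ far (0, 0) k w

lemma PSym.central_reflX : (PSym.reflX 0).Central := by
  refine ⟨PSym.reflX_sh 0, fun k z => ?_, fun k z => ?_⟩
  · rw [PSym.reflX_cell, mem_bx, mem_bx]; simp only; omega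
  · rw [PSym.reflX_pt]; unfold far; simp only; omega

lemma PSym.central_reflY : (PSym.reflY 0).Central := by
  refine ⟨PSym.reflY_sh 0, fun k z => ?_, fun k z => ?_⟩
  · rw [PSym.reflY_cell, mem_bx, mem_bx]; simp only; omega
  · rw [PSym.reflY_pt]; unfold far; simp only; omega

lemma PSym.central_swap : PSym.swap.Central := by
  refine ⟨PSym.swap_sh, fun k z => ?_, fun k z => ?_⟩
  · rw [PSym.swap_cell, mem_bx, mem_bx]; simp only; omega
  · rw [PSym.swap_pt]; unfold far; simp only; omega

lemma pp_arm_central {σ : PSym} (hσ : σ.Central) (hπ : π = 0 ∨ π = 1) (hx : 0 < x) (hq : 1 ≤ q)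
    {K m n : ℤ} {U U' : ℤ² → Prop} (hU : ∀ u, U' (σ.pt u) ↔ U u) :
    PP π (bx (0, 0) K) Set.univ x q (GArm π (ann m n) U' (far (0, 0) n)) =
      PP π (bx (0, 0) K) Set.univ x q (GArm π (ann m n) U (far (0, 0) n)) := by
  refine pp_garm_image σ hπ ?_ hx hq (hσ.2.1 K) (by simp) ?_ hU (hσ.2.2 n)
  · rw [hσ.1]; omega
  · intro z
    rw [mem_ann, mem_ann, hσ.2.1, hσ.2.1]

lemma pp_arm_half {σ : PSym} (hσ : σ.Central) (hπ : π = 0 ∨ π = 1) (hx : 0 < x) (hq : 1 ≤ q)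
    {K m n : ℤ} {U U' V : ℤ² → Prop} (hU : ∀ u, U' (σ.pt u) ↔ U u) (hV : ∀ u, V u → U u ∨ U' u)
    {ε : ℝ} (hε : 0 ≤ ε)
    (h : 1 - ε ^ 2 ≤ PP π (bx (0, 0) K) Set.univ x q (GArm π (ann m n) V (far (0, 0) n))) :
    1 - ε ≤ PP π (bx (0, 0) K) Set.univ x q (GArm π (ann m n) U (far (0, 0) n)) := by
  refine pp_sq_trick hπ hx hq (garm_mono _ _ _ _) (garm_mono _ _ U' (far (0, 0) n))
    (pp_arm_central hσ hπ hx hq hU) hε (h.trans (pp_mono hπ hx hq fun O _ h => ?_))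
  exact garm_or.1 (h.sub subset_rfl hV fun _ h => h)

def sideTL (m : ℤ) (u : ℤ²) : Prop := u.2 = m ∧ -m ≤ u.1 ∧ u.1 ≤ 0
def sideTR (m : ℤ) (u : ℤ²) : Prop := u.2 = m ∧ 0 ≤ u.1 ∧ u.1 ≤ m
def sideBL (m : ℤ) (u : ℤ²) : Prop := u.2 = -m ∧ -m ≤ u.1 ∧ u.1 ≤ 0
def sideBR (m : ℤ) (u : ℤ²) : Prop := u.2 = -m ∧ 0 ≤ u.1 ∧ u.1 ≤ m
def sideRT (m : ℤ) (u : ℤ²) : Prop := u.1 = m ∧ 0 ≤ u.2 ∧ u.2 ≤ m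
def sideRB (m : ℤ) (u : ℤ²) : Prop := u.1 = m ∧ -m ≤ u.2 ∧ u.2 ≤ 0

/-- In the percolating phase each half-side of a large box is connected to distance `n` with large
probability. -/
lemma le_pp_arms (hπ : π = 0 ∨ π = 1) (hx : 0 < x) (hq : 1 ≤ q) {ε₀ ε : ℝ} (hε₀ : 0 < ε₀)
    (hθ : ∀ n : ℕ, ε₀ ≤ theta n x q) (hε : 0 < ε) :
    ∃ m₀ : ℤ, 0 < m₀ ∧ ∀ m n : ℤ, m₀ ≤ m → m < n → ∀ D, ∀ U ∈ ({sideTL m, sideTR m, sideBL m,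
      sideBR m, sideRT m, sideRB m} : Set (ℤ² → Prop)),
      1 - ε ≤ PP π D Set.univ x q (GArm π (ann m n) U (far (0, 0) n)) := by
  obtain ⟨m₀, hm₀, h⟩ := le_pp_garm_rim hπ hx hq hε₀ hθ (pow_pos hε 8)
  refine ⟨m₀, hm₀, fun m n hm hmn D U hU => ?_⟩
  obtain ⟨K, hK⟩ : ∃ K : ℕ, D ⊆ bx (0, 0) K := by
    refine ⟨∑ z ∈ D, (z.1.natAbs + z.2.natAbs + 1), fun z hz => ?_⟩
    have := single_le_sum (f := fun z : ℤ² =>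
      z.1.natAbs + z.2.natAbs + 1) (fun _ _ => Nat.zero_le _) hz
    rw [mem_bx]; omega
  refine le_trans ?_ (pp_shrink (ζ := Set.univ) hπ hx hq hK le_rfl (garm_mono _ _ _ _) (by simp))
  have h8 := h m n hm hmn (bx (0, 0) K)
  have e8 : ε ^ 8 = ((ε ^ 2) ^ 2) ^ 2 := by ring
  rw [e8] at h8
  have h4 := pp_arm_half (U := fun u => (u.2 = m ∨ u.2 = -m) ∧ -m ≤ u.1 ∧ u.1 ≤ m)
    (U' := fun u => (u.1 = m ∨ u.1 = -m) ∧ -m ≤ u.2 ∧ u.2 ≤ m) PSym.central_swap hπ hx hq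
    (fun u => by rw [PSym.swap_pt]) (fun u hu => by unfold rim far at hu; simp only at *; omega)
    (by positivity) h8
  have h2 := pp_arm_half (U := fun u => u.2 = m ∧ -m ≤ u.1 ∧ u.1 ≤ m)
    (U' := fun u => u.2 = -m ∧ -m ≤ u.1 ∧ u.1 ≤ m) PSym.central_reflY hπ hx hq
    (fun u => by rw [PSym.reflY_pt]; simp only; omega) (fun u hu => by omega)
    (by positivity) h4
  have hTL := pp_arm_half (U := sideTL m) (U' := sideTR m) PSym.central_reflX hπ hx hq
    (fun u => by rw [PSym.reflX_pt]; simp only [sideTL, sideTR]; omega)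
    (fun u hu => by unfold sideTL sideTR; omega) hε.le h2
  have hTR : 1 - ε ≤ PP π (bx (0, 0) K) Set.univ x q
      (GArm π (ann m n) (sideTR m) (far (0, 0) n)) := by
    rwa [pp_arm_central PSym.central_reflX hπ hx hq (U := sideTL m)]
    intro u; rw [PSym.reflX_pt]; simp only [sideTL, sideTR]; omega
  rcases hU with rfl | rfl | rfl | rfl | rfl | rfl
  · exact hTL
  · exact hTR
  · rwa [pp_arm_central PSym.central_reflY hπ hx hq (U := sideTL m)]
    intro u; rw [PSym.reflY_pt]; simp only [sideTL, sideBL]; omega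
  · rwa [pp_arm_central PSym.central_reflY hπ hx hq (U := sideTR m)]
    intro u; rw [PSym.reflY_pt]; simp only [sideTR, sideBR]; omega
  · rwa [pp_arm_central PSym.central_swap hπ hx hq (U := sideTR m)]
    intro u; rw [PSym.swap_pt]; simp only [sideTR, sideRT]
  · rwa [pp_arm_central PSym.central_swap hπ hx hq (U := sideTL m)]
    intro u; rw [PSym.swap_pt]; simp only [sideTL, sideRB]

/-- Points outside a rectangle are connected by the cells outside this rectangle. -/
lemma conn_outside {O : Set ℤ²} {a b c d : ℤ}
    (h : ∀ z : ℤ², (z.1 < a ∨ b ≤ z.1 ∨ z.2 < c ∨ d ≤ z.2) → z ∈ O)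
    {w w' : ℤ²} (hw : w.1 ≤ a ∨ b ≤ w.1 ∨ w.2 ≤ c ∨ d ≤ w.2)
    (hw' : w'.1 ≤ a ∨ b ≤ w'.1 ∨ w'.2 ≤ c ∨ d ≤ w'.2) (hp : par w = par w') : Conn O w w' := by
  have hex : ∀ u v : ℤ, ∃ δ : ℤ, (δ = 0 ∨ δ = 1) ∧ (u + δ + v) % 2 = par w := by
    intro u v
    have := par_zero_or_one w
    by_cases hh : (u + v) % 2 = par w
    · exact ⟨0, by omega, by omega⟩
    · exact ⟨1, by omega, by omega⟩
  obtain ⟨δ, hδ, hδp⟩ := hex (a - 2) (c - 1)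
  set p : ℤ² := (a - 2 + δ, c - 1) with hpdef
  have hpp : par p = par w := by simpa only [par, hpdef] using hδp
  have key : ∀ u : ℤ², par u = par w → (u.1 ≤ a ∨ b ≤ u.1 ∨ u.2 ≤ c ∨ d ≤ u.2) →
      Conn O u p := by
    intro u hu hcase
    set N := |u.1| + |u.2| + |a| + |b| + |c| + |d| + 5 with hN
    have hu1 : -N ≤ u.1 - 5 ∧ u.1 + 5 ≤ N ∧ -N ≤ u.2 - 5 ∧ u.2 + 5 ≤ N := by
      have := neg_abs_le u.1; have := le_abs_self u.1; have := neg_abs_le u.2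
      have := le_abs_self u.2; have := abs_nonneg a; have := abs_nonneg b
      have := abs_nonneg c; have := abs_nonneg d; have := abs_nonneg u.1; have := abs_nonneg u.2
      omega
    have hab : -N ≤ a - 5 ∧ a + 5 ≤ N ∧ -N ≤ b - 5 ∧ b + 5 ≤ N ∧ -N ≤ c - 5 ∧ c + 5 ≤ N ∧
        -N ≤ d - 5 ∧ d + 5 ≤ N := by
      have := neg_abs_le a; have := le_abs_self a; have := neg_abs_le b
      have := le_abs_self b; have := neg_abs_le c; have := le_abs_self c
      have := neg_abs_le d; have := le_abs_self d
      have := abs_nonneg a; have := abs_nonneg b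
      have := abs_nonneg c; have := abs_nonneg d; have := abs_nonneg u.1; have := abs_nonneg u.2
      omega
    clear_value N
    have hL : ∀ v v' : ℤ², par v = par v' → v.1 ≤ a → v'.1 ≤ a → -N ≤ v.1 → -N ≤ v'.1 →
        -N ≤ v.2 → -N ≤ v'.2 → v.2 ≤ N → v'.2 ≤ N → Conn O v v' := by
      intro v v' hv h1 h2 h3 h4 h5 h6 h7 h8
      exact conn_rect (a := -N) (b := a) (c := -N) (d := N) (by omega)
        (fun x y _ hx _ _ => h _ (Or.inl hx)) h3 h1 h5 h7 h4 h2 h6 h8 (by omega) hv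
    have hB : ∀ v v' : ℤ², par v = par v' → v.2 ≤ c → v'.2 ≤ c → -N ≤ v.1 → -N ≤ v'.1 →
        -N ≤ v.2 → -N ≤ v'.2 → v.1 ≤ N → v'.1 ≤ N → Conn O v v' := by
      intro v v' hv h1 h2 h3 h4 h5 h6 h7 h8
      exact conn_rect (a := -N) (b := N) (c := -N) (d := c) (by omega)
        (fun x y _ _ _ hy => h _ (Or.inr (Or.inr (Or.inl hy)))) h3 h7 h5 h1 h4 h8 h6 h2
        (by omega) hv
    rcases hcase with hc | hc | hc | hc
    · exact hL u p (by omega) hc (by simp only [hpdef]; omega) (by omega)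
        (by simp only [hpdef]; omega) (by omega) (by simp only [hpdef]; omega) (by omega)
        (by simp only [hpdef]; omega)
    · obtain ⟨η, hη, hηp⟩ := hex (b + 1) (c - 1)
      set r : ℤ² := (b + 1 + η, c - 1) with hr
      have hrp : par r = par w := by simpa only [par, hr] using hηp
      refine Conn.trans (b := r) ?_ (hB r p (by omega) ?_ ?_ ?_ ?_ ?_ ?_ ?_ ?_)
      · exact conn_rect (a := b) (b := N) (c := -N) (d := N) (by omega)
          (fun x y hx _ _ _ => h _ (Or.inr (Or.inl hx))) hc (by omega) (by omega) (by omega)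
          (by simp only [hr]; omega) (by simp only [hr]; omega) (by simp only [hr]; omega)
          (by simp only [hr]; omega) (by omega) (by omega)
      all_goals simp only [hr, hpdef]; omega
    · exact hB u p (by omega) hc (by simp only [hpdef]; omega) (by omega)
        (by simp only [hpdef]; omega) (by omega) (by simp only [hpdef]; omega) (by omega)
        (by simp only [hpdef]; omega)
    · obtain ⟨η, hη, hηp⟩ := hex (a - 2) (d + 1)
      set r : ℤ² := (a - 2 + η, d + 1) with hr
      have hrp : par r = par w := by simpa only [par, hr] using hηp
      refine Conn.trans (b := r) ?_ (hL r p (by omega) ?_ ?_ ?_ ?_ ?_ ?_ ?_ ?_)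
      · exact conn_rect (a := -N) (b := N) (c := d) (d := N) (by omega)
          (fun x y _ _ hy _ => h _ (Or.inr (Or.inr (Or.inr hy)))) (by omega) (by omega) hc (by omega)
          (by simp only [hr]; omega) (by simp only [hr]; omega) (by simp only [hr]; omega)
          (by simp only [hr]; omega) (by omega) (by omega)
      all_goals simp only [hr, hpdef]; omega
  exact (key w rfl hw).trans (key w' hp.symm hw').symm

lemma conn_compl_bx {v : ℤ²} {n : ℤ} {w w' : ℤ²} (hw : far v n w) (hw' : far v n w')
    (hp : par w = par w') : Conn (↑(bx v n) : Set ℤ²)ᶜ w w' := by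
  refine conn_outside (a := v.1 - n) (b := v.1 + n) (c := v.2 - n) (d := v.2 + n) ?_ hw hw' hp
  intro z hz
  rw [Set.mem_compl_iff, mem_coe, mem_bx]; omega

lemma far_bx (v : ℤ²) (n : ℤ) : Far (bx v n) ∅ := by
  refine ⟨∅, Set.finite_empty, fun a b z z' ha hb _ _ _ hz _ hz' haz hbz => ?_⟩
  have h1 := near_of_corner haz
  have h2 := near_of_corner hbz
  rw [Set.empty_union]
  rw [mem_bx] at hz hz'
  refine conn_compl_bx ?_ ?_ (ha.trans hb.symm)
  · unfold far; omega
  · unfold far; omega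

/-- Increments of a potential along a horizontal line of cells. -/
lemma zig_row {s c : ℤ² → ZMod 2} {y w : ℤ} (hw : w = y ∨ w = y + 1) {t : ℤ} (n : ℕ)
    (ht : par (t, w) = 0)
    (hs : ∀ x, t ≤ x → x < t + 2 * n → ∀ a b, Lnk (x, y) a b → par a = 0 → s a + s b = c (x, y)) :
    s (t, w) + s (t + 2 * n, w) = ∑ x ∈ Ico t (t + 2 * n), c (x, y) := by
  have h0 : ∀ z : ZMod 2, z + z = 0 := by decide
  induction n with
  | zero => simp [h0]
  | succ n ih =>
    have ih := ih fun x h1 h2 => hs x h1 (by push_cast; omega)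
    have e : Ico t (t + 2 * ((n + 1 : ℕ) : ℤ)) =
        insert (t + 2 * n + 1) (insert (t + 2 * (n : ℤ)) (Ico t (t + 2 * n))) := by
      ext z; simp only [mem_insert, mem_Ico]; push_cast; omega
    rw [e, sum_insert (by simp), sum_insert (by simp), ← ih]
    set u : ℤ := 2 * y + 1 - w with hu
    have hp : (t + w) % 2 = 0 := ht
    have h1 := hs (t + 2 * n) (by omega) (by push_cast; omega) (t + 2 * n, w) (t + 2 * n + 1, u)
      (by simp only [Lnk, hu, and_self, true_or, true_and]; omega) (by show (t + 2 * n + w) % 2 = 0; omega)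
    have h2 := hs (t + 2 * n + 1) (by omega) (by push_cast; omega)
      (t + 2 * ((n + 1 : ℕ) : ℤ), w) (t + 2 * n + 1, u)
      (by simp only [Lnk, hu, true_and]; push_cast; omega)
      (by show (t + 2 * ((n + 1 : ℕ) : ℤ) + w) % 2 = 0; push_cast; omega)
    rw [← h1, ← h2]
    linear_combination -h0 (s (t + 2 * n, w)) - h0 (s (t + 2 * n + 1, u))

/-- Increments of a potential along a vertical line of cells. -/
lemma zig_col {s c : ℤ² → ZMod 2} {x w : ℤ} (hw : w = x ∨ w = x + 1) {t : ℤ} (n : ℕ)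
    (ht : par (w, t) = 0)
    (hs : ∀ y, t ≤ y → y < t + 2 * n → ∀ a b, Lnk (x, y) a b → par a = 0 → s a + s b = c (x, y)) :
    s (w, t) + s (w, t + 2 * n) = ∑ y ∈ Ico t (t + 2 * n), c (x, y) := by
  have := zig_row (s := s ∘ Prod.swap) (c := c ∘ Prod.swap) hw n (t := t)
    (by unfold par at *; simp only at *; omega) (fun y h1 h2 a b hl ha =>
      hs y h1 h2 a.swap b.swap (by unfold Lnk at *; simp only [Prod.fst_swap, Prod.snd_swap]; tauto)
        (by unfold par at *; simp only [Prod.fst_swap, Prod.snd_swap]; omega))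
  exact this

lemma sum_one_row (e : ℤ²) (y t t' : ℤ) :
    ∑ x ∈ Ico t t', one e (x, y) = if e.2 = y ∧ t ≤ e.1 ∧ e.1 < t' then 1 else 0 := by
  obtain ⟨e1, e2⟩ := e
  by_cases h : e2 = y
  · subst h
    have : ∀ x, one (e1, e2) (x, e2) = if x = e1 then (1 : ZMod 2) else 0 := by
      intro x; simp [one]
    simp only [this, sum_ite_eq', mem_Ico, true_and]
  · rw [if_neg (by tauto)]
    refine sum_eq_zero fun x _ => if_neg ?_
    simp only [Prod.mk.injEq]; exact fun hh => h hh.2.symm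

lemma sum_one_col (e : ℤ²) (x t t' : ℤ) :
    ∑ y ∈ Ico t t', one e (x, y) = if e.1 = x ∧ t ≤ e.2 ∧ e.2 < t' then 1 else 0 := by
  have := sum_one_row e.swap x t t'
  simp only [Prod.fst_swap, Prod.snd_swap] at this
  rw [← this]
  refine sum_congr rfl fun y _ => ?_
  obtain ⟨e1, e2⟩ := e
  simp only [one, Prod.swap, Prod.mk.injEq, and_comm]

lemma bd_one_of_lnk {z y b f : ℤ²} {π : ℤ} (hl : Lnk z b f) (hb : par b = π)
    (hy : par y = π) : bd (one z) y = one b y + one f y := by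
  rw [bd_one z y hy]
  rcases hl.eq_or hb with ⟨h1, h2⟩ | ⟨h1, h2⟩
  · rw [h1, h2]
  · rw [h1, h2, add_comm]

/-- The potential of the loop formed by two dual arms of an annulus and a path in the inner box. -/
lemma rim_potential {m n : ℤ} (hm : 2 ≤ m) (hmn : m < n) {O : Set ℤ²}
    {b₁ b₂ e₁ e₂ f₁ f₂ w₁ w₂ : ℤ²} (hb₁ : par b₁ = 1) (hb₂ : par b₂ = 1)
    (hc₁ : Conn (Oᶜ ∩ ann m n) b₁ w₁) (hc₂ : Conn (Oᶜ ∩ ann m n) b₂ w₂)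
    (hw₁ : far (0, 0) n w₁) (hw₂ : far (0, 0) n w₂)
    (he₁ : e₁ ∈ bx (0, 0) m) (he₂ : e₂ ∈ bx (0, 0) m) (hl₁ : Lnk e₁ b₁ f₁) (hl₂ : Lnk e₂ b₂ f₂)
    (hf₁ : -m < f₁.1 ∧ f₁.1 < m ∧ -m < f₁.2 ∧ f₁.2 < m)
    (hf₂ : -m < f₂.1 ∧ f₂.1 < m ∧ -m < f₂.2 ∧ f₂.2 < m) :
    ∃ s c : ℤ² → ZMod 2, (∀ a a', par a = 0 → Conn (O ∩ ann m n) a a' → s a = s a') ∧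
      (∀ z a b, Lnk z a b → par a = 0 → s a + s b = c z) ∧
      ∀ z ∈ bx (0, 0) m, z ∉ bx (0, 0) (m - 1) → c z = one e₁ z + one e₂ z := by
  set P : Set ℤ² := (Oᶜ ∩ ann m n) ∪ (↑(bx (0, 0) n) : Set ℤ²)ᶜ with hP
  have hww : par w₁ = par w₂ := by rw [← hc₁.par_eq, ← hc₂.par_eq, hb₁, hb₂]
  have hconn : Conn P b₁ b₂ := (hc₁.mono Set.subset_union_left).trans
    (((conn_compl_bx hw₁ hw₂ hww).mono Set.subset_union_right).trans
      (hc₂.mono Set.subset_union_left).symm)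
  obtain ⟨c₁, hc₁P, hc₁b⟩ := Conn.exists_chain hb₁ hconn
  have hf₁p : par f₁ = 1 := hl₁.par_eq.symm.trans hb₁
  have hf₂p : par f₂ = 1 := hl₂.par_eq.symm.trans hb₂
  have hin : Conn (↑(bx (0, 0) (m - 1)) : Set ℤ²) f₁ f₂ :=
    conn_rect (a := -(m - 1)) (b := m - 1) (c := -(m - 1)) (d := m - 1) (by omega)
      (fun x y h1 h2 h3 h4 => by rw [mem_coe, mem_bx]; simp only; omega)
      (by omega) (by omega) (by omega) (by omega) (by omega) (by omega) (by omega) (by omega)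
      (by omega) (hf₁p.trans hf₂p.symm)
  obtain ⟨c₃, hc₃P, hc₃b⟩ := Conn.exists_chain hf₁p hin
  have hc₁0 : ∀ z, z ∈ bx (0, 0) m → c₁ z = 0 := by
    intro z hz
    by_contra h
    rcases hc₁P z h with h | h
    · exact h.2.2 hz
    · refine h ?_
      rw [mem_coe]
      rw [mem_bx] at *; simp only at *; omega
  have hc₃0 : ∀ z, z ∉ bx (0, 0) (m - 1) → c₃ z = 0 := fun z hz => by
    by_contra h; exact hz (hc₃P z h)
  have h0 : ∀ z : ZMod 2, z + z = 0 := by decide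
  obtain ⟨s, hs⟩ := poincare (c := fun z => c₁ z + (one e₁ z + (one e₂ z + c₃ z))) (by
    intro y hy
    rw [bd_add, bd_add, bd_add, hc₁b y hy, hc₃b y hy, bd_one_of_lnk hl₁ hb₁ hy,
      bd_one_of_lnk hl₂ hb₂ hy]
    linear_combination h0 (one b₁ y) + h0 (one b₂ y) + h0 (one f₁ y) + h0 (one f₂ y))
  have hone : ∀ e ∈ bx (0, 0) m, ∀ z, z ∉ bx (0, 0) m → one e z = 0 := by
    intro e he z hz
    unfold one; rw [if_neg]; rintro rfl; exact hz he
  refine ⟨s, _, fun a a' ha h => const_of_conn hs ?_ ha h, hs, fun z hz hz' => ?_⟩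
  · intro z hz
    have h1 : c₁ z = 0 := by
      by_contra h
      rcases hc₁P z h with h | h
      · exact h.1 hz.1
      · exact h hz.2.1
    have h3 : c₃ z = 0 := hc₃0 z fun h => hz.2.2 (by rw [mem_bx] at *; simp only at *; omega)
    simp only [h1, h3, hone e₁ he₁ z hz.2.2, hone e₂ he₂ z hz.2.2, add_zero]
  · simp only [hc₁0 z hz, hc₃0 z hz', add_zero, zero_add]

/-- Evaluation of the potential along the sides of the box. -/
lemma rim_eval {m : ℤ} (hm : 2 ≤ m) (hme : m % 2 = 0) {e₁ e₂ : ℤ²} {s c : ℤ² → ZMod 2}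
    (hs : ∀ z a b, Lnk z a b → par a = 0 → s a + s b = c z)
    (hc : ∀ z ∈ bx (0, 0) m, z ∉ bx (0, 0) (m - 1) → c z = one e₁ z + one e₂ z) {t : ℤ}
    (ht : t % 2 = 0) (ht1 : -m ≤ t) (ht2 : t ≤ m) :
    (s (t, m) + s (m, m) = (if e₁.2 = m - 1 ∧ t ≤ e₁.1 ∧ e₁.1 < m then 1 else 0) +
      (if e₂.2 = m - 1 ∧ t ≤ e₂.1 ∧ e₂.1 < m then 1 else 0)) ∧
    (s (t, -m) + s (m, -m) = (if e₁.2 = -m ∧ t ≤ e₁.1 ∧ e₁.1 < m then 1 else 0) +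
      (if e₂.2 = -m ∧ t ≤ e₂.1 ∧ e₂.1 < m then 1 else 0)) ∧
    (s (m, t) + s (m, m) = (if e₁.1 = m - 1 ∧ t ≤ e₁.2 ∧ e₁.2 < m then 1 else 0) +
      (if e₂.1 = m - 1 ∧ t ≤ e₂.2 ∧ e₂.2 < m then 1 else 0)) := by
  obtain ⟨k, hk⟩ : ∃ k : ℕ, m = t + 2 * k := ⟨((m - t) / 2).toNat, by omega⟩
  have hrow : ∀ y w : ℤ, (w = y ∨ w = y + 1) → w % 2 = 0 → (y = m - 1 ∨ y = -m) →
      s (t, w) + s (m, w) = (if e₁.2 = y ∧ t ≤ e₁.1 ∧ e₁.1 < m then 1 else 0) +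
      (if e₂.2 = y ∧ t ≤ e₂.1 ∧ e₂.1 < m then 1 else 0) := by
    intro y w hw hwe hy
    have := zig_row (s := s) (c := c) hw (t := t) k (by show (t + w) % 2 = 0; omega)
      (fun x _ _ => hs _)
    rw [← hk] at this
    rw [this, ← sum_one_row, ← sum_one_row, ← sum_add_distrib]
    refine sum_congr rfl fun x hx => hc _ ?_ ?_
    · rw [mem_Ico] at hx; rw [mem_bx]; simp only; omega
    · rw [mem_bx]; simp only; omega
  refine ⟨hrow (m - 1) m (by omega) hme (by omega), hrow (-m) (-m) (by omega) (by omega)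
    (by omega), ?_⟩
  have := zig_col (s := s) (c := c) (x := m - 1) (w := m) (by omega) (t := t) k
    (by show (m + t) % 2 = 0; omega) (fun x _ _ => hs _)
  rw [← hk] at this
  rw [this, ← sum_one_col, ← sum_one_col, ← sum_add_distrib]
  refine sum_congr rfl fun x hx => hc _ ?_ ?_
  · rw [mem_Ico] at hx; rw [mem_bx]; simp only; omega
  · rw [mem_bx]; simp only; omega

/-- Three dual arms separate three primal arms. -/
lemma arms_separate {m n : ℤ} (hm : 2 ≤ m) (hme : m % 2 = 0) (hmn : m < n) {O : Set ℤ²}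
    (hTR : GArm 1 (ann m n) (sideTR m) (far (0, 0) n) Oᶜ)
    (hRB : GArm 1 (ann m n) (sideRB m) (far (0, 0) n) Oᶜ)
    (hBL : GArm 1 (ann m n) (sideBL m) (far (0, 0) n) Oᶜ)
    {a₁ a₂ a₃ : ℤ²} (h₁ : sideTL m a₁) (h₂ : sideRT m a₂) (h₃ : sideBR m a₃)
    (hp₁ : par a₁ = 0) (hp₂ : par a₂ = 0) (hp₃ : par a₃ = 0) :
    ¬ Conn (O ∩ ann m n) a₁ a₂ ∧ ¬ Conn (O ∩ ann m n) a₁ a₃ ∧ ¬ Conn (O ∩ ann m n) a₂ a₃ := by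
  obtain ⟨⟨b, m'⟩, ⟨h1, h2, h3⟩, hbp, wb, hwb, hcb⟩ := hTR
  obtain ⟨⟨m'', d⟩, ⟨h4, h5, h6⟩, hdp, wd, hwd, hcd⟩ := hRB
  obtain ⟨⟨g, m₃⟩, ⟨h7, h8, h9⟩, hgp, wg, hwg, hcg⟩ := hBL
  obtain ⟨t, y1⟩ := a₁
  obtain ⟨y2, r⟩ := a₂
  obtain ⟨t', y3⟩ := a₃
  obtain ⟨i1, i2, i3⟩ := h₁
  obtain ⟨i4, i5, i6⟩ := h₂
  obtain ⟨i7, i8, i9⟩ := h₃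
  simp only at h1 h2 h3 h4 h5 h6 h7 h8 h9 i1 i2 i3 i4 i5 i6 i7 i8 i9
  subst m' m'' m₃ y1 y2 y3
  have jb : (b + m) % 2 = 1 := hbp
  have jd : (m + d) % 2 = 1 := hdp
  have jg : (g + -m) % 2 = 1 := hgp
  have jt : (t + m) % 2 = 0 := hp₁
  have jr : (m + r) % 2 = 0 := hp₂
  have jt' : (t' + -m) % 2 = 0 := hp₃
  have hmem : ∀ x y, -m ≤ x → x < m → -m ≤ y → y < m → (x, y) ∈ bx (0, 0) m := by
    intro x y _ _ _ _; rw [mem_bx]; simp only; omega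
  have hlb : Lnk (b - 1, m - 1) (b, m) (b - 1, m - 1) := by
    unfold Lnk; simp only [sub_add_cancel, and_self, or_true]
  have hld : Lnk (m - 1, d) (m, d) (m - 1, d + 1) := by
    unfold Lnk; simp only [sub_add_cancel, and_self, or_true, true_or]
  have hlg : Lnk (g, -m) (g, -m) (g + 1, -m + 1) := by
    unfold Lnk; simp only [and_self, true_or]
  have h0 : ∀ z : ZMod 2, z + z = 0 := by decide
  obtain ⟨s, c, hs1, hs2, hs3⟩ := rim_potential hm hmn hbp hgp hcb hcg hwb hwg
    (hmem _ _ (by omega) (by omega) (by omega) (by omega))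
    (hmem _ _ (by omega) (by omega) (by omega) (by omega)) hlb hlg
    (by omega) (by omega)
  obtain ⟨s', c', hs1', hs2', hs3'⟩ := rim_potential hm hmn hbp hdp hcb hcd hwb hwd
    (hmem _ _ (by omega) (by omega) (by omega) (by omega))
    (hmem _ _ (by omega) (by omega) (by omega) (by omega)) hlb hld
    (by simp only; omega) (by simp only; omega)
  have e1 := (rim_eval hm hme hs2 hs3 (t := t) (by omega) (by omega) (by omega)).1
  have e2 := (rim_eval hm hme hs2 hs3 (t := r) (by omega) (by omega) (by omega)).2.2
  have e3 := (rim_eval hm hme hs2 hs3 (t := t') (by omega) (by omega) (by omega)).2.1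
  have e4 := (rim_eval hm hme hs2 hs3 (t := -m) (by omega) (by omega) (by omega)).2.2
  rw [if_pos (by simp only [true_and]; omega), if_neg (by simp only; omega)] at e1
  rw [if_neg (by simp only; omega), if_neg (by simp only; omega)] at e2 e3 e4
  have e2' := (rim_eval hm hme hs2' hs3' (t := r) (by omega) (by omega) (by omega)).2.2
  have e3' := (rim_eval hm hme hs2' hs3' (t := t') (by omega) (by omega) (by omega)).2.1
  have e4' := (rim_eval hm hme hs2' hs3' (t := -m) (by omega) (by omega) (by omega)).2.2
  rw [if_neg (by simp only; omega), if_neg (by simp only; omega)] at e2' e3'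
  rw [if_neg (by simp only; omega), if_pos (by simp only [true_and]; omega)] at e4'
  refine ⟨fun h => ?_, fun h => ?_, fun h => ?_⟩
  · have := hs1 _ _ hp₁ h
    rw [this, e2] at e1
    exact absurd e1 (by decide)
  · have := hs1 _ _ hp₁ h
    rw [this] at e1
    have : (0 : ZMod 2) = 1 := by
      linear_combination e3 - e4 + e1 - h0 (s (t', -m))
    exact absurd this (by decide)
  · have := hs1' _ _ hp₂ h
    rw [this] at e2'
    have : (0 : ZMod 2) = 1 := by
      linear_combination e4' - e3' - e2' + h0 (s' (t', -m))
    exact absurd this (by decide)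

variable {y : ℝ}

/-- Three primal and three dual alternating arms around a fully open box. -/
def Six (m n : ℤ) (O : Set ℤ²) : Prop :=
  ((GArm 0 (ann m n) (sideTL m) (far (0, 0) n) O ∧ GArm 0 (ann m n) (sideRT m) (far (0, 0) n) O ∧
      GArm 0 (ann m n) (sideBR m) (far (0, 0) n) O) ∧
    (GArm 1 (ann m n) (sideTR m) (far (0, 0) n) Oᶜ ∧
      GArm 1 (ann m n) (sideRB m) (far (0, 0) n) Oᶜ ∧
      GArm 1 (ann m n) (sideBL m) (far (0, 0) n) Oᶜ)) ∧ ∀ z ∈ bx (0, 0) m, z ∈ O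

lemma garm_congr {π : ℤ} {B : Set ℤ²} {U F : ℤ² → Prop} {O O' : Set ℤ²}
    (h : O ∩ B = O' ∩ B) : GArm π B U F O ↔ GArm π B U F O' := by
  unfold GArm; rw [h]

lemma six_pos (hy : 0 < y) (hq : 1 ≤ q) (hyq : y < q / y) {ε₀ : ℝ} (hε₀ : 0 < ε₀)
    (hθ : ∀ n : ℕ, ε₀ ≤ theta n y q) :
    ∃ m : ℤ, 2 ≤ m ∧ m % 2 = 0 ∧ ∃ c : ℝ, 0 < c ∧ ∀ n, m < n → ∃ K₀ : ℕ, ∀ v K,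
      bx (0, 0) K₀ ⊆ bx v K → c ≤ PP 0 (bx v K) ∅ (q / y) q (Six m n) := by
  obtain ⟨m₀, hm₀, h0⟩ := le_pp_arms (π := 0) (Or.inl rfl) hy hq hε₀ hθ (ε := 1 / 20) (by norm_num)
  obtain ⟨m₁, hm₁, h1⟩ := le_pp_arms (π := 1) (Or.inr rfl) hy hq hε₀ hθ (ε := 1 / 20) (by norm_num)
  have hx : 0 < q / y := hy.trans hyq
  set m := 2 * (m₀ + m₁) with hm
  refine ⟨m, by omega, by omega, 1 / 2 / (2 * max 1 (q / (q / y))) ^ (bx (0, 0) m).card,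
    by positivity, fun n hmn => ?_⟩
  have hn : ∀ U ∈ ({sideTL m, sideTR m, sideBL m, sideBR m, sideRT m, sideRB m} :
      Set (ℤ² → Prop)), ∃ n₀ : ℕ, ∀ D, cb 0 n₀ ⊆ D →
      1 - 1 / 10 ≤ PP 0 D ∅ (q / y) q (GArm 0 (ann m n) U (far (0, 0) n)) := by
    intro U hU
    obtain ⟨n₀, h⟩ := wired_le_free_add (π := 0) (Or.inl rfl) hy hyq hq
      (A := GArm 0 (ann m n) U (far (0, 0) n)) (garm_mono _ _ _ _)
      (X := bx (0, 0) n \ bx (0, 0) m) (by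
        have := garm_loc (π := 0) (B := bx (0, 0) n \ bx (0, 0) m) (U := U) (F := far (0, 0) n)
        rwa [coe_sdiff] at this) (ε := 1 / 20) (by norm_num)
    refine ⟨n₀, fun D hD => ?_⟩
    have := h D hD
    have h' := h0 m n (by omega) hmn D U hU
    linarith
  obtain ⟨n₁, hn₁⟩ := hn (sideTL m) (by simp)
  obtain ⟨n₂, hn₂⟩ := hn (sideRT m) (by simp)
  obtain ⟨n₃, hn₃⟩ := hn (sideBR m) (by simp)
  refine ⟨n₁ + n₂ + n₃ + n.toNat + 1, fun v K hK => ?_⟩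
  have hsub : ∀ k : ℕ, k ≤ n₁ + n₂ + n₃ → cb 0 k ⊆ bx v K := by
    intro k hk z hz
    apply hK
    have := mem_cb.1 hz
    rw [mem_bx]
    push_cast
    simp only [Prod.fst_zero, Prod.snd_zero] at this ⊢
    omega
  have hd : ∀ U ∈ ({sideTL m, sideTR m, sideBL m, sideBR m, sideRT m, sideRB m} :
      Set (ℤ² → Prop)), 1 - 1 / 20 ≤ PP 0 (bx v K) ∅ (q / y) q
      (fun O => GArm 1 (ann m n) U (far (0, 0) n) Oᶜ) := by
    intro U hU
    rw [← pp_dual hx hq (far_bx v K), Set.compl_empty, div_div_cancel₀ (by linarith)]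
    exact h1 m n (by omega) hmn _ U hU
  have a1 := hn₁ _ (hsub _ (by omega))
  have a2 := hn₂ _ (hsub _ (by omega))
  have a3 := hn₃ _ (hsub _ (by omega))
  have d1 := hd (sideTR m) (by simp)
  have d2 := hd (sideRB m) (by simp)
  have d3 := hd (sideBL m) (by simp)
  have p1 := pp_and_ge (π := 0) (D := bx v K) (ζ := ∅) (Or.inl rfl) hx hq
    (GArm 0 (ann m n) (sideRT m) (far (0, 0) n)) (GArm 0 (ann m n) (sideBR m) (far (0, 0) n))
  have p2 := pp_and_ge (π := 0) (D := bx v K) (ζ := ∅) (Or.inl rfl) hx hq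
    (GArm 0 (ann m n) (sideTL m) (far (0, 0) n)) (fun O =>
      GArm 0 (ann m n) (sideRT m) (far (0, 0) n) O ∧ GArm 0 (ann m n) (sideBR m) (far (0, 0) n) O)
  have p3 := pp_and_ge (π := 0) (D := bx v K) (ζ := ∅) (Or.inl rfl) hx hq
    (fun O => GArm 1 (ann m n) (sideRB m) (far (0, 0) n) Oᶜ)
    (fun O => GArm 1 (ann m n) (sideBL m) (far (0, 0) n) Oᶜ)
  have p4 := pp_and_ge (π := 0) (D := bx v K) (ζ := ∅) (Or.inl rfl) hx hq
    (fun O => GArm 1 (ann m n) (sideTR m) (far (0, 0) n) Oᶜ)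
    (fun O => GArm 1 (ann m n) (sideRB m) (far (0, 0) n) Oᶜ ∧
      GArm 1 (ann m n) (sideBL m) (far (0, 0) n) Oᶜ)
  have p5 := pp_and_ge (π := 0) (D := bx v K) (ζ := ∅) (Or.inl rfl) hx hq
    (fun O => GArm 0 (ann m n) (sideTL m) (far (0, 0) n) O ∧
      GArm 0 (ann m n) (sideRT m) (far (0, 0) n) O ∧ GArm 0 (ann m n) (sideBR m) (far (0, 0) n) O)
    (fun O => GArm 1 (ann m n) (sideTR m) (far (0, 0) n) Oᶜ ∧
      GArm 1 (ann m n) (sideRB m) (far (0, 0) n) Oᶜ ∧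
      GArm 1 (ann m n) (sideBL m) (far (0, 0) n) Oᶜ)
  have hb : bx (0, 0) m ⊆ bx v K := by
    refine fun z hz => hK ?_
    rw [mem_bx] at hz ⊢
    push_cast
    simp only at hz ⊢
    omega
  have key := pp_open_cells (π := 0) (D := bx v K) (ζ := ∅) (Or.inl rfl) hx hq hb
    (A := fun O => (GArm 0 (ann m n) (sideTL m) (far (0, 0) n) O ∧
      GArm 0 (ann m n) (sideRT m) (far (0, 0) n) O ∧ GArm 0 (ann m n) (sideBR m) (far (0, 0) n) O) ∧
      (GArm 1 (ann m n) (sideTR m) (far (0, 0) n) Oᶜ ∧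
      GArm 1 (ann m n) (sideRB m) (far (0, 0) n) Oᶜ ∧
      GArm 1 (ann m n) (sideBL m) (far (0, 0) n) Oᶜ)) (by
    intro O O' h hO
    have e1 : O ∩ ann m n = O' ∩ ann m n := by
      ext z; exact and_congr_left fun hz => (h z hz.2).symm
    have e2 : Oᶜ ∩ ann m n = O'ᶜ ∩ ann m n := by
      ext z; exact and_congr_left fun hz => not_congr (h z hz.2).symm
    rwa [← garm_congr e1, ← garm_congr e1, ← garm_congr e1, ← garm_congr e2, ← garm_congr e2,
      ← garm_congr e2])
  rw [div_le_iff₀' (by positivity)]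
  refine le_trans ?_ key
  linarith

lemma corn_of_side {m : ℤ} (hm : 2 ≤ m) {u : ℤ²} (hp : par u = 0)
    (h : sideTL m u ∨ sideRT m u ∨ sideBR m u) : u ∈ corn 0 (bx (0, 0) m : Finset ℤ²) := by
  have : ∃ z ∈ bx (0, 0) m, ∃ w, Lnk z u w := by
    obtain ⟨a, b⟩ := u
    have hp' : (a + b) % 2 = 0 := hp
    unfold sideTL sideRT sideBR at h
    simp only at h
    by_cases h1 : b = m ∧ a < m
    · exact ⟨(a, b - 1), by rw [mem_bx]; simp only; omega, (a + 1, b - 1), by unfold Lnk; simp⟩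
    by_cases h2 : a = m
    · by_cases h3 : b = m
      · exact ⟨(a - 1, b - 1), by rw [mem_bx]; simp only; omega, (a - 1, b - 1), by unfold Lnk; simp⟩
      · exact ⟨(a - 1, b), by rw [mem_bx]; simp only; omega, (a - 1, b + 1), by unfold Lnk; simp⟩
    · exact ⟨(a, b), by rw [mem_bx]; simp only; omega, (a + 1, b + 1), by unfold Lnk; simp⟩
  obtain ⟨z, hz, w, hl⟩ := this
  refine ⟨z, hz, ?_⟩
  rcases hl.eq_or hp with h | h
  · exact Or.inl h.1
  · exact Or.inr h.1

/-- Boundary points of the box of radius `R`. -/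
def bdry (R : ℕ) : Finset ℤ² :=
  (Icc (-R : ℤ) R ×ˢ Icc (-R : ℤ) R).filter fun w => far (0, 0) R w

lemma card_bdry_le (R : ℕ) : (bdry R).card ≤ 4 * (2 * R + 1) := by
  have h : bdry R ⊆ (({(-R : ℤ), (R : ℤ)} : Finset ℤ) ×ˢ Icc (-R : ℤ) R) ∪
      (Icc (-R : ℤ) R ×ˢ ({(-R : ℤ), (R : ℤ)} : Finset ℤ)) := by
    intro w hw
    rw [bdry, mem_filter, mem_product, mem_Icc, mem_Icc] at hw
    simp only [far] at hw
    simp only [mem_union, mem_product, mem_Icc, mem_insert,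
      mem_singleton]
    omega
  have h1 : (Icc (-R : ℤ) R).card = 2 * R + 1 := by rw [Int.card_Icc]; omega
  have h2 : ({(-R : ℤ), (R : ℤ)} : Finset ℤ).card ≤ 2 := card_le_two
  refine (card_le_card h).trans ((card_union_le _ _).trans ?_)
  rw [card_product, card_product, h1]
  nlinarith

lemma conn_shift {O O' : Set ℤ²} {a b t : ℤ²} (h : Conn O a b)
    (hO : ∀ z ∈ O, z + t ∈ O') : Conn O' (a + t) (b + t) := by
  refine ((PSym.shift t).conn_image.2 h).mono ?_
  rintro _ ⟨z, hz, rfl⟩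
  exact hO z hz

lemma six_trif {m n : ℤ} {R : ℕ} {v : ℤ²} (hm : 2 ≤ m) (hme : m % 2 = 0) (hmn : m < n)
    (hv : par v = 0) (hmR : bx v m ⊆ bx (0, 0) (R - 1)) (hRn : bx (0, 0) R ⊆ bx v n)
    {O : Set ℤ²} (h : Six m n ((PSym.shift (-v)).cell '' O)) :
    Trif 0 (O ∩ bx (0, 0) R) (bx v m) (bdry R) := by
  obtain ⟨⟨⟨hTL, hRT, hBR⟩, hTR, hRB, hBL⟩, hop⟩ := h
  have hO : ∀ z, z ∈ (PSym.shift (-v)).cell '' O ↔ z + v ∈ O := by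
    intro z
    constructor
    · rintro ⟨z', hz', rfl⟩
      simpa using hz'
    · exact fun h => ⟨z + v, h, by simp⟩
  have hbv : ∀ (z : ℤ²) (k : ℤ), z + v ∈ bx v k ↔ z ∈ bx (0, 0) k := by
    intro z k
    rw [mem_bx, mem_bx, Prod.fst_add, Prod.snd_add]
    simp only
    omega
  have hbR := fun z h => mem_bx.1 (@hmR z h)
  have hv1 := hbR (v + (-m, -m)) (by
    rw [mem_bx, Prod.fst_add, Prod.snd_add]; simp only; omega)
  have hv2 := hbR (v + (m - 1, m - 1)) (by
    rw [mem_bx, Prod.fst_add, Prod.snd_add]; simp only; omega)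
  rw [Prod.fst_add, Prod.snd_add] at hv1 hv2
  simp only at hv1 hv2
  have harm : ∀ U : ℤ² → Prop, (∀ u, U u → sideTL m u ∨ sideRT m u ∨ sideBR m u) →
      GArm 0 (ann m n) U (far (0, 0) n) ((PSym.shift (-v)).cell '' O) →
      ∃ u w, U u ∧ par u = 0 ∧ w ∈ bdry R ∧
        Conn ((O ∩ bx (0, 0) R) \ (bx v m : Finset ℤ²)) w (u + v) := by
    rintro U hU ⟨u, hu, hp, w, hw, hc⟩
    have hc' : Conn (O ∩ {z | z ∉ bx v m}) (u + v) (w + v) := conn_shift hc fun z hz =>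
      ⟨(hO z).1 hz.1, fun h => hz.2.2 ((hbv z m).1 h)⟩
    have hnf : ¬ far (0, 0) R (u + v) := by
      unfold far
      rw [Prod.fst_add, Prod.snd_add]
      have := hU u hu
      unfold sideTL sideRT sideBR at this
      simp only
      omega
    have hex : ∃ w', far (0, 0) R w' ∧ Conn ((O ∩ {z | z ∉ bx v m}) ∩ (bx (0, 0) R : Finset ℤ²))
        (u + v) w' := by
      rcases hc'.exit (B := (bx (0, 0) R : Finset ℤ²)) (F := far (0, 0) R)
        (fun b hb z c hl => lnk_mem_bx hb hl) with h | h
      · refine ⟨_, ?_, h⟩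
        by_contra hf
        unfold far at hf hw
        rw [Prod.fst_add, Prod.snd_add] at hf
        have h1 := mem_bx.1 (@hRn (w + v) (by
          rw [mem_bx, Prod.fst_add, Prod.snd_add]; simp only at hf ⊢; omega))
        have h2 := mem_bx.1 (@hRn (w + v + (-1, -1)) (by
          rw [mem_bx, Prod.fst_add, Prod.snd_add, Prod.fst_add, Prod.snd_add]
          simp only at hf ⊢; omega))
        rw [Prod.fst_add, Prod.snd_add] at h1
        rw [Prod.fst_add, Prod.snd_add, Prod.fst_add, Prod.snd_add] at h2
        simp only at hw h1 h2
        omega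
      · exact h
    obtain ⟨w', hw', hcw⟩ := hex
    refine ⟨u, w', hu, hp, ?_, (hcw.mono ?_).symm⟩
    · have hne : u + v ≠ w' := by rintro rfl; exact hnf hw'
      obtain ⟨z, hz, a, hl⟩ := hcw.last_cell hne
      have := mem_bx.1 hz.2
      unfold Lnk at hl
      rw [bdry, mem_filter, mem_product, mem_Icc, mem_Icc]
      refine ⟨?_, hw'⟩
      simp only at this
      omega
    · exact fun z hz => ⟨⟨hz.1.1, hz.2⟩, hz.1.2⟩
  have hsep : ∀ u u' w w', Conn ((O ∩ bx (0, 0) R) \ (bx v m : Finset ℤ²)) w (u + v) →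
      Conn ((O ∩ bx (0, 0) R) \ (bx v m : Finset ℤ²)) w' (u' + v) →
      ¬ Conn ((PSym.shift (-v)).cell '' O ∩ ann m n) u u' →
      ¬ Conn ((O ∩ bx (0, 0) R) \ (bx v m : Finset ℤ²)) w w' := by
    intro u u' w w' h1 h2 h3 h4
    have h5 := (h1.symm.trans h4).trans h2
    have h6 := conn_shift (t := -v) h5 (O' := (PSym.shift (-v)).cell '' O ∩ ann m n) (by
      intro z hz
      refine ⟨⟨z, hz.1.1, rfl⟩, ?_, ?_⟩
      · rw [← hbv, neg_add_cancel_right]; exact hRn hz.1.2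
      · rw [← hbv, neg_add_cancel_right]; exact hz.2)
    rw [add_neg_cancel_right, add_neg_cancel_right] at h6
    exact h3 h6
  have hcorn : ∀ u, par u = 0 → (sideTL m u ∨ sideRT m u ∨ sideBR m u) →
      u + v ∈ corn 0 (bx v m : Finset ℤ²) := by
    intro u hp hu
    obtain ⟨z, hz, h⟩ := corn_of_side hm hp hu
    have hl : Lnk (z + v) (pu 0 z + v) (pv 0 z + v) :=
      ((PSym.shift v).lnk z _ _).2 (lnk_pu_pv 0 z)
    have hpp : par (pu 0 z + v) = 0 := by
      have := par_pu (π := 0) (Or.inl rfl) z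
      unfold par at *
      rw [Prod.fst_add, Prod.snd_add]
      omega
    refine ⟨z + v, (hbv z m).2 hz, ?_⟩
    rcases hl.eq_or hpp with h' | h' <;> rcases h with h | h <;> rw [h]
    · exact Or.inl h'.1
    · exact Or.inr h'.2
    · exact Or.inr h'.1
    · exact Or.inl h'.2
  obtain ⟨u₁, w₁, hu₁, hp₁, hw₁, hc₁⟩ := harm _ (fun _ h => Or.inl h) hTL
  obtain ⟨u₂, w₂, hu₂, hp₂, hw₂, hc₂⟩ := harm _ (fun _ h => Or.inr (Or.inl h)) hRT
  obtain ⟨u₃, w₃, hu₃, hp₃, hw₃, hc₃⟩ := harm _ (fun _ h => Or.inr (Or.inr h)) hBR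
  obtain ⟨s1, s2, s3⟩ := arms_separate hm hme hmn hTR hRB hBL hu₁ hu₂ hu₃ hp₁ hp₂ hp₃
  have t1 := hsep _ _ _ _ hc₁ hc₂ s1
  have t2 := hsep _ _ _ _ hc₁ hc₃ s2
  have t3 := hsep _ _ _ _ hc₂ hc₃ s3
  refine ⟨?_, ![w₁, w₂, w₃], ?_, ?_⟩
  · intro z hz
    have hz0 : z - v ∈ bx (0, 0) m := by rw [← hbv, sub_add_cancel]; exact hz
    have := (hO _).1 (hop _ hz0)
    rw [sub_add_cancel] at this
    refine ⟨this, ?_⟩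
    have := hbR z hz
    rw [mem_coe, mem_bx]
    simp only at this ⊢
    omega
  · intro a
    fin_cases a
    · exact ⟨hw₁, _, hcorn _ hp₁ (Or.inl hu₁), hc₁⟩
    · exact ⟨hw₂, _, hcorn _ hp₂ (Or.inr (Or.inl hu₂)), hc₂⟩
    · exact ⟨hw₃, _, hcorn _ hp₃ (Or.inr (Or.inr hu₃)), hc₃⟩
  · intro a a' haa
    fin_cases a <;> fin_cases a' <;> first | exact absurd rfl haa | skip
    · exact t1
    · exact t2
    · exact fun h => t1 h.symm
    · exact t3
    · exact fun h => t2 h.symm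
    · exact fun h => t3 h.symm

/-- Below the self-dual point there is no percolation. -/
theorem theta_small (hy : 0 < y) (hq : 1 ≤ q) (hyq : y < q / y) {ε : ℝ} (hε : 0 < ε) :
    ∃ n : ℕ, theta n y q < ε := by
  by_contra! hθ
  obtain ⟨m, hm, hme, c, hc, hsix⟩ := six_pos hy hq hyq hε hθ
  have hx : 0 < q / y := hy.trans hyq
  lift m to ℕ using by omega
  obtain ⟨k, hk⟩ := exists_nat_gt ((4 * (2 * (2 * m + m + 1) + 1) : ℕ) / c)
  have hk0 : 0 < (k : ℝ) := lt_of_le_of_lt (by positivity) hk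
  have hk1 : 1 ≤ k := by exact_mod_cast hk0
  set R : ℕ := 2 * m * k + m + 1 with hR
  obtain ⟨K₀, hK₀⟩ := hsix (2 * R + 1) (by push_cast [hR]; nlinarith)
  set K : ℤ := K₀ + R with hK
  set cen : ℕ × ℕ → ℤ² := fun i => (2 * m * i.1, 2 * m * i.2) with hcen
  set I := range k ×ˢ range k with hI
  have hcb : ∀ i ∈ I, 0 ≤ (cen i).1 ∧ (cen i).1 ≤ 2 * m * k - 2 * m ∧ 0 ≤ (cen i).2 ∧
      (cen i).2 ≤ 2 * m * k - 2 * m := by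
    intro i hi
    rw [hI, mem_product, mem_range, mem_range] at hi
    have h1 : (i.1 : ℤ) + 1 ≤ k := by exact_mod_cast hi.1
    have h2 : (i.2 : ℤ) + 1 ≤ k := by exact_mod_cast hi.2
    have hm0 : (0 : ℤ) ≤ 2 * m := by positivity
    refine ⟨by positivity, ?_, by positivity, ?_⟩ <;> simp only [hcen] <;> nlinarith
  have hlow : ∀ i ∈ I, c ≤ PP 0 (bx (0, 0) K) ∅ (q / y) q
      (fun O => Six m (2 * R + 1) ((PSym.shift (-cen i)).cell '' O)) := by
    intro i hi
    have hb := hcb i hi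
    rw [← (PSym.shift (-cen i)).pp (π := 0) (π' := 0) (D' := bx (-cen i) K) (ζ' := ∅) (Or.inl rfl) ?_
      hx hq ?_ ?_]
    · refine hK₀ _ _ fun z hz => ?_
      rw [mem_bx] at hz ⊢
      rw [Prod.fst_neg, Prod.snd_neg]
      simp only at hz
      have : (R : ℤ) = 2 * m * k + m + 1 := by push_cast [hR]; ring
      omega
    · show 0 = (0 + par (-cen i)) % 2
      unfold par
      rw [Prod.fst_neg, Prod.snd_neg]
      simp only [hcen]
      rw [mul_assoc, mul_assoc]
      omega
    · intro z
      rw [PSym.shift_cell, mem_bx, mem_bx, Prod.fst_add, Prod.snd_add, Prod.fst_neg, Prod.snd_neg]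
      simp only
      omega
    · intro z _
      simp
  have hup := pp_sum_le (π := 0) (D := bx (0, 0) K) (ζ := ∅) (Or.inl rfl) hx hq I
    (fun i O => Six m (2 * R + 1) ((PSym.shift (-cen i)).cell '' O)) (4 * (2 * R + 1)) (by
    intro O _
    refine (card_trif_le (π := 0) (O := O ∩ bx (0, 0) R) (fun i => (bx (cen i) m : Set ℤ²))
      (Or.inl rfl) ?_ ?_ (bdry R) _ ?_).trans (card_bdry_le R)
    · intro i j hij
      rw [Set.disjoint_left]
      intro z hz hz'
      rw [mem_coe, mem_bx] at hz hz'
      simp only [hcen] at hz hz'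
      apply hij
      have hm1 : (0 : ℤ) < 2 * m := by omega
      have e : ∀ a b : ℕ, ∀ t : ℤ, 2 * (m : ℤ) * a - m ≤ t → t < 2 * m * a + m →
          2 * (m : ℤ) * b - m ≤ t → t < 2 * m * b + m → a = b := by
        intro a b t h1 h2 h3 h4
        have : (2 * m : ℤ) * a < 2 * m * (b + 1) := by linarith
        have h5 := lt_of_mul_lt_mul_left this hm1.le
        have : (2 * m : ℤ) * b < 2 * m * (a + 1) := by linarith
        have h6 := lt_of_mul_lt_mul_left this hm1.le
        omega
      exact Prod.ext (e _ _ z.1 hz.1 hz.2.1 hz'.1 hz'.2.1)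
        (e _ _ z.2 hz.2.2.1 hz.2.2.2 hz'.2.2.1 hz'.2.2.2)
    · rintro i u ⟨z, hz, hu⟩ v ⟨z', hz', hv⟩
      have h1 := near_of_corner hu
      have h2 := near_of_corner hv
      have hpu : par u = par v := by
        rcases hu with rfl | rfl <;> rcases hv with rfl | rfl <;>
          simp only [par_pu (π := 0) (Or.inl rfl), par_pv (π := 0) (Or.inl rfl)]
      rw [mem_coe, mem_bx] at hz hz'
      refine conn_rect (a := (cen i).1 - m) (b := (cen i).1 + m) (c := (cen i).2 - m)
        (d := (cen i).2 + m) (by omega) (fun a b _ _ _ _ => ?_) (by omega) (by omega) (by omega)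
        (by omega) (by omega) (by omega) (by omega) (by omega) (by omega) hpu
      rw [mem_coe, mem_bx]
      simp only
      omega
    · intro i hi
      rw [mem_filter] at hi
      have hb := hcb i hi.1
      have hRe : (R : ℤ) = 2 * m * k + m + 1 := by push_cast [hR]; ring
      refine six_trif hm hme (n := 2 * R + 1) (by omega) ?_ ?_ ?_ hi.2
      · show (2 * (m : ℤ) * i.1 + 2 * m * i.2) % 2 = 0
        rw [mul_assoc, mul_assoc]
        omega
      · intro z hz
        rw [mem_bx] at hz ⊢
        simp only
        omega
      · intro z hz
        rw [mem_bx] at hz ⊢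
        simp only at hz
        omega)
  have hsum : (I.card : ℝ) * c ≤ (4 * (2 * R + 1) : ℕ) := by
    rw [← nsmul_eq_mul]
    exact (card_nsmul_le_sum _ _ _ hlow).trans hup
  rw [hI, card_product, card_range] at hsum
  rw [div_lt_iff₀ hc] at hk
  have hRk : (4 * (2 * R + 1) : ℕ) ≤ (4 * (2 * (2 * m + m + 1) + 1)) * k := by
    rw [hR]; nlinarith
  have hRk' : ((4 * (2 * R + 1) : ℕ) : ℝ) ≤ ((4 * (2 * (2 * m + m + 1) + 1) : ℕ) : ℝ) * k := by
    exact_mod_cast hRk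
  push_cast at hsum hk hRk'
  nlinarith

lemma wired_le_free_of_small (hπ : π = 0 ∨ π = 1) (hy : 0 < y) (hq : 1 ≤ q) (hyq : y < q / y)
    (hA : Monotone A) {X : Finset ℤ²} (hAX : Loc X A) {ε : ℝ} (hε : 0 < ε) :
    ∃ n₀ : ℕ, ∀ D, bx (0, 0) n₀ ⊆ D → PP π D Set.univ y q A ≤ PP π D ∅ y q A + ε := by
  set P : Finset ℤ² := X.image (pu π) ∪ X.image (pv π) with hP
  have hmP : ∀ v, v ∈ P ↔ v ∈ corn π (X : Set ℤ²) := by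
    intro v
    simp only [hP, mem_union, mem_image, corn, Set.mem_ofPred_eq, mem_coe]
    constructor
    · rintro (⟨z, hz, rfl⟩ | ⟨z, hz, rfl⟩)
      · exact ⟨z, hz, Or.inl rfl⟩
      · exact ⟨z, hz, Or.inr rfl⟩
    · rintro ⟨z, hz, rfl | rfl⟩
      · exact Or.inl ⟨z, hz, rfl⟩
      · exact Or.inr ⟨z, hz, rfl⟩
  obtain ⟨n, hn⟩ := theta_small hy hq hyq (ε := ε / (P.card + 1)) (by positivity)
  obtain ⟨K, hK⟩ : ∃ K : ℕ, ∀ v ∈ X ∪ P, |v.1| ≤ K ∧ |v.2| ≤ K := by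
    refine ⟨(X ∪ P).sup fun v => v.1.natAbs + v.2.natAbs, fun v hv => ?_⟩
    have := le_sup (f := fun v : ℤ² => v.1.natAbs + v.2.natAbs) hv
    rw [abs_le, abs_le]
    omega
  refine ⟨K + n + 1, fun D hD => ?_⟩
  have hD' : ∀ z : ℤ², |z.1| ≤ K + n → |z.2| ≤ K + n → z ∈ D := fun z h1 h2 => hD (by
    rw [mem_bx]; push_cast; rw [abs_le] at h1 h2; omega)
  have hXD : X ⊆ D := fun z hz => by
    have := hK z (mem_union_left _ hz)
    exact hD' z (by omega) (by omega)
  refine (wired_sub_free_le hπ hy hq hA hXD hAX).trans (add_le_add le_rfl ?_)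
  have h1 : PP π D Set.univ y q (fun O => ∃ v ∈ corn π (X : Set ℤ²),
      v ∈ clus (corn π (↑D)ᶜ) O) ≤ ∑ v ∈ P, ε / (P.card + 1) := by
    refine le_trans (pp_mono hπ hy hq (B := fun O => ∃ v ∈ P, v ∈ clus (corn π (↑D)ᶜ) O) ?_)
      ((pp_exists_le hπ hy hq P _).trans (sum_le_sum fun v hv => ?_))
    · rintro O _ ⟨v, hv, h⟩
      exact ⟨v, (hmP v).2 hv, h⟩
    have hvp : par v = π := by
      obtain ⟨z, -, rfl | rfl⟩ := (hmP v).1 hv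
      · exact par_pu hπ z
      · exact par_pv hπ z
    have hv' := hK v (mem_union_right _ hv)
    rw [abs_le, abs_le] at hv'
    have hb : bx v n ⊆ D := by
      intro z hz
      rw [mem_bx] at hz
      exact hD' z (by rw [abs_le]; omega) (by rw [abs_le]; omega)
    refine le_trans ?_ hn.le
    rw [← pp_reach_eq (π := π) hy hq hvp n]
    refine le_trans (pp_mono hπ hy hq (B := GArm π (bx v n : Finset ℤ²) (fun u => u = v)
      (far v n)) ?_) (pp_shrink hπ hy hq hb le_rfl (garm_mono _ _ _ _) fun _ _ _ => trivial)
    rintro O _ ⟨u, ⟨z, hz, hu⟩, hc⟩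
    have h1 := near_of_corner hu
    have : GArm π Set.univ (fun u => u = v) (far v n) O :=
      ⟨v, rfl, hvp, u, by
        by_contra hf
        refine hz (hb ?_)
        unfold far at hf
        rw [mem_bx]
        omega, by rw [Set.inter_univ]; exact hc.symm⟩
    have h2 := this.exit (F' := far v n) (B' := (bx v n : Finset ℤ²)) (fun _ h => h)
      fun b hb z c hl => lnk_mem_bx hb hl
    rwa [Set.univ_inter] at h2
  refine h1.trans ?_
  rw [sum_const, nsmul_eq_mul, mul_div_assoc', div_le_iff₀ (by positivity)]
  nlinarith

/-- Away from the self-dual point the wired and free measures agree on local events. -/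
theorem wired_le_free_of_ne (hx : 0 < x) (hq : 1 ≤ q) (hne : x ≠ q / x) (F : Finset ℤ²)
    {ε : ℝ} (hε : 0 < ε) : ∃ n₀ : ℕ, ∀ K : ℤ, n₀ ≤ K →
      PP 0 (bx (0, 0) K) Set.univ x q (fun O => ∀ z ∈ F, z ∈ O) ≤
        PP 0 (bx (0, 0) K) ∅ x q (fun O => ∀ z ∈ F, z ∈ O) + ε := by
  have hsub : ∀ {n₀ : ℕ} {K : ℤ}, (n₀ : ℤ) ≤ K → bx (0, 0) n₀ ⊆ bx (0, 0) K := by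
    intro n₀ K h z hz
    rw [mem_bx] at *
    simp only at *
    omega
  rcases lt_or_gt_of_ne hne with h | h
  · obtain ⟨n₀, h0⟩ := wired_le_free_of_small (π := 0) (Or.inl rfl) hx hq h
      (A := fun O => ∀ z ∈ F, z ∈ O) (fun O O' h hO z hz => h (hO z hz)) (X := F)
      (fun O O' h hO z hz => (h z hz).1 (hO z hz)) hε
    exact ⟨n₀, fun K hK => h0 _ (hsub hK)⟩
  · have hy : 0 < q / x := by positivity
    have hxx : q / (q / x) = x := by
      rw [div_div_cancel₀ (by linarith)]
    obtain ⟨n₀, h0⟩ := wired_le_free_of_small (π := 1) (Or.inr rfl) hy hq (by rwa [hxx])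
      (A := fun O => ∃ z ∈ F, z ∈ O) (fun O O' h ⟨z, hz, hO⟩ => ⟨z, hz, h hO⟩) (X := F)
      (fun O O' h ⟨z, hz, hO⟩ => ⟨z, hz, (h z hz).1 hO⟩) hε
    refine ⟨n₀, fun K hK => ?_⟩
    have := h0 _ (hsub hK)
    have e1 := pp_dual hx hq (far_bx (0, 0) K) (fun O => ∃ z ∈ F, z ∈ O)
    have e2 := pp_dual (D := bx (0, 0) K) (ζ := Set.univ) hx hq
      ⟨∅, Set.finite_empty, fun _ _ _ _ _ _ _ _ h => absurd trivial h⟩ (fun O => ∃ z ∈ F, z ∈ O)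
    rw [Set.compl_empty] at e1
    rw [Set.compl_univ] at e2
    have hc : ∀ ζ, PP 0 (bx (0, 0) K) ζ x q (fun O => ∀ z ∈ F, z ∈ O) =
        1 - PP 0 (bx (0, 0) K) ζ x q (fun O => ∃ z ∈ F, z ∈ Oᶜ) := by
      intro ζ
      rw [← pp_not (Or.inl rfl) hx hq]
      refine pp_congr fun O _ => ?_
      simp only [Set.mem_compl_iff, not_exists, not_and, not_not]
    rw [hc, hc, ← e1, ← e2]
    linarith

/-- The upper half of the square of half-side `n` centred at `v`. -/
def hbx (v : ℤ²) (n : ℤ) : Finset ℤ² := (bx v n).filter fun z => 0 ≤ z.2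

/-- The cells of the upper half-plane. -/
def up : Set ℤ² := {z | 0 ≤ z.2}

lemma mem_hbx {v z : ℤ²} {n : ℤ} : z ∈ hbx v n ↔
    (v.1 - n ≤ z.1 ∧ z.1 < v.1 + n ∧ v.2 - n ≤ z.2 ∧ z.2 < v.2 + n) ∧ 0 ≤ z.2 := by
  rw [hbx, mem_filter, mem_bx]

lemma mem_up {z : ℤ²} : z ∈ up ↔ 0 ≤ z.2 := Iff.rfl

/-- The probability that a boundary point of the half-plane, free on its boundary and wired at
distance `n`, is connected to distance `n`. -/
def thp (n : ℤ) (x q : ℝ) : ℝ :=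
  PP 0 (hbx (0, 0) n) up x q
    (GArm 0 (hbx (0, 0) n : Finset ℤ²) (fun u => u = (0, 0)) (far (0, 0) n))

lemma pp_hreach_eq (hx : 0 < x) (hq : 1 ≤ q) {v : ℤ²} (hv : par v = 0) (hv2 : v.2 = 0) (n : ℤ) :
    PP 0 (hbx v n) up x q
      (GArm 0 (hbx v n : Finset ℤ²) (fun u => u = v) (far v n)) = thp n x q := by
  unfold thp
  refine pp_garm_image (PSym.shift v) (Or.inl rfl) ?_ hx hq ?_ ?_ ?_ ?_ ?_
  · rw [PSym.shift_sh]; unfold par at *; omega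
  · intro z; rw [PSym.shift_cell, mem_hbx, mem_hbx]; simp only [Prod.fst_add, Prod.snd_add]; omega
  · intro z hz; rw [PSym.shift_cell, mem_up, mem_up]; simp only [Prod.snd_add]; omega
  · intro z
    rw [PSym.shift_cell, mem_coe, mem_coe, mem_hbx, mem_hbx]
    simp only [Prod.fst_add, Prod.snd_add]; omega
  · intro u
    obtain ⟨a, b⟩ := u
    obtain ⟨c, d⟩ := v
    rw [PSym.shift_pt]; simp only [Prod.mk_add_mk, Prod.mk.injEq]; omega
  · intro u
    rw [PSym.shift_pt]; unfold far; simp only [Prod.fst_add, Prod.snd_add]; omega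

lemma GArm.hexit {π : ℤ} {v v' : ℤ²} {n n' : ℤ} {U : ℤ² → Prop} {O : Set ℤ²}
    (h : GArm π (hbx v n : Finset ℤ²) U (far v n) O)
    (hF : ∀ u, far v n u → far v' n' u) :
    GArm π (hbx v' n' : Finset ℤ²) U (far v' n') O := by
  refine (h.exit (F' := far v' n') (B' := (bx v' n' : Finset ℤ²)) hF
      (fun b hb z c hl => lnk_mem_bx hb hl)).sub ?_ (fun _ h => h) (fun _ h => h)
  rintro z ⟨h1, h2⟩
  rw [mem_coe, hbx, mem_filter] at *
  exact ⟨h2, h1.2⟩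

lemma le_pp_hreach (hx : 0 < x) (hq : 1 ≤ q) {θ : ℝ} (hθ : ∀ n : ℕ, θ ≤ thp n x q)
    (hD : ∀ z ∈ D, 0 ≤ z.2) {v : ℤ²} (hv : par v = 0) (hv2 : v.2 = 0) (n : ℤ) :
    θ ≤ PP 0 D up x q
      (GArm 0 (hbx (0, 0) n : Finset ℤ²) (fun u => u = v) (far (0, 0) n)) := by
  obtain ⟨N, hN, hb⟩ := exists_sub_bx D v (n.natAbs + v.1.natAbs + v.2.natAbs)
  have hsub : D ⊆ hbx v N := fun z hz => by
    have := hb hz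
    have := hD z hz
    rw [mem_bx] at *; rw [mem_hbx]; omega
  calc θ ≤ thp N x q := hθ N
    _ = _ := (pp_hreach_eq hx hq hv hv2 N).symm
    _ ≤ PP 0 (hbx v N) up x q
      (GArm 0 (hbx (0, 0) n : Finset ℤ²) (fun u => u = v) (far (0, 0) n)) := by
        refine pp_mono (Or.inl rfl) hx hq fun O _ h => h.hexit ?_
        intro u hu
        unfold far at *; simp only; omega
    _ ≤ _ := pp_shrink (Or.inl rfl) hx hq hsub le_rfl (garm_mono _ _ _ _) (by
        rintro z - (h | h)
        · rw [mem_hbx] at h; exact h.2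
        · exact h)

/-- The points of the boundary line at distance at most `m` from `c`. -/
def seg (c m y : ℤ) (u : ℤ²) : Prop := u.2 = y ∧ c - m ≤ u.1 ∧ u.1 ≤ c + m

lemma le_pp_seg (hx : 0 < x) (hq : 1 ≤ q) {ε₀ ε : ℝ} (hε₀ : 0 < ε₀)
    (hθ : ∀ n : ℕ, ε₀ ≤ thp n x q) (hε : 0 < ε) :
    ∃ m : ℤ, 0 < m ∧ ∀ n : ℤ, ∀ D : Finset ℤ², m < n → (∀ z ∈ D, 0 ≤ z.2) →
      1 - ε ≤ PP 0 D up x q (GArm 0 (hbx (0, 0) n : Finset ℤ²) (seg 0 m 0) (far (0, 0) n)) := by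
  obtain ⟨θ, l, M, hθ0, hθn, hl, hM1, hM2⟩ := exists_scale hε₀ hθ hε
  have hπ : (0 : ℤ) = 0 ∨ (0 : ℤ) = 1 := Or.inl rfl
  set v : ℕ → ℤ² := fun j => (2 * (l * j), 0) with hv
  have hvp : ∀ j, par (v j) = 0 := by intro j; simp only [hv, par]; omega
  have hvM : ∀ j < M, (l : ℤ) * j ≤ l * M := fun j hj => by
    have : (j : ℤ) ≤ M := by exact_mod_cast hj.le
    exact mul_le_mul_of_nonneg_left this (by positivity)
  have hv0 : ∀ j : ℕ, 0 ≤ (l : ℤ) * j := fun j => by positivity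
  refine ⟨2 * (l * M) + 2 + l, by positivity, fun n D hmn hD => ?_⟩
  set m : ℤ := 2 * (l * M) + 2 + l with hm
  set F : ℕ → Set ℤ² → Prop := fun j =>
    GArm 0 (hbx (0, 0) n : Finset ℤ²) (fun u => u = v j) (far (0, 0) n) with hF
  set E : ℕ → Set ℤ² → Prop := fun j =>
    GArm 0 (hbx (v j) l : Finset ℤ²) (fun u => u = v j) (far (v j) l) with hE
  set D' := D ∪ (range M).biUnion fun j => hbx (v j) l with hD'
  have hD'0 : ∀ z ∈ D', 0 ≤ z.2 := by
    intro z hz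
    rw [hD', mem_union, mem_biUnion] at hz
    rcases hz with h | ⟨j, -, h⟩
    · exact hD z h
    · rw [mem_hbx] at h; exact h.2
  have hcl : ∀ z, z ∈ D' ∨ z ∈ up → z ∈ up := by
    rintro z (h | h)
    · exact hD'0 z h
    · exact h
  have hbD : ∀ j ∈ range M, hbx (v j) l ⊆ D' := fun j hj =>
    (subset_biUnion_of_mem (fun j => hbx (v j) l) hj).trans subset_union_right
  have hFE : ∀ j ∈ range M, ∀ O, F j O → E j O := by
    intro j hj O h
    have h1 := hvM j (mem_range.1 hj)
    have h2 := hv0 j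
    refine h.hexit ?_
    intro u hu
    simp only [hv, far] at *
    omega
  have hcheb := pp_second_moment (D := D') (ζ := up) hπ hx hq (range M) F hθ0
    (sq_nonneg (thp l x q)) (by simpa using hM1)
    (fun j _ => le_pp_hreach hx hq hθn hD'0 (hvp j) rfl n) (fun i hi j hj hij => by
      refine (pp_mono (B := fun O => E i O ∧ E j O) hπ hx hq
        fun O _ h => ⟨hFE i hi O h.1, hFE j hj O h.2⟩).trans ?_
      have := pp_two_boxes (π := 0) (D := D') (ζ := up) (ζ' := up) hπ hx hq (hbD i hi)
        (hbD j hj) ?_ (fun z _ => hcl z) (fun z _ => hcl z)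
        (garm_mono 0 (hbx (v i) l : Finset ℤ²) (fun u => u = v i) (far (v i) l))
        (garm_mono 0 (hbx (v j) l : Finset ℤ²) (fun u => u = v j) (far (v j) l)) garm_loc
      · rw [pp_hreach_eq hx hq (hvp i) rfl, pp_hreach_eq hx hq (hvp j) rfl, ← sq] at this
        exact this
      · rw [disjoint_left]
        intro z hz1 hz2
        rw [mem_hbx] at hz1 hz2
        simp only [hv] at hz1 hz2
        rcases mul_succ_le_or l hij with h | h <;> omega)
  rw [card_range] at hcheb
  have h3 : 1 - ε ≤ PP 0 D' up x q (fun O => ¬ ∀ j ∈ range M, ¬ F j O) := by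
    rw [pp_not hπ hx hq (fun O => ∀ j ∈ range M, ¬ F j O)]; linarith
  refine h3.trans ((pp_mono hπ hx hq fun O _ h => ?_).trans
    (pp_shrink hπ hx hq subset_union_left le_rfl (garm_mono _ _ _ _) fun z _ => hcl z))
  push Not at h
  obtain ⟨j, hj, h⟩ := h
  have h1 := hvM j (mem_range.1 hj)
  have h2 := hv0 j
  refine h.sub le_rfl ?_ (fun _ h => h)
  rintro u rfl
  simp only [hv, seg, hm]
  exact ⟨trivial, by omega, by omega⟩

/-- The cells of a horizontal strip of height `h`. -/
def strip (a b h : ℤ) : Finset ℤ² := Ico a b ×ˢ Ico 0 h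

/-- The cells above height `h`. -/
def zf (h : ℤ) : Set ℤ² := {z | h ≤ z.2}

/-- The column `c` is closed below height `h`. -/
def shut (h c : ℤ) (O : Set ℤ²) : Prop := ∀ y, 0 ≤ y → y < h → (c, y) ∉ O

lemma mem_strip {a b h : ℤ} {z : ℤ²} :
    z ∈ strip a b h ↔ a ≤ z.1 ∧ z.1 < b ∧ 0 ≤ z.2 ∧ z.2 < h := by
  simp only [strip, mem_product, mem_Ico]; omega

lemma mem_zf {h : ℤ} {z : ℤ²} : z ∈ zf h ↔ h ≤ z.2 := Iff.rfl

lemma conn_zf {h : ℤ} {O : Set ℤ²} (hO : zf h ⊆ O) {u v : ℤ²} (hu : h ≤ u.2)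
    (hv : h ≤ v.2) (hpar : par u = par v) : Conn O u v := by
  refine conn_rect (a := min u.1 v.1) (b := max u.1 v.1 + 1) (c := h)
    (d := max u.2 v.2 + 1) ?_ ?_ ?_ ?_ hu ?_ ?_ ?_ hv ?_ ?_ hpar <;> try omega
  intro a b _ _ hb _
  exact hO hb

lemma pp_no_shut (hx : 0 < x) (hq : 1 ≤ q) {h c : ℤ} (N : ℕ)
    (hD : ∀ i y, c ≤ i → i < c + N → 0 ≤ y → y < h → (i, y) ∈ D) :
    PP 0 D ζ x q (fun O => ∀ i, c ≤ i → i < c + N → ¬ shut h i O) ≤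
      (1 - 1 / (2 * max 1 x) ^ h.toNat) ^ N := by
  have hπ : (0 : ℤ) = 0 ∨ (0 : ℤ) = 1 := Or.inl rfl
  have hC : 1 ≤ (2 * max 1 x) ^ h.toNat :=
    one_le_pow₀ (by linarith [le_max_left 1 x])
  induction N with
  | zero => simpa using pp_le_one hπ hx hq _
  | succ N ih =>
    have ih' := ih fun i y h1 h2 => hD i y h1 (by push_cast; omega)
    set A : Set ℤ² → Prop := fun O => ∀ i, c ≤ i → i < c + N → ¬ shut h i O with hA
    set b : Finset ℤ² := {c + (N : ℤ)} ×ˢ Ico 0 h with hb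
    have hmb : ∀ z, z ∈ b ↔ z.1 = c + N ∧ 0 ≤ z.2 ∧ z.2 < h := by
      intro z
      simp only [hb, mem_product, mem_singleton, mem_Ico]
    have hcard : b.card = h.toNat := by simp [hb]
    have h1 := pp_close_cells (D := D) (ζ := ζ) (A := A) (b := b) hπ hx hq
      (by
        rintro ⟨i, y⟩ hz
        rw [hmb] at hz
        simp only at hz
        exact hD i y (by omega) (by push_cast; omega) hz.2.1 hz.2.2)
      (by
        intro O O' hO hAO i h1 h2 hs
        refine hAO i h1 h2 fun y hy1 hy2 hm => hs y hy1 hy2 ?_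
        refine (hO (i, y) ?_).2 hm
        rw [hmb]; simp only; omega)
    rw [hcard] at h1
    have h2 := pp_or_add_and 0 D ζ x q (fun O => A O ∧ ∀ z ∈ b, z ∉ O)
      (fun O => ∀ i, c ≤ i → i < c + (N + 1 : ℕ) → ¬ shut h i O)
    have h3 : PP 0 D ζ x q (fun O => (A O ∧ ∀ z ∈ b, z ∉ O) ∨
        ∀ i, c ≤ i → i < c + (N + 1 : ℕ) → ¬ shut h i O) ≤ PP 0 D ζ x q A := by
      refine pp_mono hπ hx hq ?_
      rintro O - (h | h)
      · exact h.1
      · exact fun i h1 h2 => h i h1 (by push_cast; omega)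
    have h4 : PP 0 D ζ x q (fun O => (A O ∧ ∀ z ∈ b, z ∉ O) ∧
        ∀ i, c ≤ i → i < c + (N + 1 : ℕ) → ¬ shut h i O) = 0 := by
      refine le_antisymm ?_ (pp_nonneg hπ hx hq _)
      have h5 := pp_not hπ hx hq (fun _ => True) (D := D) (ζ := ζ)
      have h6 := pp_one hπ hx hq (D := D) (ζ := ζ) (A := fun _ => True) (fun _ _ => trivial)
      rw [h6, sub_self] at h5
      rw [← h5]
      refine pp_mono hπ hx hq ?_
      rintro O - ⟨⟨-, h1⟩, h2⟩ -
      refine h2 (c + N) (by omega) (by push_cast; omega) fun y hy1 hy2 => h1 _ ?_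
      rw [hmb]; exact ⟨rfl, hy1, hy2⟩
    have h5 : PP 0 D ζ x q A / (2 * max 1 x) ^ h.toNat ≤
        PP 0 D ζ x q (fun O => A O ∧ ∀ z ∈ b, z ∉ O) := by
      rw [div_le_iff₀ (by linarith)]; linarith
    have h6 : 1 / (2 * max 1 x) ^ h.toNat ≤ 1 := by
      rw [div_le_one (by linarith)]; exact hC
    calc _ ≤ PP 0 D ζ x q A * (1 - 1 / (2 * max 1 x) ^ h.toNat) := by
            rw [mul_sub, mul_one, mul_one_div]; linarith
      _ ≤ _ := by
        rw [pow_succ]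
        exact mul_le_mul_of_nonneg_right ih' (by linarith)

lemma exit_strip {O : Set ℤ²} {h i j : ℤ} (hO : ∀ z ∈ O, 0 ≤ z.2) (hi : shut h i O)
    (hj : shut h j O) {u w : ℤ²} (hc : Conn O u w)
    (hu : i < u.1 ∧ u.1 ≤ j ∧ 0 ≤ u.2 ∧ u.2 < h)
    (hw : ¬ (i < w.1 ∧ w.1 ≤ j ∧ 0 ≤ w.2 ∧ w.2 < h)) :
    ∃ w', w'.2 = h ∧ Conn (O ∩ ↑(strip (i + 1) j h)) u w' := by
  have hex := hc.exit (F := fun w => ¬ (i < w.1 ∧ w.1 ≤ j ∧ 0 ≤ w.2 ∧ w.2 < h))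
    (B := {z | z ∈ strip (i + 1) j h ∨ z.2 < 0 ∨ (z.2 < h ∧ (z.1 = i ∨ z.1 = j))}) (by
      intro b hb z c hl
      unfold Lnk at hl
      rw [Set.mem_ofPred_eq, mem_strip]
      omega)
  obtain ⟨w', hw', hc'⟩ : ∃ w', ¬ (i < w'.1 ∧ w'.1 ≤ j ∧ 0 ≤ w'.2 ∧ w'.2 < h) ∧
      Conn (O ∩ {z | z ∈ strip (i + 1) j h ∨ z.2 < 0 ∨ (z.2 < h ∧ (z.1 = i ∨ z.1 = j))}) u w' := by
    rcases hex with h | h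
    · exact ⟨w, hw, h⟩
    · exact h
  have hc2 : Conn (O ∩ ↑(strip (i + 1) j h)) u w' := by
    refine hc'.mono ?_
    rintro ⟨a, y⟩ ⟨hz, h1⟩
    refine ⟨hz, ?_⟩
    rcases h1 with h1 | h1 | ⟨h1, h2⟩
    · exact h1
    · have := hO _ hz; omega
    · have h3 := hO _ hz
      rcases h2 with h2 | h2 <;> simp only at h1 h2 h3 <;> subst h2
      · exact absurd hz (hi y h3 h1)
      · exact absurd hz (hj y h3 h1)
  refine ⟨w', ?_, hc2⟩
  obtain ⟨z, hz, a, hl⟩ := hc2.last_cell (by rintro rfl; exact hw' hu)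
  have := hz.2
  rw [mem_coe, mem_strip] at this
  unfold Lnk at hl
  omega

lemma wired_le_free_strip (hx : 0 < x) (hq : 1 ≤ q) {A : Set ℤ² → Prop}
    {a b h i j : ℤ} {U : ℤ² → Prop} (hai : a ≤ i) (hjb : j < b)
    {B : Set ℤ² → Prop} (hB : OffD (strip (i + 1) j h) B)
    (hBi : ∀ O, B O → shut h i O) (hBj : ∀ O, B O → shut h j O)
    (hA : ∀ O, Agr (strip a b h) up O → B O → A O →
      GArm 0 (strip (i + 1) j h : Finset ℤ²) U (fun w => w.2 = h) O) :
    PP 0 (strip a b h) up x q (fun O => A O ∧ B O) ≤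
      PP 0 (strip (i + 1) j h) (zf h) x q
        (GArm 0 (strip (i + 1) j h : Finset ℤ²) U (fun w => w.2 = h)) *
      PP 0 (strip a b h) up x q B := by
  refine pp_md_upper (Or.inl rfl) hx hq ?_ le_rfl (garm_mono _ _ _ _) hB fun O hO hBO => ⟨?_, ?_⟩
  · intro z hz; rw [mem_strip] at *; omega
  · intro h1
    refine (garm_congr ?_).1 (hA O hO hBO h1)
    ext z
    simp only [Set.mem_inter_iff, mem_coe, mem_glue]
    tauto
  · intro e he _ hc
    have hzf : zf h ⊆ glue (strip (i + 1) j h) (zf h) O := by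
      intro z hz
      rw [mem_glue]
      refine Or.inr ⟨hz, fun h' => ?_⟩
      rw [mem_strip] at h'; rw [mem_zf] at hz; omega
    have hneg : ∀ z ∈ O, 0 ≤ z.2 := by
      intro z hz
      by_cases hzD : z ∈ strip a b h
      · rw [mem_strip] at hzD; omega
      · exact (hO z hzD).1 hz
    have hsi := hBi O hBO
    have hsj := hBj O hBO
    set r : ℤ² → ℤ² := fun u =>
      if h ≤ u.2 ∨ (i < u.1 ∧ u.1 ≤ j ∧ 0 ≤ u.2) then u else (u.1 + u.2 - h, h) with hr
    have hrp : ∀ u, par (r u) = par u := by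
      intro u
      by_cases h1 : h ≤ u.2 ∨ (i < u.1 ∧ u.1 ≤ j ∧ 0 ≤ u.2)
      · simp only [hr, h1, if_true]
      · simp only [hr, h1, if_false, par]; congr 1; ring
    have hgood : ∀ u, (r u = u ∧ i < u.1 ∧ u.1 ≤ j ∧ 0 ≤ u.2 ∧ u.2 < h) ∨
        (h ≤ (r u).2 ∧ (h ≤ u.2 ∨ ¬ (i < u.1 ∧ u.1 ≤ j ∧ 0 ≤ u.2))) := by
      intro u
      by_cases h1 : h ≤ u.2 ∨ (i < u.1 ∧ u.1 ≤ j ∧ 0 ≤ u.2)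
      · simp only [hr, h1, if_true, true_and]; omega
      · simp only [hr, h1, if_false]; right; exact ⟨le_rfl, by omega⟩
    have hmap := Conn.map r (O' := glue (strip (i + 1) j h) (zf h) O) (fun z hz u v hl _ => ?_) hc
    · have hfix : ∀ u, (u = pu 0 e ∨ u = pv 0 e) → r u = u := by
        intro u hu
        have := near_of_corner hu
        rw [mem_strip] at he
        simp only [hr]
        rw [if_pos (by omega)]
      unfold cn
      rw [← hfix _ (Or.inl rfl), ← hfix _ (Or.inr rfl)]
      exact hmap
    · have hz0 := hneg z hz
      have hzi : z.2 < h → z.1 ≠ i ∧ z.1 ≠ j := by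
        intro h1
        constructor <;> intro h2
        · exact hsi z.2 hz0 h1 (h2 ▸ hz)
        · exact hsj z.2 hz0 h1 (h2 ▸ hz)
      have hpar : par (r u) = par (r v) := by rw [hrp, hrp, hl.par_eq]
      have hlc := hl
      unfold Lnk at hlc
      rcases hgood u with ⟨e1, h1⟩ | ⟨h1, h1'⟩ <;> rcases hgood v with ⟨e2, h2⟩ | ⟨h2, h2'⟩
      · rw [e1, e2]
        refine Conn.of_lnk (z := z) ?_ hl
        rw [mem_glue, mem_strip]
        left; refine ⟨hz, ?_⟩; omega
      · have hv : h ≤ v.2 ∧ i < v.1 ∧ v.1 ≤ j := by omega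
        rw [e1, show r v = v by simp only [hr]; rw [if_pos (Or.inl hv.1)]]
        refine Conn.of_lnk (z := z) ?_ hl
        rw [mem_glue, mem_strip]
        left; refine ⟨hz, ?_⟩; omega
      · have hv : h ≤ u.2 ∧ i < u.1 ∧ u.1 ≤ j := by omega
        rw [e2, show r u = u by simp only [hr]; rw [if_pos (Or.inl hv.1)]]
        refine Conn.of_lnk (z := z) ?_ hl
        rw [mem_glue, mem_strip]
        left; refine ⟨hz, ?_⟩; omega
      · exact conn_zf hzf h1 h2 hpar

/-- The column `i` is the first closed one to the right of `a`. -/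
def fstShut (h a i : ℤ) (O : Set ℤ²) : Prop :=
  shut h i O ∧ ∀ i', a ≤ i' → i' < i → ¬ shut h i' O

/-- The column `j` is the first closed one to the left of `b`. -/
def lstShut (h b j : ℤ) (O : Set ℤ²) : Prop :=
  shut h j O ∧ ∀ j', j < j' → j' < b → ¬ shut h j' O

/-- The first closed columns from both sides are `t.1` and `t.2`. -/
def twoShut (h a b : ℤ) (t : ℤ²) (O : Set ℤ²) : Prop :=
  fstShut h a t.1 O ∧ lstShut h b t.2 O

/-- In a wide strip, free on the sides and the bottom and wired on top, a long segment of the bottom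
is connected to the top with large probability. -/
lemma le_pp_strip (hx : 0 < x) (hq : 1 ≤ q) {ε₀ ε : ℝ} (hε₀ : 0 < ε₀)
    (hθ : ∀ n : ℕ, ε₀ ≤ thp n x q) (hε : 0 < ε) :
    ∃ m : ℤ, 0 < m ∧ ∀ h : ℤ, 0 < h → ∃ n : ℤ, m < n ∧ ∀ a b, a ≤ -n → n ≤ b →
      1 - ε ≤ PP 0 (strip a b h) (zf h) x q
        (GArm 0 (strip a b h : Finset ℤ²) (seg 0 m 0) (fun w => w.2 = h)) := by
  obtain ⟨m, hm, H⟩ := le_pp_seg hx hq hε₀ hθ (ε := ε / 3) (by positivity)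
  refine ⟨m, hm, fun h hh => ?_⟩
  have hπ : (0 : ℤ) = 0 ∨ (0 : ℤ) = 1 := Or.inl rfl
  have hC : 1 ≤ (2 * max 1 x) ^ h.toNat :=
    one_le_pow₀ (by linarith [le_max_left 1 x])
  obtain ⟨N, hN⟩ : ∃ N : ℕ, (1 - 1 / (2 * max 1 x) ^ h.toNat) ^ N < ε / 3 := by
    refine exists_pow_lt_of_lt_one (by positivity) ?_
    have : 0 < 1 / (2 * max 1 x) ^ h.toNat := by positivity
    linarith
  set n : ℤ := m + N + h + 1 with hn
  refine ⟨n, by omega, fun a b ha hb => ?_⟩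
  set S := strip (-n) n h with hS
  set A := GArm 0 (hbx (0, 0) n : Finset ℤ²) (seg 0 m 0) (far (0, 0) n) with hA
  set P := PP 0 (strip a b h) (zf h) x q
        (GArm 0 (strip a b h : Finset ℤ²) (seg 0 m 0) (fun w => w.2 = h)) with hP
  have hS0 : ∀ z ∈ S, 0 ≤ z.2 := by intro z hz; rw [hS, mem_strip] at hz; omega
  have hA1 : 1 - ε / 3 ≤ PP 0 S up x q A := H n S (by omega) hS0
  have hl := pp_no_shut (D := S) (ζ := up) (h := h) (c := -n) hx hq N (by
    intro i y _ _ _ _; rw [hS, mem_strip]; simp only; omega)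
  have hr := pp_no_shut (D := S) (ζ := up) (h := h) (c := n - N) hx hq N (by
    intro i y _ _ _ _; rw [hS, mem_strip]; simp only; omega)
  set I := Ico (-n) (-n + N) ×ˢ Ico (n - N) n with hI
  set B : ℤ² → Set ℤ² → Prop := twoShut h (-n) n with hB
  have hterm : ∀ t ∈ I, PP 0 S up x q (fun O => A O ∧ B t O) ≤ P * PP 0 S up x q (B t) := by
    rintro ⟨i, j⟩ ht
    simp only [hI, mem_product, mem_Ico] at ht
    refine (wired_le_free_strip hx hq (U := seg 0 m 0) (i := i) (j := j) (by omega) (by omega) ?_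
      (fun O h => h.1.1) (fun O h => h.2.1) ?_).trans
      (mul_le_mul_of_nonneg_right ?_ (pp_nonneg hπ hx hq _))
    · rintro O O' hO ⟨⟨h1, h2⟩, h3, h4⟩
      have key : ∀ i', i' ≤ i ∨ j ≤ i' → (shut h i' O ↔ shut h i' O') := by
        intro i' hi'
        refine forall_congr' fun y => forall_congr' fun _ => forall_congr' fun _ => not_congr ?_
        refine (hO (i', y) ?_).symm
        rw [mem_strip]; simp only; omega
      exact ⟨⟨(key i (by omega)).1 h1, fun i' h5 h6 h7 => h2 i' h5 h6 ((key i' (by omega)).2 h7)⟩,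
        (key j (by omega)).1 h3, fun i' h5 h6 h7 => h4 i' h5 h6 ((key i' (by omega)).2 h7)⟩
    · rintro O hO ⟨⟨hi, -⟩, hj, -⟩ ⟨u, hu, hup, w, hw, hc⟩
      have hu' := hu
      unfold seg at hu'
      have hlow : ∀ c, shut h c O → shut h c (O ∩ ↑(hbx (0, 0) n)) :=
        fun c hc y h1 h2 h3 => hc y h1 h2 h3.1
      obtain ⟨w', hw', hc'⟩ := exit_strip (h := h) (i := i) (j := j)
        (fun z hz => (mem_hbx.1 hz.2).2) (hlow i hi) (hlow j hj) hc (by omega)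
        (by unfold far at hw; simp only at hw; omega)
      refine ⟨u, hu, hup, w', hw', hc'.mono ?_⟩
      rintro z ⟨hz, hz'⟩
      exact ⟨hz.1, hz'⟩
    · have hsub : strip (i + 1) j h ⊆ strip a b h := by
        intro z hz; rw [mem_strip] at *; omega
      refine (pp_enlarge hπ hx hq hsub le_rfl (garm_mono _ _ _ _) (ζ' := zf h) ?_).trans
        (pp_mono hπ hx hq fun O _ h => h.sub (by exact_mod_cast hsub) (fun _ h => h) fun _ h => h)
      intro z _ hz
      refine ⟨hz, fun h' => ?_⟩
      rw [mem_strip] at h'; rw [mem_zf] at hz; omega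
  have hsum : ∑ t ∈ I, PP 0 S up x q (B t) ≤ (1 : ℕ) := by
    refine pp_sum_le hπ hx hq I B 1 fun O _ => ?_
    rw [card_le_one]
    rintro ⟨i, j⟩ h1 ⟨i', j'⟩ h2
    obtain ⟨h1, ⟨h3, h4⟩, h5, h6⟩ := mem_filter.1 h1
    obtain ⟨h2, ⟨h7, h8⟩, h9, h10⟩ := mem_filter.1 h2
    simp only [hI, mem_product, mem_Ico] at *
    rw [Prod.mk.injEq]
    constructor
    · rcases lt_trichotomy i i' with h | h | h
      · exact absurd h3 (h8 i (by omega) h)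
      · exact h
      · exact absurd h7 (h4 i' (by omega) h)
    · rcases lt_trichotomy j j' with h | h | h
      · exact absurd h9 (h6 j' (by omega) (by omega))
      · exact h
      · exact absurd h5 (h10 j (by omega) (by omega))
  have hAB : PP 0 S up x q (fun O => ∃ t ∈ I, A O ∧ B t O) ≤ P := by
    refine (pp_exists_le hπ hx hq I _).trans ((sum_le_sum hterm).trans ?_)
    rw [← mul_sum]
    have hP0 : 0 ≤ P := pp_nonneg hπ hx hq _
    calc P * ∑ t ∈ I, PP 0 S up x q (B t) ≤ P * (1 : ℕ) := mul_le_mul_of_nonneg_left hsum hP0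
      _ = P := by simp
  have hsplit : PP 0 S up x q A ≤ PP 0 S up x q (fun O => (∃ t ∈ I, A O ∧ B t O) ∨
      ((∀ i, -n ≤ i → i < -n + N → ¬ shut h i O) ∨ ∀ i, n - N ≤ i → i < n - N + N → ¬ shut h i O)) := by
    refine pp_mono hπ hx hq fun O _ hAO => ?_
    by_contra hcon
    push Not at hcon
    obtain ⟨h1, ⟨i, hi1, hi2, hi3⟩, j, hj1, hj2, hj3⟩ := hcon
    obtain ⟨i0, ⟨hi4, hi5⟩, hi6⟩ := Int.exists_least_of_bdd (P := fun i => -n ≤ i ∧ shut h i O)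
      ⟨-n, fun z hz => hz.1⟩ ⟨i, hi1, hi3⟩
    obtain ⟨j0, ⟨hj4, hj5⟩, hj6⟩ := Int.exists_greatest_of_bdd (P := fun j => j < n ∧ shut h j O)
      ⟨n, fun z hz => hz.1.le⟩ ⟨j, by omega, hj3⟩
    have hi7 := hi6 i ⟨hi1, hi3⟩
    have hj7 := hj6 j ⟨by omega, hj3⟩
    refine h1 (i0, j0) ?_ hAO ⟨⟨hi5, fun i' h1 h2 h3 => ?_⟩, hj5, fun j' h1 h2 h3 => ?_⟩
    · simp only [hI, mem_product, mem_Ico]; omega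
    · have := hi6 i' ⟨h1, h3⟩; simp only at h2; omega
    · have := hj6 j' ⟨h2, h3⟩; simp only at h1; omega
  have h1 := pp_or_le hπ hx hq (D := S) (ζ := up) (fun O => ∃ t ∈ I, A O ∧ B t O)
    (fun O => (∀ i, -n ≤ i → i < -n + N → ¬ shut h i O) ∨ ∀ i, n - N ≤ i → i < n - N + N → ¬ shut h i O)
  have h2 := pp_or_le hπ hx hq (D := S) (ζ := up) (fun O => ∀ i, -n ≤ i → i < -n + N → ¬ shut h i O)
    (fun O => ∀ i, n - N ≤ i → i < n - N + N → ¬ shut h i O)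
  linarith

lemma far_strip (a b : ℤ) {h : ℤ} (hh : 0 < h) : Far (strip a b h) (zf h) := by
  have hlow : ∀ u v : ℤ², u.2 ≤ 0 → v.2 ≤ 0 → par u = par v →
      Conn (zf h ∪ ↑(strip a b h))ᶜ u v := by
    intro u v hu hv hp
    refine conn_rect (a := min u.1 v.1) (b := max u.1 v.1 + 1) (c := min u.2 v.2 - 1) (d := 0)
      ?_ ?_ ?_ ?_ ?_ hu ?_ ?_ ?_ hv ?_ hp <;> try omega
    intro s y _ _ _ hy
    rw [Set.mem_compl_iff, Set.mem_union, mem_coe, mem_strip, mem_zf]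
    simp only; omega
  have hcan : ∀ v z : ℤ², par v = 1 → z ∉ zf h → z ∉ strip a b h →
      (v = pu 1 z ∨ v = pv 1 z) →
      ∃ p : ℤ², p.2 ≤ 0 ∧ par p = 1 ∧ Conn (zf h ∪ ↑(strip a b h))ᶜ v p := by
    intro v z hv h1 h2 hvz
    have hcl := near_of_corner hvz
    rw [mem_zf] at h1
    rw [mem_strip] at h2
    by_cases hz : z.2 < 0
    · exact ⟨v, by omega, hv, Conn.refl _ _⟩
    refine ⟨(v.1, -v.2), by simp only; omega, by unfold par at *; simp only; omega, ?_⟩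
    have hp : par v = par (v.1, -v.2) := by unfold par; simp only; omega
    refine conn_rect (a := z.1) (b := z.1 + 1) (c := -v.2) (d := z.2 + 1)
      (by omega) ?_ (by omega) (by omega) (by omega) (by omega) ?_ ?_ ?_ ?_ (by omega) hp
    · intro s y _ _ _ hy
      rw [Set.mem_compl_iff, Set.mem_union, mem_coe, mem_strip, mem_zf]
      simp only; omega
    all_goals simp only; omega
  refine ⟨∅, Set.finite_empty, fun u v z z' hu hv _ _ h1 h2 h3 h4 h5 h6 => ?_⟩
  obtain ⟨p, hp, hp1, hc⟩ := hcan u z hu h1 h2 h5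
  obtain ⟨p', hp', hp1', hc'⟩ := hcan v z' hv h3 h4 h6
  exact (hc.trans (hlow p p' hp hp' (hp1.trans hp1'.symm))).trans hc'.symm

/-- Disjoint primal and dual crossings of a strip do not cross each other. -/
lemma crossing_color {a b h : ℤ} {O O' : Set ℤ²} (hd : ∀ z ∈ O, z ∉ O') (hh : 0 < h)
    (hO : ∀ z ∈ O, z ∈ strip a b h) (hO' : ∀ z ∈ O', z ∈ strip a b h) {v y : ℤ²}
    (hv : par v = 1) (hv2 : v.2 = h) (hy2 : y.2 = 0) (hc' : Conn O' v y) (K : ℕ) :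
    ∃ s : ℤ² → ZMod 2, ∃ e : ZMod 2,
      (∀ u w, par u = 0 → Conn O u w → s u = s w) ∧
      (∀ w : ℤ², par w = 0 → w.2 = h → w.1.natAbs ≤ K →
        s w = if v.1 < w.1 then e + 1 else e) ∧
      (∀ u : ℤ², par u = 0 → u.2 = 0 → u.1.natAbs ≤ K →
        s u = if y.1 < u.1 then e + 1 else e) := by
  have hy : par y = 1 := hc'.par_eq.symm.trans hv
  have h2 : ∀ z : ZMod 2, z + z = 0 := by decide
  obtain ⟨c1, hc1, hb1⟩ := hc'.exists_chain hv
  set r1 : ℤ² → ZMod 2 := fun z => if z.1 - v.1 = z.2 - h ∧ h ≤ z.2 then 1 else 0 with hr1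
  set r2 : ℤ² → ZMod 2 := fun z => if z.1 - y.1 = -1 - z.2 ∧ z.2 < 0 then 1 else 0 with hr2
  have hbr1 : ∀ p, par p = 1 → bd r1 p = one v p := by
    rintro ⟨p1, p2⟩ hp
    obtain ⟨v1, v2⟩ := v
    simp only at hv2
    subst hv2
    unfold par at *
    simp only [bd, one, hr1, Prod.mk.injEq] at *
    rw [if_neg (c := p1 - v1 = p2 - 1 - v2 ∧ v2 ≤ p2 - 1) (by omega),
      if_neg (c := p1 - 1 - v1 = p2 - v2 ∧ v2 ≤ p2) (by omega)]
    by_cases e : p1 - v1 = p2 - v2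
    · rcases lt_trichotomy p2 v2 with e' | e' | e'
      · rw [if_neg (by omega), if_neg (by omega), if_neg (by omega)]; rfl
      · rw [if_neg (by omega), if_pos (by omega), if_pos (by omega)]; rfl
      · rw [if_pos (by omega), if_pos (by omega), if_neg (by omega)]; rfl
    · rw [if_neg (by omega), if_neg (by omega), if_neg (by omega)]; rfl
  have hbr2 : ∀ p, par p = 1 → bd r2 p = one y p := by
    rintro ⟨p1, p2⟩ hp
    obtain ⟨y1, y2⟩ := y
    simp only at hy2
    subst hy2
    unfold par at *
    simp only [bd, one, hr2, Prod.mk.injEq] at *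
    rw [if_neg (c := p1 - 1 - y1 = -1 - (p2 - 1) ∧ p2 - 1 < 0) (by omega),
      if_neg (c := p1 - y1 = -1 - p2 ∧ p2 < 0) (by omega)]
    by_cases e : p1 - y1 = - p2
    · rcases lt_trichotomy p2 0 with e' | e' | e'
      · rw [if_pos (by omega), if_pos (by omega), if_neg (by omega)]; rfl
      · rw [if_pos (by omega), if_neg (by omega), if_pos (by omega)]; rfl
      · rw [if_neg (by omega), if_neg (by omega), if_neg (by omega)]; rfl
    · rw [if_neg (by omega), if_neg (by omega), if_neg (by omega)]; rfl
  obtain ⟨s, hs⟩ := poincare (c := fun z => c1 z + (r1 z + r2 z)) (fun p hp => by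
    rw [bd_add, bd_add, hb1 p hp, hbr1 p hp, hbr2 p hp]; linear_combination h2 (one v p) + h2 (one y p))
  have hc10 : ∀ z, z ∉ strip a b h → c1 z = 0 := by
    intro z hz
    by_contra hne
    exact hz (hO' z (hc1 z hne))
  have hr10 : ∀ z : ℤ², z.2 < h ∨ z.1 - v.1 ≠ z.2 - h → r1 z = 0 := by
    intro z hz; simp only [hr1]; rw [if_neg (by omega)]
  have hr20 : ∀ z : ℤ², 0 ≤ z.2 ∨ z.1 - y.1 ≠ -1 - z.2 → r2 z = 0 := by
    intro z hz; simp only [hr2]; rw [if_neg (by omega)]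
  have hzero : ∀ z : ℤ², z ∉ strip a b h → (z.2 < h ∨ z.1 - v.1 ≠ z.2 - h) →
      (0 ≤ z.2 ∨ z.1 - y.1 ≠ -1 - z.2) → c1 z + (r1 z + r2 z) = 0 := by
    intro z h1 h3 h4
    rw [hc10 z h1, hr10 z h3, hr20 z h4]; rfl
  have hst : ∀ {p p' : ℤ²}, par p = 0 → Conn {z | c1 z + (r1 z + r2 z) = 0} p p' → s p = s p' :=
    fun hp hc => const_of_conn hs (fun z hz => hz) hp hc
  have huw : ∀ u w, par u = 0 → Conn O u w → s u = s w := by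
    intro u w hu hc
    refine const_of_conn hs (O := O) (fun z hz => ?_) hu hc
    have h3 := hO z hz
    rw [mem_strip] at h3
    have h4 : c1 z = 0 := by
      by_contra hne
      exact hd z hz (hc1 z hne)
    rw [h4, hr10 z (by omega), hr20 z (by omega)]; rfl
  obtain ⟨l, hl⟩ : ∃ l : ℤ, l = -2 * (a.natAbs + v.1.natAbs + y.1.natAbs + K + h + 2) := ⟨_, rfl⟩
  have hlp : par (l, 0) = 0 := by unfold par; simp only; omega
  have hstrip : ∀ i j : ℤ, i < a ∨ h ≤ j ∨ j < 0 → (i, j) ∉ strip a b h := by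
    intro i j hij; rw [mem_strip]; simp only; omega
  have htop : ∀ p : ℤ², par p = 0 → p.2 = h ∨ p.2 = h + 1 → p.1 ≤ v.1 → l ≤ p.1 →
      s p = s (l, 0) := by
    intro p hp hp2 hpv hpl
    have hp' : par (l - h, h) = 0 := by unfold par; simp only; omega
    refine (hst hp ((conn_row (y := h) (a := l - h) (b := v.1) (v := (l - h, h)) ?_ ?_ hpv hp2 ?_ ?_ ?_
      (hp.trans hp'.symm)).trans (conn_rect (a := l - h) (b := l + 1) (c := 0) (d := h)
      ?_ ?_ ?_ ?_ ?_ ?_ ?_ ?_ ?_ ?_ ?_ (hp'.trans hlp.symm)))).trans rfl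
    · intro i _ hi
      exact hzero _ (hstrip _ _ (by omega)) (by simp only; omega) (by simp only; omega)
    all_goals try (simp only; omega)
    all_goals try omega
    intro i j _ hi _ hj
    exact hzero _ (hstrip _ _ (by omega)) (by simp only; omega) (by simp only; omega)
  have hbot : ∀ p : ℤ², par p = 0 → p.2 = 0 ∨ p.2 = -1 → p.1 ≤ y.1 → l ≤ p.1 →
      s p = s (l, 0) := by
    intro p hp hp2 hpv hpl
    refine hst hp (conn_row (y := -1) (a := l) (b := y.1) ?_ hpl hpv (by omega) ?_ ?_ ?_
      (hp.trans hlp.symm))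
    · intro i _ hi
      exact hzero _ (hstrip _ _ (by omega)) (by simp only; omega) (by simp only; omega)
    all_goals simp only; omega
  have htop' : ∀ w : ℤ², par w = 0 → w.2 = h → v.1 < w.1 → s w = s (l, 0) + 1 := by
    intro w hw hw2 hlt
    have h3 : par (v.1 + 1, h) = 0 := by unfold par at *; simp only; omega
    have h4 : s w = s (v.1 + 1, h) := by
      refine hst hw (conn_row (y := h) (a := v.1 + 1) (b := w.1 + 1) ?_ (by omega) (by omega)
        (by omega) ?_ ?_ ?_ (hw.trans h3.symm))
      · intro i hi _
        exact hzero _ (hstrip _ _ (by omega)) (by simp only; omega) (by simp only; omega)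
      · simp only; omega
      · simp only; omega
      · exact Or.inl rfl
    have h5 := hs (v.1, h) (v.1 + 1, h) (v.1, h + 1) (by unfold Lnk; simp) h3
    rw [hc10 _ (hstrip _ _ (by omega)), hr20 _ (by simp only; omega)] at h5
    simp only [hr1, sub_self, le_refl, and_self, if_true] at h5
    rw [htop (v.1, h + 1) (by unfold par at *; simp only; omega) (Or.inr rfl) le_rfl
      (by simp only; omega)] at h5
    linear_combination h4 + h5 - h2 (s (l, 0))
  have hbot' : ∀ u : ℤ², par u = 0 → u.2 = 0 → y.1 < u.1 → s u = s (l, 0) + 1 := by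
    intro u hu hu2 hlt
    have h3 : par (y.1 + 1, 0) = 0 := by unfold par at *; simp only; omega
    have h4 : s u = s (y.1 + 1, 0) := by
      refine hst hu (conn_row (y := -1) (a := y.1 + 1) (b := u.1 + 1) ?_ (by omega) (by omega)
        (by omega) ?_ ?_ ?_ (hu.trans h3.symm))
      · intro i hi _
        exact hzero _ (hstrip _ _ (by omega)) (by simp only; omega) (by simp only; omega)
      all_goals simp only; omega
    have h5 := hs (y.1, -1) (y.1 + 1, 0) (y.1, -1) (by unfold Lnk; simp) h3
    rw [hc10 _ (hstrip _ _ (by omega)), hr10 _ (by simp only; omega)] at h5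
    have h6 : r2 (y.1, -1) = 1 := by simp only [hr2]; rw [if_pos (by omega)]
    rw [h6, hbot (y.1, -1) (by unfold par at *; simp only; omega) (Or.inr rfl) le_rfl
      (by simp only; omega)] at h5
    linear_combination h4 + h5 - h2 (s (l, 0))
  refine ⟨s, s (l, 0), huw, fun w hw hw2 hwK => ?_, fun u hu hu2 huK => ?_⟩
  · split_ifs with h3
    · exact htop' w hw hw2 h3
    · exact htop w hw (by omega) (by omega) (by omega)
  · split_ifs with h3
    · exact hbot' u hu hu2 h3
    · exact hbot u hu (by omega) (by omega) (by omega)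

lemma if_add_one_inj {P Q : Prop} [Decidable P] [Decidable Q] {e : ZMod 2}
    (h : (if P then e + 1 else e) = if Q then e + 1 else e) : P ↔ Q := by
  have h01 : ∀ z : ZMod 2, z + 1 ≠ z := by decide
  by_cases hP : P <;> by_cases hQ : Q <;> simp only [hP, hQ, if_true, if_false] at h ⊢
  · exact (h01 _ h).elim
  · exact (h01 _ h.symm).elim

lemma crossing_order {a b h : ℤ} {O O' : Set ℤ²} (hd : ∀ z ∈ O, z ∉ O') (hh : 0 < h)
    (hO : ∀ z ∈ O, z ∈ strip a b h) (hO' : ∀ z ∈ O', z ∈ strip a b h) {u w v y : ℤ²}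
    (hu : par u = 0) (hu2 : u.2 = 0) (hw2 : w.2 = h) (hv : par v = 1) (hv2 : v.2 = h)
    (hy2 : y.2 = 0) (hc : Conn O u w) (hc' : Conn O' v y) : y.1 < u.1 ↔ v.1 < w.1 := by
  obtain ⟨s, e, hs, ht, hb⟩ :=
    crossing_color hd hh hO hO' hv hv2 hy2 hc' (u.1.natAbs + w.1.natAbs)
  have h1 := hs u w hu hc
  rw [ht w (hc.par_eq.symm.trans hu) hw2 (by omega), hb u hu hu2 (by omega)] at h1
  exact if_add_one_inj h1

lemma crossing_separates {a b h : ℤ} {O O' : Set ℤ²} (hd : ∀ z ∈ O, z ∉ O') (hh : 0 < h)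
    (hO : ∀ z ∈ O, z ∈ strip a b h) (hO' : ∀ z ∈ O', z ∈ strip a b h) {u w v y : ℤ²}
    (hu : par u = 0) (hu2 : u.2 = 0) (hw2 : w.2 = 0) (hv : par v = 1) (hv2 : v.2 = h)
    (hy2 : y.2 = 0) (hc : Conn O u w) (hc' : Conn O' v y) : y.1 < u.1 ↔ y.1 < w.1 := by
  obtain ⟨s, e, hs, -, hb⟩ :=
    crossing_color hd hh hO hO' hv hv2 hy2 hc' (u.1.natAbs + w.1.natAbs)
  have h1 := hs u w hu hc
  rw [hb w (hc.par_eq.symm.trans hu) hw2 (by omega), hb u hu hu2 (by omega)] at h1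
  exact if_add_one_inj h1

/-- A dual crossing of the strip with free bottom is at least as likely as a primal one. -/
lemma le_pp_dual_cross (hx : 0 < x) (hq : 1 ≤ q) (hxq : q / x = x) {a b h : ℤ} (hh : 0 < h)
    (hodd : h % 2 = 1) {U F U' F' : ℤ² → Prop} (hU : ∀ u : ℤ², U' (u.1, h - u.2) ↔ U u)
    (hF : ∀ u : ℤ², F' (u.1, h - u.2) ↔ F u) :
    PP 0 (strip a b h) (zf h) x q (GArm 0 (strip a b h : Finset ℤ²) U F) ≤
      PP 0 (strip a b h) (zf h) x q (fun O => GArm 1 (strip a b h : Finset ℤ²) U' F' Oᶜ) := by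
  have hπ : (0 : ℤ) = 0 ∨ (0 : ℤ) = 1 := Or.inl rfl
  have e1 := pp_dual hx hq (far_strip a b hh) (GArm 1 (strip a b h : Finset ℤ²) U' F')
  rw [hxq] at e1
  have e2 : PP 1 (strip a b h) (zf h)ᶜ x q (GArm 1 (strip a b h : Finset ℤ²) U' F') =
      PP 0 (strip a b h) up x q (GArm 0 (strip a b h : Finset ℤ²) U F) := by
    refine pp_garm_image (PSym.reflY h) hπ ?_ hx hq ?_ ?_ ?_ ?_ ?_
    · rw [PSym.reflY_sh]; omega
    · intro z; rw [PSym.reflY_cell, mem_strip, mem_strip]; simp only; omega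
    · intro z _; rw [PSym.reflY_cell, Set.mem_compl_iff, mem_zf, mem_up]; simp only; omega
    · intro z
      rw [PSym.reflY_cell, mem_coe, mem_coe, mem_strip, mem_strip]; simp only; omega
    · intro u; rw [PSym.reflY_pt]; exact hU u
    · intro u; rw [PSym.reflY_pt]; exact hF u
  refine le_trans ?_ (e2.symm.trans e1).le
  refine pp_dom hπ hx hq le_rfl (fun z _ hz => ?_) (garm_mono _ _ _ _)
  rw [mem_zf] at hz; rw [mem_up]; omega

lemma pp_strip_shift (hx : 0 < x) (hq : 1 ≤ q) {a b h c : ℤ} (hc : c % 2 = 0)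
    {U F U' F' : ℤ² → Prop} (hU : ∀ u : ℤ², U' (u.1 + c, u.2) ↔ U u)
    (hF : ∀ u : ℤ², F' (u.1 + c, u.2) ↔ F u) :
    PP 0 (strip (a + c) (b + c) h) (zf h) x q
      (GArm 0 (strip (a + c) (b + c) h : Finset ℤ²) U' F') =
    PP 0 (strip a b h) (zf h) x q (GArm 0 (strip a b h : Finset ℤ²) U F) := by
  refine pp_garm_image (PSym.shift (c, 0)) (Or.inl rfl) ?_ hx hq ?_ ?_ ?_ ?_ ?_
  · rw [PSym.shift_sh]; unfold par; simp only; omega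
  · rintro ⟨s, t⟩; rw [PSym.shift_cell, mem_strip, mem_strip]; simp only [Prod.mk_add_mk]; omega
  · rintro ⟨s, t⟩ -; rw [PSym.shift_cell, mem_zf, mem_zf]; simp only [Prod.mk_add_mk]; omega
  · rintro ⟨s, t⟩
    rw [PSym.shift_cell, mem_coe, mem_coe, mem_strip, mem_strip]
    simp only [Prod.mk_add_mk]; omega
  · rintro ⟨s, t⟩; rw [PSym.shift_pt, ← hU]; simp [Prod.mk_add_mk]
  · rintro ⟨s, t⟩; rw [PSym.shift_pt, ← hF]; simp [Prod.mk_add_mk]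

lemma pp_strip_refl (hx : 0 < x) (hq : 1 ≤ q) {a b h : ℤ}
    {U F U' F' : ℤ² → Prop} (hU : ∀ u : ℤ², U' (-u.1, u.2) ↔ U u)
    (hF : ∀ u : ℤ², F' (-u.1, u.2) ↔ F u) :
    PP 0 (strip (-b) (-a) h) (zf h) x q
      (GArm 0 (strip (-b) (-a) h : Finset ℤ²) U' F') =
    PP 0 (strip a b h) (zf h) x q (GArm 0 (strip a b h : Finset ℤ²) U F) := by
  refine pp_garm_image (PSym.reflX 0) (Or.inl rfl) ?_ hx hq ?_ ?_ ?_ ?_ ?_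
  · rw [PSym.reflX_sh]; rfl
  · intro z; rw [PSym.reflX_cell, mem_strip, mem_strip]; simp only; omega
  · intro z _; rw [PSym.reflX_cell, mem_zf, mem_zf]
  · intro z
    rw [PSym.reflX_cell, mem_coe, mem_coe, mem_strip, mem_strip]; simp only; omega
  · intro u; rw [PSym.reflX_pt, ← hU, zero_sub]
  · intro u; rw [PSym.reflX_pt, ← hF, zero_sub]

lemma pp_strip_mono (hx : 0 < x) (hq : 1 ≤ q) {a b a' b' h : ℤ} (ha : a' ≤ a) (hb : b ≤ b')
    {U F : ℤ² → Prop} :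
    PP 0 (strip a b h) (zf h) x q (GArm 0 (strip a b h : Finset ℤ²) U F) ≤
    PP 0 (strip a' b' h) (zf h) x q (GArm 0 (strip a' b' h : Finset ℤ²) U F) := by
  have hπ : (0 : ℤ) = 0 ∨ (0 : ℤ) = 1 := Or.inl rfl
  have hsub : strip a b h ⊆ strip a' b' h := by
    intro z hz; rw [mem_strip] at *; omega
  refine (pp_enlarge hπ hx hq hsub le_rfl (garm_mono _ _ _ _) (ζ' := zf h) ?_).trans
    (pp_mono hπ hx hq fun O _ h => h.sub (by exact_mod_cast hsub) (fun _ h => h) fun _ h => h)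
  intro z _ hz
  refine ⟨hz, fun h' => ?_⟩
  rw [mem_strip] at h'; rw [mem_zf] at hz; omega

/-- A crossing does not deviate to the right with large probability. -/
lemma pp_cross_right_le (hx : 0 < x) (hq : 1 ≤ q) (hxq : q / x = x) {ε : ℝ} (hε : ε ≤ 1 / 4)
    {m n h : ℤ} (hh : 0 < h) (hodd : h % 2 = 1)
    (H : ∀ a b, a ≤ -n → n ≤ b → 1 - ε ≤ PP 0 (strip a b h) (zf h) x q
        (GArm 0 (strip a b h : Finset ℤ²) (seg 0 m 0) (fun w => w.2 = h))) (a b : ℤ) :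
    PP 0 (strip a b h) (zf h) x q
      (GArm 0 (strip a b h : Finset ℤ²) (seg 0 m 0) (fun w => w.2 = h ∧ 3 * m < w.1)) ≤
      2 / 3 := by
  have hπ : (0 : ℤ) = 0 ∨ (0 : ℤ) = 1 := Or.inl rfl
  by_contra hcon
  rw [not_le] at hcon
  obtain ⟨k, hk⟩ : ∃ k : ℤ, k = a.natAbs + b.natAbs + 2 * m.natAbs + n.natAbs := ⟨_, rfl⟩
  set D := strip (-k) k h with hD
  set E1 := GArm 0 (D : Finset ℤ²) (seg (-(2 * m)) m 0) (fun w => w.2 = h ∧ m < w.1) with hE1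
  set E2 := GArm 0 (D : Finset ℤ²) (seg (2 * m) m 0) (fun w => w.2 = h ∧ w.1 < -m) with hE2
  have h1 : 2 / 3 < PP 0 D (zf h) x q E1 := by
    refine hcon.trans_le ?_
    rw [← pp_strip_shift hx hq (c := -(2 * m)) (a := a) (b := b) (h := h)
      (U' := seg (-(2 * m)) m 0) (F' := fun w => w.2 = h ∧ m < w.1) (by omega)
      (fun u => by unfold seg; simp only; omega) (fun u => by simp only; omega)]
    exact pp_strip_mono hx hq (by omega) (by omega)
  have h2 : 2 / 3 < PP 0 D (zf h) x q E2 := by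
    have := pp_strip_refl hx hq (a := -k) (b := k) (h := h) (U := seg (-(2 * m)) m 0)
      (F := fun w => w.2 = h ∧ m < w.1) (U' := seg (2 * m) m 0) (F' := fun w => w.2 = h ∧ w.1 < -m)
      (fun u => by unfold seg; simp only; omega) (fun u => by simp only; omega)
    rw [neg_neg] at this
    rw [hE2, hD, this]; exact h1
  have h3 := (H (-k) k (by omega) (by omega)).trans (le_pp_dual_cross hx hq hxq hh hodd
    (U' := seg 0 m h) (F' := fun w => w.2 = 0)
    (fun u => by unfold seg; simp only; omega) (fun u => by simp only; omega))
  have h4 := pp_and_ge hπ hx hq (D := D) (ζ := zf h) E1 E2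
  have h5 := pp_and_ge hπ hx hq (D := D) (ζ := zf h) (fun O => E1 O ∧ E2 O)
    (fun O => GArm 1 (D : Finset ℤ²) (seg 0 m h) (fun w => w.2 = 0) Oᶜ)
  have h6 : PP 0 D (zf h) x q (fun O => (E1 O ∧ E2 O) ∧
      GArm 1 (D : Finset ℤ²) (seg 0 m h) (fun w => w.2 = 0) Oᶜ) ≤ 0 := by
    have e1 := pp_not hπ hx hq (fun _ => True) (D := D) (ζ := zf h)
    have e2 := pp_one hπ hx hq (D := D) (ζ := zf h) (A := fun _ => True) (fun _ _ => trivial)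
    rw [e2, sub_self] at e1
    rw [← e1]
    refine pp_mono hπ hx hq ?_
    rintro O - ⟨⟨⟨u, hu, hup, w, hw, hc⟩, u', hu', hup', w', hw', hc'⟩, v, hv, hvp, y, hy, hcd⟩ -
    have hdis : ∀ z ∈ O ∩ (D : Set ℤ²), z ∉ Oᶜ ∩ (D : Set ℤ²) :=
      fun z hz hz' => hz'.1 hz.1
    unfold seg at *
    have o1 := crossing_order hdis hh (fun z hz => hz.2) (fun z hz => hz.2) hup hu.1 hw.1 hvp hv.1
      hy hc hcd
    have o2 := crossing_order hdis hh (fun z hz => hz.2) (fun z hz => hz.2) hup' hu'.1 hw'.1 hvp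
      hv.1 hy hc' hcd
    omega
  linarith

/-- In the percolating phase, strips are crossed by primal and dual paths near any given place. -/
lemma le_pp_cross (hx : 0 < x) (hq : 1 ≤ q) (hxq : q / x = x) {ε₀ ε : ℝ} (hε₀ : 0 < ε₀)
    (hθ : ∀ n : ℕ, ε₀ ≤ thp n x q) (hε : 0 < ε) :
    ∃ m : ℤ, 0 < m ∧ ∀ h : ℤ, 0 < h → h % 2 = 1 → ∃ n : ℤ, 0 < n ∧ ∀ a b c, c % 2 = 0 →
      a ≤ c - n → c + n ≤ b →
      1 - ε ≤ PP 0 (strip a b h) (zf h) x q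
        (GArm 0 (strip a b h : Finset ℤ²) (seg c m 0) (seg c (3 * m) h)) ∧
      1 - ε ≤ PP 0 (strip a b h) (zf h) x q
        (fun O => GArm 1 (strip a b h : Finset ℤ²) (seg c m h) (seg c (3 * m) 0) Oᶜ) := by
  have hπ : (0 : ℤ) = 0 ∨ (0 : ℤ) = 1 := Or.inl rfl
  obtain ⟨m, hm, H⟩ := le_pp_strip hx hq hε₀ hθ (ε := min (ε / 9) (1 / 4)) (by positivity)
  refine ⟨m, hm, fun h hh hodd => ?_⟩
  obtain ⟨n, hn, H⟩ := H h hh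
  refine ⟨n, by omega, fun a b c hc ha hb => ?_⟩
  have hprimal : 1 - ε ≤ PP 0 (strip a b h) (zf h) x q
        (GArm 0 (strip a b h : Finset ℤ²) (seg c m 0) (seg c (3 * m) h)) := by
    have e := pp_strip_shift hx hq (a := a - c) (b := b - c) (h := h) hc (U := seg 0 m 0)
      (F := seg 0 (3 * m) h) (U' := seg c m 0) (F' := seg c (3 * m) h)
      (fun u => by unfold seg; simp only; omega) (fun u => by unfold seg; simp only; omega)
    rw [sub_add_cancel, sub_add_cancel] at e
    rw [e]
    set D := strip (a - c) (b - c) h with hD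
    set A1 := GArm 0 (D : Finset ℤ²) (seg 0 m 0) (fun w => w.2 = h ∧ 3 * m < w.1) with hA1
    set A2 := GArm 0 (D : Finset ℤ²) (seg 0 m 0) (fun w => w.2 = h ∧ w.1 < -(3 * m)) with hA2
    set A3 := GArm 0 (D : Finset ℤ²) (seg 0 m 0) (seg 0 (3 * m) h) with hA3
    have h1 : PP 0 D (zf h) x q A1 ≤ 2 / 3 :=
      pp_cross_right_le hx hq hxq (min_le_right _ _) hh hodd H _ _
    have h2 : PP 0 D (zf h) x q A2 ≤ 2 / 3 := by
      have := pp_strip_refl hx hq (a := a - c) (b := b - c) (h := h) (U := seg 0 m 0)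
        (F := fun w => w.2 = h ∧ w.1 < -(3 * m)) (U' := seg 0 m 0)
        (F' := fun w => w.2 = h ∧ 3 * m < w.1)
        (fun u => by unfold seg; simp only; omega) (fun u => by simp only; omega)
      rw [← this]
      exact pp_cross_right_le hx hq hxq (min_le_right _ _) hh hodd H _ _
    have h3 : 1 - ε / 9 ≤ PP 0 D (zf h) x q (fun O => A1 O ∨ (A2 O ∨ A3 O)) := by
      refine (sub_le_sub_left (min_le_left _ (1 / 4)) 1).trans
        ((H (a - c) (b - c) (by omega) (by omega)).trans (pp_mono hπ hx hq ?_))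
      rintro O - ⟨u, hu, hp, w, hw, hcn⟩
      rcases lt_or_ge (3 * m) w.1 with h4 | h4
      · exact Or.inl ⟨u, hu, hp, w, ⟨hw, h4⟩, hcn⟩
      rcases lt_or_ge w.1 (-(3 * m)) with h5 | h5
      · exact Or.inr (Or.inl ⟨u, hu, hp, w, ⟨hw, h5⟩, hcn⟩)
      · exact Or.inr (Or.inr ⟨u, hu, hp, w, ⟨hw, by omega, by omega⟩, hcn⟩)
    have hm1 : Monotone A1 := garm_mono _ _ _ _
    have hm2 : Monotone A2 := garm_mono _ _ _ _
    have hm3 : Monotone A3 := garm_mono _ _ _ _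
    have hm23 : Monotone fun O => A2 O ∨ A3 O := fun O O' hO h =>
      h.imp (hm2 hO) (hm3 hO)
    have e1 := pp_or_add_and 0 D (zf h) x q A1 (fun O => A2 O ∨ A3 O)
    have e2 := pp_or_add_and 0 D (zf h) x q A2 A3
    have f1 := pp_fkg hπ hx hq (D := D) (ζ := zf h) hm1 hm23
    have f2 := pp_fkg hπ hx hq (D := D) (ζ := zf h) hm2 hm3
    have p3 := pp_le_one hπ hx hq (D := D) (ζ := zf h) A3
    have p23 := pp_le_one hπ hx hq (D := D) (ζ := zf h) (fun O => A2 O ∨ A3 O)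
    set P1 := PP 0 D (zf h) x q A1
    set P2 := PP 0 D (zf h) x q A2
    set P3 := PP 0 D (zf h) x q A3
    set P23 := PP 0 D (zf h) x q fun O => A2 O ∨ A3 O
    have g1 : (1 - P1) * (1 - P23) ≤ ε / 9 := by nlinarith
    have g2 : (1 - P2) * (1 - P3) ≤ 1 - P23 := by nlinarith
    have g3 : 1 / 3 * (1 - P23) ≤ (1 - P1) * (1 - P23) :=
      mul_le_mul_of_nonneg_right (by linarith) (by linarith)
    have g4 : 1 / 3 * (1 - P3) ≤ (1 - P2) * (1 - P3) :=
      mul_le_mul_of_nonneg_right (by linarith) (by linarith)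
    linarith
  exact ⟨hprimal, hprimal.trans (le_pp_dual_cross hx hq hxq hh hodd
    (fun u => by unfold seg; simp only; omega) (fun u => by unfold seg; simp only; omega))⟩

/-- A crossing of the strip started in a window reaches intermediate rows inside a larger window. -/
lemma le_pp_window (hx : 0 < x) (hq : 1 ≤ q) {ε : ℝ} {k c m j h : ℤ} (hj : 0 < j) (hjh : j ≤ h)
    (hG : 1 - ε ≤ PP 0 (strip (-k) k h) (zf h) x q
      (GArm 0 (strip (-k) k h : Finset ℤ²) (seg c m 0) (fun w => w.2 = h)))
    (hH : ∀ d, d = c - 6 * m ∨ d = c + 6 * m → 1 - ε ≤ PP 0 (strip (-k) k j) (zf j) x q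
        (fun O => GArm 1 (strip (-k) k j : Finset ℤ²) (seg d m j) (seg d (3 * m) 0) Oᶜ))
    (hm : 0 < m) :
    1 - 3 * ε ≤ PP 0 (strip (-k) k h) (zf h) x q
      (GArm 0 (strip (-k) k j : Finset ℤ²) (seg c m 0) (seg c (7 * m) j)) := by
  have hπ : (0 : ℤ) = 0 ∨ (0 : ℤ) = 1 := Or.inl rfl
  set A := GArm 0 (strip (-k) k j : Finset ℤ²) (seg c m 0) (seg c (7 * m) j) with hA
  set B := GArm 0 (strip (-k) k j : Finset ℤ²) (seg c m 0)
    (fun w => w.2 = j ∧ ¬ seg c (7 * m) j w) with hB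
  have h1 : PP 0 (strip (-k) k h) (zf h) x q
      (GArm 0 (strip (-k) k h : Finset ℤ²) (seg c m 0) (fun w => w.2 = h)) ≤
      PP 0 (strip (-k) k h) (zf h) x q (fun O => A O ∨ B O) := by
    refine pp_mono hπ hx hq ?_
    rintro O - ⟨u, hu, hup, w, hw, hc⟩
    obtain ⟨w', hw', hc'⟩ : ∃ w', w'.2 = j ∧
        Conn (O ∩ (strip (-k) k j : Finset ℤ²)) u w' := by
      have hmono : ∀ {u w}, Conn (O ∩ (strip (-k) k h : Finset ℤ²) ∩ {z | z.2 < j}) u w →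
          Conn (O ∩ (strip (-k) k j : Finset ℤ²)) u w := fun hc => hc.mono (by
        rintro z ⟨⟨h3, h4⟩, h5 : z.2 < j⟩
        refine ⟨h3, ?_⟩
        rw [mem_coe, mem_strip] at *; omega)
      have hu2 := hu.1
      have key : ∀ w, Conn (O ∩ (strip (-k) k h : Finset ℤ²)) u w → w.2 ≤ j - 1 ∨
          ∃ w', w'.2 = j ∧ Conn (O ∩ (strip (-k) k j : Finset ℤ²)) u w' := by
        intro w hc
        induction hc with
        | refl => exact Or.inl (by omega)
        | @tail b w hub hs ih =>
          obtain ih | ih := ih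
          · by_cases hw : w.2 ≤ j - 1
            · exact Or.inl hw
            · right
              obtain ⟨z, hz, hl⟩ := hs
              rcases (Conn.exit (B := {z | z.2 < j}) (F := fun w => ¬ w.2 ≤ j - 1)
                (by intro b hb z c hl; unfold Lnk at hl; simp only [Set.mem_ofPred_eq]; omega)
                (hub.trans (Conn.of_lnk hz hl))) with h6 | ⟨w', hw', h6⟩
              · refine ⟨w, ?_, hmono h6⟩
                unfold Lnk at hl; omega
              · by_cases hne : u = w'
                · subst hne; omega
                · obtain ⟨z', hz', a, hl'⟩ := h6.last_cell hne
                  have h7 : z'.2 < j := hz'.2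
                  refine ⟨w', ?_, hmono h6⟩
                  unfold Lnk at hl'; omega
          · exact Or.inr ih
      rcases key w hc with h6 | h6
      · omega
      · exact h6
    by_cases hs : seg c (7 * m) j w'
    · exact Or.inl ⟨u, hu, hup, w', hs, hc'⟩
    · exact Or.inr ⟨u, hu, hup, w', ⟨hw', hs⟩, hc'⟩
  have h2 : PP 0 (strip (-k) k h) (zf h) x q B ≤ PP 0 (strip (-k) k j) (zf j) x q B := by
    refine pp_shrink hπ hx hq (fun z hz => ?_) le_rfl (garm_mono _ _ _ _) (fun z hz hz' => ?_)
    · rw [mem_strip] at *; omega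
    · rw [mem_strip, mem_zf] at *; omega
  set H1 := fun O : Set ℤ² => GArm 1 (strip (-k) k j : Finset ℤ²) (seg (c - 6 * m) m j)
    (seg (c - 6 * m) (3 * m) 0) Oᶜ with hH1
  set H2 := fun O : Set ℤ² => GArm 1 (strip (-k) k j : Finset ℤ²) (seg (c + 6 * m) m j)
    (seg (c + 6 * m) (3 * m) 0) Oᶜ with hH2
  have h3 : PP 0 (strip (-k) k j) (zf j) x q B ≤
      PP 0 (strip (-k) k j) (zf j) x q (fun O => ¬ H1 O ∨ ¬ H2 O) := by
    refine pp_mono hπ hx hq ?_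
    rintro O - ⟨u, hu, hup, w, hw, hc⟩
    by_contra hcon
    rw [not_or, not_not, not_not] at hcon
    obtain ⟨⟨v, hv, hvp, y, hy, hcd⟩, v', hv', hvp', y', hy', hcd'⟩ := hcon
    have hdis : ∀ z ∈ O ∩ (strip (-k) k j : Finset ℤ²),
        z ∉ Oᶜ ∩ (strip (-k) k j : Finset ℤ²) := fun z hz hz' => hz'.1 hz.1
    unfold seg at *
    have o1 := crossing_order hdis hj (fun z hz => hz.2) (fun z hz => hz.2) hup hu.1 hw.1 hvp hv.1
      hy.1 hc hcd
    have o2 := crossing_order hdis hj (fun z hz => hz.2) (fun z hz => hz.2) hup hu.1 hw.1 hvp'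
      hv'.1 hy'.1 hc hcd'
    omega
  have h4 := pp_or_le hπ hx hq (D := strip (-k) k j) (ζ := zf j) (fun O => ¬ H1 O)
    (fun O => ¬ H2 O)
  have h5 := pp_or_le hπ hx hq (D := strip (-k) k h) (ζ := zf h) A B
  rw [pp_not hπ hx hq H1, pp_not hπ hx hq H2] at h4
  have h6 := hH _ (Or.inl rfl)
  have h7 := hH _ (Or.inr rfl)
  linarith

/-- Two windows on the bottom of the strip are not connected. -/
def Sep (m k h : ℤ) (O : Set ℤ²) : Prop :=
  ∀ u u', seg 0 m 0 u → seg (12 * m) m 0 u' → par u = 0 →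
    ¬ Conn (O ∩ (strip (-k) k h : Finset ℤ²)) u u'

/-- In the half plane with free boundary conditions, the origin is not connected to infinity. -/
theorem thp_small (hx : 0 < x) (hq : 1 ≤ q) (hxq : q / x = x) {ε₀ : ℝ} (hε₀ : 0 < ε₀) :
    ∃ n : ℕ, thp n x q < ε₀ := by
  by_contra hcon
  simp only [not_exists, not_lt] at hcon
  have hπ : (0 : ℤ) = 0 ∨ (0 : ℤ) = 1 := Or.inl rfl
  obtain ⟨m, hm, key⟩ := le_pp_cross hx hq hxq hε₀ hcon (ε := 1 / 14) (by norm_num)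
  choose! n hn key using key
  set C : ℝ := (2 * max 1 (q / x)) ^ (28 * m).toNat with hC
  have hC0 : 0 < C := by positivity
  obtain ⟨N, hN⟩ := exists_nat_gt (2 * C)
  obtain ⟨k, hk⟩ : ∃ k : ℤ, k = 20 * m + ∑ i ∈ range (N + 1), n (2 * i + 1) := ⟨_, rfl⟩
  have hnk : ∀ i : ℕ, i ≤ N → n (2 * i + 1) + 20 * m ≤ k := by
    intro i hi
    have := single_le_sum (f := fun i : ℕ => n (2 * i + 1)) (s := range (N + 1))
      (fun j _ => (hn (2 * j + 1) (by omega) (by omega)).le) (mem_range.2 (by omega : i < N + 1))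
    omega
  have cr : ∀ i : ℕ, i ≤ N → ∀ c, c % 2 = 0 → -(20 * m) ≤ c → c ≤ 20 * m → _ :=
    fun i hi c hc h1 h2 => key (2 * i + 1) (by omega) (by omega) (-k) k c hc
      (by have := hnk i hi; omega) (by have := hnk i hi; omega)
  set h : ℤ := 2 * N + 1 with hh
  set P := PP 0 (strip (-k) k h) (zf h) x q with hP
  have hwin : ∀ i : ℕ, i ≤ N → ∀ c, c = 0 ∨ c = 12 * m → 1 - 3 * (1 / 14) ≤ P
      (GArm 0 (strip (-k) k (2 * i + 1) : Finset ℤ²) (seg c m 0)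
        (seg c (7 * m) (2 * i + 1))) := by
    intro i hi c hc
    refine le_pp_window hx hq (by omega) (by omega) ?_ ?_ hm
    · refine (cr N le_rfl c (by omega) (by omega) (by omega)).1.trans
        (pp_mono hπ hx hq fun O _ hG => hG.sub subset_rfl (fun _ h => h) fun _ h => h.1)
    · intro d hd
      exact (cr i hi d (by omega) (by omega) (by omega)).2
  have hlast : 1 - 1 / 14 ≤ P (Sep m k h) := by
    refine (cr N le_rfl (6 * m) (by omega) (by omega) (by omega)).2.trans (pp_mono hπ hx hq ?_)
    rintro O - ⟨v, hv, hvp, y, hy, hcd⟩ u u' hu hu' hup hc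
    unfold seg at *
    have := crossing_separates (fun z hz hz' => hz'.1 hz.1) (by omega) (fun z hz => hz.2)
      (fun z hz => hz.2) hup hu.1 hu'.1 hvp hv.1 hy.1 hc hcd
    omega
  have hanti : ∀ {i j : ℤ}, i ≤ j → ∀ {O}, Sep m k j O → Sep m k i O := by
    intro i j hij O hs u u' hu hu' hup hc
    refine hs u u' hu hu' hup (hc.mono ?_)
    rintro z ⟨h1, h2⟩
    refine ⟨h1, ?_⟩
    rw [mem_coe, mem_strip] at *; omega
  have hstep : ∀ i : ℕ, i < N → 1 / 2 ≤ C * (P (Sep m k (2 * i + 1)) - P (Sep m k (2 * i + 3))) := by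
    intro i hi
    set j : ℤ := 2 * i + 1 with hj
    set E := fun c => GArm 0 (strip (-k) k j : Finset ℤ²) (seg c m 0) (seg c (7 * m) j) with hE
    set b : Finset ℤ² := Ico (-8 * m) (20 * m) ×ˢ {j} with hb
    have mem_b : ∀ z : ℤ², z ∈ b ↔ -8 * m ≤ z.1 ∧ z.1 < 20 * m ∧ z.2 = j := by
      intro z; rw [hb, mem_product, mem_Ico, mem_singleton, and_assoc]
    have hcard : b.card = (28 * m).toNat := by
      rw [hb, card_product, Int.card_Ico, card_singleton, mul_one]; congr 1; ring
    have h1 := pp_and_ge hπ hx hq (D := strip (-k) k h) (ζ := zf h) (E 0) (E (12 * m))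
    have h2 := pp_and_ge hπ hx hq (D := strip (-k) k h) (ζ := zf h) (Sep m k j)
      (fun O => E 0 O ∧ E (12 * m) O)
    have h3 : P (Sep m k h) ≤ P (Sep m k j) := pp_mono hπ hx hq fun O _ => hanti (by omega)
    have h4 := pp_open_cells (π := 0) (D := strip (-k) k h) (ζ := zf h) (b := b) hπ hx hq
      (A := fun O => Sep m k j O ∧ E 0 O ∧ E (12 * m) O)
      (fun z hz => by have := hnk i hi.le; have := hn (2 * i + 1) (by omega) (by omega)
                      rw [mem_b] at hz; rw [mem_strip]; omega)
      (fun O O' hO => by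
        have : O ∩ (strip (-k) k j : Finset ℤ²) = O' ∩ (strip (-k) k j : Finset ℤ²) := by
          ext z
          constructor <;>
          · rintro ⟨h5, h6⟩
            have h7 := hO z (by rw [mem_coe, mem_strip] at h6; rw [mem_b]; omega)
            exact ⟨by tauto, h6⟩
        simp only [Sep, hE, GArm, this]
        exact id)
    have h5 : P (fun O => (Sep m k j O ∧ E 0 O ∧ E (12 * m) O) ∧ ∀ z ∈ b, z ∈ O) ≤
        P (fun O => Sep m k j O ∧ ¬ Sep m k (2 * i + 3) O) := by
      refine pp_mono hπ hx hq ?_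
      rintro O - ⟨⟨hs, ⟨u, hu, hup, w, hw, hc⟩, u', hu', hup', w', hw', hc'⟩, hO⟩
      refine ⟨hs, fun hs' => hs' u u' hu hu' hup ?_⟩
      have hsub : O ∩ (strip (-k) k j : Finset ℤ²) ⊆
          O ∩ (strip (-k) k (2 * i + 3) : Finset ℤ²) := by
        rintro z ⟨h6, h7⟩
        refine ⟨h6, ?_⟩
        rw [mem_coe, mem_strip] at *; omega
      refine (hc.mono hsub).trans (Conn.trans ?_ (hc'.mono hsub).symm)
      have hp := hc.par_eq.symm.trans (hup.trans (hup'.symm.trans hc'.par_eq))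
      unfold seg at hw hw'
      refine conn_row (y := j) (a := -8 * m) (b := 20 * m) ?_
        (by omega) (by omega) (by omega) (by omega) (by omega) (by omega) hp
      intro s hs1 hs2
      refine ⟨hO _ ?_, ?_⟩
      · rw [mem_b]; exact ⟨hs1, hs2, rfl⟩
      · have := hnk i hi.le; have := hn (2 * i + 1) (by omega) (by omega)
        rw [mem_coe, mem_strip]; simp only; omega
    have h6 := pp_or_add_and 0 (strip (-k) k h) (zf h) x q
      (fun O => Sep m k j O ∧ ¬ Sep m k (2 * i + 3) O) (Sep m k (2 * i + 3))
    have h7 : P (fun O => (Sep m k j O ∧ ¬ Sep m k (2 * i + 3) O) ∨ Sep m k (2 * i + 3) O) ≤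
        P (Sep m k j) := by
      refine pp_mono hπ hx hq fun O _ hO => ?_
      rcases hO with hO | hO
      · exact hO.1
      · exact hanti (by omega) hO
    have h8 : P (fun O => (Sep m k j O ∧ ¬ Sep m k (2 * i + 3) O) ∧ Sep m k (2 * i + 3) O) ≤ 0 := by
      have e1 := pp_not hπ hx hq (fun _ => True) (D := strip (-k) k h) (ζ := zf h)
      rw [pp_one hπ hx hq (A := fun _ => True) (fun _ _ => trivial), sub_self] at e1
      rw [← e1]
      exact pp_mono hπ hx hq fun O _ hO => (hO.1.2 hO.2).elim
    have h9 := hwin i hi.le 0 (Or.inl rfl)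
    have h10 := hwin i hi.le (12 * m) (Or.inr rfl)
    rw [hcard, ← hC] at h4
    have h11 : 1 / 2 ≤ C * P (fun O => (Sep m k j O ∧ E 0 O ∧ E (12 * m) O) ∧ ∀ z ∈ b, z ∈ O) := by
      refine le_trans ?_ h4
      linarith
    refine h11.trans (mul_le_mul_of_nonneg_left ?_ hC0.le)
    linarith
  have hsum : ∀ i : ℕ, i ≤ N → (i : ℝ) * (1 / 2) ≤ C * (1 - P (Sep m k (2 * i + 1))) := by
    intro i
    induction i with
    | zero =>
      intro _
      have := pp_le_one hπ hx hq (D := strip (-k) k h) (ζ := zf h) (Sep m k (2 * (0 : ℕ) + 1))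
      rw [Nat.cast_zero, zero_mul]
      exact mul_nonneg hC0.le (by linarith)
    | succ i ih =>
      intro hi
      have h1 := ih (by omega)
      have h2 := hstep i (by omega)
      have h3 : (2 * ((i + 1 : ℕ) : ℤ) + 1) = 2 * i + 3 := by push_cast; ring
      rw [h3]
      push_cast
      linarith
  have h1 := hsum N le_rfl
  have h2 := pp_nonneg hπ hx hq (D := strip (-k) k h) (ζ := zf h) (Sep m k (2 * N + 1))
  have h3 : C * (1 - P (Sep m k (2 * N + 1))) ≤ C * 1 :=
    mul_le_mul_of_nonneg_left (by linarith) hC0.le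
  linarith

variable {P : Set ℤ²} {X : Finset ℤ²} {k L l : ℤ}

/-- The cells of the lower half-plane of height `-2`. -/
def dn : Set ℤ² := {z | z.2 ≤ -3}

/-- The lower half of the square of half-side `k` centred at `(0, -2)`. -/
def lbx (k : ℤ) : Finset ℤ² := (bx (0, -2) k).filter fun z => z.2 ≤ -3

/-- Two half-squares, separated by two rows of cells. The upper one is shifted by one, so that the
domain has a symmetry exchanging the two sublattices. -/
def dom (k : ℤ) : Finset ℤ² := hbx (1, 0) k ∪ lbx k

/-- A configuration on the two separating rows. -/
structure Pat (L : ℤ) (P : Set ℤ²) : Prop where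
  rows : ∀ z ∈ P, z.2 = -1 ∨ z.2 = -2
  low : ∀ z ∈ P, z.2 = -2 → -L ≤ z.1 ∧ z.1 ≤ L
  wide : ∀ x : ℤ, x ≤ -L ∨ L ≤ x → (x, -1) ∈ P

/-- The boundary condition wired outside of `dom k`. -/
def wp (k : ℤ) (P : Set ℤ²) : Set ℤ² :=
  up ∪ P ∪ dn ∪ {z | z.2 = -2 ∧ (z.1 < -k ∨ k ≤ z.1)}

/-- The lower points of the boundary of `dom k`, and those outside. -/
def out (k : ℤ) (w : ℤ²) : Prop := par w = 0 ∧ w.2 ≤ -2 ∧ far (0, -2) k w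

lemma mem_dn {z : ℤ²} : z ∈ dn ↔ z.2 ≤ -3 := Iff.rfl

lemma mem_lbx {z : ℤ²} : z ∈ lbx k ↔ -k ≤ z.1 ∧ z.1 < k ∧ -2 - k ≤ z.2 ∧ z.2 ≤ -3 := by
  rw [lbx, mem_filter, mem_bx]; dsimp only; omega

lemma mem_hbx' {z : ℤ²} : z ∈ hbx (0, 0) k ↔ -k ≤ z.1 ∧ z.1 < k ∧ 0 ≤ z.2 ∧ z.2 < k := by
  rw [mem_hbx]; dsimp only; omega

lemma mem_dom {z : ℤ²} : z ∈ dom k ↔ -k < z.1 ∧ z.1 ≤ k ∧ 0 ≤ z.2 ∧ z.2 < k ∨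
    -k ≤ z.1 ∧ z.1 < k ∧ -2 - k ≤ z.2 ∧ z.2 ≤ -3 := by
  rw [dom, mem_union, mem_lbx, mem_hbx]; dsimp only; omega

lemma mem_wp {z : ℤ²} : z ∈ wp k P ↔
    0 ≤ z.2 ∨ z ∈ P ∨ z.2 ≤ -3 ∨ z.2 = -2 ∧ (z.1 < -k ∨ k ≤ z.1) := by
  simp only [wp, Set.mem_union, Set.mem_ofPred_eq, mem_up, mem_dn, or_assoc]

/-- Transport of connections along a map of the points of one sublattice. -/
lemma Conn.map_par {O O' : Set ℤ²} {u v : ℤ²} (r : ℤ² → ℤ²) (h : Conn O u v)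
    (hr : ∀ z ∈ O, ∀ a b, Lnk z a b → par a = par u → Conn O' (r a) (r b)) :
    Conn O' (r u) (r v) := by
  induction h with
  | refl => exact Conn.refl _ _
  | tail hc h ih => obtain ⟨z, hz, hl⟩ := h; exact ih.trans (hr z hz _ _ hl (Conn.par_eq hc).symm)

lemma conn_up_out {O : Set ℤ²} (hk : 0 < k)
    (hO : ∀ z : ℤ², 0 ≤ z.2 → z.1 < -k ∨ k ≤ z.1 ∨ k ≤ z.2 → z ∈ O) {u : ℤ²}
    (hu : par u = 0) (hu2 : 0 ≤ u.2) (hu1 : u.1 ≤ -k ∨ k ≤ u.1 ∨ k ≤ u.2) :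
    Conn O (2 * k, 2 * k) u := by
  set m : ℤ := u.1.natAbs + u.2.natAbs + 2 * k + 1 with hm
  have hp : par u = par (2 * k, 2 * k) ∧ par u = par (-(2 * k), 2 * k) := by
    simp only [par] at *; omega
  have htop : ∀ a b : ℤ², -m ≤ a.1 → a.1 ≤ m → k ≤ a.2 → a.2 ≤ m → -m ≤ b.1 → b.1 ≤ m →
      k ≤ b.2 → b.2 ≤ m → par a = par b → Conn O a b := fun a b h1 h2 h3 h4 h5 h6 h7 h8 =>
    conn_rect (by omega) (fun x y _ _ h _ => hO (x, y) (by dsimp only; omega) (by dsimp only; omega))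
      h1 h2 h3 h4 h5 h6 h7 h8 (by omega)
  rcases hu1 with h | h | h
  · refine (htop _ (-(2 * k), 2 * k) ?_ ?_ ?_ ?_ ?_ ?_ ?_ ?_ (hp.1.symm.trans hp.2)).trans
      (conn_rect (a := -m) (b := -k) (c := 0) (d := m) (by omega)
        (fun x y _ _ h _ => hO (x, y) (by dsimp only; omega) (by dsimp only; omega))
        ?_ ?_ ?_ ?_ ?_ ?_ ?_ ?_ (by omega) hp.2.symm) <;> (try dsimp only) <;> omega
  · refine conn_rect (a := k) (b := m) (c := 0) (d := m) (by omega)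
        (fun x y _ _ h _ => hO (x, y) (by dsimp only; omega) (by dsimp only; omega))
        ?_ ?_ ?_ ?_ ?_ ?_ ?_ ?_ (by omega) hp.1.symm <;> (try dsimp only) <;> omega
  · refine htop _ _ ?_ ?_ ?_ ?_ ?_ ?_ ?_ ?_ hp.1.symm <;> (try dsimp only) <;> omega

lemma conn_dn_out {O : Set ℤ²} (hk : 0 < k)
    (hO : ∀ z ∈ dn, z.1 < -k ∨ k ≤ z.1 ∨ z.2 < -2 - k → z ∈ O) {u : ℤ²} (hu : out k u) :
    Conn O (2 * k, -2 - 2 * k) u := by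
  obtain ⟨h1, h2, h3⟩ := hu
  have := (PSym.conn_image (PSym.reflY (-2))).2 (conn_up_out (u := (u.1, -2 - u.2)) (k := k)
    (O := {z | (z.1, -3 - z.2) ∈ O}) hk (fun z hz hz' => hO _ (by rw [mem_dn]; dsimp only; omega)
      (by dsimp only; omega)) (by simp only [par] at *; omega) (by dsimp only; omega)
      (by simp only [far] at h3; dsimp only; omega))
  rw [PSym.reflY_pt, PSym.reflY_pt] at this
  simp only [sub_sub_cancel, Prod.mk.eta] at this
  refine this.mono ?_
  rintro _ ⟨z, hz, rfl⟩
  rw [PSym.reflY_cell, show (-2 - 1 - z.2 : ℤ) = -3 - z.2 by ring]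
  exact hz

/-- A boundary point of the slit is joined to the lower boundary of `dom k`, off `lbx l`. -/
def LowArm (l k : ℤ) (O : Set ℤ²) : Prop :=
  ∃ v ∈ corn 0 (lbx l : Set ℤ²), ∃ w, out k w ∧ Conn (O ∩ (dn \ lbx l)) v w

lemma lowArm_mono (l k : ℤ) : Monotone (LowArm l k) := by
  rintro O O' h ⟨v, hv, w, hw, hc⟩
  exact ⟨v, hv, w, hw, hc.mono (Set.inter_subset_inter_left _ h)⟩

set_option maxHeartbeats 1000000 in
/-- Comparison of the two boundary conditions on the lower half-plane. -/
lemma pp_wp_le (hx : 0 < x) (hq : 1 ≤ q) (hA : Monotone A) (hP : Pat L P) (hL : 0 ≤ L)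
    (hl : L + 2 ≤ l) (hk : l ≤ k) (hX : X ⊆ dom k) (hXl : ∀ z ∈ X, z ∈ dn → z ∈ lbx l)
    (hAX : Loc X A) :
    PP 0 (dom k) (wp k P) x q A ≤
      PP 0 (dom k) (up ∪ P) x q A + PP 0 (dom k) (wp k P) x q (LowArm l k) := by
  set s : Set ℤ² := {w | out k w} with hs
  have hspar : ∀ u ∈ s, par u = 0 := fun u hu => hu.1
  set C : Set ℤ² → Set ℤ² := fun O => clus s (O ∩ dn) with hC
  have hClow : ∀ O, ∀ v ∈ C O, v.2 ≤ -2 := by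
    rintro O v ⟨u, hu, hc⟩
    by_cases huv : u = v
    · exact huv ▸ hu.2.1
    · obtain ⟨z, hz, a, hl⟩ := hc.last_cell huv
      have := mem_dn.1 hz.2
      unfold Lnk at hl; omega
  have hstep : ∀ O, ∀ z ∈ O, z ∈ dn → ∀ a b, Lnk z a b → a ∈ C O → b ∈ C O := by
    rintro O z hz hzd a b hl ⟨u, hu, hc⟩
    exact ⟨u, hu, hc.trans (Conn.of_lnk ⟨hz, hzd⟩ hl)⟩
  have hcorn : ∀ a : ℤ², par a = 0 → -l < a.1 → a.1 < l → a.2 = -2 → a ∈ corn 0 (lbx l : Set ℤ²) := by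
    intro a hp h1 h2 h3
    have hl : Lnk (a.1, -3) a (a.1 + 1, -3) := by unfold Lnk; dsimp only; omega
    refine ⟨(a.1, -3), by rw [mem_coe, mem_lbx]; dsimp only; omega, ?_⟩
    have := hl.eq_or hp
    tauto
  have h1 : PP 0 (dom k) (wp k P) x q (fun O => A O ∧ ∀ v ∈ corn 0 (lbx l : Set ℤ²), v ∉ C O) ≤
      PP 0 (dom k) (up ∪ P) x q A *
        PP 0 (dom k) (wp k P) x q (fun O => ∀ v ∈ corn 0 (lbx l : Set ℤ²), v ∉ C O) := by
    refine pp_explore_on dn (Or.inl rfl) hx hq hspar (fun C => ∀ v ∈ corn 0 (lbx l : Set ℤ²), v ∉ C) _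
      fun O hO hN => ⟨up ∪ P, A, hA, ?_, ?_⟩
    · refine pp_enlarge (Or.inl rfl) hx hq sdiff_subset le_rfl hA fun z hz hz' => ⟨hz', fun hzD => ?_⟩
      rw [Finset.mem_sdiff, not_and_not_right] at hz
      have h3 := mem_dn.1 (mem_filter.1 (touch_sub _ _ (hz hzD))).2
      rcases hz' with h | h
      · rw [mem_up] at h; omega
      · have := hP.rows z h; omega
    intro O' hO' hcl
    set K := touch 0 s ((dom k).filter (· ∈ dn)) (O ∩ dn) with hK
    have hmemK : ∀ z, z ∈ K ↔ z ∈ dom k ∧ z ∈ dn ∧ (pu 0 z ∈ C O' ∨ pv 0 z ∈ C O') := by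
      intro z
      rw [hK, touch, mem_filter, mem_filter, and_assoc, hC, ← hcl]
    rw [← hcl] at hN
    have hXK : ∀ z ∈ X, z ∉ K := by
      intro z hz hzK
      obtain ⟨-, h3, h4⟩ := (hmemK z).1 hzK
      have := hXl z hz h3
      rcases h4 with h | h
      · exact hN _ ⟨z, this, Or.inl rfl⟩ h
      · exact hN _ ⟨z, this, Or.inr rfl⟩ h
    set G := glue (dom k \ K) (up ∪ P) O' with hG
    have hGup : ∀ z ∈ O', 0 ≤ z.2 → z ∈ G := by
      intro z hz h0
      rw [hG, mem_glue, Finset.mem_sdiff]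
      by_cases hzD : z ∈ dom k
      · refine Or.inl ⟨hz, hzD, fun h => ?_⟩
        have := mem_dn.1 ((hmemK z).1 h).2.1; omega
      · exact Or.inr ⟨Or.inl h0, fun h => hzD h.1⟩
    have hGP : ∀ z ∈ P, z ∈ G := by
      intro z hz
      rw [hG, mem_glue, Finset.mem_sdiff]
      refine Or.inr ⟨Or.inr hz, fun h => ?_⟩
      have := hP.rows z hz
      have := mem_dom.1 h.1
      omega
    have hGout : ∀ u : ℤ², par u = 0 → 0 ≤ u.2 → u.1 ≤ -(k + 1) ∨ k + 1 ≤ u.1 ∨ k + 1 ≤ u.2 →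
        Conn G (2 * (k + 1), 2 * (k + 1)) u := fun u => conn_up_out (by omega) fun z hz hz' => hGup z
      ((hO' z (by rw [mem_dom]; omega)).2 (mem_wp.2 (Or.inl hz))) hz
    refine ⟨hAX _ _ fun z hz => ?_, fun e he heO hc => ?_⟩
    · rw [mem_glue, Finset.mem_sdiff]
      have := hXK z hz; have := hX hz; tauto
    set r : ℤ² → ℤ² := fun v => if v ∈ C O' then (2 * (k + 1), 2 * (k + 1)) else v with hr
    have hfix : ∀ v, v ∉ C O' → r v = v := fun v hv => by simp only [hr, hv, if_false]
    have hin : ∀ v, v ∈ C O' → r v = (2 * (k + 1), 2 * (k + 1)) := fun v hv => by simp only [hr, hv, if_true]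
    have hhigh : ∀ v : ℤ², -1 ≤ v.2 → r v = v := fun v hv => hfix v fun h => by
      have := hClow O' v h; omega
    have hgate : ∀ z a b, Lnk z a b → par a = 0 → z ∉ P → z.2 = -2 → z.1 < -k ∨ k ≤ z.1 →
        a.2 = -2 → Conn G (r a) (r b) := by
      intro z a b hl hp _ hz2 hz1 ha2
      have haC : a ∈ C O' := ⟨a, ⟨hp, by omega, by
        unfold far; unfold Lnk at hl; dsimp only; omega⟩, Conn.refl _ _⟩
      have hb : b.2 = -1 ∧ (b.1 ≤ -k ∨ k ≤ b.1) ∧ par b = 0 := by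
        refine ⟨?_, ?_, hl.par_eq.symm.trans hp⟩ <;> unfold Lnk at hl <;> omega
      rw [hin a haC, hhigh b (by omega)]
      obtain ⟨hb2, hb1, hbp⟩ := hb
      rcases hb1 with hb1 | hb1
      · have hl' : Lnk (b.1 - 1, -1) (b.1 - 1, 0) b := by unfold Lnk; dsimp only; omega
        refine (hGout (b.1 - 1, 0) (hl'.par_eq.trans hbp) le_rfl (by dsimp only; omega)).trans
          (Conn.of_lnk (hGP _ (hP.wide _ (by omega))) hl')
      · have hl' : Lnk (b.1, -1) (b.1 + 1, 0) b := by unfold Lnk; dsimp only; omega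
        refine (hGout (b.1 + 1, 0) (hl'.par_eq.trans hbp) le_rfl (by dsimp only; omega)).trans
          (Conn.of_lnk (hGP _ (hP.wide _ (by omega))) hl')
    have hends : ∀ v, v = pu 0 e ∨ v = pv 0 e → r v = v := by
      intro v hv
      rw [Finset.mem_sdiff, hmemK] at he
      by_cases hed : e ∈ dn
      · refine hfix v fun h => he.2 ⟨he.1, hed, ?_⟩
        rcases hv with rfl | rfl
        · exact Or.inl h
        · exact Or.inr h
      · have := near_of_corner hv
        have := mem_dom.1 he.1
        rw [mem_dn] at hed
        exact hhigh v (by omega)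
    have := hc.map_par r (O' := G) fun z hz a b hl hp => ?_
    · rwa [hends _ (Or.inl rfl), hends _ (Or.inr rfl)] at this
    rw [par_pu (Or.inl rfl)] at hp
    have hpb : par b = 0 := hl.par_eq.symm.trans hp
    by_cases hzd : z ∈ dn
    · by_cases haC : a ∈ C O'
      · rw [hin a haC, hin b (hstep O' z hz hzd a b hl haC)]; exact Conn.refl _ _
      · have hbC : b ∉ C O' := fun h => haC (hstep O' z hz hzd b a hl.symm h)
        rw [hfix a haC, hfix b hbC]
        refine Conn.of_lnk (mem_glue.2 (Or.inl ⟨hz, Finset.mem_sdiff.2 ⟨?_, fun hzK => ?_⟩⟩)) hl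
        · by_contra hzD
          rw [mem_dn] at hzd
          refine haC ⟨a, ⟨hp, ?_⟩, Conn.refl _ _⟩
          rw [mem_dom] at hzD
          unfold far; unfold Lnk at hl; dsimp only; omega
        · have := ((hmemK z).1 hzK).2.2
          rcases hl.eq_or hp with ⟨rfl, rfl⟩ | ⟨rfl, rfl⟩ <;> tauto
    rw [mem_dn] at hzd
    by_cases h0 : 0 ≤ z.2
    · rw [hhigh a (by unfold Lnk at hl; omega), hhigh b (by unfold Lnk at hl; omega)]
      exact Conn.of_lnk (hGup z hz h0) hl
    have hzw := (hO' z (by rw [mem_dom]; omega)).1 hz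
    rw [mem_wp] at hzw
    by_cases hzP : z ∈ P
    · have hnb : ∀ v : ℤ², par v = 0 → (v.1 = z.1 ∨ v.1 = z.1 + 1) → (v.2 = z.2 ∨ v.2 = z.2 + 1) →
          r v = v := by
        intro v hvp hv1 hv2
        by_cases hv : v.2 = -2
        · have := hP.low z hzP (by omega)
          exact hfix v (hN v (hcorn v hvp (by omega) (by omega) hv))
        · exact hhigh v (by omega)
      rw [hnb a hp (by unfold Lnk at hl; omega) (by unfold Lnk at hl; omega),
        hnb b hpb (by unfold Lnk at hl; omega) (by unfold Lnk at hl; omega)]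
      exact Conn.of_lnk (hGP z hzP) hl
    · have hz2 : z.2 = -2 ∧ (z.1 < -k ∨ k ≤ z.1) := by tauto
      by_cases ha2 : a.2 = -2
      · exact hgate z a b hl hp hzP hz2.1 hz2.2 ha2
      · exact (hgate z b a hl.symm hpb hzP hz2.1 hz2.2 (by unfold Lnk at hl; omega)).symm
  have h2 := pp_le_one (D := dom k) (ζ := wp k P) (Or.inl rfl) hx hq
    (fun O => ∀ v ∈ corn 0 (lbx l : Set ℤ²), v ∉ C O)
  have h3 := pp_nonneg (D := dom k) (ζ := up ∪ P) (Or.inl rfl) hx hq A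
  have h4 : PP 0 (dom k) (wp k P) x q A ≤
      PP 0 (dom k) (wp k P) x q (fun O => A O ∧ ∀ v ∈ corn 0 (lbx l : Set ℤ²), v ∉ C O) +
      PP 0 (dom k) (wp k P) x q (LowArm l k) := by
    refine le_trans (pp_mono (Or.inl rfl) hx hq fun O _ hA => ?_) (pp_or_le (Or.inl rfl) hx hq _ _)
    by_cases h : ∃ v ∈ corn 0 (lbx l : Set ℤ²), v ∈ C O
    · obtain ⟨v, hv, u, hu, hc⟩ := h
      have hsub : ((O ∩ dn) \ (lbx l : Set ℤ²)) ⊆ O ∩ (dn \ (lbx l : Set ℤ²)) :=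
        fun z hz => ⟨hz.1.1, hz.1.2, hz.2⟩
      rcases hc.avoid_or (lbx l) hu.1 with h | ⟨z, hz, v', hv', h⟩
      · exact Or.inr ⟨v, hv, u, hu, (h.mono hsub).symm⟩
      · exact Or.inr ⟨v', ⟨z, hz, hv'⟩, u, hu, (h.mono hsub).symm⟩
    · push Not at h; exact Or.inl ⟨hA, h⟩
  nlinarith

lemma lowArm_offD (l k : ℤ) (D : Finset ℤ²) (h : ∀ z ∈ D, z ∈ dn → z ∈ lbx l) :
    OffD D (LowArm l k) := by
  rintro O O' hO ⟨v, hv, w, hw, hc⟩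
  refine ⟨v, hv, w, hw, hc.mono ?_⟩
  rintro z ⟨h1, h2, h3⟩
  exact ⟨(hO z fun hz => h3 (h z hz h2)).2 h1, h2, h3⟩

lemma lbx_sub (h : l ≤ k) : lbx l ⊆ lbx k := by
  intro z hz
  rw [mem_lbx] at *; omega

lemma pp_garm_dn_le_thp (hx : 0 < x) (hq : 1 ≤ q) {n : ℤ} (hn : n ≤ k) :
    PP 0 (lbx k) dn x q (GArm 0 dn (fun u => u = (0, -2)) (fun w => w.2 ≤ -2 ∧ far (0, -2) k w)) ≤
      thp n x q := by
  have h6 : PP 0 (lbx k) dn x q (GArm 0 dn (fun u => u = (0, -2)) (fun w => w.2 ≤ -2 ∧ far (0, -2) k w)) =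
      PP 0 (hbx (0, 0) k) up x q (GArm 0 up (fun u => u = (0, 0)) (fun w => 0 ≤ w.2 ∧ far (0, 0) k w)) := by
    refine pp_garm_image (PSym.reflY (-2)) (Or.inl rfl) (by rw [PSym.reflY_sh]; rfl) hx hq ?_ ?_ ?_ ?_ ?_
    · intro z; rw [PSym.reflY_cell, mem_lbx, mem_hbx']; dsimp only; omega
    · intro z _; rw [PSym.reflY_cell, mem_dn, mem_up]; dsimp only; omega
    · intro z; rw [PSym.reflY_cell, mem_dn, mem_up]; dsimp only; omega
    · rintro ⟨a, b⟩; rw [PSym.reflY_pt, Prod.mk.injEq, Prod.mk.injEq]; dsimp only; omega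
    · intro u; rw [PSym.reflY_pt]; unfold far; dsimp only; omega
  refine h6.le.trans ?_
  · refine le_trans (pp_mono (Or.inl rfl) hx hq fun O _ h => ?_) (pp_shrink (Or.inl rfl) hx hq
      (D' := hbx (0, 0) n) ?_ le_rfl (garm_mono _ _ _ _) ?_)
    · obtain ⟨u, hu, hpu, w, hw, hc⟩ := h
      refine GArm.sub (GArm.exit ⟨u, hu, hpu, w, hw.2, hc⟩ (F' := far (0, 0) n)
        (B' := (bx (0, 0) n : Finset ℤ²)) (fun v hv => by unfold far at *; dsimp only at *; omega)
        (fun b hb z c hl => lnk_mem_bx hb hl)) ?_ (fun _ h => h) (fun _ h => h)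
      rintro z ⟨h1, h2⟩
      rw [mem_coe, hbx, mem_filter]
      exact ⟨h2, h1⟩
    · intro z hz; rw [mem_hbx'] at *; omega
    · rintro z - (h | h)
      · rw [mem_hbx'] at h; exact h.2.2.1
      · exact h

set_option maxHeartbeats 1000000 in
lemma pp_lowArm_le_thp (hx : 0 < x) (hq : 1 ≤ q) (hP : Pat L P) (hL : 0 ≤ L) (hl : L + 2 ≤ l)
    (hk : l ≤ k) {n : ℤ} (hn : n ≤ k) :
    PP 0 (dom k) (wp k P) x q (LowArm l k) ≤
      (2 * max 1 x) ^ (lbx l).card * ((2 * max 1 (q / x)) ^ (lbx l).card * thp n x q) := by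
  have hmd : ∀ z, z ∈ dom k → z ∈ dn → z ∈ lbx k := by
    intro z h h'; rw [mem_dom] at h; rw [mem_dn] at h'; rw [mem_lbx]; omega
  have hsub : lbx k ⊆ dom k := subset_union_right
  have h1 := pp_close_cells (π := 0) (D := dom k) (ζ := wp k P) (b := lbx l) (A := LowArm l k)
    (Or.inl rfl) hx hq ((lbx_sub hk).trans hsub) (lowArm_offD l k _ fun z h _ => h)
  have h2 : PP 0 (dom k) (wp k P) x q (fun O => LowArm l k O ∧ ∀ z ∈ lbx l, z ∉ O) ≤
      PP 0 (lbx k \ lbx l) (dn \ lbx l) x q (LowArm l k) *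
        PP 0 (dom k) (wp k P) x q (fun O => ∀ z ∈ lbx l, z ∉ O) := by
    refine pp_md_upper (B := fun O => ∀ z ∈ lbx l, z ∉ O) (Or.inl rfl) hx hq
      (sdiff_subset.trans hsub) le_rfl (lowArm_mono l k)
      (fun O O' h hO z hz => fun hz' => hO z hz ((h z fun h => (Finset.mem_sdiff.1 h).2 hz).1 hz'))
      fun O hO hB => ?_
    set G := glue (lbx k \ lbx l) (dn \ lbx l) O with hG
    have hGd : ∀ z ∈ O, z ∈ dn → z ∈ G := by
      intro z hz hzd
      rw [hG, mem_glue, Finset.mem_sdiff]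
      have := hB z
      by_cases h : z ∈ lbx k
      · exact Or.inl ⟨hz, h, fun h => this h hz⟩
      · exact Or.inr ⟨⟨hzd, fun h => this h hz⟩, fun h' => h h'.1⟩
    refine ⟨fun ⟨v, hv, w, hw, hc⟩ => ⟨v, hv, w, hw, hc.mono (O' := G ∩ (dn \ lbx l)) fun z hz =>
      ⟨hGd z hz.1 hz.2.1, hz.2⟩⟩, fun e he heO hc => ?_⟩
    set r : ℤ² → ℤ² := fun v =>
      if -1 ≤ v.2 ∨ v.2 = -2 ∧ -l < v.1 ∧ v.1 < l then (2 * k, -2 - 2 * k) else v with hr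
    have hfix : ∀ v : ℤ², ¬ (-1 ≤ v.2 ∨ v.2 = -2 ∧ -l < v.1 ∧ v.1 < l) → r v = v :=
      fun v hv => by simp only [hr, hv, if_false]
    have hin : ∀ v : ℤ², (-1 ≤ v.2 ∨ v.2 = -2 ∧ -l < v.1 ∧ v.1 < l) →
        r v = (2 * k, -2 - 2 * k) := fun v hv => by simp only [hr, hv, if_true]
    have hout : ∀ u, out k u → Conn G (2 * k, -2 - 2 * k) u := fun u =>
      conn_dn_out (by omega) fun z hz hz' => hGd z ((hO z (by rw [mem_dom]; rw [mem_dn] at hz; omega)).2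
        (mem_wp.2 (Or.inr (Or.inr (Or.inl hz))))) hz
    have hlow : ∀ z ∈ O, z ∈ dn → ∀ v : ℤ², (v.1 = z.1 ∨ v.1 = z.1 + 1) ∧
        (v.2 = z.2 ∨ v.2 = z.2 + 1) → r v = v := by
      intro z hz hzd v hv
      have := hB z
      rw [mem_lbx] at this
      rw [mem_dn] at hzd
      by_cases h : -l ≤ z.1 ∧ z.1 < l ∧ z.2 = -3
      · exact absurd hz (this (by omega))
      · exact hfix v (by omega)
    have hmix : ∀ a b, par a = 0 → (-1 ≤ b.2 ∧ a.2 = -2 ∧ (a.1 ≤ -k ∨ k ≤ a.1 ∨ -l < a.1 ∧ a.1 < l)) →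
        Conn G (r a) (r b) := by
      intro a b hp h
      rw [hin b (by omega)]
      by_cases ha : -l < a.1 ∧ a.1 < l
      · rw [hin a (by omega)]; exact Conn.refl _ _
      · rw [hfix a (by omega)]
        exact (hout a ⟨hp, by omega, by unfold far; dsimp only; omega⟩).symm
    have := hc.map_par r (O' := G) fun z hz a b hl hp => ?_
    · have hends : ∀ v, v = pu 0 e ∨ v = pv 0 e → r v = v := by
        intro v hv
        have := near_of_corner hv
        rw [Finset.mem_sdiff, mem_lbx, mem_lbx] at he
        exact hfix v (by omega)
      rwa [hends _ (Or.inl rfl), hends _ (Or.inr rfl)] at this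
    rw [par_pu (Or.inl rfl)] at hp
    have hpb : par b = 0 := hl.par_eq.symm.trans hp
    by_cases hzd : z ∈ dn
    · rw [hlow z hz hzd a (by unfold Lnk at hl; omega), hlow z hz hzd b (by unfold Lnk at hl; omega)]
      exact Conn.of_lnk (hGd z hz hzd) hl
    rw [mem_dn] at hzd
    by_cases h0 : -1 ≤ z.2
    · rw [hin a (by unfold Lnk at hl; omega), hin b (by unfold Lnk at hl; omega)]
      exact Conn.refl _ _
    have hzw := (hO z (by rw [mem_dom]; omega)).1 hz
    rw [mem_wp] at hzw
    have hz1 : (-L ≤ z.1 ∧ z.1 ≤ L) ∨ z.1 < -k ∨ k ≤ z.1 := by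
      by_cases hzP : z ∈ P
      · exact Or.inl (hP.low z hzP (by omega))
      · rcases hzw with h | h | h | h
        · omega
        · exact absurd h hzP
        · omega
        · exact Or.inr h.2
    by_cases ha : a.2 = -2
    · exact hmix a b hp (by unfold Lnk at hl; omega)
    · exact (hmix b a hpb (by unfold Lnk at hl; omega)).symm
  have h3 : PP 0 (lbx k \ lbx l) (dn \ lbx l) x q (LowArm l k) ≤ PP 0 (lbx k) dn x q (LowArm l k) :=
    pp_enlarge (Or.inl rfl) hx hq sdiff_subset le_rfl (lowArm_mono l k) fun z hz hz' =>
      ⟨hz'.1, fun h => hz (Finset.mem_sdiff.2 ⟨h, hz'.2⟩)⟩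
  have h4 := pp_open_cells (π := 0) (D := lbx k) (ζ := dn) (b := lbx l) (A := LowArm l k)
    (Or.inl rfl) hx hq (lbx_sub hk) (lowArm_offD l k _ fun z h _ => h)
  have h5 : PP 0 (lbx k) dn x q (fun O => LowArm l k O ∧ ∀ z ∈ lbx l, z ∈ O) ≤
      PP 0 (lbx k) dn x q (GArm 0 dn (fun u => u = (0, -2)) (fun w => w.2 ≤ -2 ∧ far (0, -2) k w)) := by
    refine pp_mono (Or.inl rfl) hx hq ?_
    rintro O - ⟨⟨v, ⟨z, hz, hv⟩, w, hw, hc⟩, hb⟩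
    have h6 := near_of_corner hv
    have hpv : par v = 0 := by
      rcases hv with rfl | rfl
      · exact par_pu (Or.inl rfl) z
      · exact par_pv (Or.inl rfl) z
    rw [mem_coe, mem_lbx] at hz
    refine ⟨(0, -2), rfl, by simp [par], w, hw.2, Conn.trans ?_ (hc.mono (Set.inter_subset_inter_right _
      Set.sdiff_subset))⟩
    refine conn_rect (O := O ∩ dn) (a := -l) (b := l) (c := -2 - l) (d := -2) (by omega) (fun a b h1 h2 h3 h4 =>
      ⟨hb _ (by rw [mem_lbx]; dsimp only; omega), by rw [mem_dn]; dsimp only; omega⟩)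
      ?_ ?_ ?_ ?_ ?_ ?_ ?_ ?_ (by omega) ?_
    any_goals omega
    rw [hpv]; simp [par]
  have h7 := pp_garm_dn_le_thp hx hq hn
  have h8 := pp_le_one (D := dom k) (ζ := wp k P) (Or.inl rfl) hx hq (fun O => ∀ z ∈ lbx l, z ∉ O)
  have h9 := pp_nonneg (D := lbx k \ lbx l) (ζ := dn \ lbx l) (Or.inl rfl) hx hq (LowArm l k)
  refine h1.trans (mul_le_mul_of_nonneg_left ?_ (by positivity))
  refine h2.trans ((mul_le_of_le_one_right h9 h8).trans (h3.trans (h4.trans ?_)))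
  exact mul_le_mul_of_nonneg_left (h5.trans h7) (by positivity)

/-- The wired boundary condition on the lower half-plane has no local effect. -/
lemma pp_wp_le_add (hx : 0 < x) (hq : 1 ≤ q) (hxq : q / x = x) (hA : Monotone A) (hP : Pat L P)
    (hL : 0 ≤ L) (hX : ∀ z ∈ X, z ∈ up ∪ dn) (hAX : Loc X A) {ε : ℝ} (hε : 0 < ε) :
    ∃ k₀ : ℤ, ∀ k, k₀ ≤ k → PP 0 (dom k) (wp k P) x q A ≤ PP 0 (dom k) (up ∪ P) x q A + ε := by
  set l : ℤ := L + 2 + ∑ z ∈ X, (z.1.natAbs + z.2.natAbs + 1 : ℕ) with hl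
  have hXl : ∀ z ∈ X, (z.1.natAbs + z.2.natAbs + 1 : ℤ) ≤ l := by
    intro z hz
    have := single_le_sum (f := fun z : ℤ² => z.1.natAbs + z.2.natAbs + 1)
      (fun _ _ => Nat.zero_le _) hz
    omega
  set C : ℝ := (2 * max 1 x) ^ (lbx l).card * (2 * max 1 (q / x)) ^ (lbx l).card with hC
  have hC0 : 0 < C := by positivity
  obtain ⟨n, hn⟩ := thp_small hx hq hxq (div_pos hε hC0)
  refine ⟨max l n, fun k hk => ?_⟩
  have h1 := pp_wp_le hx hq hA hP hL (l := l) (k := k) (by omega) (by omega) (fun z hz => by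
    have := hXl z hz; have := hX z hz
    rw [Set.mem_union, mem_up, mem_dn] at this
    rw [mem_dom]; omega) (fun z hz h => by
    have := hXl z hz
    rw [mem_dn] at h; rw [mem_lbx]; omega) hAX
  have h2 := pp_lowArm_le_thp hx hq hP hL (l := l) (k := k) (by omega) (by omega) (n := n) (by omega)
  have h3 := mul_le_mul_of_nonneg_left hn.le hC0.le
  rw [mul_div_cancel₀ _ hC0.ne', hC, mul_assoc] at h3
  linarith

/-- A half-turn exchanging the two sublattices and the two halves of `dom k`. -/
def rot : PSym where
  cell := ⟨fun z => (-z.1, -3 - z.2), fun z => (-z.1, -3 - z.2), fun z => by simp, fun z => by simp⟩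
  pt := ⟨fun z => (1 - z.1, -2 - z.2), fun z => (1 - z.1, -2 - z.2), fun z => by simp,
    fun z => by simp⟩
  sh := 1
  lnk z a b := by simp only [Lnk, Equiv.coe_fn_mk]; omega
  par_pt a := by simp only [par, Equiv.coe_fn_mk]; omega

/-- The dual configuration, turned back to the primal lattice. -/
def dual (S : Set ℤ²) : Set ℤ² := {z | (-z.1, -3 - z.2) ∉ S}

lemma mem_dual {S : Set ℤ²} {z : ℤ²} : z ∈ dual S ↔ (-z.1, -3 - z.2) ∉ S := Iff.rfl

lemma pp_rot (hx : 0 < x) (hq : 1 ≤ q) {ζ : Set ℤ²} (hfar : Far (dom k) ζ)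
    (A : Set ℤ² → Prop) :
    PP 0 (dom k) (dual ζ) (q / x) q (fun O => ¬ A (dual O)) = 1 - PP 0 (dom k) ζ x q A := by
  have hqx : 0 < q / x := div_pos (by linarith) hx
  have hdual := pp_dual hx hq hfar (fun O => ¬ A Oᶜ)
  simp only [compl_compl] at hdual
  rw [pp_not (Or.inl rfl) hx hq A] at hdual
  rw [← hdual, PSym.pp rot (π := 1) (π' := 0) (Or.inr rfl) rfl hqx hq (D := dom k) (ζ := ζᶜ)]
  · congr 1; funext O
    have : dual (rot.cell '' O) = Oᶜ := by
      ext z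
      have := rot.cell.injective.mem_set_image (s := O) (a := z)
      exact not_congr this
    rw [this]
  · intro z; rw [mem_dom, mem_dom]; simp only [rot, Equiv.coe_fn_mk]; omega
  · intro z _
    simp only [rot, Equiv.coe_fn_mk, dual, Set.mem_ofPred_eq, Set.mem_compl_iff, neg_neg,
      sub_sub_cancel, Prod.mk.eta]

lemma finite_box (m : ℤ) : {a : ℤ² | -m < a.1 ∧ a.1 < m ∧ -m < a.2 ∧ a.2 < m}.Finite :=
  ((Set.finite_Ioo (-m) m).prod (Set.finite_Ioo (-m) m)).subset fun a h => by
    rw [Set.mem_prod, Set.mem_Ioo, Set.mem_Ioo]; exact ⟨⟨h.1, h.2.1⟩, h.2.2⟩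

lemma far_up (hP : Pat L P) (hL : 0 ≤ L) (hk : 0 < k) : Far (dom k) (up ∪ P) := by
  set m := k + L + 5 with hm
  have hO : ∀ z : ℤ², z.2 ≤ -2 → z.1 < -m ∨ m ≤ z.1 ∨ z.2 ≤ -2 - m →
      z ∈ (up ∪ P ∪ ↑(dom k))ᶜ := by
    rintro z h1 h2 ((h | h) | h)
    · rw [mem_up] at h; omega
    · have := hP.low z h; have := hP.rows z h; omega
    · rw [mem_coe, mem_dom] at h; omega
  have key : ∀ a z : ℤ², par a = 1 → a ∉ {a : ℤ² | -(m + 1) < a.1 ∧ a.1 < m + 1 ∧ -(m + 1) < a.2 ∧ a.2 < m + 1} →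
      z ∉ up ∪ P → (a = pu 1 z ∨ a = pv 1 z) →
      Conn (up ∪ P ∪ ↑(dom k))ᶜ (2 * m, -1 - 2 * m) a := by
    intro a z ha haB hz hc
    have h1 := near_of_corner hc
    have h2 := hP.wide z.1
    simp only [Set.mem_union, mem_up, not_or] at hz
    have h3 : a.2 ≤ -1 := by
      by_contra h3
      have : z = (z.1, -1) := Prod.ext rfl (by dsimp only; omega)
      rw [← this] at h2
      have h4 : ¬ (z.1 ≤ -L ∨ L ≤ z.1) := fun h => hz.2 (h2 h)
      exact haB ⟨by omega, by omega, by omega, by omega⟩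
    have h4 : ¬ (-(m + 1) < a.1 ∧ a.1 < m + 1 ∧ -(m + 1) < a.2 ∧ a.2 < m + 1) := haB
    have := (PSym.conn_image (PSym.reflY (-1))).2 (conn_up_out (u := (a.1, -1 - a.2)) (k := m)
      (O := {z | (z.1, -2 - z.2) ∈ (up ∪ P ∪ ↑(dom k))ᶜ}) (by omega)
      (fun z hz hz' => hO _ (by dsimp only; omega) (by dsimp only; omega))
      (by simp only [par] at *; omega) (by dsimp only; omega) (by dsimp only; omega))
    rw [PSym.reflY_pt, PSym.reflY_pt] at this
    simp only [sub_sub_cancel, Prod.mk.eta] at this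
    refine this.mono ?_
    rintro _ ⟨z, hz, rfl⟩
    rw [PSym.reflY_cell, show (-1 - 1 - z.2 : ℤ) = -2 - z.2 by ring]
    exact hz
  exact ⟨_, finite_box (m + 1), fun a b z z' ha hb haB hbB hz _ hz' _ haz hbz =>
    (key a z ha haB hz haz).symm.trans (key b z' hb hbB hz' hbz)⟩

lemma far_of_bounded {ζ : Set ℤ²} {D : Finset ℤ²} {m : ℤ}
    (h : ∀ z, z ∈ ζ ∨ z ∈ D → -m ≤ z.1 ∧ z.1 < m ∧ -m ≤ z.2 ∧ z.2 < m) : Far D ζ := by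
  refine ⟨_, finite_box m, fun a b z z' ha hb haB hbB _ _ _ _ _ _ => ?_⟩
  have h1 : ¬ (-m < a.1 ∧ a.1 < m ∧ -m < a.2 ∧ a.2 < m) := haB
  have h2 : ¬ (-m < b.1 ∧ b.1 < m ∧ -m < b.2 ∧ b.2 < m) := hbB
  refine conn_outside (a := -m) (b := m) (c := -m) (d := m) ?_ (by omega) (by omega) (ha.trans hb.symm)
  intro z hz hzO
  have := h z hzO
  omega

/-- The boundary condition on the separating rows has no more local effect. -/
lemma pp_up_le_add (hx : 0 < x) (hq : 1 ≤ q) (hxq : q / x = x) (hA : Monotone A) (hP : Pat L P)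
    (hL : 0 ≤ L) (hX : ∀ z ∈ X, z ∈ up ∪ dn) (hAX : Loc X A) {ε : ℝ} (hε : 0 < ε) :
    ∃ k₀ : ℤ, ∀ k, k₀ ≤ k → PP 0 (dom k) (up ∪ P) x q A ≤ PP 0 (dom k) P x q A + ε := by
  set P' : Set ℤ² := {z | (z.2 = -1 ∨ z.2 = -2) ∧ z ∈ dual P} with hP'
  have hPat : Pat (L + 1) P' := by
    refine ⟨fun z h => h.1, fun z h h2 => ?_, fun x hx => ⟨Or.inl rfl, fun h => ?_⟩⟩
    · have h3 := h.2
      rw [mem_dual, h2] at h3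
      have := mt (hP.wide (-z.1)) h3
      omega
    · have := hP.low _ h rfl
      dsimp only at this; omega
  have hA' : Monotone (fun O => ¬ A (dual O)) := fun O O' h hO hO' =>
    hO (hA (fun z (hz : _ ∉ O') hz' => hz (h hz')) hO')
  have hAX' : Loc (X.image rot.cell) (fun O => ¬ A (dual O)) := by
    refine fun O O' h hO hO' => hO (hAX _ _ (fun z hz => ?_) hO')
    exact not_congr (h _ (mem_image_of_mem rot.cell hz)).symm
  obtain ⟨k₀, hk₀⟩ := pp_wp_le_add (X := X.image rot.cell) hx hq hxq hA' hPat (by omega)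
    (by
      intro z hz
      obtain ⟨w, hw, rfl⟩ := mem_image.1 hz
      have := hX w hw
      simp only [Set.mem_union, mem_up, mem_dn, rot, Equiv.coe_fn_mk] at *
      omega) hAX' hε
  refine ⟨max k₀ (L + 1), fun k hk => ?_⟩
  have h1 := hk₀ k (by omega)
  set T : Set ℤ² := {z | z ∈ P ∧ -k ≤ z.1 ∧ z.1 ≤ k} with hT
  have h2 : PP 0 (dom k) T x q A ≤ PP 0 (dom k) P x q A :=
    pp_dom (Or.inl rfl) hx hq le_rfl (fun z _ hz => hz.1) hA
  have h3 := pp_rot hx hq (far_up (k := k) hP hL (by omega)) A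
  have h4 := pp_rot hx hq (k := k) (ζ := T) (far_of_bounded (m := k + 5) fun z hz => by
    rcases hz with hz | hz
    · obtain ⟨h1, h2, h3⟩ := hz; have := hP.rows z h1; omega
    · rw [mem_dom] at hz; omega) A
  rw [hxq] at h3 h4
  have h5 : PP 0 (dom k) (dual (up ∪ P)) x q (fun O => ¬ A (dual O)) =
      PP 0 (dom k) (up ∪ P') x q (fun O => ¬ A (dual O)) := by
    refine pp_congr_env fun z hz => ?_
    have := hP.rows (-z.1, -3 - z.2)
    rw [mem_dual]
    simp only [Set.mem_union, mem_up, hP', Set.mem_ofPred_eq, mem_dual]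
    by_cases h : (-z.1, -3 - z.2) ∈ P
    · have := this h
      simp only [h, or_true, not_true, and_false, or_false, iff_false]
      dsimp only at this; omega
    · simp only [h, or_false, not_false_iff, and_true]; omega
  have h6 : PP 0 (dom k) (dual T) x q (fun O => ¬ A (dual O)) ≤
      PP 0 (dom k) (wp k P') x q (fun O => ¬ A (dual O)) := by
    refine pp_dom (Or.inl rfl) hx hq le_rfl (fun z _ hz => ?_) hA'
    rw [mem_dual] at hz
    rw [mem_wp]
    by_cases hr : z.2 = -1 ∨ z.2 = -2
    · by_cases hk' : -k ≤ -z.1 ∧ -z.1 ≤ k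
      · exact Or.inr (Or.inl ⟨hr, fun h => hz ⟨h, hk'⟩⟩)
      · rcases hr with hr | hr
        · have := hPat.wide z.1 (by omega)
          rw [← hr] at this
          exact Or.inr (Or.inl this)
        · omega
    · omega
  linarith

/-- Both boundary conditions on the two half-planes have the same limit. -/
lemma exists_slit_limit (hx : 0 < x) (hq : 1 ≤ q) (hxq : q / x = x) (hA : Monotone A)
    (hP : Pat L P) (hL : 0 ≤ L) (hX : ∀ z ∈ X, z ∈ up ∪ dn) (hAX : Loc X A) :
    ∃ a : ℝ, Tendsto (fun k : ℕ => PP 0 (dom k) (wp k P) x q A) atTop (nhds a) ∧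
      Tendsto (fun k : ℕ => PP 0 (dom k) P x q A) atTop (nhds a) := by
  have hanti : Antitone (fun k : ℕ => PP 0 (dom k) (wp k P) x q A) := by
    intro k l hkl
    have hkl' : (k : ℤ) ≤ l := by exact_mod_cast hkl
    refine pp_shrink (Or.inl rfl) hx hq (fun z hz => ?_) le_rfl hA fun z hz h => ?_
    · rw [mem_dom] at *; omega
    · rw [mem_dom, mem_wp] at h; rw [mem_wp]
      have := hP.rows z; by_cases hzP : z ∈ P
      · exact Or.inr (Or.inl hzP)
      · simp only [hzP, false_or] at h ⊢; omega
  have hbdd : BddBelow (Set.range fun k : ℕ => PP 0 (dom k) (wp k P) x q A) :=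
    ⟨0, by rintro _ ⟨k, rfl⟩; exact pp_nonneg (Or.inl rfl) hx hq _⟩
  have ht := tendsto_atTop_ciInf hanti hbdd
  refine ⟨_, ht, ?_⟩
  rw [Metric.tendsto_atTop] at ht ⊢
  intro ε hε
  obtain ⟨n, hn⟩ := ht (ε / 3) (by positivity)
  obtain ⟨k₁, h₁⟩ := pp_wp_le_add hx hq hxq hA hP hL hX hAX (ε := ε / 3) (by positivity)
  obtain ⟨k₂, h₂⟩ := pp_up_le_add hx hq hxq hA hP hL hX hAX (ε := ε / 3) (by positivity)
  refine ⟨max n (max k₁.toNat k₂.toNat), fun k hk => ?_⟩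
  have e1 := hn k (by omega)
  have e2 := h₁ k (by omega)
  have e3 := h₂ k (by omega)
  have e4 : PP 0 (dom k) P x q A ≤ PP 0 (dom k) (wp k P) x q A :=
    pp_dom (Or.inl rfl) hx hq le_rfl (fun z _ hz => mem_wp.2 (Or.inr (Or.inl hz))) hA
  rw [Real.dist_eq, abs_lt] at *
  constructor <;> linarith

variable {T : Type*} {r : ℤ² → T} {I : ℤ² → T → Prop} {w : T → T → Prop}
  {D F : Finset ℤ²} {ζ : Set ℤ²} {x q : ℝ}

/-- The points of `T` are linked by the open cells to which they are incident and by `w`. -/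
def Rl (I : ℤ² → T → Prop) (w : T → T → Prop) (S : Finset ℤ²) (a b : T) : Prop :=
  (∃ z ∈ S, I z a ∧ I z b) ∨ w a b

/-- The FK weight counting the clusters in `T`. -/
def Wn (I : ℤ² → T → Prop) (w : T → T → Prop) (x q : ℝ) (S : Finset ℤ²) : ℝ :=
  x ^ S.card * q ^ Nat.card (Quot (Rl I w S))

lemma Wn_isFK [Finite T] (hx : 0 < x) (hq : 1 ≤ q)
    (hI : ∀ z ∈ D, ∀ a, I z a ↔ a = r (pu 0 z) ∨ a = r (pv 0 z)) :
    IsFK D x q (fun z S => Quot.mk (Rl I w S) (r (pu 0 z)) = Quot.mk _ (r (pv 0 z)))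
      (Wn I w x q) := by
  have hq0 : 0 < q := by linarith
  refine ⟨fun S _ => by unfold Wn; positivity, fun S hS e he heS => ?_⟩
  have hcard : ∀ S, Nat.card (Quot (Rl I w S)) =
      Nat.card (Quotient (Setoid.ker (Quot.mk (Rl I w S)))) := fun S =>
    Nat.card_congr (Setoid.quotientKerEquivOfSurjective _ Quot.mk_surjective).symm
  have hm := card_quotient_merge (Setoid.ker (Quot.mk (Rl I w S)))
    (Setoid.ker (Quot.mk (Rl I w (insert e S)))) (r (pu 0 e)) (r (pv 0 e)) fun a b => ?_
  · unfold Wn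
    rw [card_insert_of_notMem heS, hcard, hcard, hm]
    have : (Setoid.ker (Quot.mk (Rl I w S))).r (r (pu 0 e)) (r (pv 0 e)) ↔
      Quot.mk (Rl I w S) (r (pu 0 e)) = Quot.mk _ (r (pv 0 e)) := Iff.rfl
    simp only [this]
    split_ifs
    · rw [add_zero]; ring
    · rw [pow_succ q]; field_simp; ring
  · set m := Quot.mk (Rl I w S) with hm
    set m' := Quot.mk (Rl I w (insert e S)) with hm'
    have hsub : ∀ a b, m a = m b → m' a = m' b := fun a b h => by
      rw [hm, Quot.eq] at h
      rw [hm', Quot.eq]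
      exact h.mono fun a b h => h.imp_left fun ⟨z, hz, h⟩ => ⟨z, mem_insert_of_mem hz, h⟩
    have huv : m' (r (pu 0 e)) = m' (r (pv 0 e)) := Quot.sound (Or.inl ⟨e, mem_insert_self _ _,
      (hI e he _).2 (Or.inl rfl), (hI e he _).2 (Or.inr rfl)⟩)
    show m' a = m' b ↔ m a = m b ∨ (m a = m (r (pu 0 e)) ∧ m (r (pv 0 e)) = m b) ∨
      (m a = m (r (pv 0 e)) ∧ m (r (pu 0 e)) = m b)
    constructor
    · intro h
      rw [hm', Quot.eq] at h
      induction h with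
      | rel a b h =>
        rcases h with ⟨z, hz, ha, hb⟩ | h
        · rcases mem_insert.1 hz with rfl | hz
          · rcases (hI z he a).1 ha with rfl | rfl <;> rcases (hI z he b).1 hb with rfl | rfl <;> simp
          · exact Or.inl (Quot.sound (Or.inl ⟨z, hz, ha, hb⟩))
        · exact Or.inl (Quot.sound (Or.inr h))
      | refl => exact Or.inl rfl
      | symm a b _ ih => grind
      | trans a b c _ _ h1 h2 => grind
    · rintro (h | ⟨h1, h2⟩ | ⟨h1, h2⟩)
      · exact hsub _ _ h
      · exact (hsub _ _ h1).trans (huv.trans (hsub _ _ h2))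
      · exact (hsub _ _ h1).trans (huv.symm.trans (hsub _ _ h2))

lemma sub_cfg_iff (hF : F ⊆ D) (S : Finset ℤ²) : (∀ z ∈ F, z ∈ cfg D ζ S) ↔ F ⊆ S :=
  forall₂_congr fun z hz => by
    rw [mem_cfg]; have := hF hz; tauto

lemma incr_sub (D F : Finset ℤ²) : Incr D (F ⊆ ·) := fun _ _ h _ h' => h'.trans h

/-- Comparison from above with an FK measure on cells. -/
lemma net_le_pp [Finite T] (hx : 0 < x) (hq : 1 ≤ q)
    (hI : ∀ z ∈ D, ∀ a, I z a ↔ a = r (pu 0 z) ∨ a = r (pv 0 z)) (ρ : T → ℤ²)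
    (hρ : ∀ z ∈ D, ∀ a, a = pu 0 z ∨ a = pv 0 z → Conn (ζ \ ↑D) (ρ (r a)) a)
    (hw : ∀ a b, w a b → Conn (ζ \ ↑D) (ρ a) (ρ b)) (hF : F ⊆ D) :
    pr D (Wn I w x q) (F ⊆ ·) ≤ PP 0 D ζ x q (fun O => ∀ z ∈ F, z ∈ O) := by
  unfold PP
  simp only [sub_cfg_iff hF]
  refine (Wn_isFK hx hq hI).pr_le (Wt_isFK (Or.inl rfl) D ζ hx hq) hx le_rfl hq ?_ (incr_sub D F)
  intro S S' e hS hS' he _ h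
  have hsub : ζ \ ↑D ⊆ cfg D ζ S' := Set.subset_union_right
  have key : ∀ a b, Relation.EqvGen (Rl I w S) a b → Conn (cfg D ζ S') (ρ a) (ρ b) := by
    intro a b h
    induction h with
    | rel a b h =>
      rcases h with ⟨z, hz, ha, hb⟩ | h
      · have hzD := hS' (hS hz)
        have hz' : z ∈ cfg D ζ S' := Or.inl (hS hz)
        have hu := (hρ z hzD _ (Or.inl rfl)).mono hsub
        have hv := (hρ z hzD _ (Or.inr rfl)).mono hsub
        have huv := Conn.of_lnk hz' (lnk_pu_pv 0 z)
        rcases (hI z hzD a).1 ha with rfl | rfl <;> rcases (hI z hzD b).1 hb with rfl | rfl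
        · exact Conn.refl _ _
        · exact hu.trans (huv.trans hv.symm)
        · exact hv.trans (huv.symm.trans hu.symm)
        · exact Conn.refl _ _
      · exact (hw a b h).mono hsub
    | refl => exact Conn.refl _ _
    | symm a b _ ih => exact ih.symm
    | trans a b c _ _ h1 h2 => exact h1.trans h2
  exact ((hρ e he _ (Or.inl rfl)).mono hsub).symm.trans
    ((key _ _ (Quot.eq.1 h)).trans ((hρ e he _ (Or.inr rfl)).mono hsub))

/-- Comparison from below with an FK measure on cells. -/
lemma pp_le_net [Finite T] (hx : 0 < x) (hq : 1 ≤ q)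
    (hI : ∀ z ∈ D, ∀ a, I z a ↔ a = r (pu 0 z) ∨ a = r (pv 0 z))
    (hζ : ∀ z ∈ ζ, r (pu 0 z) = r (pv 0 z) ∨ w (r (pu 0 z)) (r (pv 0 z))) (hF : F ⊆ D) :
    PP 0 D ζ x q (fun O => ∀ z ∈ F, z ∈ O) ≤ pr D (Wn I w x q) (F ⊆ ·) := by
  unfold PP
  simp only [sub_cfg_iff hF]
  refine (Wt_isFK (Or.inl rfl) D ζ hx hq).pr_le (Wn_isFK (w := w) hx hq hI) hx le_rfl hq ?_ (incr_sub D F)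
  intro S S' e hS hS' he _ h
  have hz : ∀ z ∈ cfg D ζ S, Quot.mk (Rl I w S') (r (pu 0 z)) = Quot.mk _ (r (pv 0 z)) := by
    rintro z (hz | hz)
    · have hzD := hS' (hS hz)
      exact Quot.sound (Or.inl ⟨z, hS hz, (hI z hzD _).2 (Or.inl rfl), (hI z hzD _).2 (Or.inr rfl)⟩)
    · rcases hζ z hz.1 with h | h
      · rw [h]
      · exact Quot.sound (Or.inr h)
  have key : ∀ a b, Conn (cfg D ζ S) a b → par a = 0 →
      Quot.mk (Rl I w S') (r a) = Quot.mk _ (r b) := by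
    intro a b h hp
    induction h with
    | refl => rfl
    | tail hc h ih =>
      obtain ⟨z, hzO, hl⟩ := h
      have := hz z hzO
      rcases hl.eq_or ((Conn.par_eq hc).symm.trans hp) with ⟨rfl, rfl⟩ | ⟨rfl, rfl⟩
      · exact ih.trans this
      · exact ih.trans this.symm
  exact key _ _ h (par_pu (Or.inl rfl) _)

/-- The edges of `F` are open. -/
def opn (F : Finset (Edge AdjL)) : Set (Config AdjL) := {ω | ∀ e ∈ F, ω e = true}

/-- The edges of `A` are open and those of `B` are closed. -/
def cyl (A B : Finset (Edge AdjL)) : Set (Config AdjL) := opn A ∩ {ω | ∀ e ∈ B, ω e = false}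

lemma isClopen_cyl (A B : Finset (Edge AdjL)) : IsClopen (cyl A B) := by
  have h : ∀ (b : Bool) (e : Edge AdjL), IsClopen {ω : Config AdjL | ω e = b} := fun b e =>
    (isClopen_discrete {b}).preimage (continuous_apply e)
  have h' : ∀ (b : Bool) (F : Finset (Edge AdjL)), IsClopen {ω : Config AdjL | ∀ e ∈ F, ω e = b} := by
    intro b F
    simp only [Set.ofPred_forall]
    exact isClopen_biInter_finset fun e _ => h b e
  exact (h' true A).inter (h' false B)

lemma tendsto_cyl {ι : Type*} {l : Filter ι} {μs : ι → Measure (Config AdjL)}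
    [∀ i, IsFiniteMeasure (μs i)] {μ : Measure (Config AdjL)} [IsFiniteMeasure μ]
    (h : ∀ F, Tendsto (fun i => (μs i).real (opn F)) l (nhds (μ.real (opn F))))
    (B : Finset (Edge AdjL)) :
    ∀ A, Tendsto (fun i => (μs i).real (cyl A B)) l (nhds (μ.real (cyl A B))) := by
  induction B using Finset.induction_on with
  | empty =>
    intro A
    have : cyl A ∅ = opn A := by ext; simp [cyl]
    rw [this]; exact h A
  | insert e B _ ih =>
    intro A
    have hsub : cyl (insert e A) B ⊆ cyl A B := fun ω hω =>
      ⟨fun e he => hω.1 e (mem_insert_of_mem he), hω.2⟩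
    have heq : cyl A (insert e B) = cyl A B \ cyl (insert e A) B := by
      ext ω
      simp only [cyl, opn, Set.mem_inter_iff, Set.mem_ofPred_eq, forall_mem_insert,
        Set.mem_sdiff]
      cases ω e <;> simp
    have hd : ∀ (ν : Measure (Config AdjL)) [IsFiniteMeasure ν], ν.real (cyl A (insert e B)) =
        ν.real (cyl A B) - ν.real (cyl (insert e A) B) := fun ν _ => by
      rw [heq, measureReal_sdiff hsub (isClopen_cyl _ _).isOpen.measurableSet]
    simp only [hd]
    exact (ih A).sub (ih _)

lemma weakLim_of_opn {μs : ℕ → Measure (Config AdjL)} [∀ i, IsFiniteMeasure (μs i)]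
    {μ : Measure (Config AdjL)} [IsFiniteMeasure μ]
    (h : ∀ F, Tendsto (fun i => (μs i).real (opn F)) atTop (nhds (μ.real (opn F)))) :
    WeakLim AdjL μs μ := by
  intro D η
  have : FK.cylinder AdjL D η = cyl (D.filter fun e => ∃ h : e ∈ D, η ⟨e, h⟩ = true)
      (D.filter fun e => ∃ h : e ∈ D, η ⟨e, h⟩ = false) := by
    ext ω
    simp only [FK.cylinder, cyl, opn, Set.mem_inter_iff, Set.mem_ofPred_eq, mem_filter]
    refine ⟨fun h => ⟨fun e ⟨_, he, h'⟩ => (h ⟨e, he⟩).trans h', fun e ⟨_, he, h'⟩ =>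
      (h ⟨e, he⟩).trans h'⟩, fun ⟨h1, h2⟩ e => ?_⟩
    cases hη : η e
    · exact h2 e.1 ⟨e.2, e.2, hη⟩
    · exact h1 e.1 ⟨e.2, e.2, hη⟩
  rw [this]
  exact (ENNReal.tendsto_toReal_iff (fun _ => measure_ne_top _ _) (measure_ne_top _ _)).1
    (tendsto_cyl h _ _)

lemma ext_opn {μ ν : Measure (Config AdjL)} [IsProbabilityMeasure μ] [IsProbabilityMeasure ν]
    (h : ∀ F, μ (opn F) = ν (opn F)) : μ = ν := by
  refine ext_of_generate_finite (Set.range opn) (le_antisymm ?_ ?_) ?_ (by rintro _ ⟨F, rfl⟩; exact h F)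
    (by simp)
  · have : @Measurable _ _ (MeasurableSpace.generateFrom (Set.range opn)) _ (id : Config AdjL → _) := by
      refine @measurable_pi_lambda _ _ _ (MeasurableSpace.generateFrom _) _ _ fun e => ?_
      refine @measurable_to_bool _ (MeasurableSpace.generateFrom _) _ ?_
      refine MeasurableSpace.measurableSet_generateFrom ⟨{e}, ?_⟩
      ext; simp [opn]
    exact fun s hs => this hs
  · refine MeasurableSpace.generateFrom_le ?_
    rintro _ ⟨F, rfl⟩
    have : cyl F ∅ = opn F := by ext; simp [cyl]
    exact this ▸ (isClopen_cyl F ∅).isOpen.measurableSet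
  · rintro _ ⟨F, rfl⟩ _ ⟨G, rfl⟩ _
    refine ⟨F ∪ G, ?_⟩
    ext; simp only [opn, mem_union, Set.mem_ofPred_eq, Set.mem_inter_iff]; grind

/-- Sequences of probability measures with a common limit on increasing cylinders. -/
lemma exists_weakLim {ι : Type*} (Y : ι → Prop) (μs : ι → ℕ → Measure (Config AdjL))
    (hp : ∀ i, Y i → ∀ k, IsProbabilityMeasure (μs i k))
    (h : ∀ F, ∃ a, ∀ i, Y i → Tendsto (fun k => (μs i k).real (opn F)) atTop (nhds a)) :
    ∃ μ, ∀ i, Y i → WeakLim AdjL (μs i) μ := by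
  by_cases hY : ∃ i, Y i
  swap
  · exact ⟨0, fun i hi => (hY ⟨i, hi⟩).elim⟩
  obtain ⟨i, hi⟩ := hY
  choose α hα using h
  let P : ℕ → ProbabilityMeasure (Config AdjL) := fun k => ⟨μs i k, hp i hi k⟩
  obtain ⟨μ, -, hμ⟩ := (isCompact_univ (X := ProbabilityMeasure (Config AdjL))).ultrafilter_le_nhds
    (Ultrafilter.map P (hyperfilter ℕ)) (by simp)
  have hα' : ∀ F, (μ : Measure (Config AdjL)).real (opn F) = α F := by
    intro F
    have hc : cyl F ∅ = opn F := by ext; simp [cyl]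
    have h1 := ProbabilityMeasure.tendsto_measure_of_null_frontier_of_tendsto (show
      Tendsto P (hyperfilter ℕ : Filter ℕ) (nhds μ) from hμ) (E := opn F) (by
        rw [← hc, (isClopen_cyl F ∅).frontier_eq]; exact μ.coeFn_empty)
    have h2 := (hα F i hi).mono_left (Nat.hyperfilter_le_atTop)
    exact tendsto_nhds_unique ((NNReal.tendsto_coe).2 h1) h2
  refine ⟨μ, fun j hj => ?_⟩
  have := hp j hj
  exact weakLim_of_opn fun F => by rw [hα']; exact hα F j hj

/-- Passage from configurations to sets of open cells. -/
lemma real_opn {D : Finset (Edge AdjL)} {D' : Finset ℤ²} {f : ℤ² → Edge AdjL}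
    (hf : Set.InjOn f D') (hD : D = D'.image f) {wt : ({e // e ∈ D} → Bool) → ℝ}
    {W : Finset ℤ² → ℝ} {x q : ℝ} {c : ℤ² → Finset ℤ² → Prop} (hW : IsFK D' x q c W)
    (hwt : ∀ S ⊆ D', wt (fun e => decide (e.1 ∈ S.image f)) = W S) :
    IsProbabilityMeasure (((∑ η, ENNReal.ofReal (wt η))⁻¹ •
      ∑ η, ENNReal.ofReal (wt η) • Measure.dirac η).map (extendBy AdjL D)) ∧
    ∀ F ⊆ D', (((∑ η, ENNReal.ofReal (wt η))⁻¹ •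
      ∑ η, ENNReal.ofReal (wt η) • Measure.dirac η).map (extendBy AdjL D)).real (opn (F.image f)) =
        pr D' W (F ⊆ ·) := by
  set G := (∑ η, ENNReal.ofReal (wt η))⁻¹ • ∑ η, ENNReal.ofReal (wt η) • Measure.dirac η with hG
  set e : Finset ℤ² → ({e // e ∈ D} → Bool) := fun S e => decide (e.1 ∈ S.image f) with he
  have hmem : ∀ S ⊆ D', ∀ z ∈ D', f z ∈ S.image f ↔ z ∈ S := fun S hS z hz => by
    refine ⟨fun h => ?_, mem_image_of_mem f⟩
    obtain ⟨y, hy, hyz⟩ := mem_image.1 h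
    exact hf (hS hy) hz hyz ▸ hy
  have hDf : ∀ z ∈ D', f z ∈ D := fun z hz => hD ▸ mem_image_of_mem f hz
  have hsum : ∀ g : ({e // e ∈ D} → Bool) → ℝ≥0∞, ∑ η, g η = ∑ S ∈ D'.powerset, g (e S) := by
    intro g
    symm
    refine sum_nbij' e (fun η => D'.filter fun z => ∃ h : f z ∈ D, η ⟨f z, h⟩ = true)
      (fun _ _ => mem_univ _) (fun _ _ => mem_powerset.2 (filter_subset _ _))
      (fun S hS => ?_) (fun η _ => ?_) (fun _ _ => rfl)
    · rw [mem_powerset] at hS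
      ext z
      simp only [mem_filter, he, decide_eq_true_eq]
      refine ⟨fun ⟨h1, _, h2⟩ => (hmem S hS z h1).1 h2, fun h => ⟨hS h, hDf z (hS h), mem_image_of_mem f h⟩⟩
    · funext ⟨a, ha⟩
      obtain ⟨z, hz, rfl⟩ := mem_image.1 (hD ▸ ha)
      simp only [he]
      rw [Bool.eq_iff_iff, decide_eq_true_eq, hmem _ (filter_subset _ _) z hz, mem_filter]
      exact ⟨fun ⟨_, _, h⟩ => h, fun h => ⟨hz, ha, h⟩⟩
  have hGB : ∀ B : Set ({e // e ∈ D} → Bool), G B = ENNReal.ofReal (pr D' W (fun S => e S ∈ B)) := by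
    intro B
    have h0 : ∑ η, ENNReal.ofReal (wt η) = ENNReal.ofReal (∑ S ∈ D'.powerset, W S) := by
      rw [hsum, ENNReal.ofReal_sum_of_nonneg fun S hS => (hW.pos S (mem_powerset.1 hS)).le]
      exact sum_congr rfl fun S hS => by rw [hwt S (mem_powerset.1 hS)]
    rw [hG, Measure.smul_apply, h0, Measure.finsetSum_apply, hsum, smul_eq_mul, pr, ex,
      ENNReal.ofReal_div_of_pos hW.tot_pos, ENNReal.div_eq_inv_mul,
      ENNReal.ofReal_sum_of_nonneg fun S hS =>
        mul_nonneg (hW.pos S (mem_powerset.1 hS)).le (ind_nonneg _ _)]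
    congr 1
    refine sum_congr rfl fun S hS => ?_
    rw [Measure.smul_apply, hwt S (mem_powerset.1 hS), Measure.dirac_apply, smul_eq_mul, ind]
    by_cases h : e S ∈ B
    · simp [h]
    · simp [h]
  have hm : ∀ A B, (G.map (extendBy AdjL D)) (cyl A B) = G (extendBy AdjL D ⁻¹' cyl A B) := fun A B =>
    Measure.map_apply (Measurable.of_discrete) (isClopen_cyl A B).isOpen.measurableSet
  constructor
  · have : cyl ∅ ∅ = Set.univ := by ext; simp [cyl, opn]
    refine ⟨?_⟩
    rw [← this, hm, this, hGB, hW.pr_of_forall (fun _ _ => by simp), ENNReal.ofReal_one]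
  · intro F hF
    have : cyl (F.image f) ∅ = opn (F.image f) := by ext; simp [cyl]
    rw [Measure.real, ← this, hm, this, hGB, ENNReal.toReal_ofReal (hW.pr_nonneg _)]
    refine IsFK.pr_congr fun S hS => ?_
    rw [Set.mem_preimage, opn, Set.mem_ofPred_eq, forall_mem_image]
    refine forall₂_congr fun z hz => ?_
    rw [extendBy, dif_pos (hDf z (hF hz))]
    simp only [he, decide_eq_true_eq, hmem S hS z (hF hz)]

lemma adjL_cell (z : ℤ²) : AdjL (pu 0 z) (pv 0 z) := by
  unfold AdjL pu pv par
  split_ifs with h <;> simp only [Int.even_iff] <;> refine ⟨?_, ?_, by ring, by ring⟩ <;> omega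

/-- The edge of the lattice crossing the cell `z`. -/
def ce (z : ℤ²) : Edge AdjL := ⟨s(pu 0 z, pv 0 z), _, _, adjL_cell z, rfl⟩

lemma inc_ce {a z : ℤ²} : Inc AdjL a (ce z) ↔ a = pu 0 z ∨ a = pv 0 z := Sym2.mem_iff

lemma exists_ce (e : Edge AdjL) : ∃ z, e = ce z := by
  obtain ⟨_, ⟨u1, u2⟩, ⟨v1, v2⟩, ⟨h1, h2, h3, h4⟩, rfl⟩ := e
  dsimp only at h1 h2 h3 h4
  rw [Int.even_iff] at h1 h2
  rw [pow_two, mul_self_eq_one_iff] at h3 h4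
  refine ⟨(min u1 v1, min u2 v2), Subtype.ext (Sym2.eq_iff.2 ?_)⟩
  simp only [pu, pv]
  split_ifs with h <;> unfold par at h <;> dsimp only at h <;> simp only [Prod.ext_iff] <;> omega

lemma ce_injective : Function.Injective ce := by
  intro z z' h
  have := Sym2.eq_iff.1 (Subtype.ext_iff.1 h)
  revert this
  simp only [pu, pv]
  split_ifs <;> simp only [Prod.ext_iff] <;> omega

lemma ce_mem_HP {z : ℤ²} : ce z ∈ HPedges ↔ 0 ≤ z.2 := by
  change (∀ v ∈ s(pu 0 z, pv 0 z), 0 ≤ v.2) ↔ _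
  simp only [Sym2.mem_iff, forall_eq_or_imp, forall_eq, pu, pv]
  split_ifs <;> dsimp only <;> omega

lemma ce_mem_boxE {z : ℤ²} {K : ℤ} : ce z ∈ boxE K ↔ z ∈ bx (0, 0) K := by
  have h : ce z ∈ boxE K ↔ pu 0 z ∈ rectV (-K) K (-K) K ∧ pv 0 z ∈ rectV (-K) K (-K) K := by
    simp only [boxE, finEdgesIn, mem_subtype, mem_image, mem_filter,
      mem_product]
    refine ⟨fun ⟨⟨a, b⟩, ⟨⟨ha, hb⟩, _⟩, h⟩ => ?_, fun h => ⟨(_, _), ⟨h, adjL_cell z⟩, rfl⟩⟩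
    rcases Sym2.eq_iff.1 h with ⟨h1, h2⟩ | ⟨h1, h2⟩ <;> rw [← h1, ← h2]
    exacts [⟨ha, hb⟩, ⟨hb, ha⟩]
  rw [h, mem_bx]
  simp only [rectV, mem_product, mem_Icc, pu, pv]
  split_ifs <;> dsimp only <;> omega

lemma boxE_eq (K : ℤ) : boxE K = (bx (0, 0) K).image ce := by
  ext e
  obtain ⟨z, rfl⟩ := exists_ce e
  rw [ce_mem_boxE, mem_image]
  exact ⟨fun h => ⟨z, h, rfl⟩, fun ⟨y, hy, h⟩ => ce_injective h ▸ hy⟩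

lemma exists_image (F : Finset (Edge AdjL)) : ∃ F' : Finset ℤ², F = F'.image ce :=
  ⟨F.preimage ce ce_injective.injOn, by
    rw [image_preimage, filter_true_of_mem]
    exact fun e _ => (exists_ce e).imp fun _ => Eq.symm⟩

lemma isExhaustion_boxE : IsExhaustion AdjL fun k : ℕ => boxE k := by
  refine ⟨fun m n h e he => ?_, fun e => ?_⟩ <;> obtain ⟨z, rfl⟩ := exists_ce e
  · rw [ce_mem_boxE, mem_bx] at *
    dsimp only at *; omega
  · refine ⟨z.1.natAbs + z.2.natAbs + 1, ?_⟩
    rw [ce_mem_boxE, mem_bx]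
    dsimp only; omega

/-- Lattice points in the interior of the box have four neighbours in it. -/
lemma four_le_degree {a : ℤ²} {K : ℤ} (hp : par a = 0) (ha : ¬ far (0, 0) K a) :
    4 ≤ degree AdjL (boxE K) a := by
  have hsub : ({(a.1, a.2), (a.1 - 1, a.2), (a.1, a.2 - 1), (a.1 - 1, a.2 - 1)} :
      Finset ℤ²).image ce ⊆ (boxE K).filter fun e => Inc AdjL a e := by
    intro e he
    obtain ⟨z, hz, rfl⟩ := mem_image.1 he
    rw [mem_filter, ce_mem_boxE, mem_bx, inc_ce]
    simp only [far] at ha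
    simp only [mem_insert, mem_singleton] at hz
    obtain ⟨a1, a2⟩ := a
    unfold par at hp
    dsimp only at hp ha hz
    rcases hz with rfl | rfl | rfl | rfl <;> refine ⟨by dsimp only; omega, ?_⟩ <;>
      simp only [pu, pv] <;> split_ifs with h <;> unfold par at h <;> dsimp only at h <;>
      first | omega | (simp only [Prod.ext_iff]; omega) | (simp; try omega)
  refine le_trans ?_ (card_le_card hsub)
  rw [card_image_of_injective _ ce_injective]
  rw [card_insert_of_notMem, card_insert_of_notMem, card_insert_of_notMem,
    card_singleton] <;> simp [Prod.ext_iff] <;> omega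

lemma inc_par {a : ℤ²} {e : Edge AdjL} (h : Inc AdjL a e) : par a = 0 := by
  obtain ⟨z, rfl⟩ := exists_ce e
  rcases inc_ce.1 h with rfl | rfl
  exacts [par_pu (Or.inl rfl) z, par_pv (Or.inl rfl) z]

lemma weight_eq {D : Finset (Edge AdjL)} {D' : Finset ℤ²} {f : ℤ² → Edge AdjL}
    (hf : Set.InjOn f D') (hD : D = D'.image f) {T : Type*} {x q : ℝ}
    (J : Edge AdjL → T → Prop) (w : T → T → Prop) :
    ∀ S ⊆ D', x ^ openCount AdjL D (fun e => decide (e.1 ∈ S.image f)) *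
      q ^ Nat.card (Quot fun a b => (∃ e ∈ D, extendBy AdjL D
        (fun e => decide (e.1 ∈ S.image f)) e = true ∧ J e a ∧ J e b) ∨ w a b) =
      Wn (fun z => J (f z)) w x q S := by
  intro S hS
  have hSD : S.image f ⊆ D := hD ▸ image_subset_image hS
  have h1 : openCount AdjL D (fun e => decide (e.1 ∈ S.image f)) = S.card := by
    rw [← card_image_of_injOn (hf.mono (coe_subset.2 hS)), openCount]
    simp only [decide_eq_true_eq]
    rw [← card_image_of_injective _ Subtype.val_injective]
    congr 1; ext e
    simp only [mem_image (f := Subtype.val), mem_filter, mem_univ, true_and,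
      Subtype.exists, exists_and_left, exists_prop, exists_eq_right_right]
    exact ⟨fun h => h.1, fun h => ⟨h, hSD h⟩⟩
  have h2 : (fun a b => (∃ e ∈ D, extendBy AdjL D (fun e => decide (e.1 ∈ S.image f)) e = true ∧
      J e a ∧ J e b) ∨ w a b) = Rl (fun z => J (f z)) w S := by
    funext a b
    refine propext (or_congr_left ⟨fun ⟨e, he, ho, hJ⟩ => ?_, fun ⟨z, hz, hJ⟩ => ?_⟩)
    · rw [extendBy, dif_pos he, decide_eq_true_eq] at ho
      obtain ⟨z, hz, rfl⟩ := mem_image.1 ho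
      exact ⟨z, hz, hJ⟩
    · have := mem_image_of_mem f hz
      exact ⟨f z, hSD this, by rw [extendBy, dif_pos (hSD this), decide_eq_true_eq]; exact this, hJ⟩
  rw [h1, h2, Wn]

lemma isProb {D : Finset (Edge AdjL)} {wt : ({e // e ∈ D} → Bool) → ℝ} (h : ∀ η, 0 < wt η) :
    IsProbabilityMeasure (((∑ η, ENNReal.ofReal (wt η))⁻¹ •
      ∑ η, ENNReal.ofReal (wt η) • Measure.dirac η).map (extendBy AdjL D)) := by
  have : IsProbabilityMeasure ((∑ η, ENNReal.ofReal (wt η))⁻¹ •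
      ∑ η, ENNReal.ofReal (wt η) • (Measure.dirac η : Measure ({e // e ∈ D} → Bool))) := ⟨by
    simp only [Measure.smul_apply, Measure.finsetSum_apply, smul_eq_mul, measure_univ, mul_one]
    refine ENNReal.inv_mul_cancel (fun h0 => ?_) (ENNReal.sum_ne_top.2 fun _ _ => ENNReal.ofReal_ne_top)
    have := (sum_eq_zero_iff.1 h0) (fun _ => true) (mem_univ _)
    exact (h _).not_ge (ENNReal.ofReal_eq_zero.1 this)⟩
  exact Measure.isProbabilityMeasure_map Measurable.of_discrete.aemeasurable

variable {p : ℝ} {K : ℤ}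

lemma eventually_sub (F : Finset ℤ²) : ∀ᶠ k : ℕ in atTop, F ⊆ bx (0, 0) k := by
  refine (Filter.eventually_all_finset F).2 fun z _ => ?_
  filter_upwards [eventually_ge_atTop (z.1.natAbs + z.2.natAbs + 1)] with k hk
  rw [mem_bx]; dsimp only; omega

lemma finite_vertexSet (D : Finset (Edge AdjL)) : (vertexSet AdjL D).Finite := by
  obtain ⟨D, rfl⟩ := exists_image D
  refine ((D.image (pu 0) ∪ D.image (pv 0)).finite_toSet).subset fun v ⟨e, he, hv⟩ => ?_
  obtain ⟨z, hz, rfl⟩ := mem_image.1 he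
  rcases inc_ce.1 hv with rfl | rfl
  · exact mem_union_left _ (mem_image_of_mem _ hz)
  · exact mem_union_right _ (mem_image_of_mem _ hz)

instance (D : Finset (Edge AdjL)) : Finite (vertexSet AdjL D) := finite_vertexSet D

lemma exists_box_net (hK : 0 < K) : ∃ r : ℤ² → vertexSet AdjL (boxE K),
    ∀ z ∈ bx (0, 0) K, (r (pu 0 z)).1 = pu 0 z ∧ (r (pv 0 z)).1 = pv 0 z := by
  have h : ∀ z ∈ bx (0, 0) K, ∀ v, Inc AdjL v (ce z) → v ∈ vertexSet AdjL (boxE K) :=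
    fun z hz v hv => ⟨ce z, ce_mem_boxE.2 hz, hv⟩
  have h0 : (0, 0) ∈ bx (0, 0) K := by rw [mem_bx]; dsimp only; omega
  refine ⟨fun v => if hv : v ∈ vertexSet AdjL (boxE K) then ⟨v, hv⟩ else
    ⟨_, h _ h0 _ (inc_ce.2 (Or.inl rfl))⟩, fun z hz => ?_⟩
  simp only [dif_pos (h z hz _ (inc_ce.2 (Or.inl rfl))), dif_pos (h z hz _ (inc_ce.2 (Or.inr rfl))),
    and_self]

/-- Boundary vertices identified by `ξ`. -/
def wb (ξ : Setoid (FK.bdry AdjL 4 (boxE K))) (a b : vertexSet AdjL (boxE K)) : Prop :=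
  ∃ hu : a.1 ∈ FK.bdry AdjL 4 (boxE K), ∃ hv : b.1 ∈ FK.bdry AdjL 4 (boxE K), ξ.r ⟨a.1, hu⟩ ⟨b.1, hv⟩

lemma inc_iff_net {r : ℤ² → vertexSet AdjL (boxE K)}
    (hr : ∀ z ∈ bx (0, 0) K, (r (pu 0 z)).1 = pu 0 z ∧ (r (pv 0 z)).1 = pv 0 z) :
    ∀ z ∈ bx (0, 0) K, ∀ a, Inc AdjL a.1 (ce z) ↔ a = r (pu 0 z) ∨ a = r (pv 0 z) := by
  intro z hz a
  rw [inc_ce, Subtype.ext_iff, Subtype.ext_iff, (hr z hz).1, (hr z hz).2]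

lemma fkFin_real (hx : 0 < p / (1 - p)) (hq : 1 ≤ q) (hK : 0 < K)
    (ξ : Setoid (FK.bdry AdjL 4 (boxE K))) {F : Finset ℤ²} (hF : F ⊆ bx (0, 0) K) :
    ((fkFin AdjL p q 4 (boxE K) ξ).map (extendBy AdjL (boxE K))).real (opn (F.image ce)) =
      pr (bx (0, 0) K) (Wn (fun z a => Inc AdjL a.1 (ce z)) (wb ξ) (p / (1 - p)) q) (F ⊆ ·) := by
  obtain ⟨r, hr⟩ := exists_box_net hK
  have h := real_opn (wt := fkWeight AdjL p q 4 (boxE K) ξ) ce_injective.injOn (boxE_eq K)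
    (Wn_isFK (w := wb ξ) hx hq (inc_iff_net hr)) fun S hS => by
      rw [← weight_eq ce_injective.injOn (boxE_eq K) (fun e (a : vertexSet AdjL (boxE K)) =>
        Inc AdjL a.1 e) (wb ξ) S hS]
      unfold fkWeight clusterCount wb
      congr 1
  unfold fkFin
  convert h.2 F hF

lemma tendsto_opn {μs : ℕ → Measure (Config AdjL)} {μ : Measure (Config AdjL)}
    [IsProbabilityMeasure μ] (h : WeakLim AdjL μs μ) (F : Finset (Edge AdjL)) :
    Tendsto (fun k => (μs k).real (opn F)) atTop (nhds (μ.real (opn F))) := by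
  have : opn F = FK.cylinder AdjL F fun _ => true := by
    ext; simp [opn, FK.cylinder]
  rw [this]
  exact (ENNReal.tendsto_toReal (measure_ne_top _ _)).comp (h F _)

/-- Non-uniqueness forces the self-dual point. -/
lemma self_dual_of_ne (hx : 0 < p / (1 - p)) (hq : 1 ≤ q) (h : FreeNeqWired p q) :
    q / (p / (1 - p)) = p / (1 - p) := by
  by_contra hne
  obtain ⟨φ0, φ1, ⟨i0, h0⟩, ⟨i1, h1⟩, hφ⟩ := h
  refine hφ (ext_opn fun F => ?_)
  have hreal : φ0.real (opn F) = φ1.real (opn F) := by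
    obtain ⟨F, rfl⟩ := exists_image F
    have t0 := tendsto_opn (h0 _ isExhaustion_boxE) (F.image ce)
    have t1 := tendsto_opn (h1 _ isExhaustion_boxE) (F.image ce)
    refine le_antisymm (le_of_tendsto_of_tendsto t0 t1 ?_) (le_of_forall_pos_le_add fun ε hε => ?_)
    · filter_upwards [eventually_sub F, eventually_gt_atTop 0] with k hk hk0
      have hk0' : (0 : ℤ) < k := by omega
      obtain ⟨r, hr⟩ := exists_box_net hk0'
      rw [fkFin_real hx hq hk0' _ hk, fkFin_real hx hq hk0' _ hk]
      refine (Wn_isFK hx hq (inc_iff_net hr)).pr_le (Wn_isFK hx hq (inc_iff_net hr)) hx le_rfl hq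
        (fun S S' e hS _ _ _ h => Quot.eqvGen_sound ((Quot.eq.1 h).mono fun a b => ?_)) (incr_sub _ F)
      exact Or.imp (fun ⟨z, hz, hab⟩ => ⟨z, hS hz, hab⟩) fun ⟨hu, hv, _⟩ => ⟨hu, hv, trivial⟩
    · obtain ⟨n₀, hn⟩ := wired_le_free_of_ne hx hq (Ne.symm hne) F hε
      refine le_of_tendsto_of_tendsto t1 (t0.add_const ε) ?_
      filter_upwards [eventually_sub F, eventually_gt_atTop 0, eventually_ge_atTop n₀] with k hk hk0 hk1
      have hk0' : (0 : ℤ) < k := by omega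
      obtain ⟨r, hr⟩ := exists_box_net hk0'
      rw [fkFin_real hx hq hk0' _ hk, fkFin_real hx hq hk0' _ hk]
      have hfar : ∀ a, a ∈ FK.bdry AdjL 4 (boxE k) → far (0, 0) k a ∧ par a = 0 := fun a ha => by
        obtain ⟨⟨e, _, he⟩, hd⟩ := ha
        refine ⟨?_, inc_par he⟩
        by_contra hf
        exact hd.not_ge (four_le_degree (inc_par he) hf)
      refine (net_le_pp (ζ := Set.univ) hx hq (inc_iff_net hr) Subtype.val (fun z hz a ha => ?_)
        (fun a b ⟨hu, hv, _⟩ => ?_) hk).trans ((hn k (by exact_mod_cast hk1)).trans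
        (add_le_add_left (pp_le_net hx hq (inc_iff_net hr) (fun z hz => hz.elim) hk) ε))
      · rcases ha with rfl | rfl
        · rw [(hr z hz).1]; exact Conn.refl _ _
        · rw [(hr z hz).2]; exact Conn.refl _ _
      · rw [← Set.compl_eq_univ_sdiff]
        exact conn_compl_bx (hfar _ hu).1 (hfar _ hv).1 ((hfar _ hu).2.trans (hfar _ hv).2.symm)
  rwa [Measure.real, Measure.real, ENNReal.toReal_eq_toReal_iff' (measure_ne_top _ _) (measure_ne_top _ _)] at hreal

variable {M N : ℤ}

/-- The cells joining the two sides of the slit. -/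
def slitPat (M N : ℤ) : Set ℤ² :=
  {z | z.2 = -1 ∧ (z.1 ≤ -M - 2 ∨ N + 2 ≤ z.1) ∨
    (z.2 = -1 ∨ z.2 = -2) ∧ -M ≤ z.1 ∧ z.1 ≤ N ∧ z.1 % 2 = 0}

lemma mem_slitPat {z : ℤ²} : z ∈ slitPat M N ↔ z.2 = -1 ∧ (z.1 ≤ -M - 2 ∨ N + 2 ≤ z.1) ∨
    (z.2 = -1 ∨ z.2 = -2) ∧ -M ≤ z.1 ∧ z.1 ≤ N ∧ z.1 % 2 = 0 := Iff.rfl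

lemma pat_slitPat (hM : 0 ≤ M) (hN : 0 ≤ N) : Pat (M + N + 2) (slitPat M N) := by
  refine ⟨fun z hz => ?_, fun z hz h => ?_, fun x hx => ?_⟩ <;> rw [mem_slitPat] at * <;>
    (try dsimp only) <;> omega

/-- Lowering of the cells below the axis. -/
def low (z : ℤ²) : ℤ² := if 0 ≤ z.2 then z else (z.1, z.2 - 2)

/-- The edge crossing a cell, after lowering. -/
def sce (z : ℤ²) : Edge AdjL := if 0 ≤ z.2 then ce z else ce (z.1, z.2 + 2)

lemma sce_low (y : ℤ²) : sce (low y) = ce y := by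
  unfold sce low
  split_ifs <;> first | rfl | (simp only [sub_add_cancel]) | (dsimp only at *; omega)

/-- The lowered box. -/
def sl (k : ℤ) : Finset ℤ² := (bx (0, 0) k).image low

lemma mem_sl {z : ℤ²} : z ∈ sl k ↔
    -k ≤ z.1 ∧ z.1 < k ∧ (0 ≤ z.2 ∧ z.2 < k ∨ -2 - k ≤ z.2 ∧ z.2 ≤ -3) := by
  simp only [sl, mem_image, mem_bx, low]
  refine ⟨fun ⟨y, hy, h⟩ => ?_, fun h => ?_⟩
  · split_ifs at h <;> subst h <;> (try dsimp only at hy ⊢) <;> omega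
  · by_cases h0 : 0 ≤ z.2
    · exact ⟨z, by omega, if_pos h0⟩
    · refine ⟨(z.1, z.2 + 2), by dsimp only; omega, ?_⟩
      rw [if_neg (by dsimp only; omega)]; simp

/-- The vertex of the slit graph at a lattice point. -/
def key (M N : ℤ) (v : ℤ²) : V × Bool :=
  if 0 ≤ v.2 then (v, true) else if v.2 = -1 then ((v.1 - 1, 0), true)
    else ((v.1, v.2 + 2), !decide (SplitPt M N (v.1, v.2 + 2)))

lemma endSide_ce {v y : ℤ²} :
    endSide M N v (ce y) = !decide (SplitPt M N v ∧ y.2 < 0) := by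
  unfold endSide
  simp only [ce_mem_HP, not_le]
  split_ifs with h <;> simp [h]

lemma corner_low (y : ℤ²) : pu 0 (low y) = (if 0 ≤ y.2 then pu 0 y else
      ((pu 0 y).1, (pu 0 y).2 - 2)) ∧ pv 0 (low y) = (if 0 ≤ y.2 then pv 0 y else
      ((pv 0 y).1, (pv 0 y).2 - 2)) := by
  unfold low pu pv
  split_ifs with h h1 h2 <;> unfold par at * <;> (try dsimp only at *) <;>
    first | exact ⟨rfl, rfl⟩ | omega | (simp; ring)

lemma key_low {y a : ℤ²} (ha : a = pu 0 y ∨ a = pv 0 y) :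
    key M N (if 0 ≤ y.2 then a else (a.1, a.2 - 2)) = (a, endSide M N a (ce y)) := by
  have := near_of_corner ha
  rw [endSide_ce, key]
  by_cases h : 0 ≤ y.2
  · rw [if_pos h, if_pos (by omega)]; simp [h]
  · rw [if_neg h, if_neg (by dsimp only; omega), if_neg (by dsimp only; omega)]
    simp [not_le.1 h]

/-- The lattice point, below the axis lowered, of a vertex of the slit graph. -/
def pt (a : V × Bool) : ℤ² := if 0 < a.1.2 ∨ a.1.2 = 0 ∧ a.2 = true then a.1 else (a.1.1, a.1.2 - 2)

lemma conn_pt {O : Set ℤ²} (hO : slitPat M N ⊆ O) {y a : ℤ²}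
    (ha : a = pu 0 y ∨ a = pv 0 y) :
    Conn O (pt (a, endSide M N a (ce y))) (if 0 ≤ y.2 then a else (a.1, a.2 - 2)) := by
  have hn := near_of_corner ha
  have hp := inc_par (inc_ce.2 ha)
  rw [endSide_ce, pt]
  by_cases h : 0 ≤ y.2
  · have : 0 < a.2 ∨ a.2 = 0 := by omega
    simpa [h, this] using Conn.refl O a
  by_cases h0 : a.2 = 0
  · by_cases hs : SplitPt M N a
    · simpa [h0, h, hs, not_le.1 h] using Conn.refl O _
    · have hc : ∀ i : ℤ, i = -1 ∨ i = -2 → (a.1, i) ∈ O := fun i hi => hO (by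
        unfold par at hp
        unfold SplitPt at hs
        rw [mem_slitPat]; dsimp only; omega)
      have h1 : Conn O (a.1, 0) (a.1 + 1, -1) := Conn.of_lnk (hc (-1) (Or.inl rfl)) (by simp [Lnk])
      have h2 : Conn O (a.1, -2) (a.1 + 1, -1) := Conn.of_lnk (hc (-2) (Or.inr rfl)) (by simp [Lnk])
      have ha0 : a = (a.1, 0) := Prod.ext rfl h0
      rw [if_neg h, if_pos (Or.inr ⟨h0, by simp [hs]⟩), h0]
      exact ha0 ▸ h1.trans h2.symm
  · rw [if_neg h, if_neg (by dsimp only; omega)]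
    exact Conn.refl _ _

lemma split_deg_lt {D : Finset (Edge AdjL)} {a : V × Bool} (h : SplitPt M N a.1) (ha : a.2 = true) :
    slitDeg M N D a < 4 := by
  have hsub : (D.filter fun e => Inc AdjL a.1 e ∧ a.2 = endSide M N a.1 e) ⊆
      {ce (a.1.1, 0), ce (a.1.1 - 1, 0)} := by
    intro e he
    obtain ⟨z, rfl⟩ := exists_ce e
    obtain ⟨-, h1, h2⟩ := mem_filter.1 he
    rw [ha, endSide_ce] at h2
    have h3 : ¬ z.2 < 0 := by simpa [h] using h2
    have := near_of_corner (inc_ce.1 h1)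
    have h0 := h.1
    rw [mem_insert, mem_singleton, ce_injective.eq_iff, ce_injective.eq_iff,
      Prod.ext_iff, Prod.ext_iff]
    dsimp only; omega
  exact (card_le_card hsub).trans_lt (card_le_two.trans_lt (by norm_num))

instance (D : Finset (Edge AdjL)) : Finite {a : V × Bool // SlitPresent M N D a} :=
  (((finite_vertexSet D).prod Set.finite_univ).subset fun a ha => by
    obtain ⟨e, he⟩ := card_pos.1 ha.2
    rw [mem_filter] at he
    exact ⟨⟨e, he.1, he.2.1⟩, trivial⟩ : {a | SlitPresent M N D a}.Finite)

lemma conn_far_of_bdry {ξ : Setoid (V × Bool)} (hξ : SlitBCWiredFree M N (boxE k) ξ)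
    (hM : 0 ≤ M) (hN : 0 ≤ N) (hMe : Even M) (hNe : Even N) (hk : M + N + 4 ≤ k) {a b : V × Bool}
    (ha : a ∈ slitBdry M N (boxE k)) (hb : b ∈ slitBdry M N (boxE k)) (hab : ξ.r a b) :
    Conn (wp k (slitPat M N) \ ↑(sl k)) (pt a) (pt b) := by
  by_cases hne : a = b
  · exact hne ▸ Conn.refl _ _
  rw [Int.even_iff] at hMe hNe
  set O : Set ℤ² := wp k (slitPat M N) \ ↑(sl k) with hO
  have hmem : ∀ z, z ∈ O ↔ (0 ≤ z.2 ∨ z ∈ slitPat M N ∨ z.2 ≤ -3 ∨ z.2 = -2 ∧ (z.1 < -k ∨ k ≤ z.1)) ∧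
      z ∉ sl k := fun z => and_congr_left fun _ => mem_wp
  simp only [mem_sl, mem_slitPat] at hmem
  have hex : ∀ c : V × Bool, c ∈ slitBdry M N (boxE k) → ¬ (SplitPt M N c.1 ∧ c.2 = false) →
      ∃ o : ℤ², (o.1 ≤ -k ∨ k ≤ o.1 ∨ o.2 ≤ -2 - k ∨ k ≤ o.2) ∧ par o = 0 ∧ Conn O (pt c) o := by
    rintro ⟨⟨x, y⟩, s⟩ ⟨⟨hok, hpos⟩, hd⟩ hc
    obtain ⟨e, he⟩ := card_pos.1 hpos
    have hp := inc_par (mem_filter.1 he).2.1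
    have hs : s = true := hok.elim id fun h => by
      cases s
      · exact (hc ⟨h, rfl⟩).elim
      · rfl
    subst hs
    by_cases h : SplitPt M N (x, y)
    · have h0 : y = 0 := h.1
      subst h0
      have h1 := h.2
      have hpt : pt ((x, 0), true) = (x, 0) := if_pos (Or.inr ⟨rfl, rfl⟩)
      rw [hpt]
      unfold par at hp
      dsimp only at hp h1
      rcases h1 with h1 | h1
      · refine ⟨(x - 2 * k, 0), by dsimp only; omega, by unfold par; dsimp only; omega,
          conn_row (y := -1) (a := x - 2 * k) (b := x) (fun t _ ht => (hmem _).2 ?_) ?_ le_rfl (Or.inr rfl) le_rfl ?_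
            (Or.inr rfl) (by unfold par; dsimp only; omega)⟩ <;> dsimp only <;> omega
      · refine ⟨(x + 2 * k, 0), by dsimp only; omega, by unfold par; dsimp only; omega,
          conn_row (y := -1) (a := x) (b := x + 2 * k) (fun t _ ht => (hmem _).2 ?_) le_rfl ?_ (Or.inr rfl) ?_ le_rfl
            (Or.inr rfl) (by unfold par; dsimp only; omega)⟩ <;> dsimp only <;> omega
    · have hdeg : slitDeg M N (boxE k) ((x, y), true) = degree AdjL (boxE k) (x, y) := by
        unfold slitDeg degree endSide
        simp [h]
      have hf : far (0, 0) k (x, y) := by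
        by_contra hf
        exact hd.not_ge (hdeg ▸ four_le_degree hp hf)
      refine ⟨_, ?_, ?_, Conn.refl _ _⟩ <;> unfold pt par at * <;> unfold far at hf <;>
        dsimp only at * <;> split_ifs with h' <;> simp only [and_true] at h' <;> dsimp only <;> omega
  obtain ⟨o, ho, hop, hao⟩ := hex a ha fun h => hne (hξ.2.1 a b h.1 h.2 hab)
  obtain ⟨o', ho', hop', hbo⟩ := hex b hb fun h => hne (hξ.2.1 b a h.1 h.2 (ξ.symm hab)).symm
  refine hao.trans ((conn_outside (a := -k) (b := k) (c := -2 - k) (d := k) (fun z hz => (hmem z).2 ?_)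
    ho ho' (hop.trans hop'.symm)).trans hbo.symm)
  omega

lemma key_wide {x : ℤ} (h : x ≤ -M - 2 ∨ N + 2 ≤ x) {a : ℤ²}
    (ha : a = pu 0 (x, -1) ∨ a = pv 0 (x, -1)) :
    SplitPt M N (key M N a).1 ∧ (key M N a).2 = true := by
  have := near_of_corner ha
  unfold key SplitPt
  dsimp only at this
  by_cases h0 : 0 ≤ a.2
  · rw [if_pos h0]; exact ⟨⟨by dsimp only; omega, by dsimp only; omega⟩, rfl⟩
  · rw [if_neg h0, if_pos (by omega)]; exact ⟨⟨rfl, by dsimp only; omega⟩, rfl⟩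

/-- Comparison of the FK measure on the slit box with FK measures on cells. -/
lemma slit_bounds (hx : 0 < p / (1 - p)) (hq : 1 ≤ q) (hM : 0 ≤ M) (hN : 0 ≤ N) (hMe : Even M)
    (hNe : Even N) (hk : M + N + 4 ≤ k) {ξ : Setoid (V × Bool)}
    (hξ : SlitBCWiredFree M N (boxE k) ξ) {F : Finset ℤ²} (hF : F ⊆ bx (0, 0) k) :
    PP 0 (sl k) (slitPat M N) (p / (1 - p)) q (fun O => ∀ z ∈ F.image low, z ∈ O) ≤
      ((slitFin p q M N (boxE k) ξ).map (extendBy AdjL (boxE k))).real (opn (F.image ce)) ∧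
    ((slitFin p q M N (boxE k) ξ).map (extendBy AdjL (boxE k))).real (opn (F.image ce)) ≤
      PP 0 (sl k) (wp k (slitPat M N)) (p / (1 - p)) q (fun O => ∀ z ∈ F.image low, z ∈ O) := by
  have hF' : F.image low ⊆ sl k := image_subset_image hF
  have hinc : ∀ y ∈ bx (0, 0) k, ∀ a, a = pu 0 y ∨ a = pv 0 y →
      SlitPresent M N (boxE k) (a, endSide M N a (ce y)) := fun y hy a ha => by
    refine ⟨?_, card_pos.2 ⟨ce y, mem_filter.2 ⟨ce_mem_boxE.2 hy, inc_ce.2 ha, rfl⟩⟩⟩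
    by_cases h : SplitPt M N a
    · exact Or.inr h
    · exact Or.inl (by simp [endSide_ce, h])
  have hc : SlitPresent M N (boxE k) ((-M - 2, 0), true) := by
    have := hinc (-M - 2, 0) (mem_bx.2 (by dsimp only; omega)) (-M - 2, 0) (Or.inl (if_pos (by
      rw [Int.even_iff] at hMe; unfold par; dsimp only; omega)).symm)
    simpa [endSide_ce] using this
  set T := {a : V × Bool // SlitPresent M N (boxE k) a}
  set R : V × Bool → T := fun a => if h : SlitPresent M N (boxE k) a then ⟨a, h⟩ else ⟨_, hc⟩ with hR
  set r : ℤ² → T := fun v => R (key M N v) with hr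
  set J : Edge AdjL → T → Prop := fun e a => Inc AdjL a.1.1 e ∧ a.1.2 = endSide M N a.1.1 e with hJ
  set w : T → T → Prop := fun a b => a.1 ∈ slitBdry M N (boxE k) ∧ b.1 ∈ slitBdry M N (boxE k) ∧
    ξ.r a.1 b.1 with hw
  have hrv : ∀ y ∈ bx (0, 0) k, ∀ a, a = pu 0 y ∨ a = pv 0 y →
      (r (if 0 ≤ y.2 then a else (a.1, a.2 - 2))).1 = (a, endSide M N a (ce y)) := fun y hy a ha => by
    simp only [hr, key_low ha, hR, dif_pos (hinc y hy a ha)]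
  have hI : ∀ z ∈ sl k, ∀ a, J (sce z) a ↔ a = r (pu 0 z) ∨ a = r (pv 0 z) := by
    intro z hz a
    obtain ⟨y, hy, rfl⟩ := mem_image.1 hz
    have hpe : ∀ c, a.1 = c ↔ a.1.1 = c.1 ∧ a.1.2 = c.2 := fun c => Prod.ext_iff
    rw [sce_low, (corner_low y).1, (corner_low y).2, Subtype.ext_iff, Subtype.ext_iff,
      hrv y hy _ (Or.inl rfl), hrv y hy _ (Or.inr rfl), hpe, hpe]
    simp only [hJ, inc_ce]
    constructor
    · rintro ⟨h | h, h'⟩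
      · exact Or.inl ⟨h, h ▸ h'⟩
      · exact Or.inr ⟨h, h ▸ h'⟩
    · rintro (⟨h, h'⟩ | ⟨h, h'⟩)
      · exact ⟨Or.inl h, by rw [h', h]⟩
      · exact ⟨Or.inr h, by rw [h', h]⟩
  have hinj : Set.InjOn sce (sl k) := by
    intro z hz z' hz' h
    obtain ⟨y, -, rfl⟩ := mem_image.1 hz
    obtain ⟨y', -, rfl⟩ := mem_image.1 hz'
    rw [sce_low, sce_low] at h
    rw [ce_injective h]
  have himg : ∀ G : Finset ℤ², G.image ce = (G.image low).image sce := fun G => by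
    rw [image_image]; congr 1; funext y; exact (sce_low y).symm
  have hreal : ((slitFin p q M N (boxE k) ξ).map (extendBy AdjL (boxE k))).real (opn (F.image ce)) =
      pr (sl k) (Wn (fun z => J (sce z)) w (p / (1 - p)) q) (F.image low ⊆ ·) := by
    have hD := (boxE_eq k).trans (himg _)
    have h := real_opn (wt := slitWeight p q M N (boxE k) ξ) hinj hD
      (Wn_isFK (w := w) hx hq hI) fun S hS => by
        rw [← weight_eq hinj hD J w S hS]
        unfold slitWeight slitClusterCount
        congr 4
        funext a b
        simp only [hJ, hw, and_assoc, and_left_comm]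
    unfold slitFin
    rw [himg]
    convert h.2 _ hF'
  rw [hreal]
  refine ⟨pp_le_net hx hq hI (fun z hz => ?_) hF', net_le_pp hx hq hI (fun a => pt a.1) (fun z hz a ha => ?_)
    (fun a b hab => conn_far_of_bdry hξ hM hN hMe hNe hk hab.1 hab.2.1 hab.2.2) hF'⟩
  · have hup : ∀ c : V × Bool, SplitPt M N c.1 ∧ c.2 = true → SplitPt M N (R c).1.1 ∧ (R c).1.2 = true := by
      intro c hc'
      simp only [hR]
      split_ifs
      · exact hc'
      · exact ⟨⟨rfl, Or.inl (by dsimp only; omega)⟩, rfl⟩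
    have hwr : ∀ c d : V × Bool, SplitPt M N c.1 ∧ c.2 = true → SplitPt M N d.1 ∧ d.2 = true →
        w (R c) (R d) := fun c d h1 h2 => by
      have hc' := hup c h1
      have hd' := hup d h2
      exact ⟨⟨(R c).2, split_deg_lt hc'.1 hc'.2⟩, ⟨(R d).2, split_deg_lt hd'.1 hd'.2⟩,
        hξ.1 _ _ (R c).2 (R d).2 hc'.1 hc'.2 hd'.1 hd'.2⟩
    rw [Int.even_iff] at hMe hNe
    obtain ⟨x, y⟩ := z
    rcases mem_slitPat.1 hz with ⟨rfl, h⟩ | ⟨h, h1, h2, h3⟩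
    · exact Or.inr (hwr _ _ (key_wide h (Or.inl rfl)) (key_wide h (Or.inr rfl)))
    · refine Or.inl (congrArg R ?_)
      dsimp only at h h1 h2 h3
      rcases h with rfl | rfl
      · have hp : ¬ par (x, -1) = 0 := by unfold par; dsimp only; omega
        simp [key, pu, pv, hp]
      · have hp : par (x, -2) = 0 := by unfold par; dsimp only; omega
        have : ¬ SplitPt M N (x, 0) := fun h => by have := h.2; dsimp only at this; omega
        simp [key, pu, pv, hp, this]
  · obtain ⟨y, hy, rfl⟩ := mem_image.1 hz
    have hsub : slitPat M N ⊆ wp k (slitPat M N) \ ↑(sl k) := fun z hz =>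
      ⟨mem_wp.2 (Or.inr (Or.inl hz)), fun h => by
        rw [mem_coe, mem_sl] at h
        rw [mem_slitPat] at hz
        omega⟩
    rw [(corner_low y).1, (corner_low y).2] at ha
    rcases ha with rfl | rfl
    · rw [hrv y hy _ (Or.inl rfl)]; exact conn_pt hsub (Or.inl rfl)
    · rw [hrv y hy _ (Or.inr rfl)]; exact conn_pt hsub (Or.inr rfl)

end FKS

open FK in
/-- **Theorem.** For any sequence of boundary conditions on `Λ_k ∩ Slit(M,N)` which are
wired on `∂H` and free on `∂H⁻`, the finite-volume FK measures converge weakly as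
`k → ∞`, and the limit does not depend on the chosen sequence. -/
theorem slit_dobrushin_limit_exists (p q : ℝ) (hp0 : 0 < p) (hp1 : p < 1) (hq : 1 ≤ q)
    (hneq : FreeNeqWired p q) (M N : ℤ) (hM : 0 ≤ M) (hN : 0 ≤ N)
    (hMe : Even M) (hNe : Even N) :
    ∃ μ : Measure (Config AdjL),
      ∀ ξseq : ℕ → Setoid (V × Bool),
        (∀ k : ℕ, SlitBCWiredFree M N (boxE (k : ℤ)) (ξseq k)) →
        WeakLim AdjL
          (fun k => (slitFin p q M N (boxE (k : ℤ)) (ξseq k)).map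
            (extendBy AdjL (boxE (k : ℤ)))) μ := by

  open FKS in
  have hx : 0 < p / (1 - p) := div_pos hp0 (by linarith)
  have hxq := self_dual_of_ne hx hq hneq
  refine exists_weakLim (ι := ℕ → Setoid (V × Bool))
    (fun ξ => ∀ k : ℕ, SlitBCWiredFree M N (boxE k) (ξ k))
    (fun ξ k => (slitFin p q M N (boxE k) (ξ k)).map (extendBy AdjL (boxE k)))
    (fun ξ hξ k => ?_) fun F => ?_
  · have hw : ∀ η, 0 < slitWeight p q M N (boxE k) (ξ k) η := fun η => by
      unfold slitWeight
      have : 0 < q := by linarith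
      positivity
    unfold slitFin
    convert isProb hw
  obtain ⟨F, rfl⟩ := exists_image F
  have hlow : ∀ z ∈ F.image low, z ∈ up ∪ dn := fun z hz => by
    obtain ⟨y, -, rfl⟩ := Finset.mem_image.1 hz
    rw [Set.mem_union, mem_up, mem_dn, low]
    split_ifs
    · exact Or.inl ‹_›
    · right; dsimp only; omega
  have hA : Monotone fun O : Set (ℤ × ℤ) => ∀ z ∈ F.image low, z ∈ O :=
    fun _ _ h hO z hz => h (hO z hz)
  obtain ⟨a, h1, h2⟩ := exists_slit_limit hx hq hxq hA (pat_slitPat hM hN) (by omega) hlow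
    fun _ _ h hO z hz => (h z hz).1 (hO z hz)
  refine ⟨a, fun ξ hξ => (tendsto_add_atTop_iff_nat 1).1 (tendsto_of_tendsto_of_tendsto_of_le_of_le'
    h2 h1 ?_ ?_)⟩
  all_goals
    filter_upwards [(tendsto_add_atTop_nat 1).eventually (eventually_sub F),
      eventually_ge_atTop (M + N).toNat.succ.succ.succ] with k hF hk
    have hsub : dom (k : ℤ) ⊆ sl ((k + 1 : ℕ) : ℤ) := fun z hz => by
      rw [mem_sl]; rw [mem_dom] at hz; push_cast; omega
    have hb := slit_bounds hx hq hM hN hMe hNe (by push_cast; omega) (hξ (k + 1)) hF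
  · refine le_trans (pp_enlarge (Or.inl rfl) hx hq hsub le_rfl hA fun z _ hz => ⟨hz, fun h => ?_⟩) hb.1
    rw [mem_sl] at h
    rw [mem_slitPat] at hz
    omega
  · refine hb.2.trans (pp_shrink (Or.inl rfl) hx hq hsub le_rfl hA fun z hz h => ?_)
    rw [mem_wp, mem_sl, mem_slitPat] at h
    rw [mem_dom] at hz
    rw [mem_wp, mem_slitPat]
    push_cast at h
    omega
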